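/- Let k be a field of characteristic zero, X an r × s matrix of indeterminates with r < s, R = k[X], I = I_r(X), and suppose i = (r−t)(s−r) + 1 for some 0 ≤ t < r. Then the set of associated primes of H^i_I(R) is exactly {I_{t+1}(X)}, the prime ideal generated by the (t+1) × (t+1) minors of X, and the localization H^i_I(R)_{I_{t+1}(X)} is isomorphic to E_R(R/I_{t+1}(X)); consequently H^i_I(R) embeds into E_R(R/I_{t+1}(X)). -/

import Mathlib

/-- The ideal of `t × t` minors of a matrix over a commutative ring. -/
noncomputable def minorsIdeal {T α β : Type*} [CommRing T] (M : Matrix α β T) (t : ℕ) :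
    Ideal T :=
  Ideal.span (Set.range fun p : (Fin t ↪ α) × (Fin t ↪ β) =>
    (M.submatrix (⇑p.1) (⇑p.2)).det)

/-- The polynomial ring `R = k[X]` in the entries of an `r × s` matrix `X` of
indeterminates. -/
abbrev detPolyRing (k : Type) [Field k] (r s : ℕ) : Type := MvPolynomial (Fin r × Fin s) k

/-- The generic `r × s` matrix `X` of indeterminates. -/
noncomputable abbrev genericMatrix (k : Type) [Field k] (r s : ℕ) :
    Matrix (Fin r) (Fin s) (detPolyRing k r s) :=
  Matrix.of fun i j => MvPolynomial.X (i, j)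

/-! ### Localization at one element, with explicit exponents -/

/-- The localization of a module at the powers of an element. -/
abbrev Loc {T : Type} [CommRing T] (f : T) (M : Type) [AddCommGroup M] [Module T M] : Type :=
  LocalizedModule (Submonoid.powers f) M

namespace Loc

variable {T : Type} [CommRing T] {f : T} {M : Type} [AddCommGroup M] [Module T M]

/-- The fraction `m / f ^ n`. -/
noncomputable def mk (f : T) (n : ℕ) (m : M) : Loc f M :=
  LocalizedModule.mk m ⟨f ^ n, n, rfl⟩

theorem ind {p : Loc f M → Prop} (h : ∀ n m, p (mk f n m)) (x : Loc f M) : p x := by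
  induction x using LocalizedModule.induction_on with
  | _ m s =>
    obtain ⟨_, n, rfl⟩ := s
    exact h n m

theorem mk_eq_mk {n n' : ℕ} {m m' : M} :
    mk f n m = mk f n' m' ↔ ∃ N : ℕ, f ^ (N + n') • m = f ^ (N + n) • m' := by
  unfold mk
  rw [LocalizedModule.mk_eq]
  constructor
  · rintro ⟨⟨_, N, rfl⟩, h⟩
    refine ⟨N, ?_⟩
    simpa [Submonoid.smul_def, pow_add, mul_smul] using h
  · rintro ⟨N, h⟩
    refine ⟨⟨_, N, rfl⟩, ?_⟩
    simpa [Submonoid.smul_def, pow_add, mul_smul] using h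

theorem mk_eq_zero {n : ℕ} {m : M} : mk f n m = 0 ↔ ∃ N : ℕ, f ^ N • m = 0 := by
  have : (0 : Loc f M) = mk f 0 0 := (LocalizedModule.zero_mk _).symm
  rw [this, mk_eq_mk]
  simp

theorem mk_cancel (n k : ℕ) (m : M) : mk f (n + k) (f ^ k • m) = mk f n m :=
  mk_eq_mk.2 ⟨0, by rw [← mul_smul, ← pow_add]; congr 2; omega⟩

theorem mk_succ (n : ℕ) (m : M) : mk f (n + 1) (f • m) = mk f n m := by
  simpa using mk_cancel (f := f) n 1 m

theorem mk_add (n : ℕ) (m m' : M) : mk f n (m + m') = mk f n m + mk f n m' := by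
  unfold mk
  rw [LocalizedModule.mk_add_mk, ← smul_add, LocalizedModule.mk_eq]
  exact ⟨1, by simp [Submonoid.smul_def, mul_smul]⟩

/-- `m ↦ m / f ^ n` as a linear map. -/
noncomputable def mkL (f : T) (n : ℕ) : M →ₗ[T] Loc f M where
  toFun := mk f n
  map_add' := mk_add n
  map_smul' t m := by
    simp only [mk, RingHom.id_apply]
    exact (LocalizedModule.smul'_mk t m _).symm

theorem mk_smul (n : ℕ) (t : T) (m : M) : mk f n (t • m) = t • mk f n m := (mkL f n).map_smul t m
@[simp] theorem mk_zero (n : ℕ) : mk f n (0 : M) = 0 := (mkL f n).map_zero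
theorem mk_sub (n : ℕ) (m m' : M) : mk f n (m - m') = mk f n m - mk f n m' := (mkL f n).map_sub m m'
theorem mk_nsmul (n k : ℕ) (m : M) : mk f n (k • m) = k • mk f n m := map_nsmul (mkL f n) k m

theorem pow_smul_mk (n : ℕ) (m : M) : f ^ n • mk f n m = mk f 0 m := by
  rw [← mk_smul]
  simpa using mk_cancel (f := f) 0 n m

theorem ind₂ {p : Loc f M → Loc f M → Prop} (h : ∀ n m m', p (mk f n m) (mk f n m'))
    (x y : Loc f M) : p x y := by
  induction x using ind with
  | _ n m =>
  induction y using ind with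
  | _ n' m' =>
    have := h (n + n') (f ^ n' • m) (f ^ n • m')
    rwa [mk_cancel, add_comm n, mk_cancel] at this

section lift

variable {X : Type} [AddCommGroup X]

/-- Additive maps out of a localization are compatible families of additive maps. -/
noncomputable def lift (g : ℕ → M →+ X) (h : ∀ n m, g (n + 1) (f • m) = g n m) : Loc f M →+ X :=
  have h' : ∀ k n m, g (n + k) (f ^ k • m) = g n m := by
    intro k
    induction k with
    | zero => simp
    | succ k ih => intro n m; rw [pow_succ', mul_smul, ← add_assoc, h, ih]
  have ex : ∀ x : Loc f M, ∃ n m, x = mk f n m := ind fun n m => ⟨n, m, rfl⟩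
  have key : ∀ n m n' m', mk f n m = mk f n' m' → g n m = g n' m' := by
    intro n m n' m' e
    obtain ⟨N, e⟩ := mk_eq_mk.1 e
    have h1 := h' (N + n') n m
    rw [e, show n + (N + n') = n' + (N + n) by omega, h'] at h1
    exact h1.symm
  { toFun := fun x => g (ex x).choose (ex x).choose_spec.choose
    map_zero' := by
      rw [key _ _ 0 0 (by rw [← (ex 0).choose_spec.choose_spec, mk_zero]), map_zero]
    map_add' := by
      have e : ∀ n m, g (ex (mk f n m)).choose (ex (mk f n m)).choose_spec.choose = g n m :=
        fun n m => key _ _ _ _ (ex (mk f n m)).choose_spec.choose_spec.symm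
      refine ind₂ ?_
      intro n m m'
      rw [← mk_add, e, e, e, map_add] }

theorem lift_mk (g : ℕ → M →+ X) (h : ∀ n m, g (n + 1) (f • m) = g n m) (n : ℕ) (m : M) :
    lift g h (mk f n m) = g n m := by
  have h' : ∀ k n m, g (n + k) (f ^ k • m) = g n m := by
    intro k
    induction k with
    | zero => simp
    | succ k ih => intro n m; rw [pow_succ', mul_smul, ← add_assoc, h, ih]
  have ex : ∀ x : Loc f M, ∃ n m, x = mk f n m := ind fun n m => ⟨n, m, rfl⟩
  have key : ∀ n m n' m', mk f n m = mk f n' m' → g n m = g n' m' := by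
    intro n m n' m' e
    obtain ⟨N, e⟩ := mk_eq_mk.1 e
    have h1 := h' (N + n') n m
    rw [e, show n + (N + n') = n' + (N + n) by omega, h'] at h1
    exact h1.symm
  exact key _ _ _ _ (ex (mk f n m)).choose_spec.choose_spec.symm

end lift

variable {T' : Type} [CommRing T'] {f' : T'} {M' : Type} [AddCommGroup M'] [Module T' M']

/-- The map of localizations induced by a semi-equivariant additive map. -/
noncomputable def map (φ : M →+ M') (h : ∀ m, φ (f • m) = f' • φ m) : Loc f M →+ Loc f' M' :=
  lift (fun n => ((mkL f' n).toAddMonoidHom.comp φ)) fun n m => by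
    change mk f' (n + 1) (φ (f • m)) = mk f' n (φ m)
    rw [h, mk_succ]

@[simp] theorem map_mk (φ : M →+ M') (h : ∀ m, φ (f • m) = f' • φ m) (n : ℕ) (m : M) :
    map φ h (mk f n m) = mk f' n (φ m) := lift_mk _ _ _ _

/-- The extension of a connection to a localization. -/
noncomputable def conn (g : T) (D : M →+ M) (h : ∀ m, D (f • m) = f • D m + g • m) :
    Loc f M →+ Loc f M :=
  lift (fun n => ((mkL f n).toAddMonoidHom.comp D) -
      n • ((mkL f (n + 1)).toAddMonoidHom.comp (DistribSMul.toAddMonoidHom M g))) fun n m => by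
    change mk f (n + 1) (D (f • m)) - (n + 1) • mk f (n + 1 + 1) (g • f • m)
      = mk f n (D m) - n • mk f (n + 1) (g • m)
    rw [h, mk_add, mk_succ, smul_comm g f, mk_succ, succ_nsmul]
    abel

theorem conn_mk (g : T) (D : M →+ M) (h : ∀ m, D (f • m) = f • D m + g • m) (n : ℕ) (m : M) :
    conn g D h (mk f n m) = mk f n (D m) - n • mk f (n + 1) (g • m) := lift_mk _ _ _ _

end Loc

/-! ### Complexes as differential modules with a family of homogeneous parts -/

/-- A cochain complex, presented as one module with a differential and its homogeneous parts. -/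
structure Cx (T : Type) [CommRing T] where
  V : Type
  [grp : AddCommGroup V]
  [mod : Module T V]
  d : V →ₗ[T] V
  gr : ℤ → Submodule T V
  d_gr : ∀ {n x}, x ∈ gr n → d x ∈ gr (n + 1)
  d_d : ∀ x, d (d x) = 0

attribute [instance] Cx.grp Cx.mod

namespace Cx

variable {T : Type} [CommRing T] {T' : Type} [CommRing T'] {T'' : Type} [CommRing T'']

/-- Cocycles of degree `n`. -/
def Z (K : Cx T) (n : ℤ) : Submodule T K.V := LinearMap.ker K.d ⊓ K.gr n

/-- Coboundaries of degree `n`. -/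
def B (K : Cx T) (n : ℤ) : Submodule T K.V := (K.gr (n - 1)).map K.d

/-- Cohomology in degree `n`. -/
abbrev H (K : Cx T) (n : ℤ) : Type := K.Z n ⧸ (K.B n).submoduleOf (K.Z n)

theorem d_gr' (K : Cx T) {n : ℤ} {x : K.V} (h : x ∈ K.gr (n - 1)) : K.d x ∈ K.gr n := by
  simpa using K.d_gr h

/-- The class of a cocycle. -/
def cl (K : Cx T) (n : ℤ) (x : K.V) (hd : K.d x = 0) (hg : x ∈ K.gr n) : K.H n :=
  Submodule.Quotient.mk ⟨x, hd, hg⟩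

variable {K : Cx T} {K' : Cx T'} {K'' : Cx T''} {n : ℤ}

theorem H_ind {p : K.H n → Prop} (h : ∀ x hd hg, p (K.cl n x hd hg)) (y : K.H n) : p y := by
  obtain ⟨⟨x, hd, hg⟩, rfl⟩ := Submodule.Quotient.mk_surjective _ y
  exact h x hd hg

theorem cl_eq_zero {x : K.V} {hd : K.d x = 0} {hg : x ∈ K.gr n} :
    K.cl n x hd hg = 0 ↔ ∃ y ∈ K.gr (n - 1), K.d y = x := by
  unfold cl
  rw [Submodule.Quotient.mk_eq_zero]
  rfl

theorem cl_add {x x' : K.V} {hd : K.d x = 0} {hg : x ∈ K.gr n} {hd' : K.d x' = 0}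
    {hg' : x' ∈ K.gr n} : K.cl n x hd hg + K.cl n x' hd' hg' =
      K.cl n (x + x') (by rw [map_add, hd, hd', add_zero]) (add_mem hg hg') := rfl

theorem cl_sub {x x' : K.V} {hd : K.d x = 0} {hg : x ∈ K.gr n} {hd' : K.d x' = 0}
    {hg' : x' ∈ K.gr n} : K.cl n x hd hg - K.cl n x' hd' hg' =
      K.cl n (x - x') (by rw [map_sub, hd, hd', sub_zero]) (sub_mem hg hg') := rfl

theorem smul_cl {x : K.V} {hd : K.d x = 0} {hg : x ∈ K.gr n} (t : T) : t • K.cl n x hd hg =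
      K.cl n (t • x) (by rw [map_smul, hd, smul_zero]) (Submodule.smul_mem _ _ hg) := rfl

theorem cl_eq_cl {x x' : K.V} {hd : K.d x = 0} {hg : x ∈ K.gr n} {hd' : K.d x' = 0}
    {hg' : x' ∈ K.gr n} : K.cl n x hd hg = K.cl n x' hd' hg' ↔
      ∃ y ∈ K.gr (n - 1), K.d y = x - x' := by
  rw [← sub_eq_zero, cl_sub, cl_eq_zero]

/-- Acyclicity in one degree. -/
theorem subsingleton_H (h : ∀ x, K.d x = 0 → x ∈ K.gr n → ∃ y ∈ K.gr (n - 1), K.d y = x) :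
    Subsingleton (K.H n) :=
  subsingleton_of_forall_eq 0 (H_ind fun x hd hg => cl_eq_zero.2 (h x hd hg))

theorem exists_of_subsingleton_H (h : Subsingleton (K.H n)) {x : K.V} (hd : K.d x = 0)
    (hg : x ∈ K.gr n) : ∃ y ∈ K.gr (n - 1), K.d y = x :=
  cl_eq_zero.1 (Subsingleton.elim (K.cl n x hd hg) 0)

/-- Additive maps of complexes, possibly over different rings. -/
structure Hom (K : Cx T) (K' : Cx T') where
  f : K.V →+ K'.V
  comm : ∀ x, f (K.d x) = K'.d (f x)
  gr : ∀ {n x}, x ∈ K.gr n → f x ∈ K'.gr n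

namespace Hom

instance : Zero (Hom K K') := ⟨⟨0, by simp, by simp⟩⟩

/-- Composition. -/
def comp (G : Hom K' K'') (F : Hom K K') : Hom K K'' :=
  ⟨G.f.comp F.f, fun x => by simp [F.comm, G.comm], fun h => G.gr (F.gr h)⟩

theorem exists_cl (F : Hom K K') (y : K.H n) : ∃ y' : K'.H n, ∀ x hd hg, y = K.cl n x hd hg →
    y' = K'.cl n (F.f x) (by rw [← F.comm, hd, map_zero]) (F.gr hg) := by
  induction y using H_ind with
  | _ x hd hg =>
    refine ⟨K'.cl n (F.f x) (by rw [← F.comm, hd, map_zero]) (F.gr hg), fun x' hd' hg' h => ?_⟩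
    obtain ⟨y, hy, e⟩ := cl_eq_cl.1 h
    exact cl_eq_cl.2 ⟨F.f y, F.gr hy, by rw [← F.comm, e, map_sub]⟩

/-- The induced map on cohomology. -/
noncomputable def H (F : Hom K K') (n : ℤ) : K.H n →+ K'.H n where
  toFun y := (F.exists_cl y).choose
  map_zero' := by
    rw [(F.exists_cl 0).choose_spec 0 (map_zero _) (zero_mem _) rfl]
    exact cl_eq_zero.2 ⟨0, zero_mem _, by simp⟩
  map_add' y y' := by
    induction y using H_ind with
    | _ x hd hg =>
    induction y' using H_ind with
    | _ x' hd' hg' =>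
    rw [(F.exists_cl (K.cl n x hd hg)).choose_spec x hd hg rfl,
      (F.exists_cl (K.cl n x' hd' hg')).choose_spec x' hd' hg' rfl,
      (F.exists_cl _).choose_spec (x + x') _ _ cl_add, cl_add]
    congr 1
    exact map_add _ _ _

theorem H_cl (F : Hom K K') {x : K.V} {hd : K.d x = 0} {hg : x ∈ K.gr n} :
    F.H n (K.cl n x hd hg) =
      K'.cl n (F.f x) (by rw [← F.comm, hd, map_zero]) (F.gr hg) :=
  (F.exists_cl (K.cl n x hd hg)).choose_spec x hd hg rfl

theorem H_comp (G : Hom K' K'') (F : Hom K K') (y : K.H n) :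
    (G.comp F).H n y = G.H n (F.H n y) := by
  induction y using H_ind with
  | _ x hd hg => simp only [H_cl]; rfl

end Hom

/-! ### Adding one element to a Čech complex -/

section step

/-- Fractions with numerator in a submodule. -/
def locSub (f : T) {M : Type} [AddCommGroup M] [Module T M] (N : Submodule T M) :
    Submodule T (Loc f M) where
  carrier := {b | ∃ n, ∃ x ∈ N, b = Loc.mk f n x}
  zero_mem' := ⟨0, 0, zero_mem _, by simp⟩
  add_mem' := by
    rintro _ _ ⟨n, x, hx, rfl⟩ ⟨n', x', hx', rfl⟩
    refine ⟨n + n', f ^ n' • x + f ^ n • x', add_mem (N.smul_mem _ hx) (N.smul_mem _ hx'), ?_⟩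
    rw [Loc.mk_add, Loc.mk_cancel, add_comm n, Loc.mk_cancel]
  smul_mem' := by
    rintro t _ ⟨n, x, hx, rfl⟩
    exact ⟨n, t • x, N.smul_mem _ hx, (Loc.mk_smul n t x).symm⟩

theorem d_smul' (K : Cx T) (f : T) (m : K.V) :
    K.d.toAddMonoidHom (f • m) = f • K.d.toAddMonoidHom m := K.d.map_smul f m

/-- The localized differential. -/
noncomputable def dLoc (K : Cx T) (f : T) : Loc f K.V →ₗ[T] Loc f K.V where
  toFun := Loc.map (f := f) (f' := f) K.d.toAddMonoidHom (K.d_smul' f)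
  map_add' := map_add _
  map_smul' t x := by
    induction x using Loc.ind with
    | _ n m =>
      rw [← Loc.mk_smul, Loc.map_mk, Loc.map_mk]
      exact (congrArg _ (K.d.map_smul t m)).trans (Loc.mk_smul _ _ _)

theorem dLoc_mk (f : T) (m : ℕ) (x : K.V) : K.dLoc f (Loc.mk f m x) = Loc.mk f m (K.d x) :=
  Loc.map_mk _ (K.d_smul' f) _ _

/-- The shifted cone of `K → K_f`. -/
noncomputable def step (f : T) (K : Cx T) : Cx T where
  V := K.V × Loc f K.V
  d := (K.d.comp (LinearMap.fst T _ _)).prod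
    ((Loc.mkL f 0).comp (LinearMap.fst T _ _) - (K.dLoc f).comp (LinearMap.snd T _ _))
  gr n := (K.gr n).prod (locSub f (K.gr (n - 1)))
  d_gr := by
    rintro n ⟨a, b⟩ ⟨ha, m, x, hx, hb⟩
    have hb : b = Loc.mk f m x := hb
    refine ⟨K.d_gr ha, sub_mem ⟨0, a, by simpa using ha, rfl⟩ ⟨m, K.d x, ?_, ?_⟩⟩
    · simpa using K.d_gr hx
    · simp [hb, dLoc_mk]
  d_d := by
    rintro ⟨a, b⟩
    refine Prod.ext (K.d_d a) ?_
    change Loc.mk f 0 (K.d a) - K.dLoc f (Loc.mk f 0 a - K.dLoc f b) = 0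
    rw [map_sub, dLoc_mk, sub_sub_cancel]
    induction b using Loc.ind with
    | _ n x => rw [dLoc_mk, dLoc_mk, K.d_d, Loc.mk_zero]

theorem step_d (f : T) (a : K.V) (b : Loc f K.V) :
    (step f K).d (a, b) = (K.d a, Loc.mk f 0 a - K.dLoc f b) := rfl

/-- Functoriality of the shifted cone. -/
noncomputable def Hom.step {f : T} {f' : T'} (F : Hom K K') (h : ∀ x, F.f (f • x) = f' • F.f x) :
    Hom (Cx.step f K) (Cx.step f' K') where
  f := F.f.prodMap (Loc.map F.f h)
  comm := by
    rintro ⟨a, b⟩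
    refine Prod.ext (F.comm a) ?_
    change Loc.map F.f h (Loc.mk f 0 a - K.dLoc f b) =
      Loc.mk f' 0 (F.f a) - K'.dLoc f' (Loc.map F.f h b)
    rw [map_sub, Loc.map_mk]
    congr 1
    induction b using Loc.ind with
    | _ n x => rw [dLoc_mk, Loc.map_mk, Loc.map_mk, dLoc_mk, F.comm]
  gr := by
    rintro n ⟨a, b⟩ ⟨ha, m, x, hx, hb⟩
    have hb : b = Loc.mk f m x := hb
    refine ⟨F.gr ha, m, F.f x, F.gr hx, ?_⟩
    change Loc.map F.f h b = _
    rw [hb, Loc.map_mk]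

theorem Hom.step_apply {f : T} {f' : T'} (F : Hom K K') (h : ∀ x, F.f (f • x) = f' • F.f x)
    (a : K.V) (b : Loc f K.V) : (F.step h).f (a, b) = (F.f a, Loc.map F.f h b) := rfl

/-- Extending a connection to the shifted cone. -/
noncomputable def Hom.stepConn {f : T} (g : T) (D : Hom K K)
    (h : ∀ x, D.f (f • x) = f • D.f x + g • x) : Hom (Cx.step f K) (Cx.step f K) where
  f := D.f.prodMap (Loc.conn g D.f h)
  comm := by
    rintro ⟨a, b⟩
    refine Prod.ext (D.comm a) ?_
    change Loc.conn g D.f h (Loc.mk f 0 a - K.dLoc f b) =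
      Loc.mk f 0 (D.f a) - K.dLoc f (Loc.conn g D.f h b)
    rw [map_sub, Loc.conn_mk, zero_smul, sub_zero]
    congr 1
    induction b using Loc.ind with
    | _ n x =>
      rw [dLoc_mk, Loc.conn_mk, Loc.conn_mk, map_sub, map_nsmul, dLoc_mk, dLoc_mk, D.comm,
        map_smul]
  gr := by
    rintro n ⟨a, b⟩ ⟨ha, m, x, hx, hb⟩
    have hb : b = Loc.mk f m x := hb
    refine ⟨D.gr ha, ?_⟩
    change Loc.conn g D.f h b ∈ locSub f (K.gr (n - 1))
    rw [hb, Loc.conn_mk]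
    have h1 : Loc.mk f m (D.f x) ∈ locSub f (K.gr (n - 1)) := ⟨_, _, D.gr hx, rfl⟩
    have h2 : Loc.mk f (m + 1) (g • x) ∈ locSub f (K.gr (n - 1)) :=
      ⟨_, _, Submodule.smul_mem _ _ hx, rfl⟩
    exact sub_mem h1 (nsmul_mem h2 _)

theorem Hom.stepConn_apply {f : T} (g : T) (D : Hom K K)
    (h : ∀ x, D.f (f • x) = f • D.f x + g • x) (a : K.V) (b : Loc f K.V) :
    (D.stepConn g h).f (a, b) = (D.f a, Loc.conn g D.f h b) := rfl

end step

/-- A module as a complex in degree zero. -/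
noncomputable def base (T : Type) [CommRing T] (M : Type) [AddCommGroup M] [Module T M] : Cx T where
  V := M
  d := 0
  gr n := if n = 0 then ⊤ else ⊥
  d_gr := by simp
  d_d := by simp

/-- The Čech complex of a module on a list of elements. -/
noncomputable def cech (M : Type) [AddCommGroup M] [Module T M] : List T → Cx T
  | [] => base T M
  | f :: l => step f (cech M l)

end Cx

namespace Cx

variable {T : Type} [CommRing T] {T' : Type} [CommRing T'] {T'' : Type} [CommRing T'']
  {M : Type} [AddCommGroup M] [Module T M] {M' : Type} [AddCommGroup M'] [Module T' M']
  {M'' : Type} [AddCommGroup M''] [Module T'' M'']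

/-- An additive map as a map of complexes in degree zero. -/
noncomputable def baseMap (T T' : Type) [CommRing T] [CommRing T'] [Module T M] [Module T' M']
    (φ : M →+ M') : Hom (base T M) (base T' M') where
  f := φ
  comm x := map_zero φ
  gr := by
    intro n x hx
    unfold base at *
    by_cases h : n = 0
    · simp [h]
    · have hx : x ∈ (if n = 0 then ⊤ else ⊥ : Submodule T M) := hx
      rw [if_neg h, Submodule.mem_bot] at hx
      subst hx
      exact (map_zero φ).symm ▸ zero_mem _

/-- The additive map intertwines the two lists of operators. -/
def Compat (φ : M →+ M') (l : List T) (l' : List T') : Prop :=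
  List.Forall₂ (fun f f' => ∀ m, φ (f • m) = f' • φ m) l l'

open Classical in
/-- Functoriality of the Čech complex; meaningful for compatible maps only. -/
noncomputable def cechMap (φ : M →+ M') : ∀ (l : List T) (l' : List T'),
    Hom (cech M l) (cech M' l')
  | [], [] => baseMap T T' φ
  | f :: l, f' :: l' =>
    if h : ∀ x, (cechMap φ l l').f (f • x) = f' • (cechMap φ l l').f x then
      (cechMap φ l l').step h else 0
  | [], _ :: _ => 0
  | _ :: _, [] => 0

/-- An element of the Čech complex on one more element. -/
noncomputable def cmk (f : T) (l : List T) (a : (cech M l).V) (n : ℕ) (b : (cech M l).V) :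
    (cech M (f :: l)).V := ((a, Loc.mk f n b) : (step f (cech M l)).V)

theorem smul_cmk {f : T} {l : List T} {a b : (cech M l).V} {m : ℕ} (t : T) :
    t • cmk f l a m b = cmk f l (t • a) m (t • b) :=
  Prod.ext rfl (Loc.mk_smul _ _ _).symm

theorem cmk_add {f : T} {l : List T} {a a' b b' : (cech M l).V} {m : ℕ} :
    cmk f l (a + a') m (b + b') = cmk f l a m b + cmk f l a' m b' :=
  Prod.ext rfl (Loc.mk_add _ _ _)

theorem cech_cons_ind {f : T} {l : List T} {p : (cech M (f :: l)).V → Prop}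
    (h : ∀ (a : (cech M l).V) (n : ℕ) (b : (cech M l).V),
      p (cmk f l a n b)) (x : (cech M (f :: l)).V) : p x := by
  obtain ⟨a, b⟩ := x
  induction b using Loc.ind with
  | _ n b => exact h a n b

theorem cechMap_smul {φ : M →+ M'} {l : List T} {l' : List T'} (hc : Compat φ l l') {t : T}
    {t' : T'} (h : ∀ m, φ (t • m) = t' • φ m) (x : (cech M l).V) :
    (cechMap φ l l').f (t • x) = t' • (cechMap φ l l').f x := by
  induction hc generalizing t t' with
  | nil => exact h x
  | @cons f f' l l' hf hl ih =>
    have hh := fun x => ih hf x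
    have e : cechMap φ (f :: l) (f' :: l') = (cechMap φ l l').step hh := dif_pos hh
    rw [e]
    induction x using cech_cons_ind with
    | _ a n b =>
    change ((cechMap φ l l').f (t • a), Loc.map _ hh (t • Loc.mk f n b)) =
      (t' • (cechMap φ l l').f a, t' • Loc.map _ hh (Loc.mk f n b))
    rw [← Loc.mk_smul, Loc.map_mk, Loc.map_mk, ih h, ih h, Loc.mk_smul]

theorem cechMap_cons {φ : M →+ M'} {f : T} {l : List T} {f' : T'} {l' : List T'}
    (hc : Compat φ (f :: l) (f' :: l')) : cechMap φ (f :: l) (f' :: l') =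
    (cechMap φ l l').step (cechMap_smul (List.forall₂_cons.1 hc).2 (List.forall₂_cons.1 hc).1) := by
  exact dif_pos _

theorem cechMap_cons_apply {φ : M →+ M'} {f : T} {l : List T} {f' : T'} {l' : List T'}
    (hc : Compat φ (f :: l) (f' :: l')) (a : (cech M l).V) (n : ℕ) (b : (cech M l).V) :
    (cechMap φ (f :: l) (f' :: l')).f (cmk f l a n b) =
    cmk f' l' ((cechMap φ l l').f a) n ((cechMap φ l l').f b) := by
  rw [cechMap_cons hc]
  exact (Hom.step_apply _ _ _ _).trans (Prod.ext rfl (Loc.map_mk _ _ _ _))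

theorem Compat.comp {ψ : M' →+ M''} {φ : M →+ M'} {l : List T} {l' : List T'} {l'' : List T''}
    (hc : Compat φ l l') (hc' : Compat ψ l' l'') : Compat (ψ.comp φ) l l'' := by
  induction hc generalizing l'' with
  | nil => cases hc'; exact List.Forall₂.nil
  | cons h1 h2 ih =>
    cases hc' with
    | cons h3 h4 => exact List.Forall₂.cons (fun m => by simp [h1, h3]) (ih h4)

theorem cechMap_comp {ψ : M' →+ M''} {φ : M →+ M'} {l : List T} {l' : List T'} {l'' : List T''}
    (hc : Compat φ l l') (hc' : Compat ψ l' l'') (x : (cech M l).V) :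
    (cechMap (ψ.comp φ) l l'').f x = (cechMap ψ l' l'').f ((cechMap φ l l').f x) := by
  induction hc generalizing l'' with
  | nil =>
    cases hc'
    rfl
  | @cons f f' l l' hf hl ih =>
    cases hc' with
    | @cons _ f'' _ l'' hf' hl' =>
    induction x using cech_cons_ind with
    | _ a n b =>
    rw [cechMap_cons_apply (Compat.comp (.cons hf hl) (.cons hf' hl')),
      cechMap_cons_apply (List.Forall₂.cons hf hl), cechMap_cons_apply
      (List.Forall₂.cons hf' hl'), ih hl', ih hl']

theorem compat_same [Module T M''] {φ : M →+ M''} {l : List T}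
    (h : ∀ f ∈ l, ∀ m, φ (f • m) = f • φ m) : Compat φ l l := by
  induction l with
  | nil => exact List.Forall₂.nil
  | cons f l ih =>
    exact List.Forall₂.cons (h f (by simp)) (ih fun g hg => h g (by simp [hg]))

theorem compat_map {φ : M →+ M'} {l : List T} {u : T → T'}
    (h : ∀ f ∈ l, ∀ m, φ (f • m) = u f • φ m) : Compat φ l (l.map u) := by
  induction l with
  | nil => exact List.Forall₂.nil
  | cons f l ih =>
    exact List.Forall₂.cons (h f (by simp)) (ih fun g hg => h g (by simp [hg]))

theorem compat_smul (t : T) (l : List T) : Compat (DistribSMul.toAddMonoidHom M t) l l :=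
  compat_same fun f _ m => smul_comm t f m

theorem cechMap_smul_eq (t : T) (l : List T) (x : (cech M l).V) :
    (cechMap (DistribSMul.toAddMonoidHom M t) l l).f x = t • x := by
  induction l with
  | nil => rfl
  | cons f l ih =>
    induction x using cech_cons_ind with
    | _ a n b =>
    rw [cechMap_cons_apply (compat_smul t _), ih, ih, smul_cmk]

theorem cechMap_id (l : List T) (x : (cech M l).V) :
    (cechMap (AddMonoidHom.id M) l l).f x = x := by
  have : AddMonoidHom.id M = DistribSMul.toAddMonoidHom M (1 : T) := by ext; simp
  rw [this, cechMap_smul_eq, one_smul]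

theorem Compat.add {φ ψ : M →+ M'} {l : List T} {l' : List T'}
    (hc : Compat φ l l') (hc' : Compat ψ l l') : Compat (φ + ψ) l l' := by
  induction hc with
  | nil => exact List.Forall₂.nil
  | cons h1 h2 ih =>
    cases hc' with
    | cons h3 h4 =>
      exact List.Forall₂.cons (fun m => by simp [h1, h3]) (ih h4)

theorem cechMap_add {φ ψ : M →+ M'} {l : List T} {l' : List T'}
    (hc : Compat φ l l') (hc' : Compat ψ l l') (x : (cech M l).V) :
    (cechMap (φ + ψ) l l').f x = (cechMap φ l l').f x + (cechMap ψ l l').f x := by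
  induction hc with
  | nil => rfl
  | cons h1 h2 ih =>
    cases hc' with
    | cons h3 h4 =>
    induction x using cech_cons_ind with
    | _ a n b =>
    rw [cechMap_cons_apply (Compat.add (.cons h1 h2) (.cons h3 h4)),
      cechMap_cons_apply (.cons h1 h2),
      cechMap_cons_apply (.cons h3 h4), ih h4, ih h4, cmk_add]

theorem compat_zero : ∀ {l : List T} {l' : List T'}, l.length = l'.length →
    Compat (0 : M →+ M') l l'
  | [], [], _ => List.Forall₂.nil
  | _ :: _, _ :: _, h => List.Forall₂.cons (by simp) (compat_zero (by simpa using h))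

theorem cechMap_zero {l : List T} {l' : List T'} (hl : l.length = l'.length) (x : (cech M l).V) :
    (cechMap (0 : M →+ M') l l').f x = 0 := by
  have h := compat_zero (M := M) (M' := M') hl
  have := cechMap_add h h x
  rw [add_zero] at this
  simpa using this

/-! ### Connections -/

open Classical in
/-- The extension of a connection to the Čech complex; meaningful for connections only. -/
noncomputable def cechConn (δ : T → T) (D : M →+ M) : ∀ l : List T, Hom (cech M l) (cech M l)
  | [] => baseMap T T D
  | f :: l =>
    if h : ∀ x, (cechConn δ D l).f (f • x) = f • (cechConn δ D l).f x + δ f • x then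
      (cechConn δ D l).stepConn (δ f) h else 0

/-- The Leibniz rule. -/
def IsConn (δ : T → T) (D : M →+ M) : Prop := ∀ (t : T) (m : M), D (t • m) = t • D m + δ t • m

theorem cechConn_smul {δ : T → T} {D : M →+ M} (hD : IsConn δ D) (l : List T) (t : T)
    (x : (cech M l).V) :
    (cechConn δ D l).f (t • x) = t • (cechConn δ D l).f x + δ t • x := by
  induction l generalizing t with
  | nil => exact hD t x
  | cons f l ih =>
    have hh := fun x => ih f x
    have e : cechConn δ D (f :: l) = (cechConn δ D l).stepConn (δ f) hh := dif_pos hh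
    rw [e]
    induction x using cech_cons_ind with
    | _ a n b =>
    refine Prod.ext (ih t a) ?_
    change Loc.conn _ _ hh (t • Loc.mk f n b) =
      t • Loc.conn _ _ hh (Loc.mk f n b) + δ t • Loc.mk f n b
    rw [← Loc.mk_smul, Loc.conn_mk, Loc.conn_mk, ih t, smul_sub, ← Loc.mk_smul, ← Loc.mk_smul,
      Loc.mk_add, smul_comm t n, ← Loc.mk_smul, smul_comm (δ f) t]
    abel

theorem cechConn_cons_apply {δ : T → T} {D : M →+ M} (hD : IsConn δ D) (f : T) (l : List T)
    (a : (cech M l).V) (n : ℕ) (b : (cech M l).V) :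
    (cechConn δ D (f :: l)).f (cmk f l a n b) =
    (((cechConn δ D l).f a, Loc.mk f n ((cechConn δ D l).f b) - n • Loc.mk f (n + 1) (δ f • b)) :
      (step f (cech M l)).V) := by
  have hh := cechConn_smul hD l f
  have e : cechConn δ D (f :: l) = (cechConn δ D l).stepConn (δ f) hh := dif_pos hh
  rw [e]
  exact (Hom.stepConn_apply _ _ _ _ _).trans (Prod.ext rfl (Loc.conn_mk _ _ _ _ _))

theorem cechConn_eq_cechMap {δ : T → T} {D : M →+ M} (hD : IsConn δ D) {l : List T}
    (hl : ∀ f ∈ l, δ f = 0) (x : (cech M l).V) :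
    (cechConn δ D l).f x = (cechMap D l l).f x := by
  induction l with
  | nil => rfl
  | cons f l ih =>
    have hc : Compat D (f :: l) (f :: l) := compat_same fun g hg m => by simp [hD g m, hl g hg]
    have ih := ih fun g hg => hl g (by simp [hg])
    induction x using cech_cons_ind with
    | _ a n b =>
    rw [cechConn_cons_apply hD, cechMap_cons_apply hc, ih, ih, hl f (by simp)]
    refine Prod.ext rfl ?_
    change Loc.mk f n _ - n • Loc.mk f (n + 1) ((0 : T) • b) = Loc.mk f n _
    rw [zero_smul, Loc.mk_zero, nsmul_zero, sub_zero]

theorem cechConn_sum {ι : Type} (s : Finset ι) (t : ι → T) (δ : ι → T → T) (D : ι → M →+ M)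
    (hD : ∀ i, IsConn (δ i) (D i)) (δ' : T → T) (D' : M →+ M) (hδ' : ∀ a, δ' a = ∑ i ∈ s, t i * δ i a)
    (hD' : ∀ m, D' m = ∑ i ∈ s, t i • D i m) (l : List T) (x : (cech M l).V) :
    (cechConn δ' D' l).f x = ∑ i ∈ s, t i • (cechConn (δ i) (D i) l).f x := by
  have hC : IsConn δ' D' := by
    intro a m
    simp only [hD', hδ', (hD _) a m, smul_add, Finset.sum_add_distrib, Finset.smul_sum,
      Finset.sum_smul, mul_smul]
    congr 1
    exact Finset.sum_congr rfl fun i _ => smul_comm _ _ _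
  induction l with
  | nil => exact hD' x
  | cons f l ih =>
    induction x using cech_cons_ind with
    | _ a n b =>
    rw [cechConn_cons_apply hC, Finset.sum_congr rfl fun i _ =>
      congrArg (t i • ·) (cechConn_cons_apply (hD i) f l a n b)]
    refine Prod.ext ?_ ?_
    · refine (ih a).trans ?_
      exact (map_sum (LinearMap.fst T (cech M l).V (Loc f (cech M l).V))
        (fun i => t i • ((cechConn (δ i) (D i) l).f a, Loc.mk f n ((cechConn (δ i) (D i) l).f b) -
          n • Loc.mk f (n + 1) (δ i f • b))) s).symm
    · refine Eq.trans ?_ (map_sum (LinearMap.snd T (cech M l).V (Loc f (cech M l).V))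
        (fun i => t i • ((cechConn (δ i) (D i) l).f a, Loc.mk f n ((cechConn (δ i) (D i) l).f b) -
          n • Loc.mk f (n + 1) (δ i f • b))) s).symm
      change Loc.mk f n ((cechConn δ' D' l).f b) - n • Loc.mk f (n + 1) (δ' f • b) =
        ∑ i ∈ s, t i • (Loc.mk f n ((cechConn (δ i) (D i) l).f b) -
          n • Loc.mk f (n + 1) (δ i f • b))
      simp only [smul_sub, Finset.sum_sub_distrib, ih, hδ', Finset.sum_smul, mul_smul]
      congr 1
      · rw [show ∀ y : (cech M l).V, Loc.mk f n y = Loc.mkL f n y from fun _ => rfl, map_sum]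
        exact Finset.sum_congr rfl fun i _ => map_smul _ _ _
      · rw [show ∀ y : (cech M l).V, Loc.mk f (n + 1) y = Loc.mkL f (n + 1) y from fun _ => rfl,
          map_sum, ← Finset.sum_nsmul]
        refine Finset.sum_congr rfl fun i _ => ?_
        rw [map_smul, smul_comm]
        rfl

theorem cechConn_comm {δ δ' : T → T} {D D' : M →+ M} (hD : IsConn δ D) (hD' : IsConn δ' D')
    (hδ : ∀ a, δ (δ' a) = δ' (δ a)) (hDD : ∀ m, D (D' m) = D' (D m))
    (l : List T) (x : (cech M l).V) :
    (cechConn δ D l).f ((cechConn δ' D' l).f x) = (cechConn δ' D' l).f ((cechConn δ D l).f x) := by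
  induction l with
  | nil => exact hDD x
  | cons f l ih =>
    induction x using cech_cons_ind with
    | _ a n b =>
    have key : ∀ {δ δ' : T → T} {D D' : M →+ M} (hD : IsConn δ D) (hD' : IsConn δ' D'),
        (cechConn δ D (f :: l)).f ((cechConn δ' D' (f :: l)).f
          (cmk f l a n b)) =
        (((cechConn δ D l).f ((cechConn δ' D' l).f a),
          (Loc.mk f n ((cechConn δ D l).f ((cechConn δ' D' l).f b)) -
            n • Loc.mk f (n + 1) (δ f • (cechConn δ' D' l).f b)) -
          n • (Loc.mk f (n + 1) (δ' f • (cechConn δ D l).f b + δ (δ' f) • b) -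
            (n + 1) • Loc.mk f (n + 1 + 1) (δ f • δ' f • b))) : (step f (cech M l)).V) := by
      intro δ δ' D D' hD hD'
      have e : (cechConn δ' D' (f :: l)).f (cmk f l a n b) = cmk f l ((cechConn δ' D' l).f a)
          (n + 1) (f • (cechConn δ' D' l).f b - n • δ' f • b) := by
        rw [cechConn_cons_apply hD']
        refine Prod.ext rfl ?_
        change Loc.mk f n ((cechConn δ' D' l).f b) - n • Loc.mk f (n + 1) (δ' f • b) =
          Loc.mk f (n + 1) (f • (cechConn δ' D' l).f b - n • δ' f • b)
        rw [← Loc.mk_nsmul, Loc.mk_sub, Loc.mk_succ]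
      rw [e, cechConn_cons_apply hD]
      refine Prod.ext rfl ?_
      change Loc.mk f (n + 1) ((cechConn δ D l).f (f • (cechConn δ' D' l).f b - n • δ' f • b)) -
        (n + 1) • Loc.mk f (n + 1 + 1) (δ f • (f • (cechConn δ' D' l).f b - n • δ' f • b)) = _
      rw [map_sub, map_nsmul, cechConn_smul hD, cechConn_smul hD, smul_sub (δ f), smul_comm (δ f) f,
        smul_comm (δ f) n, Loc.mk_sub, Loc.mk_add, Loc.mk_succ, Loc.mk_sub (n + 1 + 1), Loc.mk_succ,
        Loc.mk_nsmul, Loc.mk_nsmul]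
      simp only [succ_nsmul, nsmul_sub, nsmul_add, Loc.mk_add]
      abel
    rw [key hD hD', key hD' hD]
    refine Prod.ext (ih a) ?_
    change _ - _ - _ = _ - _ - _
    simp only [ih, hδ, Loc.mk_add, smul_comm (δ f) (δ' f), nsmul_add, nsmul_sub]
    abel

end Cx

namespace Cx

variable {T : Type} [CommRing T] {T' : Type} [CommRing T'] {T'' : Type} [CommRing T'']
  {M : Type} [AddCommGroup M] [Module T M] {M' : Type} [AddCommGroup M'] [Module T' M']
  {K : Cx T} {K' : Cx T'} {n : ℤ}

theorem Hom.H_smul (F : Hom K K') {t : T} {t' : T'} (h : ∀ x, F.f (t • x) = t' • F.f x)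
    (y : K.H n) : F.H n (t • y) = t' • F.H n y := by
  induction y using H_ind with
  | _ x hd hg =>
    rw [smul_cl, H_cl, H_cl, smul_cl]
    congr 1
    exact h x

theorem Hom.H_congr {F G : Hom K K'} (h : ∀ x, F.f x = G.f x) (y : K.H n) :
    F.H n y = G.H n y := by
  induction y using H_ind with
  | _ x hd hg =>
    rw [H_cl, H_cl]
    congr 1
    exact h x

theorem mem_base_gr {x : M} : x ∈ (base T M).gr n ↔ (n = 0 ∨ x = 0) := by
  change x ∈ (if n = 0 then ⊤ else ⊥ : Submodule T M) ↔ _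
  split_ifs with h <;> simp [h]

theorem mem_cech_nil_gr {x : (cech M ([] : List T)).V} :
    x ∈ (cech M ([] : List T)).gr n ↔ (n = 0 ∨ x = 0) :=
  @mem_base_gr T _ M _ _ n x

theorem eq_zero_of_mem_cech_gr {l : List T} (hn : n < 0 ∨ (l.length : ℤ) < n) {x : (cech M l).V}
    (hx : x ∈ (cech M l).gr n) : x = 0 := by
  induction l generalizing n with
  | nil =>
    refine (mem_cech_nil_gr.1 hx).resolve_left ?_
    simp at hn
    omega
  | cons f l ih =>
    obtain ⟨a, b⟩ := x
    obtain ⟨ha, m, y, hy, hb⟩ := hx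
    simp only [List.length_cons, Nat.cast_add, Nat.cast_one] at hn
    have ha : a = 0 := ih (by omega) ha
    have hy : y = 0 := ih (by omega) hy
    have hb : b = Loc.mk f m y := hb
    rw [hb, ha, hy, Loc.mk_zero]
    rfl

theorem subsingleton_cech_H (M : Type) [AddCommGroup M] [Module T M] {l : List T}
    (hn : n < 0 ∨ (l.length : ℤ) < n) : Subsingleton ((cech M l).H n) :=
  subsingleton_H fun x _ hx => ⟨0, zero_mem _, by rw [map_zero, eq_zero_of_mem_cech_gr hn hx]⟩

/-! ### Torsion -/

/-- The element acts locally nilpotently on the cohomology in degree `n`. -/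
def Tors (K : Cx T) (f : T) (n : ℤ) : Prop :=
  ∀ x, K.d x = 0 → x ∈ K.gr n → ∃ N : ℕ, ∃ y ∈ K.gr (n - 1), K.d y = f ^ N • x

theorem exists_loc_cocycle {g : T} {b : Loc g K.V} {n : ℤ} (hb : b ∈ locSub g (K.gr n))
    (hd : K.dLoc g b = 0) : ∃ m x, K.d x = 0 ∧ x ∈ K.gr n ∧ b = Loc.mk g m x := by
  obtain ⟨m, x, hx, rfl⟩ := hb
  rw [dLoc_mk, Loc.mk_eq_zero] at hd
  obtain ⟨N, hN⟩ := hd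
  exact ⟨m + N, g ^ N • x, by rw [map_smul, hN], Submodule.smul_mem _ _ hx,
    (Loc.mk_cancel _ _ _).symm⟩

theorem tors_step_self (f : T) (K : Cx T) (n : ℤ) : Tors (step f K) f n := by
  rintro ⟨a, b⟩ hd ⟨ha, m, x, hx, hb⟩
  have hb : b = Loc.mk f m x := hb
  subst hb
  have hd2 : Loc.mk f 0 a - K.dLoc f (Loc.mk f m x) = 0 := congrArg Prod.snd hd
  rw [dLoc_mk, sub_eq_zero, Loc.mk_eq_mk] at hd2
  obtain ⟨N, hN⟩ := hd2
  refine ⟨N + m, (f ^ N • x, 0), ⟨Submodule.smul_mem _ _ hx, zero_mem _⟩, ?_⟩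
  rw [step_d, map_smul, map_zero, sub_zero]
  refine Prod.ext hN.symm ?_
  change Loc.mk f 0 (f ^ N • x) = f ^ (N + m) • Loc.mk f m x
  rw [pow_add, mul_smul, Loc.pow_smul_mk, Loc.mk_smul]

theorem Tors.step {f : T} (h : Tors K f n) (h' : Tors K f (n - 1)) (g : T) :
    Tors (Cx.step g K) f n := by
  rintro ⟨a, b⟩ hd ⟨ha, hb⟩
  have hb : b ∈ locSub g (K.gr (n - 1)) := hb
  have hd1 : K.d a = 0 := congrArg Prod.fst hd
  have hd2 : Loc.mk g 0 a - K.dLoc g b = 0 := congrArg Prod.snd hd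
  obtain ⟨N, y, hy, e⟩ := h a hd1 ha
  have h1 : f ^ N • b - Loc.mk g 0 y ∈ locSub g (K.gr (n - 1)) :=
    sub_mem (Submodule.smul_mem _ _ hb) ⟨0, y, hy, rfl⟩
  have h2 : K.dLoc g (f ^ N • b - Loc.mk g 0 y) = 0 := by
    rw [map_sub, map_smul, dLoc_mk, e, Loc.mk_smul, ← smul_sub, ← neg_sub, hd2, neg_zero,
      smul_zero]
  obtain ⟨m, x, hx, hxg, e'⟩ := exists_loc_cocycle h1 h2
  obtain ⟨N', y', hy', e''⟩ := h' x hx hxg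
  refine ⟨N' + N, (f ^ N' • y, -Loc.mk g m y'), ⟨Submodule.smul_mem _ _ hy,
    neg_mem ⟨m, y', hy', rfl⟩⟩, ?_⟩
  rw [step_d, map_smul, map_neg, sub_neg_eq_add, e]
  refine Prod.ext (by rw [smul_smul, pow_add]; rfl) ?_
  change Loc.mk g 0 (f ^ N' • y) + K.dLoc g (Loc.mk g m y') = f ^ (N' + N) • b
  rw [dLoc_mk, e'', Loc.mk_smul, Loc.mk_smul, ← e', ← smul_add, pow_add, mul_smul]
  congr 1
  abel

theorem tors_cech (M : Type) [AddCommGroup M] [Module T M] {f : T} {l : List T} (hf : f ∈ l)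
    (n : ℤ) : Tors (cech M l) f n := by
  induction l generalizing n with
  | nil => simp at hf
  | cons g l ih =>
    rcases List.mem_cons.1 hf with rfl | hf
    · exact tors_step_self _ _ _
    · exact (ih hf _).step (ih hf _) _

theorem exists_pow_smul_eq_zero {f : T} {l : List T} (hf : f ∈ l) (y : (cech M l).H n) :
    ∃ N : ℕ, f ^ N • y = 0 := by
  induction y using H_ind with
  | _ x hd hg =>
    obtain ⟨N, z, hz, e⟩ := tors_cech M hf n x hd hg
    exact ⟨N, by rw [smul_cl, cl_eq_zero]; exact ⟨z, hz, e⟩⟩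

/-! ### Localization -/

/-- A map of complexes which is a localization in every degree. -/
structure Hom.IsLoc (F : Hom K K') (S : Submonoid T) (u : T →+* T') : Prop where
  smul : ∀ t x, F.f (t • x) = u t • F.f x
  surj : ∀ n, ∀ y ∈ K'.gr n, ∃ s ∈ S, ∃ x ∈ K.gr n, F.f x = u s • y
  inj : ∀ x, F.f x = 0 → ∃ s ∈ S, s • x = 0

theorem Hom.IsLoc.step {F : Hom K K'} {S : Submonoid T} {u : T →+* T'} (hF : F.IsLoc S u) (f : T)
    (h : ∀ x, F.f (f • x) = u f • F.f x) : (F.step h).IsLoc S u where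
  smul := by
    rintro t ⟨a, b⟩
    refine Prod.ext (hF.smul t a) ?_
    change Loc.map F.f h (t • b) = u t • Loc.map F.f h b
    induction b using Loc.ind with
    | _ n b => rw [← Loc.mk_smul, Loc.map_mk, Loc.map_mk, hF.smul, Loc.mk_smul]
  surj := by
    rintro n ⟨a, b⟩ ⟨ha, m, x, hx, hb⟩
    have hb : b = Loc.mk (u f) m x := hb
    obtain ⟨s, hs, a', ha', e⟩ := hF.surj _ _ ha
    obtain ⟨s', hs', x', hx', e'⟩ := hF.surj _ _ hx
    refine ⟨s * s', mul_mem hs hs', (s' • a', Loc.mk f m (s • x')), ⟨Submodule.smul_mem _ _ ha',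
      ⟨m, s • x', Submodule.smul_mem _ _ hx', rfl⟩⟩, ?_⟩
    refine Prod.ext ?_ ?_
    · change F.f (s' • a') = u (s * s') • a
      rw [hF.smul, e, map_mul, mul_comm, mul_smul]
    · change Loc.map F.f h (Loc.mk f m (s • x')) = u (s * s') • b
      rw [Loc.map_mk, hF.smul, e', hb, map_mul, mul_smul, Loc.mk_smul, Loc.mk_smul]
  inj := by
    rintro ⟨a, b⟩ e
    have e1 : F.f a = 0 := congrArg Prod.fst e
    have e2 : Loc.map F.f h b = 0 := congrArg Prod.snd e
    obtain ⟨s, hs, hs'⟩ := hF.inj a e1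
    induction b using Loc.ind with
    | _ m x =>
      rw [Loc.map_mk, Loc.mk_eq_zero] at e2
      obtain ⟨N, hN⟩ := e2
      obtain ⟨s', hs1, hs2⟩ := hF.inj (f ^ N • x) (by rw [hF.smul, map_pow, hN])
      refine ⟨s' * s, mul_mem hs1 hs, ?_⟩
      refine Prod.ext ?_ ?_
      · change (s' * s) • a = 0
        rw [mul_smul, hs', smul_zero]
      · change (s' * s) • Loc.mk f m x = 0
        rw [← Loc.mk_smul, Loc.mk_eq_zero]
        exact ⟨N, by rw [smul_smul, mul_comm, mul_comm s' s, mul_assoc, mul_smul, mul_smul, hs2,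
          smul_zero]⟩

theorem isLoc_cechMap {S : Submonoid T} {u : T →+* T'} {φ : M →+ M'}
    (h1 : ∀ t m, φ (t • m) = u t • φ m) (h2 : ∀ y, ∃ s ∈ S, ∃ x, φ x = u s • y)
    (h3 : ∀ x, φ x = 0 → ∃ s ∈ S, s • x = 0) (l : List T) :
    (cechMap φ l (l.map u)).IsLoc S u := by
  induction l with
  | nil =>
    refine ⟨h1, fun n y hy => ?_, h3⟩
    rcases mem_cech_nil_gr.1 hy with h | h
    · obtain ⟨s, hs, x, hx⟩ := h2 y
      exact ⟨s, hs, x, mem_cech_nil_gr.2 (Or.inl h), hx⟩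
    · exact ⟨1, one_mem _, 0, zero_mem _, by rw [h]; exact (map_zero _).trans (smul_zero _).symm⟩
  | cons f l ih =>
    have hc : Compat φ (f :: l) (u f :: l.map u) := compat_map (fun f _ m => h1 f m)
    have e := cechMap_cons hc
    rw [List.map_cons, e]
    exact ih.step f _

theorem Hom.IsLoc.H_surj {F : Hom K K'} {S : Submonoid T} {u : T →+* T'} (hF : F.IsLoc S u)
    (y : K'.H n) : ∃ s ∈ S, ∃ x, F.H n x = u s • y := by
  induction y using H_ind with
  | _ y hd hg =>
    obtain ⟨s, hs, x, hx, e⟩ := hF.surj n y hg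
    obtain ⟨s', hs', e'⟩ := hF.inj (K.d x) (by rw [F.comm, e, map_smul, hd, smul_zero])
    refine ⟨s' * s, mul_mem hs' hs, K.cl n (s' • x) (by rw [map_smul, e'])
      (Submodule.smul_mem _ _ hx), ?_⟩
    rw [H_cl, smul_cl]
    congr 1
    rw [hF.smul, e, smul_smul, map_mul]

theorem Hom.IsLoc.H_inj {F : Hom K K'} {S : Submonoid T} {u : T →+* T'} (hF : F.IsLoc S u)
    (x : K.H n) (hx : F.H n x = 0) : ∃ s ∈ S, s • x = 0 := by
  induction x using H_ind with
  | _ x hd hg =>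
    rw [H_cl, cl_eq_zero] at hx
    obtain ⟨y, hy, e⟩ := hx
    obtain ⟨s, hs, z, hz, e'⟩ := hF.surj _ y hy
    obtain ⟨s', hs', e''⟩ := hF.inj (s • x - K.d z) (by
      rw [map_sub, hF.smul, F.comm, e', map_smul, e, sub_self])
    refine ⟨s' * s, mul_mem hs' hs, ?_⟩
    rw [smul_cl, cl_eq_zero]
    refine ⟨s' • z, Submodule.smul_mem _ _ hz, ?_⟩
    rw [smul_sub, sub_eq_zero] at e''
    rw [map_smul, ← e'', mul_smul]

end Cx

namespace Cx

variable {T : Type} [CommRing T] {T' : Type} [CommRing T']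
  {M : Type} [AddCommGroup M] [Module T M] {M' : Type} [AddCommGroup M'] [Module T' M']
  {M'' : Type} [AddCommGroup M''] [Module T M''] {K : Cx T} {K' : Cx T'} {n : ℤ}

/-! ### Exactness of the Čech complex -/

theorem exists_of_mem_cech_gr {f : T} {l : List T} {n : ℤ} {x : (cech M (f :: l)).V}
    (hx : x ∈ (cech M (f :: l)).gr n) : ∃ a ∈ (cech M l).gr n, ∃ m, ∃ b ∈ (cech M l).gr (n - 1),
      x = cmk f l a m b := by
  obtain ⟨a, b⟩ := x
  obtain ⟨ha, m, y, hy, hb⟩ := hx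
  have hb : b = Loc.mk f m y := hb
  subst hb
  exact ⟨a, ha, m, y, hy, rfl⟩

theorem cmk_mem_gr {f : T} {l : List T} {n : ℤ} {a b : (cech M l).V}
    (ha : a ∈ (cech M l).gr n) (m : ℕ) (hb : b ∈ (cech M l).gr (n - 1)) :
    cmk f l a m b ∈ (cech M (f :: l)).gr n :=
  ⟨ha, m, b, hb, rfl⟩

theorem cmk_eq_zero {f : T} {l : List T} {a b : (cech M l).V} {m : ℕ} :
    cmk f l a m b = 0 ↔ a = 0 ∧ ∃ N, f ^ N • b = 0 := by
  rw [← Loc.mk_eq_zero (n := m)]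
  exact Prod.mk_eq_zero

theorem cmk_cancel {f : T} {l : List T} {a b : (cech M l).V} {m : ℕ} (N : ℕ) :
    cmk f l a (m + N) (f ^ N • b) = cmk f l a m b :=
  Prod.ext rfl (Loc.mk_cancel _ _ _)

theorem cechMap_injective {φ : M →+ M'} (hφ : Function.Injective φ) {l : List T} {l' : List T'}
    (hc : Compat φ l l') : Function.Injective (cechMap φ l l').f := by
  induction hc with
  | nil => exact hφ
  | @cons f f' l l' h1 h2 ih =>
    refine (injective_iff_map_eq_zero _).2 fun x hx => ?_
    induction x using cech_cons_ind with
    | _ a m b =>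
    rw [cechMap_cons_apply (.cons h1 h2), cmk_eq_zero] at hx
    obtain ⟨h3, N, h4⟩ := hx
    refine cmk_eq_zero.2 ⟨ih (by rw [h3, map_zero]), N, ih ?_⟩
    rw [cechMap_smul h2 (t' := f' ^ N), h4, map_zero]
    intro m
    induction N with
    | zero => simp
    | succ N _ =>
      clear h4
      induction N + 1 with
      | zero => simp
      | succ N ih' => rw [pow_succ', mul_smul, h1, ih', pow_succ', mul_smul]

theorem cechMap_surj {φ : M →+ M'} (hφ : Function.Surjective φ) {l : List T} {l' : List T'}
    (hc : Compat φ l l') (y : (cech M' l').V) (hy : y ∈ (cech M' l').gr n) :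
    ∃ x ∈ (cech M l).gr n, (cechMap φ l l').f x = y := by
  induction hc generalizing n with
  | nil =>
    rcases mem_cech_nil_gr.1 hy with h | h
    · obtain ⟨x, hx⟩ := hφ y
      exact ⟨x, mem_cech_nil_gr.2 (Or.inl h), hx⟩
    · exact ⟨0, zero_mem _, by rw [map_zero, h]⟩
  | @cons f f' l l' h1 h2 ih =>
    obtain ⟨a, ha, m, b, hb, rfl⟩ := exists_of_mem_cech_gr hy
    obtain ⟨a', ha', rfl⟩ := ih a ha
    obtain ⟨b', hb', rfl⟩ := ih b hb
    exact ⟨_, cmk_mem_gr ha' m hb', cechMap_cons_apply (.cons h1 h2) _ _ _⟩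

theorem pow_smul_comm {φ : M →+ M'} {f : T} {f' : T'} (h : ∀ m, φ (f • m) = f' • φ m) (N : ℕ)
    (m : M) : φ (f ^ N • m) = f' ^ N • φ m := by
  induction N with
  | zero => simp
  | succ N ih => rw [pow_succ', mul_smul, h, ih, pow_succ', mul_smul]

theorem cechMap_exact {A : Type} [AddCommGroup A] [Module T' A] {φ : M →+ M'}
    {ψ : M' →+ A} (h : ∀ y, ψ y = 0 → ∃ x, φ x = y) {l : List T} {l' : List T'}
    (hc : Compat φ l l') (hc' : Compat ψ l' l') (y : (cech M' l').V)
    (hy : y ∈ (cech M' l').gr n) (e : (cechMap ψ l' l').f y = 0) :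
    ∃ x ∈ (cech M l).gr n, (cechMap φ l l').f x = y := by
  induction hc generalizing n with
  | nil =>
    rcases mem_cech_nil_gr.1 hy with h' | h'
    · obtain ⟨x, hx⟩ := h y e
      exact ⟨x, mem_cech_nil_gr.2 (Or.inl h'), hx⟩
    · exact ⟨0, zero_mem _, by rw [map_zero, h']⟩
  | @cons f f' l l' h1 h2 ih =>
    cases hc' with
    | cons h3 h4 =>
    obtain ⟨a, ha, m, b, hb, rfl⟩ := exists_of_mem_cech_gr hy
    rw [cechMap_cons_apply (.cons h3 h4), cmk_eq_zero] at e
    obtain ⟨e1, N, e2⟩ := e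
    obtain ⟨a', ha', rfl⟩ := ih h4 a ha e1
    obtain ⟨b', hb', e3⟩ := ih h4 (f' ^ N • b) (Submodule.smul_mem _ _ hb) (by
      rw [cechMap_smul h4 (pow_smul_comm h3 N), e2])
    refine ⟨_, cmk_mem_gr ha' (m + N) hb', ?_⟩
    rw [cechMap_cons_apply (.cons h1 h2), e3, cmk_cancel]

theorem exists_pow_smul_elem {f : T} (h : ∀ m : M, ∃ N : ℕ, f ^ N • m = 0) {l : List T}
    (x : (cech M l).V) : ∃ N : ℕ, f ^ N • x = 0 := by
  induction l with
  | nil => exact h x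
  | cons g l ih =>
    induction x using cech_cons_ind with
    | _ a m b =>
    obtain ⟨N, hN⟩ := ih a
    obtain ⟨N', hN'⟩ := ih b
    refine ⟨N + N', ?_⟩
    rw [smul_cmk, cmk_eq_zero]
    exact ⟨by rw [add_comm, pow_add, mul_smul, hN, smul_zero],
      0, by rw [pow_add, mul_smul, hN', smul_zero, smul_zero]⟩

theorem exists_div_elem {f : T} (h : ∀ x : M, ∀ m : ℕ, ∃ N : ℕ, ∃ y, f ^ (N + m) • y = f ^ N • x)
    {l : List T} (m : ℕ) (x : (cech M l).V) (hx : x ∈ (cech M l).gr n) :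
    ∃ N : ℕ, ∃ y ∈ (cech M l).gr n, f ^ (N + m) • y = f ^ N • x := by
  induction l generalizing n with
  | nil =>
    rcases mem_cech_nil_gr.1 hx with h' | h'
    · obtain ⟨N, y, e⟩ := h x m
      exact ⟨N, y, mem_cech_nil_gr.2 (Or.inl h'), e⟩
    · exact ⟨0, 0, zero_mem _, by rw [h', smul_zero, smul_zero]⟩
  | cons g l ih =>
    obtain ⟨a, ha, p, b, hb, rfl⟩ := exists_of_mem_cech_gr hx
    obtain ⟨N, a', ha', e⟩ := ih a ha
    obtain ⟨N', b', hb', e'⟩ := ih b hb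
    refine ⟨N + N', _, cmk_mem_gr ha' p hb', ?_⟩
    have e1 : f ^ (N + N' + m) • a' = f ^ (N + N') • a := by
      rw [show N + N' + m = N' + (N + m) by ring, pow_add, mul_smul, e, ← mul_smul, ← pow_add,
        add_comm]
    have e2 : f ^ (N + N' + m) • b' = f ^ (N + N') • b := by
      rw [show N + N' + m = N + (N' + m) by ring, pow_add, mul_smul, e', ← mul_smul, ← pow_add]
    rw [smul_cmk, smul_cmk, e1, e2]

/-! ### Acyclicity of injective modules -/

section injective

/-- The submodule of elements killed by a power of `f`. -/
def powTors (f : T) (M : Type) [AddCommGroup M] [Module T M] : Submodule T M where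
  carrier := {m | ∃ N : ℕ, f ^ N • m = 0}
  zero_mem' := ⟨0, smul_zero _⟩
  add_mem' := by
    rintro a b ⟨N, h⟩ ⟨N', h'⟩
    refine ⟨N + N', ?_⟩
    rw [smul_add, pow_add, mul_smul, mul_smul, h', smul_comm, h, smul_zero, smul_zero, add_zero]
  smul_mem' := by
    rintro t a ⟨N, h⟩
    exact ⟨N, by rw [smul_comm, h, smul_zero]⟩

theorem mem_powTors {f : T} {m : M} : m ∈ powTors f M ↔ ∃ N : ℕ, f ^ N • m = 0 := Iff.rfl

variable {Q : Type} [AddCommGroup Q] [Module T Q] 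

theorem exists_div_of_injective [IsNoetherianRing T] (hQ : Module.Injective T Q) (f : T) (x : Q) (m : ℕ) :
    ∃ N : ℕ, ∃ y : Q, f ^ (N + m) • y = f ^ N • x := by
  obtain ⟨N, hN⟩ := monotone_stabilizes_iff_noetherian.2 (inferInstance : IsNoetherian T T)
    ⟨fun n => LinearMap.ker (LinearMap.mulLeft T (f ^ n)), fun a b hab => by
      intro t ht
      simp only [LinearMap.mem_ker, LinearMap.mulLeft_apply] at ht ⊢
      rw [← Nat.sub_add_cancel hab, pow_add, mul_assoc, ht, mul_zero]⟩
  have hk : LinearMap.ker (LinearMap.mulLeft T (f ^ (N + m))) ≤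
      LinearMap.ker ((LinearMap.toSpanSingleton T Q (f ^ N • x))) := by
    intro t ht
    have := hN (N + m) (by omega)
    have ht : t ∈ LinearMap.ker (LinearMap.mulLeft T (f ^ N)) := by
      have h2 : LinearMap.ker (LinearMap.mulLeft T (f ^ N)) =
        LinearMap.ker (LinearMap.mulLeft T (f ^ (N + m))) := this
      rw [h2]; exact ht
    simp only [LinearMap.mem_ker, LinearMap.mulLeft_apply, LinearMap.toSpanSingleton_apply] at ht ⊢
    rw [smul_smul, mul_comm, ht, zero_smul]
  obtain ⟨h, hh⟩ := hQ.out (Submodule.liftQ _ (LinearMap.mulLeft T (f ^ (N + m))) le_rfl)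
    (LinearMap.ker_eq_bot.1 (Submodule.ker_liftQ_eq_bot _ _ _ le_rfl))
    (Submodule.liftQ _ _ hk)
  refine ⟨N, h 1, ?_⟩
  have := hh (Submodule.Quotient.mk 1)
  rw [Submodule.liftQ_apply, Submodule.liftQ_apply, LinearMap.mulLeft_apply, mul_one,
    LinearMap.toSpanSingleton_apply, one_smul] at this
  rw [← this, ← map_smul, smul_eq_mul, mul_one]

open Classical in
theorem injective_powTors [IsNoetherianRing T] (hQ : Module.Injective T Q) (f : T) :
    Module.Injective T (powTors f Q) := by
  refine Module.Baer.injective fun I φ => ?_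
  obtain ⟨N, hN⟩ : ∃ N : ℕ, ∀ i : I, f ^ N • φ i = 0 := by
    obtain ⟨s, hs⟩ := (inferInstance : IsNoetherian T I).noetherian ⊤
    choose e he using fun i : I => mem_powTors.1 (φ i).2
    refine ⟨∑ i ∈ s, e i, fun i => ?_⟩
    have : (⊤ : Submodule T I) ≤ LinearMap.ker ((LinearMap.lsmul T _ (f ^ ∑ i ∈ s, e i)).comp φ) := by
      rw [← hs, Submodule.span_le]
      intro j hj
      change f ^ _ • φ j = 0
      rw [← Finset.sum_erase_add _ _ hj, pow_add, mul_smul]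
      have : f ^ e j • φ j = 0 := Subtype.ext (he j)
      rw [this, smul_zero]
    exact this (Submodule.mem_top (x := i))
  obtain ⟨k, hk⟩ := Ideal.exists_pow_inf_eq_pow_smul (Ideal.span {f}) (I : Submodule T T)
  have key : ∀ i : I, f ^ (k + N) ∣ (i : T) → φ i = 0 := by
    rintro ⟨i, hi⟩ hd
    have h1 : i ∈ (Ideal.span {f}) ^ (k + N) • (⊤ : Submodule T T) ⊓ I := by
      refine ⟨?_, hi⟩
      obtain ⟨c, rfl⟩ := hd
      simp [Ideal.span_singleton_pow, Ideal.mem_span_singleton]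
    rw [hk (k + N) (by omega), Nat.add_sub_cancel_left, Ideal.span_singleton_pow f N,
      Submodule.ideal_span_singleton_smul] at h1
    obtain ⟨j, hj, e⟩ := h1
    have e : f ^ N * j = i := e
    have : (⟨i, hi⟩ : I) = f ^ N • (⟨j, hj.2⟩ : I) := Subtype.ext e.symm
    rw [this, map_smul, hN]
  set J : Ideal T := Ideal.span {f ^ (k + N)}
  have hle : Submodule.comap I.subtype J ≤ LinearMap.ker ((powTors f Q).subtype.comp φ) := by
    intro i hi
    have := key i (Ideal.mem_span_singleton.1 hi)
    simp [this]
  obtain ⟨h, hh⟩ := hQ.out (Submodule.mapQ (Submodule.comap I.subtype J) J I.subtype le_rfl)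
    (LinearMap.ker_eq_bot.1 (by
      rw [Submodule.mapQ, Submodule.ker_liftQ_eq_bot]
      intro i hi
      exact (Submodule.Quotient.mk_eq_zero J).1 hi))
    (Submodule.liftQ _ _ hle)
  let g : T →ₗ[T] Q := h.comp (Submodule.mkQ J)
  have hg : ∀ t, g t ∈ powTors f Q := by
    intro t
    refine ⟨k + N, ?_⟩
    rw [← map_smul]
    have : Submodule.mkQ J (f ^ (k + N) • t) = 0 := by
      rw [Submodule.mkQ_apply, Submodule.Quotient.mk_eq_zero, Ideal.mem_span_singleton]
      exact Dvd.intro _ rfl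
    change h (Submodule.mkQ J _) = 0
    rw [this, map_zero]
  refine ⟨g.codRestrict _ hg, fun x hx => Subtype.ext ?_⟩
  exact hh (Submodule.Quotient.mk ⟨x, hx⟩)

theorem injective_smul_quot (f : T) (M : Type) [AddCommGroup M] [Module T M] :
    Function.Injective (DistribSMul.toAddMonoidHom (M ⧸ powTors f M) f) := by
  refine (injective_iff_map_eq_zero _).2 fun x hx => ?_
  obtain ⟨x, rfl⟩ := Submodule.Quotient.mk_surjective _ x
  have hx : f • Submodule.Quotient.mk x = (0 : M ⧸ powTors f M) := hx
  rw [← Submodule.Quotient.mk_smul, Submodule.Quotient.mk_eq_zero] at hx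
  obtain ⟨N, hN⟩ := hx
  exact (Submodule.Quotient.mk_eq_zero _).2 ⟨N + 1, by rw [pow_succ, mul_smul, hN]⟩

theorem compat_linear {N : Type} [AddCommGroup N] [Module T N] (φ : M →ₗ[T] N) (l : List T) :
    Compat φ.toAddMonoidHom l l := compat_same fun f _ m => φ.map_smul f m

theorem pow_smul_injective_of {f : T} {V : Type} [AddCommGroup V] [Module T V]
    (h : ∀ x : V, f • x = 0 → x = 0) (N : ℕ) (x : V) (hx : f ^ N • x = 0) : x = 0 := by
  induction N with
  | zero => simpa using hx
  | succ N ih =>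
    rw [pow_succ', mul_smul] at hx
    exact ih (h _ hx)

theorem acyclic_of_injective [IsNoetherianRing T] (l : List T) (hQ : Module.Injective T Q) (hn : 0 < n)
    (x : (cech Q l).V) (hd : (cech Q l).d x = 0) (hx : x ∈ (cech Q l).gr n) :
    ∃ y ∈ (cech Q l).gr (n - 1), (cech Q l).d y = x := by
  induction l generalizing Q n with
  | nil =>
    refine ⟨0, zero_mem _, ?_⟩
    rw [map_zero, (mem_cech_nil_gr.1 hx).resolve_left hn.ne']
  | cons f l ih =>
    obtain ⟨a, ha, m, x, hx', rfl⟩ := exists_of_mem_cech_gr hx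
    have hd1 : (cech Q l).d a = 0 := congrArg Prod.fst hd
    have hd2 : Loc.mk f 0 a - (cech Q l).dLoc f (Loc.mk f m x) = 0 := congrArg Prod.snd hd
    obtain ⟨N, y, hy, e⟩ := exists_div_elem (exists_div_of_injective hQ f) m x hx'
    have e : Loc.mk f m x = Loc.mk f 0 y := by
      rw [Loc.mk_eq_mk]
      exact ⟨N, by simpa using e.symm⟩
    have hd3 : Loc.mk f 0 (a - (cech Q l).d y) = 0 := by
      rw [Loc.mk_sub, ← dLoc_mk, ← e, hd2]
    obtain ⟨N', hN'⟩ := Loc.mk_eq_zero.1 hd3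
    have hc1 := compat_linear (powTors f Q).subtype l
    have hc2 := compat_linear (powTors f Q).mkQ l
    obtain ⟨a', ha', e'⟩ := cechMap_exact (φ := (powTors f Q).subtype.toAddMonoidHom)
      (ψ := (powTors f Q).mkQ.toAddMonoidHom) (n := n) (fun y hy => by
        have hy : (powTors f Q).mkQ y = 0 := hy
        rw [Submodule.mkQ_apply, Submodule.Quotient.mk_eq_zero] at hy
        exact ⟨⟨y, hy⟩, rfl⟩) hc1 hc2 (a - (cech Q l).d y)
      (sub_mem ha (d_gr' _ hy)) (by
        refine pow_smul_injective_of (f := f) (fun z hz => ?_) N' _ ?_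
        · refine cechMap_injective (injective_smul_quot f Q) (compat_smul f l) ?_
          rw [cechMap_smul_eq, hz, map_zero]
        · rw [← cechMap_smul hc2 (pow_smul_comm (fun m => (powTors f Q).mkQ.map_smul f m) N'), hN', map_zero])
    obtain ⟨w, hw, e''⟩ := ih (injective_powTors hQ f) hn a' (by
      refine cechMap_injective (φ := (powTors f Q).subtype.toAddMonoidHom)
        Subtype.val_injective hc1 ?_
      rw [Hom.comm, e', map_sub, hd1, d_d, sub_zero, map_zero]) ha'
    refine ⟨_, cmk_mem_gr (add_mem hy
      (Hom.gr (cechMap (powTors f Q).subtype.toAddMonoidHom l l) hw)) 0 (zero_mem _), ?_⟩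
    refine (step_d _ _ _).trans (Prod.ext ?_ ?_)
    · change (cech Q l).d (y + (cechMap (powTors f Q).subtype.toAddMonoidHom l l).f w) = a
      rw [map_add, ← Hom.comm, e'', e', add_sub_cancel]
    · change Loc.mk f 0 (y + _) - (cech Q l).dLoc f (Loc.mk f 0 0) = Loc.mk f m x
      rw [Loc.mk_zero, map_zero, sub_zero, Loc.mk_add, ← e]
      convert add_zero _ using 2
      obtain ⟨N, hN⟩ := exists_pow_smul_elem (f := f) (M := powTors f Q) (fun m => by
        obtain ⟨N, h⟩ := m.2
        exact ⟨N, Subtype.ext h⟩) w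
      refine Loc.mk_eq_zero.2 ⟨N, ?_⟩
      rw [← cechMap_smul hc1 (pow_smul_comm (fun m => (powTors f Q).subtype.map_smul f m) N), hN, map_zero]

end injective

end Cx

/-- Two surjections with the same kernel have isomorphic targets. -/
noncomputable def equivOfKerEq {T Z A B : Type*} [CommRing T] [AddCommGroup Z] [Module T Z]
    [AddCommGroup A] [Module T A] [AddCommGroup B] [Module T B] (α : Z →ₗ[T] A) (β : Z →ₗ[T] B)
    (hα : Function.Surjective α) (hβ : Function.Surjective β)
    (h : LinearMap.ker α = LinearMap.ker β) : A ≃ₗ[T] B :=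
  (α.quotKerEquivOfSurjective hα).symm ≪≫ₗ (Submodule.quotEquivOfEq _ _ h) ≪≫ₗ
    β.quotKerEquivOfSurjective hβ

namespace Cx

variable {T : Type} [CommRing T] {K L N : Cx T} {n : ℤ}

/-- A linear map of complexes induces a linear map on cohomology. -/
noncomputable def Hom.HL (F : Hom K L) (hF : ∀ (t : T) x, F.f (t • x) = t • F.f x) (n : ℤ) :
    K.H n →ₗ[T] L.H n where
  toFun := F.H n
  map_add' := map_add _
  map_smul' t := F.H_smul (hF t)

theorem Hom.HL_apply (F : Hom K L) (hF : ∀ (t : T) x, F.f (t • x) = t • F.f x) (y : K.H n) :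
    F.HL hF n y = F.H n y := rfl

/-- The connecting isomorphism of a short exact sequence of complexes. -/
theorem exists_connecting (F : Hom K L) (G : Hom L N) (hF : ∀ (t : T) x, F.f (t • x) = t • F.f x)
    (hG : ∀ (t : T) x, G.f (t • x) = t • G.f x) (inj : Function.Injective F.f)
    (ex : ∀ n, ∀ y ∈ L.gr n, G.f y = 0 → ∃ x ∈ K.gr n, F.f x = y)
    (zero : ∀ x, G.f (F.f x) = 0)
    (surj : ∀ n, ∀ y ∈ N.gr n, ∃ x ∈ L.gr n, G.f x = y) (n : ℤ)
    (hL : Subsingleton (L.H (n + 1))) :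
    Nonempty ((N.H n ⧸ LinearMap.range (G.HL hG n)) ≃ₗ[T] K.H (n + 1)) := by
  let Fl : K.V →ₗ[T] L.V := { toFun := F.f, map_add' := map_add _, map_smul' := hF }
  let Gl : L.V →ₗ[T] N.V := { toFun := G.f, map_add' := map_add _, map_smul' := hG }
  let Z : Submodule T (L.V × K.V) := (L.gr n).prod (K.gr (n + 1)) ⊓
    LinearMap.ker ((L.d.comp (LinearMap.fst T _ _)) - (Fl.comp (LinearMap.snd T _ _)))
  have hZ : ∀ z : Z, L.d z.1.1 = F.f z.1.2 := fun z => sub_eq_zero.1 z.2.2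
  have hG0 : ∀ z : Z, N.d (G.f z.1.1) = 0 := fun z => by rw [← G.comm, hZ, zero]
  have hK0 : ∀ z : Z, K.d z.1.2 = 0 := fun z => inj (by rw [F.comm, ← hZ, d_d, map_zero])
  let α' : Z →ₗ[T] N.H n :=
    { toFun := fun z => N.cl n (G.f z.1.1) (hG0 z) (G.gr z.2.1.1)
      map_add' := fun z w => by
        rw [cl_add]
        congr 1
        exact map_add _ _ _
      map_smul' := fun t z => by
        rw [RingHom.id_apply, smul_cl]
        congr 1
        exact hG _ _ }
  let β : Z →ₗ[T] K.H (n + 1) :=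
    { toFun := fun z => K.cl (n + 1) z.1.2 (hK0 z) z.2.1.2
      map_add' := fun z w => rfl
      map_smul' := fun t z => rfl }
  refine ⟨equivOfKerEq ((Submodule.mkQ _).comp α') β ?_ ?_ ?_⟩
  · refine (Submodule.mkQ_surjective _).comp fun y => ?_
    induction y using H_ind with
    | _ y hd hg =>
      obtain ⟨q, hq, rfl⟩ := surj n y hg
      obtain ⟨m, hm, e⟩ := ex (n + 1) (L.d q) (L.d_gr hq) (by rw [G.comm, hd])
      exact ⟨⟨(q, m), ⟨hq, hm⟩, sub_eq_zero.2 e.symm⟩, rfl⟩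
  · intro y
    induction y using H_ind with
    | _ y hd hg =>
      obtain ⟨q, hq, e⟩ := exists_of_subsingleton_H hL (x := F.f y) (by rw [← F.comm, hd, map_zero])
        (F.gr hg)
      rw [add_sub_cancel_right] at hq
      exact ⟨⟨(q, y), ⟨hq, hg⟩, sub_eq_zero.2 e⟩, rfl⟩
  · ext z
    rw [LinearMap.mem_ker, LinearMap.mem_ker, LinearMap.comp_apply, Submodule.mkQ_apply,
      Submodule.Quotient.mk_eq_zero]
    constructor
    · rintro ⟨y, hy⟩
      induction y using H_ind with
      | _ y hd hg =>
        rw [Hom.HL_apply, Hom.H_cl] at hy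
        obtain ⟨w, hw, e⟩ := (cl_eq_cl (K := N) (hd := hG0 z) (hg := G.gr z.2.1.1)).1 hy.symm
        obtain ⟨v, hv, rfl⟩ := surj _ w hw
        obtain ⟨u, hu, e'⟩ := ex n (z.1.1 - y - L.d v)
          (sub_mem (sub_mem z.2.1.1 hg) (d_gr' _ hv)) (by
            rw [map_sub, map_sub, G.comm, e, sub_self])
        refine (cl_eq_zero (K := K) (hd := hK0 z) (hg := z.2.1.2)).2
          ⟨u, by rwa [add_sub_cancel_right], inj ?_⟩
        rw [F.comm, e', map_sub, map_sub, d_d, hd, hZ, sub_zero, sub_zero]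
    · intro hz
      obtain ⟨u, hu, e⟩ := (cl_eq_zero (K := K) (hd := hK0 z) (hg := z.2.1.2)).1 hz
      rw [add_sub_cancel_right] at hu
      refine ⟨L.cl n (z.1.1 - F.f u) ?_ (sub_mem z.2.1.1 (F.gr hu)), ?_⟩
      · rw [map_sub, hZ, ← F.comm, e, sub_self]
      · rw [Hom.HL_apply, Hom.H_cl]
        change _ = N.cl n (G.f z.1.1) (hG0 z) (G.gr z.2.1.1)
        congr 1
        rw [map_sub, zero, sub_zero]

/-! ### Degree zero -/

section zero

variable {M : Type} [AddCommGroup M] [Module T M] {M' : Type} [AddCommGroup M'] [Module T M']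

/-- The inclusion of the module as the degree zero part of the Čech complex. -/
noncomputable def emb (M : Type) [AddCommGroup M] [Module T M] :
    ∀ l : List T, M →ₗ[T] (cech M l).V
  | [] => LinearMap.id
  | f :: l => (LinearMap.inl T (cech M l).V (Loc f (cech M l).V)).comp (emb M l)

theorem emb_cons (f : T) (l : List T) (m : M) : emb M (f :: l) m = cmk f l (emb M l m) 0 0 :=
  Prod.ext rfl (Loc.mk_zero _).symm

theorem emb_injective (l : List T) : Function.Injective (emb M l) := by
  induction l with
  | nil => exact Function.injective_id
  | cons f l ih => exact LinearMap.inl_injective.comp ih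

theorem emb_mem (l : List T) (m : M) : emb M l m ∈ (cech M l).gr 0 := by
  induction l with
  | nil => exact mem_cech_nil_gr.2 (Or.inl rfl)
  | cons f l ih =>
    rw [emb_cons]
    exact cmk_mem_gr ih _ (zero_mem _)

theorem exists_emb (l : List T) (x : (cech M l).V) (hx : x ∈ (cech M l).gr 0) :
    ∃ m, emb M l m = x := by
  induction l with
  | nil => exact ⟨x, rfl⟩
  | cons f l ih =>
    obtain ⟨a, ha, m, b, hb, rfl⟩ := exists_of_mem_cech_gr hx
    obtain ⟨a, rfl⟩ := ih a ha
    refine ⟨a, ?_⟩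
    rw [emb_cons, eq_zero_of_mem_cech_gr (Or.inl (by omega)) hb, ← cmk_cancel m, zero_add, smul_zero]

theorem cechMap_emb (φ : M →ₗ[T] M') (l : List T) (m : M) :
    (cechMap φ.toAddMonoidHom l l).f (emb M l m) = emb M' l (φ m) := by
  induction l with
  | nil => rfl
  | cons f l ih =>
    rw [emb_cons, cechMap_cons_apply (compat_linear φ _), emb_cons, ih, map_zero]

theorem d_emb_eq_zero (l : List T) (m : M) :
    (cech M l).d (emb M l m) = 0 ↔ ∀ f ∈ l, m ∈ powTors f M := by
  induction l with
  | nil => exact ⟨fun _ _ h => by simp at h, fun _ => rfl⟩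
  | cons f l ih =>
    rw [List.forall_mem_cons, ← ih, mem_powTors]
    have : (cech M (f :: l)).d (emb M (f :: l) m) =
        cmk f l ((cech M l).d (emb M l m)) 0 (emb M l m) := by
      rw [emb_cons]
      refine (step_d _ _ _).trans (Prod.ext rfl ?_)
      change Loc.mk f 0 _ - (cech M l).dLoc f (Loc.mk f 0 0) = Loc.mk f 0 _
      rw [Loc.mk_zero, map_zero, sub_zero]
    rw [this, cmk_eq_zero, and_comm]
    refine and_congr_left fun _ => exists_congr fun N => ?_
    rw [← map_smul]
    exact map_eq_zero_iff _ (emb_injective l)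

/-- Elements killed by powers of all members of the list. -/
def listTors (l : List T) (M : Type) [AddCommGroup M] [Module T M] : Submodule T M :=
  ⨅ f ∈ l, powTors f M

theorem mem_listTors {l : List T} {m : M} : m ∈ listTors l M ↔ ∀ f ∈ l, m ∈ powTors f M := by
  simp [listTors]

/-- Degree zero cohomology. -/
noncomputable def H0 (l : List T) (M : Type) [AddCommGroup M] [Module T M] :
    listTors l M →ₗ[T] (cech M l).H 0 where
  toFun m := (cech M l).cl 0 (emb M l m) ((d_emb_eq_zero l _).2 (mem_listTors.1 m.2)) (emb_mem l _)
  map_add' x y := by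
    rw [cl_add]
    congr 1
    exact map_add _ _ _
  map_smul' t x := by
    rw [RingHom.id_apply, smul_cl]
    congr 1
    exact map_smul _ _ _

theorem H0_apply (l : List T) (m : listTors l M) :
    H0 l M m = (cech M l).cl 0 (emb M l m) ((d_emb_eq_zero l _).2 (mem_listTors.1 m.2))
      (emb_mem l _) := rfl

theorem H0_bijective (l : List T) (M : Type) [AddCommGroup M] [Module T M] :
    Function.Bijective (H0 l M) := by
  constructor
  · refine (injective_iff_map_eq_zero _).2 fun m hm => ?_
    obtain ⟨y, hy, e⟩ := (cl_eq_zero (hd := (d_emb_eq_zero l _).2 (mem_listTors.1 m.2))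
      (hg := emb_mem l _)).1 hm
    rw [eq_zero_of_mem_cech_gr (Or.inl (by omega)) hy, map_zero] at e
    exact Subtype.ext (emb_injective l (by rw [← e]; exact (map_zero _).symm))
  · intro y
    induction y using H_ind with
    | _ y hd hg =>
      obtain ⟨m, rfl⟩ := exists_emb l y hg
      exact ⟨⟨m, mem_listTors.2 ((d_emb_eq_zero l m).1 hd)⟩, rfl⟩

theorem map_mem_listTors (φ : M →ₗ[T] M') {l : List T} {m : M} (hm : m ∈ listTors l M) :
    φ m ∈ listTors l M' := by
  rw [mem_listTors] at *
  intro f hf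
  obtain ⟨N, h⟩ := hm f hf
  exact ⟨N, by rw [← map_smul, h, map_zero]⟩

theorem H_H0 (φ : M →ₗ[T] M') (l : List T) (m : listTors l M) :
    (cechMap φ.toAddMonoidHom l l).H 0 (H0 l M m) =
      H0 l M' ⟨φ m, map_mem_listTors φ m.2⟩ := by
  rw [H0_apply, H0_apply, Hom.H_cl]
  congr 1
  exact cechMap_emb φ l m

variable {M'' : Type} [AddCommGroup M''] [Module T M'']

theorem cechMap_linear (φ : M →ₗ[T] M') (l : List T) (t : T) (x : (cech M l).V) :
    (cechMap φ.toAddMonoidHom l l).f (t • x) = t • (cechMap φ.toAddMonoidHom l l).f x :=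
  cechMap_smul (compat_linear φ l) (φ.map_smul t) x

variable [IsNoetherianRing T]

theorem cech_connecting (ι : M →ₗ[T] M') (π : M' →ₗ[T] M'') (hι : Function.Injective ι)
    (hπ : Function.Surjective π) (h : Function.Exact ι π) (hQ : Module.Injective T M')
    (l : List T) (n : ℕ) :
    Nonempty (((cech M'' l).H n ⧸ LinearMap.range ((cechMap π.toAddMonoidHom l l).HL
      (cechMap_linear π l) n)) ≃ₗ[T] (cech M l).H (n + 1 : ℕ)) := by
  have c1 := compat_linear ι l
  have c2 := compat_linear π l
  refine exists_connecting (cechMap ι.toAddMonoidHom l l) (cechMap π.toAddMonoidHom l l)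
    (cechMap_linear ι l) (cechMap_linear π l) (cechMap_injective hι c1)
    (fun n y hy e => cechMap_exact (φ := ι.toAddMonoidHom) (fun y hy => (h y).1 hy) c1 c2 y hy e) (fun x => ?_)
    (fun n y hy => cechMap_surj hπ c2 y hy) n
    (subsingleton_H (acyclic_of_injective l hQ (by omega)))
  rw [← cechMap_comp c1 c2]
  have : π.toAddMonoidHom.comp ι.toAddMonoidHom = 0 := by
    ext m
    exact h.apply_apply_eq_zero m
  rw [this, cechMap_zero rfl]

theorem cech_shift (ι : M →ₗ[T] M') (π : M' →ₗ[T] M'') (hι : Function.Injective ι)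
    (hπ : Function.Surjective π) (h : Function.Exact ι π) (hQ : Module.Injective T M')
    (l : List T) (n : ℕ) (hn : 0 < n) :
    Nonempty ((cech M'' l).H n ≃ₗ[T] (cech M l).H (n + 1 : ℕ)) := by
  obtain ⟨e⟩ := cech_connecting ι π hι hπ h hQ l n
  have : Subsingleton ((cech M' l).H n) := subsingleton_H (acyclic_of_injective l hQ (by omega))
  exact ⟨(Submodule.quotEquivOfEqBot _ (by
    rw [LinearMap.range_eq_bot]
    refine LinearMap.ext fun x => ?_
    rw [Subsingleton.elim x 0, map_zero, map_zero])).symm ≪≫ₗ e⟩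

/-- The torsion functor on maps. -/
noncomputable def listTorsMap (φ : M →ₗ[T] M') (l : List T) : listTors l M →ₗ[T] listTors l M' :=
  φ.restrict fun _ h => map_mem_listTors φ h

theorem cech_one (ι : M →ₗ[T] M') (π : M' →ₗ[T] M'') (hι : Function.Injective ι)
    (hπ : Function.Surjective π) (h : Function.Exact ι π) (hQ : Module.Injective T M')
    (l : List T) :
    Nonempty ((listTors l M'' ⧸ LinearMap.range (listTorsMap π l)) ≃ₗ[T] (cech M l).H 1) := by
  obtain ⟨e⟩ := cech_connecting ι π hι hπ h hQ l 0
  refine ⟨Submodule.Quotient.equiv _ _ (LinearEquiv.ofBijective _ (H0_bijective l M'')) ?_ ≪≫ₗ e⟩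
  ext y
  constructor
  · rintro ⟨_, ⟨x, rfl⟩, rfl⟩
    exact ⟨H0 l M' x, H_H0 π l x⟩
  · rintro ⟨x, rfl⟩
    obtain ⟨x, rfl⟩ := (H0_bijective l M').2 x
    exact ⟨_, ⟨x, rfl⟩, (H_H0 π l x).symm⟩

end zero

end Cx

namespace Cx

variable {T : Type} [CommRing T]

/-- If `x` acts injectively on `K` with cokernel `N`, the `x`-torsion of the cohomology of `K`
is the cohomology of `N` in one degree less. -/
theorem exists_torsion_equiv {K N : Cx T} (x : T) (inj : ∀ v : K.V, x • v = 0 → v = 0)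
    (G : Hom K N) (hG : ∀ (t : T) v, G.f (t • v) = t • G.f v)
    (zero : ∀ v, G.f (x • v) = 0)
    (ex : ∀ n, ∀ y ∈ K.gr n, G.f y = 0 → ∃ v ∈ K.gr n, x • v = y)
    (surj : ∀ n, ∀ y ∈ N.gr n, ∃ v ∈ K.gr n, G.f v = y) (n : ℤ)
    (hK : Subsingleton (K.H n)) :
    ∃ e : N.H n →ₗ[T] K.H (n + 1), Function.Injective e ∧
      ∀ v, x • v = 0 → v ∈ LinearMap.range e := by
  let Gl : K.V →ₗ[T] N.V := { toFun := G.f, map_add' := map_add _, map_smul' := hG }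
  let Z : Submodule T (K.V × K.V) :=
    { carrier := {p | (p.1 ∈ K.gr n ∧ p.2 ∈ K.gr (n + 1)) ∧ K.d p.1 = x • p.2}
      add_mem' := fun {a b} ha hb => ⟨⟨add_mem ha.1.1 hb.1.1, add_mem ha.1.2 hb.1.2⟩, by
        rw [Prod.fst_add, Prod.snd_add, map_add, ha.2, hb.2, smul_add]⟩
      zero_mem' := ⟨⟨zero_mem _, zero_mem _⟩, by
        rw [Prod.fst_zero, Prod.snd_zero, map_zero, smul_zero]⟩
      smul_mem' := fun t a ha => ⟨⟨Submodule.smul_mem _ _ ha.1.1, Submodule.smul_mem _ _ ha.1.2⟩, by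
        rw [Prod.smul_fst, Prod.smul_snd, map_smul, ha.2, smul_comm]⟩ }
  have hN0 (z : Z) : N.d (G.f z.1.1) = 0 := by rw [← G.comm, z.2.2, zero]
  have hK0 (z : Z) : K.d z.1.2 = 0 := inj _ (by rw [← map_smul, ← z.2.2, d_d])
  let α : Z →ₗ[T] N.H n :=
    { toFun := fun z => N.cl n (G.f z.1.1) (hN0 z) (G.gr z.2.1.1)
      map_add' := fun a b => by
        rw [cl_add]
        congr 1
        exact map_add G.f _ _
      map_smul' := fun t a => by
        rw [RingHom.id_apply, smul_cl]
        congr 1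
        exact hG _ _ }
  let β : Z →ₗ[T] K.H (n + 1) :=
    { toFun := fun z => K.cl (n + 1) z.1.2 (hK0 z) z.2.1.2
      map_add' := fun a b => rfl
      map_smul' := fun t a => rfl }
  have hα : Function.Surjective α := fun y => by
    induction y using H_ind with
    | _ y hd hg =>
      obtain ⟨w, hw, rfl⟩ := surj _ y hg
      obtain ⟨z, hz, e⟩ := ex (n + 1) (K.d w) (K.d_gr hw) (by rw [G.comm, hd])
      exact ⟨⟨(w, z), ⟨hw, hz⟩, e.symm⟩, rfl⟩
  have hk : LinearMap.ker α = LinearMap.ker β := by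
    ext z
    rw [LinearMap.mem_ker, LinearMap.mem_ker]
    constructor
    · intro hz
      obtain ⟨y, hy, e⟩ := (cl_eq_zero (K := N) (hd := hN0 z) (hg := G.gr z.2.1.1)).1 hz
      obtain ⟨v, hv, rfl⟩ := surj _ y hy
      obtain ⟨u, hu, e'⟩ := ex n (z.1.1 - K.d v) (sub_mem z.2.1.1 (d_gr' _ hv)) (by
        rw [map_sub, G.comm, e, sub_self])
      refine (cl_eq_zero (K := K) (hd := hK0 z) (hg := z.2.1.2)).2
        ⟨u, by rwa [add_sub_cancel_right], sub_eq_zero.1 (inj _ ?_)⟩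
      rw [smul_sub, ← map_smul, e', map_sub, d_d, z.2.2, sub_zero, sub_self]
    · intro hz
      obtain ⟨u, hu, e⟩ := (cl_eq_zero (K := K) (hd := hK0 z) (hg := z.2.1.2)).1 hz
      rw [add_sub_cancel_right] at hu
      obtain ⟨v, hv, e'⟩ := exists_of_subsingleton_H hK (x := z.1.1 - x • u)
        (by rw [map_sub, map_smul, e, z.2.2, sub_self])
        (sub_mem z.2.1.1 (Submodule.smul_mem _ _ hu))
      refine (cl_eq_zero (K := N) (hd := hN0 z) (hg := G.gr z.2.1.1)).2 ⟨G.f v, G.gr hv, ?_⟩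
      rw [← G.comm, e', map_sub, zero, sub_zero]
  refine ⟨(β.range.subtype).comp ((α.quotKerEquivOfSurjective hα).symm ≪≫ₗ
    (Submodule.quotEquivOfEq _ _ hk) ≪≫ₗ β.quotKerEquivRange).toLinearMap, ?_, ?_⟩
  · exact Subtype.val_injective.comp (LinearEquiv.injective _)
  · intro v hv
    have : v ∈ LinearMap.range β := by
      induction v using H_ind with
      | _ v hd hg =>
        rw [smul_cl, cl_eq_zero] at hv
        obtain ⟨w, hw, e⟩ := hv
        rw [add_sub_cancel_right] at hw
        exact ⟨⟨(w, v), ⟨hw, hg⟩, e⟩, rfl⟩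
    obtain ⟨y, hy⟩ := LinearEquiv.surjective ((α.quotKerEquivOfSurjective hα).symm ≪≫ₗ
      (Submodule.quotEquivOfEq _ _ hk) ≪≫ₗ β.quotKerEquivRange) ⟨v, this⟩
    exact ⟨y, congrArg Subtype.val hy⟩

open RingTheory.Sequence in
/-- Čech cohomology of a module along a list containing a regular sequence. -/
theorem cech_regular (l xs : List T) (hxs : ∀ x ∈ xs, x ∈ l) :
    ∀ (M : Type) [AddCommGroup M] [Module T M], IsWeaklyRegular M xs →
    (∀ n : ℕ, n < xs.length → Subsingleton ((cech M l).H n)) ∧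
    ∃ e : listTors l (M ⧸ (Ideal.ofList xs • ⊤ : Submodule T M)) →ₗ[T] (cech M l).H xs.length,
      Function.Injective e ∧ ∀ v, (∀ x ∈ xs, x • v = 0) → v ∈ LinearMap.range e := by
  induction xs with
  | nil =>
    intro M _ _ _
    refine ⟨fun n hn => by simp at hn, ?_⟩
    let q : (M ⧸ (Ideal.ofList ([] : List T) • ⊤ : Submodule T M)) ≃ₗ[T] M :=
      Submodule.quotEquivOfEqBot _ (by simp)
    have hq := H0_bijective l M
    refine ⟨(H0 l M).comp (listTorsMap q.toLinearMap l), hq.1.comp ?_, fun v _ => ?_⟩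
    · intro a b hab
      exact Subtype.ext (q.injective (congrArg Subtype.val hab))
    · obtain ⟨m, rfl⟩ := hq.2 v
      refine ⟨⟨q.symm m, map_mem_listTors q.symm.toLinearMap m.2⟩, ?_⟩
      exact congrArg (H0 l M) (Subtype.ext (q.apply_symm_apply _))
  | cons x xs ih =>
    intro M _ _ hM
    rw [isWeaklyRegular_cons_iff] at hM
    rw [List.forall_mem_cons] at hxs
    obtain ⟨h1, e, he, he'⟩ := ih hxs.2 (QuotSMulTop x M) hM.2
    let π : M →ₗ[T] QuotSMulTop x M := Submodule.mkQ _
    have c0 := compat_smul (M := M) x l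
    have c2 := compat_linear π l
    have key (n : ℤ) (hn : Subsingleton ((cech M l).H n)) := exists_torsion_equiv (K := cech M l)
      (N := cech (QuotSMulTop x M) l) x
      (fun v hv => cechMap_injective (φ := DistribSMul.toAddMonoidHom M x) hM.1 c0
        (by rw [cechMap_smul_eq, hv, map_zero]))
      (cechMap π.toAddMonoidHom l l) (cechMap_linear π l)
      (fun v => by
        suffices h0 : π.toAddMonoidHom.comp (DistribSMul.toAddMonoidHom M x) = 0 by
          rw [← cechMap_smul_eq, ← cechMap_comp c0 c2, h0, cechMap_zero rfl]
        ext m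
        refine (Submodule.Quotient.mk_eq_zero _).2 ?_
        exact Submodule.smul_mem_pointwise_smul _ _ _ trivial)
      (fun n y hy h => by
        obtain ⟨v, hv, e⟩ := cechMap_exact (φ := DistribSMul.toAddMonoidHom M x) (fun y hy => by
          have hy := (Submodule.Quotient.mk_eq_zero _).1 hy
          obtain ⟨z, _, hz⟩ := (Submodule.mem_smul_pointwise_iff_exists _ _ _).1 hy
          exact ⟨z, hz⟩) c0 c2 y hy h
        exact ⟨v, hv, by rw [← e, cechMap_smul_eq]⟩)
      (fun n y hy => cechMap_surj (Submodule.mkQ_surjective _) c2 y hy) n hn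
    have h2 : ∀ n : ℕ, n < (x :: xs).length → Subsingleton ((cech M l).H n) := by
      intro n
      induction n with
      | zero =>
        intro _
        refine subsingleton_of_forall_eq 0 fun v => ?_
        obtain ⟨v, rfl⟩ := (H0_bijective l M).2 v
        obtain ⟨N, hN⟩ := mem_listTors.1 v.2 x hxs.1
        have hv : v = 0 :=
          Subtype.ext (pow_smul_injective_of (fun v hv => hM.1 (by simpa using hv)) N _ hN)
        rw [hv, map_zero]
      | succ n ih =>
        intro hn
        rw [List.length_cons] at hn
        obtain ⟨e, _, h⟩ := key n (ih (by rw [List.length_cons]; omega))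
        have := h1 n (by omega)
        refine subsingleton_of_forall_eq 0 fun v => ?_
        obtain ⟨N, hN⟩ := exists_pow_smul_eq_zero hxs.1 v
        refine pow_smul_injective_of (f := x) (fun v hv => ?_) N v hN
        obtain ⟨y, rfl⟩ := h v hv
        rw [Subsingleton.elim y 0, map_zero]
    refine ⟨h2, ?_⟩
    obtain ⟨e1, he1, h⟩ := key xs.length (h2 _ (by simp))
    let q := Submodule.quotOfListConsSMulTopEquivQuotSMulTopInner M x xs
    refine ⟨e1.comp (e.comp (listTorsMap q.toLinearMap l)), ?_, fun v hv => ?_⟩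
    · refine he1.comp (he.comp fun a b hab => ?_)
      exact Subtype.ext (q.injective (congrArg Subtype.val hab))
    · rw [List.forall_mem_cons] at hv
      obtain ⟨y, rfl⟩ := h v hv.1
      obtain ⟨m, rfl⟩ := he' y fun x hx => he1 (by rw [map_smul, hv.2 x hx, map_zero])
      refine ⟨⟨q.symm m, map_mem_listTors q.symm.toLinearMap m.2⟩, ?_⟩
      refine congrArg e1 (congrArg e (Subtype.ext (q.apply_symm_apply _)))

end Cx

section

open MvPolynomial

section derivatives

variable {σ k : Type} [Field k] [CharZero k]

/-- A nonzero ideal of a polynomial ring stable under the partial derivatives is everything. -/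
theorem one_mem_of_pderiv_mem {I : Ideal (MvPolynomial σ k)} (hI : I ≠ ⊥)
    (h : ∀ i, ∀ c ∈ I, pderiv i c ∈ I) : (1 : MvPolynomial σ k) ∈ I := by
  have key : ∀ n : ℕ, ∀ c ∈ I, ∀ m : σ →₀ ℕ, coeff m c ≠ 0 → m.degree = n → c.totalDegree ≤ n →
      (1 : MvPolynomial σ k) ∈ I := by
    intro n
    induction n with
    | zero =>
      intro c hc m hm hn ht
      rw [Finsupp.degree_eq_zero_iff] at hn
      rw [nonpos_iff_eq_zero, totalDegree_eq_zero_iff_eq_C] at ht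
      rw [hn] at hm
      have := I.mul_mem_left (C (coeff 0 c)⁻¹) hc
      rw [ht, coeff_zero_C, ← C_mul, inv_mul_cancel₀ hm, C_1] at this
      exact this
    | succ n ih =>
      intro c hc m hm hn ht
      have hm0 : m ≠ 0 := by
        rintro rfl
        simp at hn
      obtain ⟨i, hi⟩ := Finsupp.ne_iff.1 hm0
      have hle : Finsupp.single i 1 ≤ m := by
        rw [Finsupp.single_le_iff]
        exact Nat.one_le_iff_ne_zero.2 hi
      refine ih (pderiv i c) (h i c hc) (m - Finsupp.single i 1) ?_ ?_ ?_
      · rw [coeff_pderiv, tsub_add_cancel_of_le hle]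
        exact mul_ne_zero hm (Nat.cast_add_one_ne_zero _)
      · have := congrArg Finsupp.degree (tsub_add_cancel_of_le hle)
        rw [map_add, Finsupp.degree_single] at this
        omega
      · refine Finset.sup_le fun b hb => ?_
        rw [mem_support_iff, coeff_pderiv] at hb
        have := le_totalDegree (mem_support_iff.2 (left_ne_zero_of_mul hb))
        have e := map_add Finsupp.degree b (Finsupp.single i 1)
        rw [Finsupp.degree_single] at e
        have e2 : (b + Finsupp.single i 1).degree = (b + Finsupp.single i 1).sum fun _ e => e := rfl
        have e3 : b.degree = b.sum fun _ e => e := rfl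
        omega
  obtain ⟨c, hc, h0⟩ := Submodule.exists_mem_ne_zero_of_ne_bot hI
  obtain ⟨m, hm, e⟩ := c.support.exists_mem_eq_sup (support_nonempty.2 h0)
    (fun m => m.sum fun _ e => e)
  exact key _ c hc m (mem_support_iff.1 hm) rfl e.le

end derivatives

section regular

variable (k : Type) [Field k] (d : ℕ)

/-- The list of variables. -/
noncomputable abbrev varList : List (MvPolynomial (Fin d) k) := List.ofFn X

theorem isWeaklyRegular_varList :
    RingTheory.Sequence.IsWeaklyRegular (MvPolynomial (Fin d) k) (varList k d) := by
  rw [RingTheory.Sequence.isWeaklyRegular_iff]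
  intro i hi
  have hid : i < d := by simpa using hi
  have e : (Ideal.ofList ((varList k d).take i) • ⊤ : Ideal (MvPolynomial (Fin d) k)) =
      Ideal.span (X '' {j : Fin d | j.1 < i}) := by
    rw [smul_eq_mul, Ideal.mul_top]
    refine congrArg Ideal.span (Set.ext fun x => ?_)
    simp only [Set.mem_ofPred_eq, List.mem_take_iff_getElem, List.getElem_ofFn, List.length_ofFn,
      Set.mem_image]
    constructor
    · rintro ⟨j, hj, rfl⟩
      exact ⟨⟨j, by omega⟩, by simp only; omega, rfl⟩
    · rintro ⟨j, hj, rfl⟩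
      exact ⟨j, by omega, rfl⟩
  rw [List.getElem_ofFn, e]
  refine isSMulRegular_iff_right_eq_zero_of_smul.2 fun m hm => ?_
  obtain ⟨m, rfl⟩ := Submodule.Quotient.mk_surjective _ m
  rw [← Submodule.Quotient.mk_smul, Submodule.Quotient.mk_eq_zero, mem_ideal_span_X_image] at hm
  rw [Submodule.Quotient.mk_eq_zero, mem_ideal_span_X_image]
  intro a ha
  obtain ⟨j, hj, h⟩ := hm (Finsupp.single ⟨i, hid⟩ 1 + a) (by
    rw [mem_support_iff, smul_eq_mul, coeff_X_mul]
    exact mem_support_iff.1 ha)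
  refine ⟨j, hj, ?_⟩
  rwa [Finsupp.add_apply, Finsupp.single_eq_of_ne, zero_add] at h
  rintro rfl
  exact absurd hj (lt_irrefl i)

end regular

namespace Cx

section poly

variable (k : Type) [Field k] (d : ℕ)

local notation "P" => MvPolynomial (Fin d) k

theorem subsingleton_poly (n : ℕ) (hn : n < d) : Subsingleton ((cech P (varList k d)).H n) :=
  (cech_regular (varList k d) _ (fun _ h => h) P (isWeaklyRegular_varList k d)).1 n (by simpa)

theorem exists_socle_poly : ∃ z : (cech P (varList k d)).H d, z ≠ 0 ∧ (∀ i, (X i : P) • z = 0) ∧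
    ∀ v : (cech P (varList k d)).H d, (∀ i, (X i : P) • v = 0) → ∃ a : k, v = (C a : P) • z := by
  have hl : ((varList k d).length : ℤ) = d := by simp
  have key := (cech_regular (varList k d) _ (fun _ h => h) P (isWeaklyRegular_varList k d)).2
  rw [hl] at key
  obtain ⟨e, he, h⟩ := key
  have hX (i) : (X i : P) ∈ Ideal.ofList (varList k d) :=
    Ideal.subset_span (List.mem_ofFn.2 ⟨i, rfl⟩)
  have h0 (f : P) (i) : (X i : P) • (Submodule.Quotient.mk f :
      P ⧸ (Ideal.ofList (varList k d) • ⊤ : Submodule P P)) = 0 := by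
    rw [← Submodule.Quotient.mk_smul, Submodule.Quotient.mk_eq_zero, smul_eq_mul, smul_eq_mul,
      Ideal.mul_top]
    exact Ideal.mul_mem_right _ _ (hX i)
  have h1 (f : P) : (Submodule.Quotient.mk f :
      P ⧸ (Ideal.ofList (varList k d) • ⊤ : Submodule P P)) ∈ listTors (varList k d) _ := by
    refine mem_listTors.2 fun x hx => ?_
    obtain ⟨i, rfl⟩ := List.mem_ofFn.1 hx
    exact ⟨1, by rw [pow_one, h0]⟩
  refine ⟨e ⟨_, h1 1⟩, fun hz => ?_, fun i => ?_, fun v hv => ?_⟩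
  · have := congrArg Subtype.val ((map_eq_zero_iff e he).1 hz)
    have h2 : (1 : P) ∈ Ideal.ofList (varList k d) := by
      have := (Submodule.Quotient.mk_eq_zero _).1 this
      rwa [smul_eq_mul, Ideal.mul_top] at this
    have h3 : Ideal.ofList (varList k d) ≤ RingHom.ker (constantCoeff (σ := Fin d) (R := k)) := by
      refine Ideal.span_le.2 fun x hx => ?_
      obtain ⟨i, rfl⟩ := List.mem_ofFn.1 hx
      exact constantCoeff_X k i
    simpa using h3 h2
  · rw [← map_smul]
    exact (congrArg e (Subtype.ext (h0 1 i))).trans (map_zero e)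
  · obtain ⟨⟨m, hm⟩, rfl⟩ := h v fun x hx => by
      obtain ⟨i, rfl⟩ := List.mem_ofFn.1 hx
      exact hv i
    obtain ⟨f, rfl⟩ := Submodule.Quotient.mk_surjective _ m
    refine ⟨constantCoeff f, ?_⟩
    rw [← map_smul]
    refine congrArg e (Subtype.ext ?_)
    change Submodule.Quotient.mk f = (C (constantCoeff f) : P) • Submodule.Quotient.mk (1 : P)
    rw [← Submodule.Quotient.mk_smul, Submodule.Quotient.eq, smul_eq_mul, smul_eq_mul,
      Ideal.mul_top, mul_one]
    have h4 : Ideal.span (X '' Set.univ) ≤ Ideal.ofList (varList k d) := by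
      refine Ideal.span_le.2 ?_
      rintro _ ⟨i, _, rfl⟩
      exact hX i
    refine h4 (mem_ideal_span_X_image.2 fun a ha => ?_)
    by_contra! h5
    have : a = 0 := Finsupp.ext fun i => h5 i trivial
    rw [mem_support_iff, this] at ha
    simp [constantCoeff_eq] at ha

end poly

section con

variable {k T : Type} [CommRing k] [CommRing T] [Algebra k T] {l : List T} {n : ℤ}

theorem cl_sum {K : Cx T} {ι : Type} (s : Finset ι) (x : ι → K.V) (hd : ∀ i, K.d (x i) = 0)
    (hg : ∀ i, x i ∈ K.gr n) : ∑ i ∈ s, K.cl n (x i) (hd i) (hg i) =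
      K.cl n (∑ i ∈ s, x i) (by rw [map_sum, Finset.sum_eq_zero fun i _ => hd i])
        (sum_mem fun i _ => hg i) := by
  classical
  induction s using Finset.induction_on with
  | empty => rfl
  | insert a s ha ih =>
    rw [Finset.sum_insert ha, ih, cl_add]
    congr 1
    rw [Finset.sum_insert ha]

theorem isConn_derivation (δ : Derivation k T T) : IsConn (T := T) δ (δ : T →+ T) := fun t m => by
  simp [Derivation.leibniz, mul_comm]

/-- The action of a derivation on Čech cohomology. -/
noncomputable def conH (δ : Derivation k T T) (l : List T) (n : ℤ) :
    (cech T l).H n →+ (cech T l).H n :=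
  (cechConn δ (δ : T →+ T) l).H n

theorem conH_smul (δ : Derivation k T T) (t : T) (y : (cech T l).H n) :
    conH δ l n (t • y) = t • conH δ l n y + δ t • y := by
  induction y using H_ind with
  | _ x hd hg =>
    rw [smul_cl, conH, Hom.H_cl, Hom.H_cl, smul_cl, smul_cl, cl_add]
    congr 1
    exact cechConn_smul (isConn_derivation δ) l t x

theorem conH_comm (δ δ' : Derivation k T T) (h : ∀ a, δ (δ' a) = δ' (δ a))
    (y : (cech T l).H n) : conH δ l n (conH δ' l n y) = conH δ' l n (conH δ l n y) := by
  induction y using H_ind with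
  | _ x hd hg =>
    rw [conH, conH, Hom.H_cl, Hom.H_cl, Hom.H_cl, Hom.H_cl]
    congr 1
    exact cechConn_comm (isConn_derivation δ) (isConn_derivation δ') h h l x

theorem conH_eq (δ : Derivation k T T) (h : ∀ f ∈ l, δ f = 0) (y : (cech T l).H n) :
    conH δ l n y = (cechMap (δ : T →+ T) l l).H n y :=
  Hom.H_congr (fun x => cechConn_eq_cechMap (isConn_derivation δ) h x) y

theorem conH_sum {ι : Type} (s : Finset ι) (t : ι → T) (δ : ι → Derivation k T T)
    (δ' : Derivation k T T) (h : ∀ a, δ' a = ∑ i ∈ s, t i * δ i a) (y : (cech T l).H n) :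
    conH δ' l n y = ∑ i ∈ s, t i • conH (δ i) l n y := by
  induction y using H_ind with
  | _ x hd hg =>
    have key : ∀ i, t i • conH (δ i) l n ((cech T l).cl n x hd hg) =
        (cech T l).cl n (t i • (cechConn (δ i) (δ i : T →+ T) l).f x)
          (by rw [map_smul, ← Hom.comm, hd, map_zero, smul_zero])
          (Submodule.smul_mem _ _ (Hom.gr _ hg)) := fun i => by
      rw [conH, Hom.H_cl, smul_cl]
    rw [Finset.sum_congr rfl fun i _ => key i, cl_sum, conH, Hom.H_cl]
    congr 1
    exact cechConn_sum s t (fun i => δ i) (fun i => (δ i : T →+ T)) (fun i => isConn_derivation _)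
      δ' δ' h h l x

end con

theorem smul_ne_zero_poly (k : Type) [Field k] [CharZero k] (d : ℕ) (c : MvPolynomial (Fin d) k)
    (hc : c ≠ 0) : ∃ v : (cech (MvPolynomial (Fin d) k) (varList k d)).H d, c • v ≠ 0 := by
  by_contra! h
  obtain ⟨z, hz, _⟩ := exists_socle_poly k d
  let I := Module.annihilator (MvPolynomial (Fin d) k)
    ((cech (MvPolynomial (Fin d) k) (varList k d)).H d)
  have : (1 : MvPolynomial (Fin d) k) ∈ I := by
    refine one_mem_of_pderiv_mem (fun e => hc ?_) fun i f hf => ?_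
    · rw [← Ideal.mem_bot, ← e]
      exact Module.mem_annihilator.2 h
    · refine Module.mem_annihilator.2 fun v => ?_
      have e := conH_smul (pderiv i) f v
      rwa [Module.mem_annihilator.1 hf, map_zero, Module.mem_annihilator.1 hf, zero_add,
        eq_comm] at e
  exact hz (by rw [← one_smul (MvPolynomial (Fin d) k) z, Module.mem_annihilator.1 this])

end Cx

end

/-- Projective resolutions of the quotients `T ⧸ J ^ t` together with lifts of the projections. -/
structure ResSys {T : Type} [CommRing T] (J : Ideal T) where
  P : ℕ → ℕ → ModuleCat.{0} T
  d : ∀ t i, P t (i + 1) →ₗ[T] P t i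
  ε : ∀ t, P t 0 →ₗ[T] T ⧸ J ^ t
  proj : ∀ t i, Module.Projective T (P t i)
  exact : ∀ t i, Function.Exact (d t (i + 1)) (d t i)
  exact₀ : ∀ t, Function.Exact (d t 0) (ε t)
  surj : ∀ t, Function.Surjective (ε t)
  φ : ∀ {t t'}, t ≤ t' → ∀ i, P t' i →ₗ[T] P t i
  φ_d : ∀ {t t'} (h : t ≤ t') i x, φ h i (d t' i x) = d t i (φ h (i + 1) x)
  φ_ε : ∀ {t t'} (h : t ≤ t') x,
    ε t (φ h 0 x) = Ideal.Quotient.factor (Ideal.pow_le_pow_right h) (ε t' x)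

namespace ResSys

variable {T : Type} [CommRing T] {J : Ideal T} (Φ : ResSys J)

/-- Cocycles with values in `M`. -/
def Z (t i : ℕ) (M : Type) [AddCommGroup M] [Module T M] : Submodule T (Φ.P t i →ₗ[T] M) where
  carrier := {f | ∀ x, f (Φ.d t i x) = 0}
  zero_mem' _ := rfl
  add_mem' ha hb x := by simp [ha x, hb x]
  smul_mem' c f hf x := by simp [hf x]

/-- Coboundaries. -/
def IsCob {t : ℕ} : ∀ {i : ℕ} {M : Type} [AddCommGroup M] [Module T M] (_ : Φ.P t i →ₗ[T] M), Prop
  | 0, _, _, _, f => f = 0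
  | i + 1, _, _, _, f => ∃ e : Φ.P t i →ₗ[T] _, f = e.comp (Φ.d t i)

variable {M Q C : Type} [AddCommGroup M] [Module T M] [AddCommGroup Q] [Module T Q]
  [AddCommGroup C] [Module T C]

def pull {t t' : ℕ} (h : t ≤ t') {i : ℕ} (f : Φ.Z t i M) : Φ.Z t' i M :=
  ⟨f.1.comp (Φ.φ h i), fun x => by
    rw [LinearMap.comp_apply, Φ.φ_d]; exact f.2 _⟩

def push (π : M →ₗ[T] Q) {t i : ℕ} (f : Φ.Z t i M) : Φ.Z t i Q :=
  ⟨π.comp f.1, fun x => by rw [LinearMap.comp_apply, f.2, map_zero]⟩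

/-- The class of a cocycle vanishes after finitely many transition maps. -/
inductive Dies {i : ℕ} : ∀ {t : ℕ}, Φ.Z t i M → Prop
  | cob {t : ℕ} (f : Φ.Z t i M) (h : Φ.IsCob f.1) : Dies f
  | pull {t t' : ℕ} (h : t ≤ t') (f : Φ.Z t i M) (hf : Dies (Φ.pull h f)) : Dies f

/-- `H` is the direct limit of the cohomology of `Hom (P t, M)` in degree `i`. -/
structure Computes (i : ℕ) (M : Type) [AddCommGroup M] [Module T M]
    (H : Type) [AddCommGroup H] [Module T H] where
  c : ∀ t, Φ.Z t i M →ₗ[T] H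
  pull : ∀ {t t'} (h : t ≤ t') f, c t' (Φ.pull h f) = c t f
  surj : ∀ y, ∃ t f, c t f = y
  cob : ∀ {t} f, Φ.IsCob f.1 → c t f = 0
  ker : ∀ {t} f, c t f = 0 → Φ.Dies f

/-- Extension of maps into injective modules along `d`. -/
theorem exists_extension (hQ : Module.Injective T Q) {t i : ℕ} (f : Φ.Z t (i + 1) Q) :
    ∃ g : Φ.P t i →ₗ[T] Q, f.1 = g.comp (Φ.d t i) := by
  have hk : LinearMap.ker (Φ.d t i) ≤ LinearMap.ker f.1 := by
    intro x hx
    obtain ⟨y, rfl⟩ := (Φ.exact t i x).1 hx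
    exact f.2 y
  obtain ⟨g, hg⟩ := hQ.out ((LinearMap.ker (Φ.d t i)).liftQ (Φ.d t i) le_rfl)
    (LinearMap.ker_eq_bot.1 (Submodule.ker_liftQ_eq_bot _ _ _ le_rfl))
    ((LinearMap.ker (Φ.d t i)).liftQ f.1 hk)
  refine ⟨g, LinearMap.ext fun x => ?_⟩
  have := hg (Submodule.Quotient.mk x)
  simpa using this.symm

variable {H H' : Type} [AddCommGroup H] [Module T H] [AddCommGroup H'] [Module T H']

/-- Dimension shifting. -/
theorem Computes.shift {i : ℕ} (ι : M →ₗ[T] Q) (π : Q →ₗ[T] C) (hι : Function.Injective ι)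
    (hπ : Function.Surjective π) (hex : Function.Exact ι π) (hQ : Module.Injective T Q)
    (c : Φ.Computes i C H) (s : H →ₗ[T] H') (hs : Function.Surjective s)
    (ha : ∀ t (q : Φ.Z t i Q), s (c.c t (Φ.push π q)) = 0)
    (hb : ∀ x, s x = 0 → ∃ t, ∃ q : Φ.Z t i Q, x = c.c t (Φ.push π q)) :
    Nonempty (Φ.Computes (i + 1) M H') := by
  have hπι : ∀ x, π (ι x) = 0 := fun x => (hex _).2 ⟨x, rfl⟩
  choose g hg using fun t (f : Φ.Z t (i + 1) M) => Φ.exists_extension hQ (Φ.push ι f)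
  have hgx : ∀ t f x, ι (f.1 x) = g t f (Φ.d t i x) := fun t f x => by
    have := LinearMap.congr_fun (hg t f) x
    exact this
  have mk : ∀ {t} (f : Φ.Z t (i + 1) M) (u : Φ.P t i →ₗ[T] Q)
      (hu : ∀ x, ι (f.1 x) = u (Φ.d t i x)), π.comp u ∈ Φ.Z t i C := fun f u hu x => by
    rw [LinearMap.comp_apply, ← hu, hπι]
  have ind : ∀ {t} (f : Φ.Z t (i + 1) M) (u u' : Φ.P t i →ₗ[T] Q)
      (hu : ∀ x, ι (f.1 x) = u (Φ.d t i x)) (hu' : ∀ x, ι (f.1 x) = u' (Φ.d t i x)),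
      s (c.c t ⟨_, mk f u hu⟩) = s (c.c t ⟨_, mk f u' hu'⟩) := by
    intro t f u u' hu hu'
    rw [← sub_eq_zero, ← map_sub, ← map_sub]
    have := ha t ⟨u - u', fun x => by rw [LinearMap.sub_apply, ← hu, ← hu', sub_self]⟩
    convert this using 3
    refine Subtype.ext (LinearMap.ext fun x => ?_)
    simp [push]
  let c' : ∀ t, Φ.Z t (i + 1) M →ₗ[T] H' := fun t =>
    { toFun := fun f => s (c.c t ⟨_, mk f (g t f) (hgx t f)⟩)
      map_add' := fun f f' => by
        rw [← map_add, ← map_add, ind (f + f') _ (g t f + g t f') (hgx t _) (fun x => by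
          simp [hgx])]
        congr 2
        refine Subtype.ext (LinearMap.ext fun x => ?_)
        simp
      map_smul' := fun a f => by
        rw [RingHom.id_apply, ← map_smul, ← map_smul,
          ind (a • f) _ (a • g t f) (hgx t _) (fun x => by simp [hgx])]
        congr 2
        refine Subtype.ext (LinearMap.ext fun x => ?_)
        simp }
  have hc' : ∀ {t} (f : Φ.Z t (i + 1) M) (u : Φ.P t i →ₗ[T] Q)
      (hu : ∀ x, ι (f.1 x) = u (Φ.d t i x)), c' t f = s (c.c t ⟨_, mk f u hu⟩) :=
    fun f u hu => ind f _ _ (hgx _ f) hu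
  have key : ∀ t f, IsCob Φ (f : Φ.Z t (i + 1) M).1 → c' t f = 0 := by
    rintro t f ⟨e, he⟩
    rw [hc' f (ι.comp e) (fun x => by rw [he]; rfl)]
    suffices h : (⟨_, mk f (ι.comp e) (fun x => by rw [he]; rfl)⟩ : Φ.Z t i C) = 0 by
      rw [h, map_zero, map_zero]
    refine Subtype.ext (LinearMap.ext fun x => ?_)
    simp [hπι]
  have hpull : ∀ {t t'} (h : t ≤ t') f, c' t' (Φ.pull h f) = c' t f := by
    intro t t' h f
    rw [hc' (Φ.pull h f) ((g t f).comp (Φ.φ h i)) (fun x => by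
      rw [LinearMap.comp_apply, Φ.φ_d, ← hgx]; rfl), hc' f _ (hgx t f), ← c.pull h]
    rfl
  have dvd : ∀ t (u : Φ.P t i →ₗ[T] Q), π.comp u ∈ Φ.Z t i C →
      ∃ f : Φ.Z t (i + 1) M, ∀ x, ι (f.1 x) = u (Φ.d t i x) := by
    intro t u hu
    have h1 : ∀ x, u (Φ.d t i x) ∈ LinearMap.range ι := fun x => (hex _).1 (hu x)
    let e := LinearEquiv.ofInjective ι hι
    have he : ∀ y, ι (e.symm y) = y := fun y =>
      congrArg Subtype.val (e.apply_symm_apply y)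
    refine ⟨⟨e.symm.toLinearMap.comp ((u.comp (Φ.d t i)).codRestrict _ h1), fun x => ?_⟩,
      fun x => ?_⟩
    · apply hι
      refine (he _).trans ?_
      rw [map_zero]
      change u (Φ.d t i (Φ.d t (i + 1) x)) = 0
      rw [(Φ.exact t i).apply_apply_eq_zero, map_zero]
    · exact he _
  have factor : ∀ {t i} (v : Φ.P t i →ₗ[T] Q), (∀ x, π (v x) = 0) →
      ∃ e : Φ.P t i →ₗ[T] M, ∀ x, ι (e x) = v x := by
    intro t i v hv
    have h1 : ∀ x, v x ∈ LinearMap.range ι := fun x => (hex _).1 (hv x)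
    let e := LinearEquiv.ofInjective ι hι
    have he : ∀ y, ι (e.symm y) = y := fun y =>
      congrArg Subtype.val (e.apply_symm_apply y)
    exact ⟨e.symm.toLinearMap.comp (v.codRestrict _ h1), fun x => he _⟩
  have dvd : ∀ t (u : Φ.P t i →ₗ[T] Q), π.comp u ∈ Φ.Z t i C →
      ∃ f : Φ.Z t (i + 1) M, ∀ x, ι (f.1 x) = u (Φ.d t i x) := by
    intro t u hu
    obtain ⟨e, he⟩ := factor (u.comp (Φ.d t i)) hu
    refine ⟨⟨e, fun x => hι ?_⟩, he⟩
    rw [he, map_zero]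
    change u (Φ.d t i (Φ.d t (i + 1) x)) = 0
    rw [(Φ.exact t i).apply_apply_eq_zero, map_zero]
  have dies : ∀ {t} (v : Φ.Z t i C), Φ.Dies v → ∀ (f : Φ.Z t (i + 1) M) (u : Φ.P t i →ₗ[T] Q),
      (∀ x, ι (f.1 x) = u (Φ.d t i x)) → (∀ x, v.1 x = π (u x)) → Φ.Dies f := by
    intro t v hv
    induction hv with
    | @cob t v h =>
      intro f u hu huv
      refine .cob _ ?_
      suffices h : ∃ u' : Φ.P t i →ₗ[T] Q, (∀ x, π (u' x) = 0) ∧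
          ∀ x, u' (Φ.d t i x) = u (Φ.d t i x) by
        obtain ⟨u', h1, h2⟩ := h
        obtain ⟨e, he⟩ := factor u' h1
        refine ⟨e, LinearMap.ext fun x => hι ?_⟩
        rw [hu, LinearMap.comp_apply, he, h2]
      cases i with
      | zero =>
        refine ⟨u, fun x => ?_, fun _ => rfl⟩
        rw [← huv, show v.1 = 0 from h, LinearMap.zero_apply]
      | succ i =>
        obtain ⟨e, he⟩ := h
        have := Φ.proj t i
        obtain ⟨e', he'⟩ := Module.projective_lifting_property π e hπ
        refine ⟨u - e'.comp (Φ.d t i), fun x => ?_, fun x => ?_⟩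
        · rw [LinearMap.sub_apply, map_sub, ← huv, he, ← he']
          simp
        · rw [LinearMap.sub_apply, LinearMap.comp_apply,
            (Φ.exact t i).apply_apply_eq_zero, map_zero, sub_zero]
    | @pull t t' h v hv ih =>
      intro f u hu huv
      refine .pull h _ (ih _ (u.comp (Φ.φ h i)) (fun x => ?_) fun x => huv _)
      rw [LinearMap.comp_apply, Φ.φ_d, ← hu]
      rfl
  refine ⟨⟨c', hpull, ?_, key _, ?_⟩⟩
  · intro y
    obtain ⟨x, rfl⟩ := hs y
    obtain ⟨t, f, rfl⟩ := c.surj x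
    have := Φ.proj t i
    obtain ⟨u, hu⟩ := Module.projective_lifting_property π f.1 hπ
    obtain ⟨f', hf'⟩ := dvd t u (hu ▸ f.2)
    refine ⟨t, f', ?_⟩
    rw [hc' f' u hf']
    congr 2
    exact Subtype.ext hu
  · intro t f h0
    obtain ⟨t₁, q, hq⟩ := hb _ h0
    have h1 : t ≤ max t t₁ := le_max_left _ _
    have h2 : t₁ ≤ max t t₁ := le_max_right _ _
    rw [← c.pull h1, ← c.pull h2, ← sub_eq_zero, ← map_sub] at hq
    refine .pull h1 _ (dies _ (c.ker _ hq) _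
      ((g t f).comp (Φ.φ h1 i) - q.1.comp (Φ.φ h2 i)) (fun x => ?_) fun x => ?_)
    · rw [LinearMap.sub_apply, LinearMap.comp_apply, LinearMap.comp_apply, Φ.φ_d, Φ.φ_d, q.2,
        sub_zero, ← hgx]
      rfl
    · rw [LinearMap.sub_apply, map_sub]
      rfl

/-- Degree zero. -/
theorem computes_zero (l : List T) (hJ : J = Ideal.span {f | f ∈ l}) :
    Nonempty {c : Φ.Computes 0 M (Cx.listTors l M) //
      ∀ t f e, Φ.ε t e = 1 → (c.c t f : M) = f.1 e} := by
  choose e he using fun t => Φ.surj t 1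
  have hker : ∀ t (f : Φ.Z t 0 M) x, Φ.ε t x = 0 → f.1 x = 0 := by
    intro t f x hx
    obtain ⟨y, rfl⟩ := (Φ.exact₀ t x).1 hx
    exact f.2 y
  have hind : ∀ t (f : Φ.Z t 0 M) x y, Φ.ε t x = Φ.ε t y → f.1 x = f.1 y := by
    intro t f x y h
    rw [← sub_eq_zero, ← map_sub]
    exact hker t f _ (by rw [map_sub, h, sub_self])
  have hmul : ∀ t (a : T), Φ.ε t (a • e t) = Ideal.Quotient.mk _ a := by
    intro t a
    rw [map_smul, he, Algebra.smul_def, mul_one]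
    rfl
  have hlt : ∀ t (f : Φ.Z t 0 M), f.1 (e t) ∈ Cx.listTors l M := by
    intro t f
    rw [Cx.mem_listTors]
    intro a ha
    refine Cx.mem_powTors.2 ⟨t, ?_⟩
    rw [← map_smul]
    refine hker t f _ ?_
    rw [hmul, Ideal.Quotient.eq_zero_iff_mem]
    exact Ideal.pow_mem_pow (hJ ▸ Ideal.subset_span ha) t
  let c : ∀ t, Φ.Z t 0 M →ₗ[T] Cx.listTors l M := fun t =>
    { toFun := fun f => ⟨f.1 (e t), hlt t f⟩
      map_add' := fun _ _ => rfl
      map_smul' := fun _ _ => rfl }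
  refine ⟨⟨⟨c, ?_, ?_, ?_, ?_⟩, fun t f x hx => hind t f _ _ ((he t).trans hx.symm)⟩⟩
  · intro t t' h f
    refine Subtype.ext (hind t f _ _ ?_)
    rw [Φ.φ_ε, he, he, map_one]
  · intro m
    have hm := m.2
    have : ∃ t, ∀ a ∈ J ^ t, a • (m : M) = 0 := by
      have h1 : J ≤ (Ideal.span {a : T | a • (m : M) = 0}).radical := by
        rw [hJ, Ideal.span_le]
        intro a ha
        obtain ⟨N, hN⟩ := Cx.mem_powTors.1 (Cx.mem_listTors.1 hm a ha)
        exact ⟨N, Ideal.subset_span hN⟩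
      have hfg : J.FG := hJ ▸ Submodule.fg_span l.finite_toSet
      obtain ⟨t, ht⟩ := Ideal.exists_pow_le_of_le_radical_of_fg h1 hfg
      refine ⟨t, fun a ha => ?_⟩
      have h2 := ht ha
      have h3 : Ideal.span {a : T | a • (m : M) = 0} ≤ LinearMap.ker (LinearMap.toSpanSingleton T M m) :=
        Ideal.span_le.2 fun b hb => hb
      exact h3 h2
    obtain ⟨t, ht⟩ := this
    have hle : J ^ t ≤ LinearMap.ker (LinearMap.toSpanSingleton T M m) := fun a ha => ht a ha
    refine ⟨t, ⟨((J ^ t).liftQ (LinearMap.toSpanSingleton T M m) hle).comp (Φ.ε t), fun x => ?_⟩, Subtype.ext ?_⟩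
    · rw [LinearMap.comp_apply, (Φ.exact₀ t).apply_apply_eq_zero, map_zero]
    · change ((J ^ t).liftQ _ hle) (Φ.ε t (e t)) = _
      rw [he]
      exact one_smul T _
  · intro t f h
    refine Subtype.ext ?_
    change f.1 (e t) = 0
    rw [show f.1 = 0 from h, LinearMap.zero_apply]
  · intro t f h
    refine .cob _ (LinearMap.ext fun x => ?_)
    obtain ⟨a, ha⟩ := Ideal.Quotient.mk_surjective (Φ.ε t x)
    rw [hind t f x (a • e t) (by rw [hmul, ha]), map_smul]
    have := congrArg Subtype.val h
    change f.1 (e t) = 0 at this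
    rw [this, smul_zero, LinearMap.zero_apply]

theorem exists_injective (M : Type) [AddCommGroup M] [Module T M] :
    ∃ (Q : Type) (_ : AddCommGroup Q) (_ : Module T Q) (ι : M →ₗ[T] Q),
      Module.Injective T Q ∧ Function.Injective ι := by
  obtain ⟨P⟩ := CategoryTheory.EnoughInjectives.presentation (ModuleCat.of T M)
  have := P.injective
  exact ⟨P.J, inferInstance, inferInstance, P.f.hom,
    Module.injective_module_of_injective_object T P.J,
    (ModuleCat.mono_iff_injective P.f).1 P.mono⟩

theorem computes_cech [IsNoetherianRing T] (l : List T) (hJ : J = Ideal.span {f | f ∈ l}) (i : ℕ) :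
    ∀ (M : Type) [AddCommGroup M] [Module T M], Nonempty (Φ.Computes i M ((Cx.cech M l).H i)) := by
  induction i with
  | zero =>
    intro M _ _
    obtain ⟨⟨c, -⟩⟩ := Φ.computes_zero (M := M) l hJ
    let e := LinearEquiv.ofBijective _ (Cx.H0_bijective l M)
    refine ⟨⟨fun t => e.toLinearMap.comp (c.c t), fun h f => congrArg e (c.pull h f), fun y => ?_,
      fun f h => ?_, fun f h => ?_⟩⟩
    · obtain ⟨t, f, h⟩ := c.surj (e.symm y)
      exact ⟨t, f, e.symm_apply_eq.1 h.symm |>.symm⟩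
    · exact (congrArg e (c.cob f h)).trans (map_zero e)
    · exact c.ker f (e.map_eq_zero_iff.1 h)
  | succ i ih =>
    intro M _ _
    obtain ⟨Q, _, _, ι, hQ, hι⟩ := exists_injective (T := T) M
    have hπ := (LinearMap.range ι).mkQ_surjective
    have hex := LinearMap.exact_map_mkQ_range ι
    cases i with
    | zero =>
      obtain ⟨⟨c, hc⟩⟩ := Φ.computes_zero (M := Q ⧸ LinearMap.range ι) l hJ
      obtain ⟨⟨b, hb⟩⟩ := Φ.computes_zero (M := Q) l hJ
      obtain ⟨e⟩ := Cx.cech_one ι _ hι hπ hex hQ l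
      have key : ∀ t (q : Φ.Z t 0 Q), c.c t (Φ.push (LinearMap.range ι).mkQ q) =
          Cx.listTorsMap (LinearMap.range ι).mkQ l (b.c t q) := by
        intro t q
        obtain ⟨x, hx⟩ := Φ.surj t 1
        refine Subtype.ext ?_
        rw [hc t _ x hx]
        change _ = (LinearMap.range ι).mkQ (b.c t q)
        rw [hb t _ x hx]
        rfl
      refine Computes.shift Φ ι _ hι hπ hex hQ c (e.toLinearMap.comp (Submodule.mkQ _))
        (e.surjective.comp (Submodule.mkQ_surjective _)) (fun t q => ?_) fun x hx => ?_
      · rw [key, LinearMap.comp_apply, Submodule.mkQ_apply,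
          (Submodule.Quotient.mk_eq_zero _).2 (LinearMap.mem_range_self _ _), map_zero]
      · rw [LinearMap.comp_apply, LinearEquiv.coe_coe, e.map_eq_zero_iff, Submodule.mkQ_apply,
          Submodule.Quotient.mk_eq_zero] at hx
        obtain ⟨y, rfl⟩ : ∃ y, Cx.listTorsMap (LinearMap.range ι).mkQ l y = x := hx
        obtain ⟨t, q, rfl⟩ := b.surj y
        exact ⟨t, q, (key t q).symm⟩
    | succ i =>
      obtain ⟨c⟩ := ih (Q ⧸ LinearMap.range ι)
      obtain ⟨e⟩ := Cx.cech_shift ι _ hι hπ hex hQ l (i + 1) i.succ_pos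
      refine Computes.shift Φ ι _ hι hπ hex hQ c e.toLinearMap e.surjective (fun t q => ?_)
        fun x hx => ?_
      · rw [c.cob _ ?_, map_zero]
        obtain ⟨g, hg⟩ := Φ.exists_extension hQ q
        refine ⟨(LinearMap.range ι).mkQ.comp g, ?_⟩
        change (LinearMap.range ι).mkQ.comp q.1 = _
        rw [hg]
        rfl
      · refine ⟨0, 0, ?_⟩
        rw [e.map_eq_zero_iff.1 hx]
        refine (c.cob _ ⟨0, LinearMap.ext fun x => ?_⟩).symm
        exact map_zero (LinearMap.range ι).mkQ

end ResSys

section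

namespace LocCoh
open CategoryTheory Limits Opposite

section Homology

variable {T : Type} [CommRing T] (K L : CochainComplex (ModuleCat.{0} T) ℕ) (n : ℕ)

noncomputable def toCyc : ModuleCat.of T (LinearMap.ker (K.d n (n + 1)).hom) ⟶ K.cycles n :=
  K.liftCycles (ModuleCat.ofHom (LinearMap.ker (K.d n (n + 1)).hom).subtype) (n + 1)
    (CochainComplex.next ℕ n) (by ext x; exact x.2)

theorem iCycles_toCyc (x) : K.iCycles n (toCyc K n x) = x.1 := by
  have := K.liftCycles_i (ModuleCat.ofHom (LinearMap.ker (K.d n (n + 1)).hom).subtype) (n + 1)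
    (CochainComplex.next ℕ n) (by ext x; exact x.2)
  exact ConcreteCategory.congr_hom this x

theorem toCyc_iCycles (c : K.cycles n) :
    ∃ h : K.iCycles n c ∈ LinearMap.ker (K.d n (n + 1)).hom, toCyc K n ⟨_, h⟩ = c := by
  have h : K.iCycles n c ∈ LinearMap.ker (K.d n (n + 1)).hom :=
    ConcreteCategory.congr_hom (K.iCycles_d n (n + 1)) c
  refine ⟨h, (ModuleCat.mono_iff_injective (K.iCycles n)).1 inferInstance ?_⟩
  rw [iCycles_toCyc]

/-- The class of a cocycle. -/
noncomputable def hcl : LinearMap.ker (K.d n (n + 1)).hom →ₗ[T] K.homology n :=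
  (toCyc K n ≫ K.homologyπ n).hom

theorem hcl_surjective : Function.Surjective (hcl K n) := by
  intro z
  obtain ⟨c, rfl⟩ := (ModuleCat.epi_iff_surjective (K.homologyπ n)).1 inferInstance z
  obtain ⟨h, hc⟩ := toCyc_iCycles K n c
  refine ⟨⟨_, h⟩, ?_⟩
  conv_rhs => rw [← hc]
  rfl

theorem hcl_eq_zero (x) :
    hcl K n x = 0 ↔ ∃ y, (K.d ((ComplexShape.up ℕ).prev n) n).hom y = x.1 := by
  have hex : (ShortComplex.mk _ _ (K.toCycles_comp_homologyπ _ n)).Exact :=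
    ShortComplex.exact_of_g_is_cokernel _ (K.homologyIsCokernel _ n rfl)
  rw [ShortComplex.moduleCat_exact_iff] at hex
  have hinj := (ModuleCat.mono_iff_injective (K.iCycles n)).1 inferInstance
  have hto : ∀ y, K.iCycles n (K.toCycles ((ComplexShape.up ℕ).prev n) n y) =
      (K.d ((ComplexShape.up ℕ).prev n) n).hom y := fun y =>
    ConcreteCategory.congr_hom (K.toCycles_i ((ComplexShape.up ℕ).prev n) n) y
  constructor
  · intro h
    obtain ⟨y, hy⟩ := hex (toCyc K n x) h
    refine ⟨y, ?_⟩
    rw [← hto, ← iCycles_toCyc]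
    exact congrArg _ hy
  · rintro ⟨y, hy⟩
    have : toCyc K n x = K.toCycles ((ComplexShape.up ℕ).prev n) n y := by
      apply hinj
      rw [iCycles_toCyc, hto, hy]
    change K.homologyπ n (toCyc K n x) = 0
    rw [this]
    exact ConcreteCategory.congr_hom (K.toCycles_comp_homologyπ _ n) y

variable {K L}

theorem homologyMap_hcl (φ : K ⟶ L) (x : LinearMap.ker (K.d n (n + 1)).hom)
    (y : LinearMap.ker (L.d n (n + 1)).hom) (h : φ.f n x.1 = y.1) :
    HomologicalComplex.homologyMap φ n (hcl K n x) = hcl L n y := by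
  have h1 : HomologicalComplex.cyclesMap φ n (toCyc K n x) = toCyc L n y := by
    apply (ModuleCat.mono_iff_injective (L.iCycles n)).1 inferInstance
    rw [iCycles_toCyc, ← h, ← iCycles_toCyc K]
    exact ConcreteCategory.congr_hom (HomologicalComplex.cyclesMap_i φ n) (toCyc K n x)
  change HomologicalComplex.homologyMap φ n (K.homologyπ n (toCyc K n x)) = L.homologyπ n (toCyc L n y)
  rw [← h1]
  exact ConcreteCategory.congr_hom (HomologicalComplex.homologyπ_naturality φ n) (toCyc K n x)

end Homology

section Ext

variable {T : Type} [CommRing T] {X Y : ModuleCat.{0} T} (P : ProjectiveResolution X)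
  (Q : ProjectiveResolution Y) (M : ModuleCat.{0} T) (n : ℕ)

theorem isoExt_naturality (f : X ⟶ Y) (φ : P.complex ⟶ Q.complex)
    (comm : φ.f 0 ≫ Q.π.f 0 = P.π.f 0 ≫ f) (φ' : Q.complex.linearYonedaObj T M ⟶ P.complex.linearYonedaObj T M)
    (hφ' : ∀ n, φ'.f n = ((linearYoneda T _).obj M).map (φ.f n).op) :
    ((Ext T (ModuleCat.{0} T) n).map f.op).app M ≫ (P.isoExt n M).hom =
      (Q.isoExt n M).hom ≫ HomologicalComplex.homologyMap φ' n := by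
  have h1 := congrArg Quiver.Hom.unop (ProjectiveResolution.isoLeftDerivedObj_inv_naturality
    f P Q φ comm ((linearYoneda T (ModuleCat.{0} T)).obj M).rightOp n)
  have h2 := HomologicalComplex.homologyOp_hom_naturality φ' n
  have h2' := (Iso.inv_comp_eq _).2 (((Iso.eq_comp_inv _).2 h2).trans (Category.assoc _ _ _))
  have h3 := congrArg Quiver.Hom.unop h2'
  have h4 : (HomologicalComplex.opFunctor (ModuleCat.{0} T) (ComplexShape.up ℕ)).map φ'.op =
      ((((linearYoneda T (ModuleCat.{0} T)).obj M).rightOp.mapHomologicalComplex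
        (ComplexShape.down ℕ)).map φ) := by
    ext n : 1
    exact congrArg Quiver.Hom.op (hφ' n)
  rw [h4] at h3
  calc _ = _ := (Category.assoc _ _ _).symm
    _ = _ := congrArg (fun u => u ≫ (HomologicalComplex.homologyOp
      (P.complex.linearYonedaObj T M) n).inv.unop) h1
    _ = _ := Category.assoc _ _ _
    _ = _ := congrArg (fun u => (Q.isoLeftDerivedObj ((linearYoneda T
      (ModuleCat.{0} T)).obj M).rightOp n).inv.unop ≫ u) h3
    _ = _ := (Category.assoc _ _ _).symm

end Ext

section Comparison

variable {T : Type} [CommRing T] (J : Ideal T)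

noncomputable abbrev pres (t : ℕ) : ProjectiveResolution (ModuleCat.of T (T ⧸ J ^ t)) :=
  projectiveResolution _

noncomputable def trans {t t' : ℕ} (h : t ≤ t') :
    ModuleCat.of T (T ⧸ J ^ t') ⟶ ModuleCat.of T (T ⧸ J ^ t) :=
  ModuleCat.ofHom (Submodule.mapQ _ _ LinearMap.id (Ideal.pow_le_pow_right h))

noncomputable def resSys : ResSys J where
  P t i := (pres J t).complex.X i
  d t i := ((pres J t).complex.d (i + 1) i).hom
  ε t := ((pres J t).π.f 0).hom
  proj t i := (IsProjective.iff_projective _).2 ((pres J t).projective i)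
  exact t i := (ShortComplex.ShortExact.moduleCat_exact_iff_function_exact _).1
    ((pres J t).exact_succ i)
  exact₀ t := (ShortComplex.ShortExact.moduleCat_exact_iff_function_exact _).1 (pres J t).exact₀
  surj t := (ModuleCat.epi_iff_surjective ((pres J t).π.f 0)).1 inferInstance
  φ {t t'} h i := ((ProjectiveResolution.lift (trans J h) (pres J t') (pres J t)).f i).hom
  φ_d {t t'} h i x := (ConcreteCategory.congr_hom
    ((ProjectiveResolution.lift (trans J h) (pres J t') (pres J t)).comm (i + 1) i) x).symm
  φ_ε {t t'} h x := by
    have := ConcreteCategory.congr_hom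
      (ProjectiveResolution.lift_commutes_zero (trans J h) (pres J t') (pres J t)) x
    refine this.trans ?_
    change trans J h ((pres J t').π.f 0 x) = _
    obtain ⟨a, ha⟩ := Ideal.Quotient.mk_surjective ((pres J t').π.f 0 x)
    refine (congrArg (trans J h) ha.symm).trans ?_
    exact congrArg (Ideal.Quotient.factor (Ideal.pow_le_pow_right h)) ha

variable (M : Type) [AddCommGroup M] [Module T M] (n : ℕ)

noncomputable def mkHom (t : ℕ) : (resSys J).Z t n M →ₗ[T]
    LinearMap.ker (((pres J t).complex.linearYonedaObj T (ModuleCat.of T M)).d n (n + 1)).hom where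
  toFun f := ⟨ModuleCat.ofHom f.1, by
    change (pres J t).complex.d (n + 1) n ≫ ModuleCat.ofHom f.1 = 0
    ext x
    exact f.2 x⟩
  map_add' _ _ := rfl
  map_smul' _ _ := rfl

theorem mkHom_surjective (t : ℕ) : Function.Surjective (mkHom J M n t) := by
  intro y
  refine ⟨⟨y.1.hom, fun x => ?_⟩, rfl⟩
  have h : (pres J t).complex.d (n + 1) n ≫ y.1 = 0 := y.2
  exact ConcreteCategory.congr_hom h x

/-- The class of a cocycle in `Ext`. -/
noncomputable def extCl (t : ℕ) : (resSys J).Z t n M →ₗ[T]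
    (localCohomology.diagram (localCohomology.idealPowersDiagram J) n).obj (op (op t)) |>.obj
      (ModuleCat.of T M) :=
  ((pres J t).isoExt n (ModuleCat.of T M)).inv.hom.comp ((hcl _ n).comp (mkHom J M n t))

theorem extCl_surjective (t : ℕ) : Function.Surjective (extCl J M n t) :=
  ((pres J t).isoExt n (ModuleCat.of T M)).toLinearEquiv.symm.surjective.comp
    ((hcl_surjective _ n).comp (mkHom_surjective J M n t))

theorem extCl_eq_zero (t : ℕ) (f : (resSys J).Z t n M) :
    extCl J M n t f = 0 ↔ (resSys J).IsCob f.1 := by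
  have h1 : extCl J M n t f = 0 ↔ hcl ((pres J t).complex.linearYonedaObj T (ModuleCat.of T M)) n
      (mkHom J M n t f) = 0 :=
    ((pres J t).isoExt n (ModuleCat.of T M)).toLinearEquiv.symm.map_eq_zero_iff
  rw [h1, hcl_eq_zero]
  cases n with
  | zero =>
    rw [CochainComplex.prev_nat_zero, HomologicalComplex.shape _ _ _ (by simp)]
    constructor
    · rintro ⟨y, hy⟩
      exact LinearMap.ext fun x => (ConcreteCategory.congr_hom hy x).symm
    · intro h
      refine ⟨0, ?_⟩
      rw [map_zero]
      change 0 = ModuleCat.ofHom f.1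
      rw [show f.1 = 0 from h]
      rfl
  | succ n =>
    rw [CochainComplex.prev_nat_succ]
    constructor
    · rintro ⟨y, hy⟩
      exact ⟨y.hom, LinearMap.ext fun x => (ConcreteCategory.congr_hom hy x).symm⟩
    · rintro ⟨e, he⟩
      refine ⟨ModuleCat.ofHom e, ?_⟩
      change (pres J t).complex.d (n + 1) n ≫ ModuleCat.ofHom e = ModuleCat.ofHom f.1
      rw [he]
      rfl

theorem extCl_map {t t' : ℕ} (h : t ≤ t') (f : (resSys J).Z t n M) :
    ((localCohomology.diagram (localCohomology.idealPowersDiagram J) n).map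
      (homOfLE h).op.op).app (ModuleCat.of T M) (extCl J M n t f) =
      extCl J M n t' ((resSys J).pull h f) := by
  let φ := ProjectiveResolution.lift (trans J h) (pres J t') (pres J t)
  let φ' : (pres J t).complex.linearYonedaObj T (ModuleCat.of T M) ⟶
      (pres J t').complex.linearYonedaObj T (ModuleCat.of T M) :=
    (HomologicalComplex.unopFunctor _ _).map
      (((((linearYoneda T (ModuleCat.{0} T)).obj (ModuleCat.of T M)).rightOp.mapHomologicalComplex
        (ComplexShape.down ℕ)).map φ)).op
  have := isoExt_naturality (pres J t') (pres J t) (ModuleCat.of T M) n (trans J h) φ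
    (ProjectiveResolution.lift_commutes_zero _ _ _) φ' (fun _ => rfl)
  rw [← Iso.inv_comp_eq, ← Category.assoc, ← Iso.eq_comp_inv] at this
  have h2 := ConcreteCategory.congr_hom this (hcl _ n (mkHom J M n t f))
  refine Eq.trans ?_ (h2.trans ?_)
  · rfl
  · change ((pres J t').isoExt n (ModuleCat.of T M)).inv (HomologicalComplex.homologyMap φ' n _) = _
    rw [homologyMap_hcl n φ' (mkHom J M n t f) (mkHom J M n t' ((resSys J).pull h f)) rfl]
    rfl

/-- Local cohomology is Čech cohomology. -/
theorem localCohomology_equiv [IsNoetherianRing T] (l : List T)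
    (hJ : J.radical = (Ideal.span {f | f ∈ l}).radical) :
    Nonempty ((localCohomology J n).obj (ModuleCat.of T M) ≃ₗ[T] (Cx.cech M l).H n) := by
  suffices key : Nonempty ((localCohomology (Ideal.span {f | f ∈ l}) n).obj (ModuleCat.of T M)
      ≃ₗ[T] (Cx.cech M l).H n) by
    obtain ⟨e⟩ := key
    exact ⟨((localCohomology.isoOfSameRadical hJ n).app (ModuleCat.of T M)).toLinearEquiv.trans e⟩
  generalize hI : Ideal.span {f | f ∈ l} = I
  obtain ⟨c⟩ := (resSys I).computes_cech l hI.symm n M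
  let D := localCohomology.diagram (localCohomology.idealPowersDiagram I) n
  have : HasColimit D := localCohomology.hasColimitDiagram.{0, 0} _ n
  let F := D ⋙ (evaluation _ _).obj (ModuleCat.of T M)
  let cc : Cocone F := ((evaluation _ _).obj (ModuleCat.of T M)).mapCocone (colimit.cocone D)
  have hcc : IsColimit cc := isColimitOfPreserves _ (colimit.isColimit D)
  have hle : ∀ t, LinearMap.ker (extCl I M n t) ≤ LinearMap.ker (c.c t) := fun t f hf =>
    c.cob f ((extCl_eq_zero I M n t f).1 hf)
  let u : ∀ t, F.obj (op (op t)) ⟶ ModuleCat.of T ((Cx.cech M l).H n) := fun t =>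
    ModuleCat.ofHom (((LinearMap.ker (extCl I M n t)).liftQ (c.c t) (hle t)).comp
      ((extCl I M n t).quotKerEquivOfSurjective (extCl_surjective I M n t)).symm.toLinearMap)
  have hu : ∀ t f, u t (extCl I M n t f) = c.c t f := by
    intro t f
    change ((LinearMap.ker (extCl I M n t)).liftQ (c.c t) (hle t))
      (((extCl I M n t).quotKerEquivOfSurjective (extCl_surjective I M n t)).symm
        (extCl I M n t f)) = _
    rw [LinearMap.quotKerEquivOfSurjective_symm_apply]
    rfl
  have hmap : ∀ {t t'} (h : t ≤ t') f, F.map (homOfLE h).op.op (extCl I M n t f) =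
      extCl I M n t' ((resSys I).pull h f) := fun h f => extCl_map I M n h f
  let cH : Cocone F :=
    { pt := ModuleCat.of T ((Cx.cech M l).H n)
      ι :=
        { app := fun t => u t.unop.unop
          naturality := by
            intro t t' w
            obtain ⟨h, rfl⟩ : ∃ h : t.unop.unop ≤ t'.unop.unop, w = (homOfLE h).op.op :=
              ⟨leOfHom w.unop.unop, rfl⟩
            refine ModuleCat.hom_ext (LinearMap.ext fun x => ?_)
            obtain ⟨f, rfl⟩ := extCl_surjective I M n _ x
            change u _ (F.map _ (extCl I M n _ f)) = u _ (extCl I M n _ f)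
            rw [hmap, hu, hu, c.pull] } }
  have hdesc : ∀ t f, (hcc.desc cH).hom (cc.ι.app (op (op t)) (extCl I M n t f)) = c.c t f := by
    intro t f
    refine Eq.trans ?_ (hu t f)
    exact ConcreteCategory.congr_hom (hcc.fac cH (op (op t))) (extCl I M n t f)
  have hdies : ∀ {t} (f : (resSys I).Z t n M), (resSys I).Dies f →
      cc.ι.app (op (op t)) (extCl I M n t f) = 0 := by
    intro t f hf
    induction hf with
    | cob f h => rw [(extCl_eq_zero I M n _ f).2 h, map_zero]
    | pull h f hf ih =>
      rw [← ih, ← hmap h]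
      exact (ConcreteCategory.congr_hom (cc.w (homOfLE h).op.op) (extCl I M n _ f)).symm
  refine ⟨LinearEquiv.ofBijective (hcc.desc cH).hom ⟨?_, fun y => ?_⟩⟩
  · refine (injective_iff_map_eq_zero _).2 fun x hx => ?_
    obtain ⟨t, x, rfl⟩ := Concrete.isColimit_exists_rep F hcc x
    obtain ⟨f, rfl⟩ := extCl_surjective I M n _ x
    exact hdies f (c.ker f ((hdesc _ f).symm.trans hx))
  · obtain ⟨t, f, rfl⟩ := c.surj y
    exact ⟨_, hdesc t f⟩

end Comparison

end LocCoh

end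

section Fischer

variable {σ : Type} [Fintype σ]

/-- The Fischer (apolar) bilinear form on rational polynomials. -/
noncomputable def fischer : MvPolynomial σ ℚ →ₗ[ℚ] MvPolynomial σ ℚ →ₗ[ℚ] ℚ :=
  (MvPolynomial.basisMonomials σ ℚ).constr ℚ fun a =>
    ((∏ p, (a p).factorial : ℕ) : ℚ) • MvPolynomial.lcoeff ℚ a

theorem fischer_monomial (a : σ →₀ ℕ) (c : ℚ) (g : MvPolynomial σ ℚ) :
    fischer (MvPolynomial.monomial a c) g =
      c * (((∏ p, (a p).factorial : ℕ) : ℚ) * MvPolynomial.coeff a g) := by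
  have : (MvPolynomial.monomial a c : MvPolynomial σ ℚ) =
      c • MvPolynomial.basisMonomials σ ℚ a := by
    simp [MvPolynomial.coe_basisMonomials, MvPolynomial.smul_monomial]
  rw [this, map_smul, fischer, Module.Basis.constr_basis]
  simp

theorem fischer_symm (f g : MvPolynomial σ ℚ) : fischer f g = fischer g f := by
  classical
  induction f using MvPolynomial.induction_on' with
  | add p q hp hq => simp [hp, hq]
  | monomial a c =>
    induction g using MvPolynomial.induction_on' with
    | add p q hp hq => simp [hp, hq]
    | monomial b d =>
      rw [fischer_monomial, fischer_monomial, MvPolynomial.coeff_monomial,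
        MvPolynomial.coeff_monomial]
      by_cases h : a = b
      · subst h; simp; ring
      · simp [h, Ne.symm h]

theorem fischer_X_mul (p : σ) (f g : MvPolynomial σ ℚ) :
    fischer (MvPolynomial.X p * f) g = fischer f (MvPolynomial.pderiv p g) := by
  classical
  induction f using MvPolynomial.induction_on' with
  | add p q hp hq => simp [hp, hq, mul_add]
  | monomial a c =>
    have : (MvPolynomial.X p * MvPolynomial.monomial a c : MvPolynomial σ ℚ) =
        MvPolynomial.monomial (a + Finsupp.single p 1) c := by
      rw [MvPolynomial.X, MvPolynomial.monomial_mul, add_comm, one_mul]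
    rw [this, fischer_monomial, fischer_monomial, MvPolynomial.coeff_pderiv,
      ← Finset.mul_prod_erase _ _ (Finset.mem_univ p),
      ← Finset.mul_prod_erase _ (fun q => (a q).factorial) (Finset.mem_univ p)]
    have h : ∏ x ∈ Finset.univ.erase p, ((a + Finsupp.single p 1 : σ →₀ ℕ) x).factorial =
        ∏ x ∈ Finset.univ.erase p, (a x).factorial :=
      Finset.prod_congr rfl fun x hx => by
        simp [Ne.symm (Finset.ne_of_mem_erase hx)]
    rw [h, Finsupp.add_apply, Finsupp.single_eq_same, Nat.factorial_succ]
    push_cast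
    ring

theorem eq_zero_of_fischer_self (f : MvPolynomial σ ℚ) (h : fischer f f = 0) : f = 0 := by
  have e : fischer f f = ∑ a ∈ f.support,
      (((∏ p, (a p).factorial : ℕ) : ℚ) * (MvPolynomial.coeff a f) ^ 2) := by
    conv_lhs => enter [1]; rw [f.as_sum]
    rw [map_sum, LinearMap.sum_apply]
    refine Finset.sum_congr rfl fun a _ => ?_
    rw [fischer_monomial]
    ring
  rw [e, Finset.sum_eq_zero_iff_of_nonneg (fun a _ => by positivity)] at h
  ext a
  by_contra ha
  have := h a (MvPolynomial.mem_support_iff.2 ha)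
  have h2 : ((∏ p, (a p).factorial : ℕ) : ℚ) ≠ 0 :=
    Nat.cast_ne_zero.2 (Finset.prod_ne_zero_iff.2 fun p _ => Nat.factorial_ne_zero _)
  simp_all

end Fischer

section coeffMap

variable {σ K L : Type} [CommSemiring K] [CommSemiring L]

/-- Applying an additive map to all coefficients of a polynomial. -/
noncomputable def coeffMap (g : K →+ L) : MvPolynomial σ K →+ MvPolynomial σ L where
  toFun f := AddMonoidAlgebra.map g f
  map_zero' := AddMonoidAlgebra.map_zero g
  map_add' := AddMonoidAlgebra.map_add g

theorem coeff_coeffMap (g : K →+ L) (f : MvPolynomial σ K) (a) :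
    MvPolynomial.coeff a (coeffMap g f) = g (MvPolynomial.coeff a f) := rfl

theorem coeffMap_X_mul (g : K →+ L) (p : σ) (f : MvPolynomial σ K) :
    coeffMap g (MvPolynomial.X p * f) = MvPolynomial.X p * coeffMap g f := by
  classical
  ext a
  rw [coeff_coeffMap, MvPolynomial.coeff_X_mul', MvPolynomial.coeff_X_mul']
  split <;> simp [coeff_coeffMap]

theorem coeffMap_pderiv (g : K →+ L) (p : σ) (f : MvPolynomial σ K) :
    coeffMap g (MvPolynomial.pderiv p f) = MvPolynomial.pderiv p (coeffMap g f) := by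
  ext a
  rw [coeff_coeffMap, MvPolynomial.coeff_pderiv, MvPolynomial.coeff_pderiv, coeff_coeffMap]
  have := map_nsmul g (a p + 1) (MvPolynomial.coeff (a + Finsupp.single p 1) f)
  simpa [nsmul_eq_mul, mul_comm] using this

end coeffMap

section polarization

variable (K : Type) [CommRing K] {ι κ : Type} [Fintype κ]

/-- The polarization operator `∑ₖ Xᵢₖ ∂/∂Xⱼₖ`. -/
noncomputable def polar (i j : ι) :
    Derivation K (MvPolynomial (ι × κ) K) (MvPolynomial (ι × κ) K) :=
  ∑ c, (MvPolynomial.X (i, c) : MvPolynomial (ι × κ) K) • MvPolynomial.pderiv (j, c)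

theorem polar_apply (i j : ι) (f : MvPolynomial (ι × κ) K) :
    polar K i j f = ∑ c, MvPolynomial.X (i, c) * MvPolynomial.pderiv (j, c) f := by
  have : ∀ s : Finset κ, (∑ c ∈ s, (MvPolynomial.X (i, c) : MvPolynomial (ι × κ) K) •
      MvPolynomial.pderiv (R := K) (j, c)) f =
      ∑ c ∈ s, MvPolynomial.X (i, c) * MvPolynomial.pderiv (j, c) f := by
    classical
    intro s
    induction s using Finset.induction with
    | empty => simp
    | insert a s h ih => rw [Finset.sum_insert h, Finset.sum_insert h, ← ih]; rfl
  exact this _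

/-- The off-diagonal Casimir-type operator `∑_{i ≠ j} Eⱼᵢ Eᵢⱼ`. -/
noncomputable def casimir [Fintype ι] [DecidableEq ι] :
    MvPolynomial (ι × κ) K →ₗ[K] MvPolynomial (ι × κ) K :=
  ∑ p ∈ Finset.univ.filter fun p : ι × ι => p.1 ≠ p.2,
    (polar (κ := κ) K p.2 p.1).toLinearMap ∘ₗ (polar K p.1 p.2).toLinearMap

theorem casimir_apply [Fintype ι] [DecidableEq ι] (f : MvPolynomial (ι × κ) K) :
    casimir K f = ∑ p ∈ Finset.univ.filter fun p : ι × ι => p.1 ≠ p.2,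
      polar K p.2 p.1 (polar K p.1 p.2 f) := by
  simp [casimir, LinearMap.sum_apply]

theorem coeffMap_polar {L : Type} [CommRing L] (g : K →+ L) (i j : ι)
    (f : MvPolynomial (ι × κ) K) :
    coeffMap g (polar K i j f) = polar L i j (coeffMap g f) := by
  rw [polar_apply, polar_apply, map_sum]
  exact Finset.sum_congr rfl fun c _ => by rw [coeffMap_X_mul, coeffMap_pderiv]

theorem coeffMap_casimir [Fintype ι] [DecidableEq ι] {L : Type} [CommRing L] (g : K →+ L)
    (f : MvPolynomial (ι × κ) K) :
    coeffMap g (casimir K f) = casimir L (coeffMap g f) := by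
  rw [casimir_apply, casimir_apply, map_sum]
  exact Finset.sum_congr rfl fun c _ => by rw [coeffMap_polar, coeffMap_polar]

theorem fischer_polar [Fintype ι] (i j : ι) (f g : MvPolynomial (ι × κ) ℚ) :
    fischer (polar ℚ i j f) g = fischer f (polar ℚ j i g) := by
  rw [polar_apply, polar_apply, map_sum, map_sum, LinearMap.sum_apply]
  refine Finset.sum_congr rfl fun c _ => ?_
  rw [fischer_X_mul, fischer_symm f, fischer_X_mul, fischer_symm]

theorem polar_eq_zero_of_fischer [Fintype ι] [DecidableEq ι] (f : MvPolynomial (ι × κ) ℚ)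
    (h : fischer (casimir ℚ f) f = 0) (i j : ι) (hij : i ≠ j) : polar ℚ i j f = 0 := by
  have e : fischer (casimir ℚ f) f = ∑ p ∈ Finset.univ.filter fun p : ι × ι => p.1 ≠ p.2,
      fischer (polar ℚ p.1 p.2 f) (polar ℚ p.1 p.2 f) := by
    rw [casimir_apply, map_sum, LinearMap.sum_apply]
    exact Finset.sum_congr rfl fun p _ => fischer_polar _ _ _ _
  have nn : ∀ g : MvPolynomial (ι × κ) ℚ, 0 ≤ fischer g g := by
    intro g
    conv_rhs => enter [1]; rw [g.as_sum]
    rw [map_sum, LinearMap.sum_apply]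
    refine Finset.sum_nonneg fun a _ => ?_
    rw [fischer_monomial]
    have : 0 ≤ ((∏ p, (a p).factorial : ℕ) : ℚ) * (MvPolynomial.coeff a g) ^ 2 := by positivity
    linarith
  rw [e, Finset.sum_eq_zero_iff_of_nonneg fun p _ => nn _] at h
  exact eq_zero_of_fischer_self _ (h (i, j) (by simpa using hij))

theorem polar_eq_zero_of_casimir_sq {k : Type} [Field k] [CharZero k] [Fintype ι] [DecidableEq ι]
    (f : MvPolynomial (ι × κ) k) (h : casimir k (casimir k f) = 0) (i j : ι) (hij : i ≠ j) :
    polar k i j f = 0 := by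
  have hQ : ∀ g : MvPolynomial (ι × κ) ℚ, casimir ℚ (casimir ℚ g) = 0 → polar ℚ i j g = 0 := by
    intro g hg
    have sa : ∀ f g : MvPolynomial (ι × κ) ℚ,
        fischer (casimir ℚ f) g = fischer f (casimir ℚ g) := by
      intro f g
      rw [casimir_apply, casimir_apply, map_sum, LinearMap.sum_apply, map_sum]
      refine Finset.sum_congr rfl fun p _ => ?_
      rw [fischer_polar, fischer_polar]
    have h0 : casimir ℚ g = 0 := by
      apply eq_zero_of_fischer_self
      rw [← sa, hg]; simp
    exact polar_eq_zero_of_fischer g (by rw [h0]; simp) i j hij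
  by_contra hne
  obtain ⟨a, ha⟩ := MvPolynomial.ne_zero_iff.1 hne
  let _ : Algebra ℚ k := DivisionRing.toRatAlgebra
  obtain ⟨l, hl⟩ := Module.Projective.exists_dual_ne_zero ℚ ha
  apply hl
  have h1 := hQ (coeffMap l.toAddMonoidHom f) (by
    rw [← coeffMap_casimir, ← coeffMap_casimir, h, map_zero])
  rw [← coeffMap_polar] at h1
  have h2 := congrArg (MvPolynomial.coeff a) h1
  rwa [coeff_coeffMap] at h2

end polarization

section

theorem exists_splitting_of_ker_range {k V : Type} [Field k] [AddCommGroup V] [Module k V]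
    (Ω : V →ₗ[k] V) (h1 : ∀ f, Ω (Ω f) = 0 → Ω f = 0) (h2 : ∀ f, ∃ y w, Ω y = 0 ∧ f = y + Ω w) :
    ∃ ρ τ : V →ₗ[k] V, (∀ f, Ω (ρ f) = 0) ∧ (∀ f, ρ (Ω f) = 0) ∧ (∀ f, f = ρ f + τ (Ω f)) ∧
      ∀ φ : V →+ V, (∀ f, φ (Ω f) = Ω (φ f)) → ∀ f, φ (ρ f) = ρ (φ f) ∧ φ (τ f) = τ (φ f) := by
  have h3 : ∀ f, ∃ p : V × V, Ω p.1 = 0 ∧ (∃ v, Ω v = p.2) ∧ f = p.1 + Ω p.2 := by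
    intro f
    obtain ⟨y, w, hy, rfl⟩ := h2 f
    obtain ⟨y', w', hy', rfl⟩ := h2 w
    exact ⟨(y, Ω w'), hy, ⟨w', rfl⟩, by simp [hy']⟩
  have un : ∀ y y' w w', Ω y = 0 → Ω y' = 0 → (∃ v, Ω v = w) → (∃ v, Ω v = w') →
      y + Ω w = y' + Ω w' → y = y' ∧ w = w' := by
    rintro y y' _ _ hy hy' ⟨v, rfl⟩ ⟨v', rfl⟩ h
    have e1 : Ω (Ω (Ω (v - v'))) = 0 := by
      have := congrArg Ω h
      simp only [map_add, hy, hy', zero_add] at this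
      simp [this]
    have e2 := h1 _ (h1 _ e1)
    rw [map_sub, sub_eq_zero] at e2
    rw [e2] at h
    exact ⟨add_right_cancel h, e2⟩
  choose p hp1 hp2 hp3 using h3
  have key : ∀ f y w, Ω y = 0 → (∃ v, Ω v = w) → f = y + Ω w → (p f).1 = y ∧ (p f).2 = w :=
    fun f y w hy hw hf => un _ _ _ _ (hp1 f) hy (hp2 f) hw ((hp3 f).symm.trans hf)
  have kadd : ∀ f g, (p (f + g)).1 = (p f).1 + (p g).1 ∧ (p (f + g)).2 = (p f).2 + (p g).2 := by
    intro f g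
    obtain ⟨v, hv⟩ := hp2 f
    obtain ⟨v', hv'⟩ := hp2 g
    refine key _ _ _ (by simp [hp1]) ⟨v + v', by simp [hv, hv']⟩ ?_
    conv_lhs => rw [hp3 f, hp3 g]
    rw [map_add]; abel
  have ksmul : ∀ (c : k) f, (p (c • f)).1 = c • (p f).1 ∧ (p (c • f)).2 = c • (p f).2 := by
    intro c f
    obtain ⟨v, hv⟩ := hp2 f
    refine key _ _ _ (by simp [hp1]) ⟨c • v, by simp [hv]⟩ ?_
    conv_lhs => rw [hp3 f]
    rw [map_smul, smul_add]
  refine ⟨⟨⟨fun f => (p f).1, fun f g => (kadd f g).1⟩, fun c f => (ksmul c f).1⟩,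
    ⟨⟨fun f => (p f).2, fun f g => (kadd f g).2⟩, fun c f => (ksmul c f).2⟩, hp1, ?_, ?_, ?_⟩
  · intro f
    refine (key (Ω f) 0 (Ω (p f).2) (map_zero _) ⟨_, rfl⟩ ?_).1
    conv_lhs => rw [hp3 f]
    simp [hp1]
  · intro f
    change f = (p f).1 + (p (Ω f)).2
    have : (p (Ω f)).2 = Ω (p f).2 := by
      refine (key (Ω f) 0 _ (map_zero _) ⟨_, rfl⟩ ?_).2
      conv_lhs => rw [hp3 f]
      simp [hp1]
    rw [this]; exact hp3 f
  · intro φ hφ f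
    have := key (φ f) (φ (p f).1) (φ (p f).2) (by rw [← hφ, hp1, map_zero])
      (by obtain ⟨v, hv⟩ := hp2 f; exact ⟨φ v, by rw [← hφ, hv]⟩) (by
        rw [← hφ, ← map_add, ← hp3])
    exact ⟨this.1.symm, this.2.symm⟩

open MvPolynomial

section
variable {k : Type} [Field k] {ι κ : Type} [Fintype κ]

theorem isHomogeneous_polar {n : ℕ} (i j : ι) (f : MvPolynomial (ι × κ) k)
    (hf : f.IsHomogeneous n) : (polar k i j f).IsHomogeneous n := by
  rw [polar_apply]
  refine IsHomogeneous.sum _ _ _ fun c _ => ?_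
  rcases n with _ | n
  · have : pderiv (j, c) f = 0 := by
      rw [← totalDegree_zero_iff_isHomogeneous, totalDegree_eq_zero_iff_eq_C] at hf
      rw [hf, pderiv_C]
    rw [this, mul_zero]; exact isHomogeneous_zero _ _ _
  · have := (isHomogeneous_X k (i, c)).mul (hf.pderiv (i := (j, c)))
    rwa [Nat.add_sub_cancel, add_comm] at this

variable [Fintype ι] [DecidableEq ι]

theorem isHomogeneous_casimir {n : ℕ} (f : MvPolynomial (ι × κ) k)
    (hf : f.IsHomogeneous n) : (casimir k f).IsHomogeneous n := by
  rw [casimir_apply]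
  exact IsHomogeneous.sum _ _ _ fun p _ => isHomogeneous_polar _ _ _ (isHomogeneous_polar _ _ _ hf)

theorem homogeneousComponent_casimir (n : ℕ) (f : MvPolynomial (ι × κ) k) :
    homogeneousComponent n (casimir k f) = casimir k (homogeneousComponent n f) := by
  conv_lhs => rw [← sum_homogeneousComponent f]
  rw [map_sum, map_sum]
  rw [Finset.sum_congr rfl fun i _ => homogeneousComponent_of_mem
    (isHomogeneous_casimir _ (homogeneousComponent_isHomogeneous i f))]
  by_cases h : n ∈ Finset.range (f.totalDegree + 1)
  · rw [Finset.sum_eq_single_of_mem n h fun b _ hb => if_neg (Ne.symm hb), if_pos rfl]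
  · rw [homogeneousComponent_eq_zero _ _ (by simpa using h), map_zero]
    exact Finset.sum_eq_zero fun i hi => if_neg fun (e : n = i) => h (e ▸ hi)

variable [CharZero k]

theorem casimir_sq (f : MvPolynomial (ι × κ) k) (h : casimir k (casimir k f) = 0) :
    casimir k f = 0 := by
  rw [casimir_apply]
  refine Finset.sum_eq_zero fun p hp => ?_
  rw [polar_eq_zero_of_casimir_sq f h _ _ (by simpa using hp), map_zero]

theorem casimir_ker_range (f : MvPolynomial (ι × κ) k) :
    ∃ y w, casimir k y = 0 ∧ f = y + casimir k w := by
  have hom : ∀ n, ∀ f : MvPolynomial (ι × κ) k, f.IsHomogeneous n →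
      ∃ y w, casimir k y = 0 ∧ f = y + casimir k w := by
    intro n f hf
    have : Module.Finite k (homogeneousSubmodule (ι × κ) k n) :=
      Module.Finite.iff_fg.2 (homogeneousSubmodule_fg _ _ n)
    let Ω : homogeneousSubmodule (ι × κ) k n →ₗ[k] homogeneousSubmodule (ι × κ) k n :=
      (casimir k).restrict fun f hf => isHomogeneous_casimir f hf
    have hd : Disjoint (LinearMap.ker Ω) (LinearMap.range Ω) := by
      rw [Submodule.disjoint_def]
      rintro _ hx ⟨y, rfl⟩
      have : casimir k (casimir k y.1) = 0 := congrArg Subtype.val (LinearMap.mem_ker.1 hx)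
      exact Subtype.ext (casimir_sq _ this)
    have hc := (Submodule.isCompl_iff_disjoint _ _ (by
      rw [add_comm, LinearMap.finrank_range_add_finrank_ker])).2 hd
    obtain ⟨y, hy, z, ⟨w, rfl⟩, h⟩ := Submodule.mem_sup.1
      (hc.sup_eq_top ▸ Submodule.mem_top : (⟨f, hf⟩ : homogeneousSubmodule (ι × κ) k n) ∈ _)
    exact ⟨y, w, congrArg Subtype.val (LinearMap.mem_ker.1 hy), (congrArg Subtype.val h).symm⟩
  choose y w h1 h2 using fun n => hom n _ (homogeneousComponent_isHomogeneous n f)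
  refine ⟨∑ n ∈ Finset.range (f.totalDegree + 1), y n,
    ∑ n ∈ Finset.range (f.totalDegree + 1), w n, ?_, ?_⟩
  · rw [map_sum]; exact Finset.sum_eq_zero fun n _ => h1 n
  · rw [map_sum, ← Finset.sum_add_distrib]
    conv_lhs => rw [← sum_homogeneousComponent f]
    exact Finset.sum_congr rfl fun n _ => h2 n

theorem casimir_mul (a f : MvPolynomial (ι × κ) k) (ha : casimir k a = 0) :
    casimir k (a * f) = a * casimir k f := by
  have h := fun i j hij => polar_eq_zero_of_casimir_sq a (by rw [ha, map_zero]) i j hij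
  rw [casimir_apply, casimir_apply, Finset.mul_sum]
  refine Finset.sum_congr rfl fun p hp => ?_
  have hp : p.1 ≠ p.2 := by simpa using hp
  rw [Derivation.leibniz, h _ _ hp, smul_zero, add_zero, smul_eq_mul, Derivation.leibniz,
    h _ _ hp.symm, smul_zero, add_zero, smul_eq_mul]

/-- The Reynolds-type operator: the projection onto the kernel of the Casimir operator. -/
theorem exists_reynolds (k ι κ : Type) [Field k] [CharZero k] [Fintype ι] [DecidableEq ι]
    [Fintype κ] :
    ∃ ρ τ : MvPolynomial (ι × κ) k →ₗ[k] MvPolynomial (ι × κ) k,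
      (∀ f, casimir k (ρ f) = 0) ∧ (∀ f, ρ (casimir k f) = 0) ∧
      (∀ f, f = ρ f + τ (casimir k f)) ∧
      (∀ n f, homogeneousComponent n (ρ f) = ρ (homogeneousComponent n f)) ∧
      ∀ a, casimir k a = 0 → ∀ f, ρ (a * f) = a * ρ f ∧ τ (a * f) = a * τ f := by
  obtain ⟨ρ, τ, h1, h2, h3, h4⟩ := exists_splitting_of_ker_range (casimir (κ := κ) (ι := ι) k)
    casimir_sq casimir_ker_range
  refine ⟨ρ, τ, h1, h2, h3, fun n f => ?_, fun a ha f => ?_⟩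
  · exact (h4 (homogeneousComponent n).toAddMonoidHom
      (fun f => homogeneousComponent_casimir n f) f).1
  · have := h4 (AddMonoidHom.mulLeft a) (fun f => (casimir_mul a f ha).symm) f
    exact ⟨this.1.symm, this.2.symm⟩
end

end

section

open MvPolynomial

section
variable {k : Type} [Field k] {ι κ : Type} [DecidableEq ι] [Fintype κ]

theorem polar_X (i j : ι) (p : ι × κ) :
    polar k i j (X p) = if p.1 = j then X (i, p.2) else 0 := by
  classical
  rw [polar_apply]
  simp only [pderiv_X, Pi.single_apply]
  by_cases h : p.1 = j
  · rw [if_pos h, Finset.sum_eq_single p.2]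
    · rw [if_pos (by rw [← h]), mul_one]
    · intro b _ hb
      rw [if_neg (by rintro rfl; exact hb rfl), mul_zero]
    · simp
  · rw [if_neg h]
    exact Finset.sum_eq_zero fun c _ => by rw [if_neg (by rintro rfl; exact h rfl), mul_zero]

/-- The generic transvection adding `T` times row `i` to row `j`. -/
noncomputable def transv (k : Type) [Field k] {ι κ : Type} [DecidableEq ι] (i j : ι) :
    MvPolynomial (ι × κ) k →ₐ[k] Polynomial (MvPolynomial (ι × κ) k) :=
  aeval fun p => Polynomial.C (X p) +
    if p.1 = j then Polynomial.X * Polynomial.C (X (i, p.2)) else 0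

omit [Fintype κ] in
theorem transv_X (i j : ι) (p : ι × κ) : transv k i j (X p) = Polynomial.C (X p) +
    if p.1 = j then Polynomial.X * Polynomial.C (X (i, p.2)) else 0 := by
  rw [transv, aeval_X]

theorem derivative_transv (i j : ι) (hij : i ≠ j) (f : MvPolynomial (ι × κ) k) :
    Polynomial.derivative (transv k i j f) = transv k i j (polar k i j f) := by
  induction f using MvPolynomial.induction_on with
  | C a =>
    have : transv (κ := κ) k i j (C a) = Polynomial.C (C a) :=
      (transv (κ := κ) k i j).commutes a
    rw [this, Polynomial.derivative_C, derivation_C, map_zero]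
  | add p q hp hq => simp [hp, hq]
  | mul_X p q h =>
    rw [map_mul, Polynomial.derivative_mul, h, Derivation.leibniz, map_add, smul_eq_mul, smul_eq_mul,
      map_mul, map_mul, polar_X, transv_X]
    by_cases e : q.1 = j
    · simp [e, transv_X, hij]; ring
    · simp [e]; ring

theorem transv_eval_zero (i j : ι) (f : MvPolynomial (ι × κ) k) :
    (transv k i j f).eval 0 = f := by
  induction f using MvPolynomial.induction_on with
  | C a =>
    have : transv (κ := κ) k i j (C a) = Polynomial.C (C a) :=
      (transv (κ := κ) k i j).commutes a
    rw [this, Polynomial.eval_C]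
  | add p q hp hq => simp [hp, hq]
  | mul_X p q h =>
    rw [map_mul, Polynomial.eval_mul, h, transv_X]
    split <;> simp

theorem transv_eq_C_iff [CharZero k] (i j : ι) (hij : i ≠ j) (f : MvPolynomial (ι × κ) k) :
    transv k i j f = Polynomial.C f ↔ polar k i j f = 0 := by
  constructor
  · intro h
    rw [← transv_eval_zero i j (polar k i j f), ← derivative_transv i j hij, h]
    simp
  · intro h
    have h1 := derivative_transv i j hij f
    rw [h, map_zero] at h1
    have h2 := Polynomial.eq_C_of_derivative_eq_zero h1
    have h3 := transv_eval_zero i j f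
    rw [h2, Polynomial.eval_C] at h3
    rw [h2, h3]

theorem polar_det [CharZero k] [Fintype ι] (c : ι → κ) (i j : ι) (hij : i ≠ j) :
    polar k i j (Matrix.det (Matrix.of fun a b => X (a, c b))) = 0 := by
  rw [← transv_eq_C_iff i j hij, ← AlgHom.coe_toRingHom, RingHom.map_det, RingHom.map_det]
  refine Eq.trans ?_ (Matrix.det_updateRow_add_smul_self _ hij.symm Polynomial.X)
  congr 1
  refine Matrix.ext fun a b => ?_
  by_cases h : a = j
  · subst h
    simp [transv_X]
  · simp [transv_X, h]

theorem aeval_row_add [CharZero k] {K : Type} [CommRing K] [Algebra k K] (i j : ι) (hij : i ≠ j)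
    (f : MvPolynomial (ι × κ) k) (hf : polar k i j f = 0) (x : ι → κ → K) (c : K) :
    aeval (fun p : ι × κ => Function.update x j (x j + c • x i) p.1 p.2) f =
      aeval (fun p : ι × κ => x p.1 p.2) f := by
  have h := (transv_eq_C_iff i j hij f).2 hf
  have key : ∀ g : MvPolynomial (ι × κ) k,
      aeval (fun p : ι × κ => Function.update x j (x j + c • x i) p.1 p.2) g =
      Polynomial.eval₂ (aeval (fun p : ι × κ => x p.1 p.2) : _ →ₐ[k] K).toRingHom c
        (transv k i j g) := by
    intro g
    induction g using MvPolynomial.induction_on with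
    | C a =>
      have : transv (κ := κ) k i j (C a) = Polynomial.C (C a) :=
        (transv (κ := κ) k i j).commutes a
      rw [this, Polynomial.eval₂_C]
      simp
    | add p q hp hq => rw [map_add, map_add, Polynomial.eval₂_add, hp, hq]
    | mul_X p q hh =>
      rw [map_mul, map_mul, Polynomial.eval₂_mul, hh, transv_X]
      congr 1
      obtain ⟨a, b⟩ := q
      by_cases e : a = j
      · subst e
        rw [aeval_X, if_pos rfl, Polynomial.eval₂_add, Polynomial.eval₂_mul, Polynomial.eval₂_X,
          Polynomial.eval₂_C, Polynomial.eval₂_C, Function.update_self]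
        simp
      · simp [e]
  rw [key, h, Polynomial.eval₂_C]
  rfl

theorem polar_diag_eq (f : MvPolynomial (ι × κ) k) (i j : ι) (hij : i ≠ j)
    (h1 : polar k i j f = 0) (h2 : polar k j i f = 0) : polar k i i f = polar k j j f := by
  have : ⁅polar (κ := κ) k i j, polar (κ := κ) k j i⁆ =
      polar (κ := κ) k i i - polar (κ := κ) k j j := by
    refine derivation_ext fun p => ?_
    rw [Derivation.commutator_apply, Derivation.sub_apply]
    simp only [polar_X]
    by_cases e1 : p.1 = i
    · have : p.1 ≠ j := fun e => hij (e1 ▸ e)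
      simp [e1, hij, polar_X]
    · by_cases e2 : p.1 = j
      · simp [e2, hij.symm, polar_X]
      · simp [e1, e2]
  have := congrArg (fun D => D f) this
  simp only [Derivation.commutator_apply, h1, h2, map_zero, Derivation.sub_apply, sub_zero] at this
  exact (sub_eq_zero.1 this.symm)

variable [Fintype ι]

omit [DecidableEq ι] in
theorem sum_polar_diag {n : ℕ} (f : MvPolynomial (ι × κ) k) (hf : f.IsHomogeneous n) :
    ∑ i, polar k i i f = n • f := by
  rw [← hf.sum_X_mul_pderiv, Fintype.sum_prod_type]
  exact Finset.sum_congr rfl fun i _ => polar_apply _ _ _ _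

theorem aeval_eq_zero_of_vecMul_eq_zero [CharZero k] {K : Type} [Field K] [Algebra k K]
    (f : MvPolynomial (ι × κ) k) (hf : casimir k f = 0) {n : ℕ} (hn : 0 < n)
    (hfn : f.IsHomogeneous n) (x : Matrix ι κ K) (v : ι → K) (hv : v ≠ 0)
    (hvx : Matrix.vecMul v x = 0) : aeval (fun p : ι × κ => x p.1 p.2) f = 0 := by
  have hE := fun i j hij => polar_eq_zero_of_casimir_sq f (by rw [hf, map_zero]) i j hij
  obtain ⟨j, hj⟩ := Function.ne_iff.1 hv
  have hj : v j ≠ 0 := hj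
  -- reduce row `j` to zero
  have step : ∀ s : Finset ι, j ∉ s → ∀ x : ι → κ → K,
      aeval (fun p : ι × κ => Function.update x j
        (x j + ∑ i ∈ s, ((v j)⁻¹ * v i) • x i) p.1 p.2) f =
      aeval (fun p : ι × κ => x p.1 p.2) f := by
    intro s
    induction s using Finset.induction with
    | empty => intro _ x; simp
    | insert a s ha ih =>
      intro hjs x
      have hja : a ≠ j := fun e => hjs (e ▸ Finset.mem_insert_self _ _)
      have h1 := aeval_row_add a j hja f (hE _ _ hja) (Function.update x j
        (x j + ∑ i ∈ s, ((v j)⁻¹ * v i) • x i)) ((v j)⁻¹ * v a)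
      rw [Function.update_idem, Function.update_self, Function.update_of_ne hja, add_assoc,
        add_comm (∑ i ∈ s, _), ← Finset.sum_insert (f := fun i => ((v j)⁻¹ * v i) • x i) ha,
        ih (fun h => hjs (Finset.mem_insert_of_mem h))] at h1
      exact h1
  have h0 : x j + ∑ i ∈ Finset.univ.erase j, ((v j)⁻¹ * v i) • x i = 0 := by
    have : (v j)⁻¹ • Matrix.vecMul v x = 0 := by rw [hvx, smul_zero]
    rw [Matrix.vecMul_eq_sum, Finset.smul_sum, ← Finset.add_sum_erase _ _ (Finset.mem_univ j),
      smul_smul, inv_mul_cancel₀ hj, one_smul] at this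
    rw [← this]
    simp only [smul_smul]
  rw [← step (Finset.univ.erase j) (Finset.notMem_erase _ _) x, h0]
  have hd : polar k j j f = ((n : k) / Fintype.card ι) • f := by
    have h1 := sum_polar_diag f hfn
    have h2 : ∀ i ∈ Finset.univ, polar k i i f = polar k j j f := fun i _ => by
      by_cases e : i = j
      · rw [e]
      · exact polar_diag_eq f i j e (hE _ _ e) (hE _ _ (Ne.symm e))
    rw [Finset.sum_congr rfl h2, Finset.sum_const, Finset.card_univ] at h1
    have hc : (Fintype.card ι : k) ≠ 0 := Nat.cast_ne_zero.2 
      (@Fintype.card_ne_zero _ _ ⟨j⟩)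
    rw [← Nat.cast_smul_eq_nsmul k, ← Nat.cast_smul_eq_nsmul k] at h1
    rw [div_eq_inv_mul, mul_smul, ← h1, smul_smul, inv_mul_cancel₀ hc, one_smul]
  have hc : (n : k) / Fintype.card ι ≠ 0 := div_ne_zero (Nat.cast_ne_zero.2 hn.ne')
    (Nat.cast_ne_zero.2 (@Fintype.card_ne_zero _ _ ⟨j⟩))
  have h3 : aeval (fun p : ι × κ => Function.update x j 0 p.1 p.2) (polar k j j f) = 0 := by
    rw [polar_apply, map_sum]
    refine Finset.sum_eq_zero fun c _ => ?_
    rw [map_mul, aeval_X, show Function.update x j 0 (j, c).1 (j, c).2 = 0 from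
      congrFun (Function.update_self j 0 x) c, zero_mul]
  rw [hd, map_smul] at h3
  exact (smul_eq_zero.1 h3).resolve_left hc

end

/-- Over a field the maximal minors all vanish iff the rows are dependent. -/
theorem exists_vecMul_of_minors_eq_zero {K : Type} [Field K] {r s : ℕ} (x : Matrix (Fin r) (Fin s) K)
    (h : ∀ c : Fin r ↪ Fin s, (x.submatrix id c).det = 0) :
    ∃ v ≠ 0, Matrix.vecMul v x = 0 := by
  by_contra hne
  push Not at hne
  have li : LinearIndependent K x.row := by
    rw [← Matrix.vecMul_injective_iff]
    intro v w hvw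
    by_contra hvw'
    refine hne (v - w) (sub_ne_zero.2 hvw') ?_
    rw [Matrix.sub_vecMul, sub_eq_zero]
    exact hvw
  have hr := li.rank_matrix
  rw [Matrix.rank_eq_finrank_span_cols, Fintype.card_fin] at hr
  have := Submodule.exists_fun_fin_finrank_span_eq K (Set.range x.col)
  rw [hr] at this
  obtain ⟨f, hf, -, hli⟩ := this
  choose c hc using hf
  have hinj : Function.Injective c := fun a b hab => hli.injective (by rw [← hc, ← hc, hab])
  have h1 := h ⟨c, hinj⟩
  have h2 : (x.submatrix id c).col = f := funext fun i => by rw [← hc]; rfl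
  rw [← h2, Matrix.linearIndependent_cols_iff_isUnit, Matrix.isUnit_iff_isUnit_det] at hli
  exact hli.ne_zero h1

theorem minor_eq_zero_of_vecMul {K : Type} [Field K] {r s : ℕ} (x : Matrix (Fin r) (Fin s) K)
    (v : Fin r → K) (hv : v ≠ 0) (h : Matrix.vecMul v x = 0) (c : Fin r → Fin s) :
    (x.submatrix id c).det = 0 := by
  rw [← Matrix.exists_vecMul_eq_zero_iff]
  refine ⟨v, hv, funext fun j => ?_⟩
  exact congrFun h (c j)

end

section

open MvPolynomial

section
variable {r s : ℕ}

/-- The excess of an increasing sequence of columns over the initial one. -/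
def colWeight (c : Fin r ↪o Fin s) : ℕ := ∑ i, ((c i : ℕ) - i)

theorem le_orderEmb (c : Fin r ↪o Fin s) (i : Fin r) : (i : ℕ) ≤ c i := by
  obtain ⟨i, hi⟩ := i
  induction i with
  | zero => exact Nat.zero_le _
  | succ n ih =>
    have h1 := ih (by omega)
    have h2 : c ⟨n, by omega⟩ < c ⟨n + 1, hi⟩ := c.strictMono (by simp [Fin.lt_def])
    rw [Fin.lt_def] at h2
    simp only at h1 ⊢
    omega

theorem orderEmb_le (c : Fin r ↪o Fin s) (i : Fin r) : (c i : ℕ) - i ≤ s - r := by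
  have key : ∀ n (h : n < r), (c ⟨r - 1 - n, by omega⟩ : ℕ) + 1 + n ≤ s := by
    intro n
    induction n with
    | zero => intro h; have := (c ⟨r - 1 - 0, by omega⟩).2; omega
    | succ n ih =>
      intro h
      have h1 := ih (by omega)
      have h2 : c ⟨r - 1 - (n + 1), by omega⟩ < c ⟨r - 1 - n, by omega⟩ :=
        c.strictMono (by simp only [Fin.lt_def]; omega)
      rw [Fin.lt_def] at h2
      omega
  have h := key (r - 1 - i) (by have := i.2; omega)
  have hi : (⟨r - 1 - (r - 1 - i), by have := i.2; omega⟩ : Fin r) = i := by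
    ext; simp only; have := i.2; omega
  rw [hi] at h
  have := i.2
  omega

theorem colWeight_le (c : Fin r ↪o Fin s) : colWeight c ≤ r * (s - r) := by
  refine (Finset.sum_le_sum fun i _ => orderEmb_le c i).trans ?_
  simp

theorem colWeight_add (c : Fin r ↪o Fin s) :
    colWeight c + ∑ i : Fin r, (i : ℕ) = ∑ i, (c i : ℕ) := by
  rw [colWeight, ← Finset.sum_add_distrib]
  exact Finset.sum_congr rfl fun i _ => Nat.sub_add_cancel (le_orderEmb c i)

/-- The sum of the maximal minors of a given weight. -/
noncomputable def weightMinor {T : Type*} [CommRing T] (M : Matrix (Fin r) (Fin s) T) (l : ℕ) : T :=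
  ∑ c : Fin r ↪o Fin s with colWeight c = l, (M.submatrix id c).det

theorem map_weightMinor {T T' : Type*} [CommRing T] [CommRing T'] (f : T →+* T')
    (M : Matrix (Fin r) (Fin s) T) (l : ℕ) :
    f (weightMinor M l) = weightMinor (M.map f) l := by
  rw [weightMinor, weightMinor, map_sum]
  refine Finset.sum_congr rfl fun c _ => ?_
  rw [RingHom.map_det]
  rfl

theorem weightMinor_mem {T : Type} [CommRing T] (M : Matrix (Fin r) (Fin s) T) (l : ℕ) :
    weightMinor M l ∈ minorsIdeal M r :=
  sum_mem fun c _ => Ideal.subset_span ⟨(Function.Embedding.refl _, c.toEmbedding), rfl⟩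

theorem image_subset_of_minimal {K : Type} [Field K] (x : Matrix (Fin r) (Fin s) K)
    (c c' : Fin r → Fin s) (hc : (x.submatrix id c).det ≠ 0) (hc' : (x.submatrix id c').det ≠ 0)
    (hmin : ∀ e : Fin r → Fin s, (x.submatrix id e).det ≠ 0 → ∑ i, (c i : ℕ) ≤ ∑ i, (e i : ℕ))
    (m : Fin s) (hm : m ∈ Set.range c') (hm' : m ∉ Set.range c)
    (hlow : ∀ y ∈ Set.range c, y < m → y ∈ Set.range c') : False := by
  classical
  obtain ⟨j, rfl⟩ := hm
  have hu : IsUnit (x.submatrix id c).det := isUnit_iff_ne_zero.2 hc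
  set a : Fin r → K := (x.submatrix id c)⁻¹.mulVec (fun i => x i (c' j)) with ha
  have hxa : ∀ k, x k (c' j) = ∑ i, a i • x k (c i) := by
    intro k
    have := congrFun (Matrix.mulVec_mulVec (fun i => x i (c' j)) (x.submatrix id c)
      (x.submatrix id c)⁻¹) k
    rw [Matrix.mul_nonsing_inv _ hu, Matrix.one_mulVec, ← ha] at this
    rw [← this]
    simp [Matrix.mulVec, dotProduct, mul_comm]
  by_cases h : ∀ i, c i ∉ Set.range c' → a i = 0
  · have hli : LinearIndependent K (x.submatrix id c').col :=
      Matrix.linearIndependent_cols_of_det_ne_zero hc'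
    refine hli.notMem_span_image (s := {j}ᶜ) (x := j) (by simp) ?_
    have : (x.submatrix id c').col j = ∑ i, a i • (fun k => x k (c i)) := by
      ext k
      rw [Finset.sum_apply]
      exact hxa k
    rw [this]
    refine sum_mem fun i _ => ?_
    by_cases hi : c i ∈ Set.range c'
    · obtain ⟨j', hj'⟩ := hi
      refine Submodule.smul_mem _ _ (Submodule.subset_span ⟨j', ?_, ?_⟩)
      · rintro rfl
        exact hm' ⟨i, hj'.symm⟩
      · ext k
        simp [Matrix.col, hj']
    · rw [h i hi, zero_smul]
      exact zero_mem _
  · push Not at h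
    obtain ⟨i, hi, hai⟩ := h
    have hlt : c' j < c i := by
      rcases lt_trichotomy (c i) (c' j) with h | h | h
      · exact absurd (hlow _ ⟨i, rfl⟩ h) hi
      · exact absurd ⟨j, h.symm⟩ hi
      · exact h
    have hdet : (x.submatrix id (Function.update c i (c' j))).det ≠ 0 := by
      have h1 : x.submatrix id (Function.update c i (c' j)) =
          (x.submatrix id c).updateCol i fun k => ∑ i, a i • (x.submatrix id c) k i := by
        ext k l
        rw [Matrix.updateCol_apply, Matrix.submatrix_apply, Function.update_apply]
        split_ifs with hl
        · rw [id, hxa]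
          rfl
        · rfl
      rw [h1, Matrix.det_updateCol_sum]
      exact smul_ne_zero hai hc
    have := hmin _ hdet
    refine absurd this (not_le.2 ?_)
    refine Finset.sum_lt_sum (fun l _ => ?_) ⟨i, Finset.mem_univ _, ?_⟩
    · rw [Function.update_apply]
      split_ifs with hl
      · subst hl
        exact hlt.le
      · exact le_rfl
    · rw [Function.update_self]
      exact hlt

theorem range_eq_of_minimal {K : Type} [Field K] (x : Matrix (Fin r) (Fin s) K)
    (c c' : Fin r → Fin s) (hc : (x.submatrix id c).det ≠ 0) (hc' : (x.submatrix id c').det ≠ 0)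
    (hmin : ∀ e : Fin r → Fin s, (x.submatrix id e).det ≠ 0 → ∑ i, (c i : ℕ) ≤ ∑ i, (e i : ℕ))
    (heq : ∑ i, (c i : ℕ) = ∑ i, (c' i : ℕ)) : Set.range c = Set.range c' := by
  classical
  by_contra hne
  have h1 : ∃ m, m ∈ Set.range c ∧ m ∉ Set.range c' ∨ m ∉ Set.range c ∧ m ∈ Set.range c' := by
    by_contra h
    push Not at h
    exact hne (Set.ext fun m => ⟨fun hm => (h m).1 hm, fun hm => by
      by_contra h'
      exact (h m).2 h' hm⟩)
  let S : Finset (Fin s) := {m | m ∈ Set.range c ∧ m ∉ Set.range c' ∨ m ∉ Set.range c ∧ m ∈ Set.range c'}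
  obtain ⟨m, hm⟩ := h1
  have hS : S.Nonempty := ⟨m, by simpa [S] using hm⟩
  have hmem := S.min'_mem hS
  have hlow : ∀ y, y < S.min' hS → y ∉ S := fun y hy hyS =>
    absurd (S.min'_le y hyS) (not_le.2 hy)
  generalize S.min' hS = m at hmem hlow
  simp only [S, Finset.mem_filter, Finset.mem_univ, true_and] at hmem hlow
  rcases hmem with ⟨h, h'⟩ | ⟨h, h'⟩
  · refine image_subset_of_minimal x c' c hc' hc (heq ▸ hmin) m h h' fun y hy hlt => ?_
    have := hlow y hlt
    tauto
  · refine image_subset_of_minimal x c c' hc hc' hmin m h' h fun y hy hlt => ?_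
    have := hlow y hlt
    tauto

theorem det_eq_zero_of_weightMinor {K : Type} [Field K] (x : Matrix (Fin r) (Fin s) K)
    (h : ∀ l ≤ r * (s - r), weightMinor x l = 0) (c : Fin r → Fin s) :
    (x.submatrix id c).det = 0 := by
  classical
  by_contra hc
  obtain ⟨c₀, hc₀, hmin₀⟩ := Finset.exists_min_image
    {c : Fin r → Fin s | (x.submatrix id c).det ≠ 0} (fun c => ∑ i, (c i : ℕ)) ⟨c, by simpa using hc⟩
  have hc₀ : (x.submatrix id c₀).det ≠ 0 := by simpa using hc₀
  have hmin₀ : ∀ e : Fin r → Fin s, (x.submatrix id e).det ≠ 0 →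
      ∑ i, (c₀ i : ℕ) ≤ ∑ i, (e i : ℕ) := fun e he => hmin₀ e (by simpa using he)
  have hinj : Function.Injective c₀ := by
    have hli : LinearIndependent K (x.submatrix id c₀).col :=
      Matrix.linearIndependent_cols_of_det_ne_zero hc₀
    intro i j hij
    refine hli.injective (funext fun k => ?_)
    simp [Matrix.col, hij]
  have hmono : StrictMono (c₀ ∘ Tuple.sort c₀) :=
    (Tuple.monotone_sort c₀).strictMono_of_injective (hinj.comp (Tuple.sort c₀).injective)
  let e₀ : Fin r ↪o Fin s := OrderEmbedding.ofStrictMono _ hmono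
  have he₀ : (x.submatrix id e₀).det ≠ 0 := by
    have : x.submatrix id e₀ = (x.submatrix id c₀).submatrix id (Tuple.sort c₀) := rfl
    rw [this, Matrix.det_permute']
    exact mul_ne_zero (by
      rcases Int.units_eq_one_or (Equiv.Perm.sign (Tuple.sort c₀)) with h | h <;> simp [h]) hc₀
  have hsum : ∑ i, (e₀ i : ℕ) = ∑ i, (c₀ i : ℕ) :=
    Equiv.sum_comp (Tuple.sort c₀) fun i => (c₀ i : ℕ)
  refine he₀ ?_
  have h0 := h _ (colWeight_le e₀)
  rw [weightMinor, Finset.sum_eq_single e₀] at h0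
  · exact h0
  · intro e he hne
    by_contra hde
    refine hne (OrderEmbedding.range_inj.1 ?_)
    refine (range_eq_of_minimal x e₀ e he₀ hde (fun e' he' => hsum ▸ hmin₀ e' he') ?_).symm
    rw [← colWeight_add, ← colWeight_add, (Finset.mem_filter.1 he).2]
  · intro h
    simp at h

/-- The minors ideal is contained in a prime ideal exactly if the rows of the matrix become
linearly dependent at that prime. -/
theorem minorsIdeal_le_iff {T : Type} [CommRing T] (M : Matrix (Fin r) (Fin s) T)
    (Q : Ideal T) : minorsIdeal M r ≤ Q ↔
      ∀ c : Fin r → Fin s, ((M.map (Ideal.Quotient.mk Q)).submatrix id c).det = 0 := by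
  have key : ∀ c : Fin r → Fin s, ((M.map (Ideal.Quotient.mk Q)).submatrix id c).det = 0 ↔
      (M.submatrix id c).det ∈ Q := fun c => by
    rw [← Ideal.Quotient.eq_zero_iff_mem, RingHom.map_det]
    rfl
  simp only [key]
  rw [minorsIdeal, Ideal.span_le]
  constructor
  · intro h c
    by_cases hc : Function.Injective c
    · exact h ⟨(Function.Embedding.refl _, ⟨c, hc⟩), rfl⟩
    · rw [Function.Injective] at hc
      push Not at hc
      obtain ⟨i, j, hij, hne⟩ := hc
      rw [Matrix.det_zero_of_column_eq hne fun k => by simp [hij]]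
      exact zero_mem _
  · rintro h _ ⟨⟨σ, c⟩, rfl⟩
    have hσ : Function.Bijective σ := Finite.injective_iff_bijective.1 σ.injective
    have : M.submatrix σ c = (M.submatrix id c).submatrix (Equiv.ofBijective _ hσ) id := rfl
    simp only [SetLike.mem_coe, this]
    rw [Matrix.det_permute]
    exact Q.mul_mem_left _ (h c)

theorem radical_weightMinor {T : Type} [CommRing T] (M : Matrix (Fin r) (Fin s) T) :
    (Ideal.span {f | f ∈ List.ofFn fun l : Fin (r * (s - r) + 1) => weightMinor M l}).radical =
      (minorsIdeal M r).radical := by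
  refine le_antisymm (Ideal.radical_mono (Ideal.span_le.2 ?_)) ?_
  · intro f hf
    obtain ⟨l, rfl⟩ := List.mem_ofFn.1 hf
    exact weightMinor_mem M l
  · rw [Ideal.radical_eq_sInf (Ideal.span _)]
    refine le_sInf fun Q ⟨hQ, hprime⟩ => ?_
    rw [hprime.radical_le_iff, minorsIdeal_le_iff]
    intro c
    let K := FractionRing (T ⧸ Q)
    refine IsFractionRing.injective (T ⧸ Q) K ?_
    rw [RingHom.map_det, map_zero]
    refine det_eq_zero_of_weightMinor
      ((M.map (Ideal.Quotient.mk Q)).map (algebraMap (T ⧸ Q) K)) (fun l hl => ?_) c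
    rw [← map_weightMinor, ← map_weightMinor, Ideal.Quotient.eq_zero_iff_mem.2, map_zero]
    exact hQ (Ideal.subset_span (List.mem_ofFn.2 ⟨⟨l, Nat.lt_succ_of_le hl⟩, rfl⟩))

end

end

section

open MvPolynomial

theorem homogeneousComponent_mul_of_isHomogeneous {σ k : Type} [CommRing k]
    {g : MvPolynomial σ k} {e : ℕ} (hg : g.IsHomogeneous e) (h : MvPolynomial σ k) (n : ℕ) :
    homogeneousComponent n (g * h) =
      if e ≤ n then g * homogeneousComponent (n - e) h else 0 := by
  let _ := MvPolynomial.gradedAlgebra (σ := σ) (R := k)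
  have := DirectSum.coe_decompose_mul_of_left_mem (𝒜 := homogeneousSubmodule σ k) (b := h) n
    ((mem_homogeneousSubmodule _ _).2 hg)
  have h1 : ∀ (f : MvPolynomial σ k) (m : ℕ),
      (DirectSum.decompose (homogeneousSubmodule σ k) f m : MvPolynomial σ k) =
        homogeneousComponent m f := fun f m => decomposition.decompose'_apply f m
  rw [h1, h1] at this
  exact this

section
variable {k ι κ : Type} [Field k] [CharZero k] [Fintype ι] [DecidableEq ι] [Fintype κ]

omit [CharZero k] in
theorem casimir_C (a : k) : casimir (κ := κ) (ι := ι) k (C a) = 0 := by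
  rw [casimir_apply]
  refine Finset.sum_eq_zero fun p _ => ?_
  have : polar (κ := κ) k p.1 p.2 (C a) = 0 := Derivation.map_algebraMap _ a
  rw [this, map_zero]

variable (k ι κ) in
/-- The algebra of elements annihilated by the Casimir operator. -/
noncomputable def casimirAlgebra : Subalgebra k (MvPolynomial (ι × κ) k) where
  carrier := {f | casimir k f = 0}
  mul_mem' {a b} ha hb := by
    change casimir k (a * b) = 0
    rw [casimir_mul a b ha, show casimir k b = 0 from hb, mul_zero]
  add_mem' {a b} ha hb := by
    change casimir k (a + b) = 0
    rw [map_add, show casimir k a = 0 from ha, show casimir k b = 0 from hb, add_zero]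
  algebraMap_mem' a := casimir_C a

/-- Membership of an invariant in an ideal generated by invariants is witnessed by invariants of
the right degree. -/
theorem exists_invariant_coeffs {α : Type} [Fintype α] (g : α → MvPolynomial (ι × κ) k)
    (e : α → ℕ) (hg : ∀ i, (g i).IsHomogeneous (e i)) (hgc : ∀ i, casimir k (g i) = 0)
    {n : ℕ} (f : MvPolynomial (ι × κ) k) (hf : f.IsHomogeneous n) (hfc : casimir k f = 0)
    (hmem : f ∈ Ideal.span (Set.range g)) :
    ∃ h : α → MvPolynomial (ι × κ) k, (∀ i, (h i).IsHomogeneous (n - e i)) ∧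
      (∀ i, casimir k (h i) = 0) ∧ (∀ i, n < e i → h i = 0) ∧ f = ∑ i, g i * h i := by
  obtain ⟨ρ, τ, h1, h2, h3, h4, h5⟩ := exists_reynolds k ι κ
  obtain ⟨c, rfl⟩ := (Ideal.mem_span_range_iff_exists_fun).1 hmem
  refine ⟨fun i => if e i ≤ n then homogeneousComponent (n - e i) (ρ (c i)) else 0,
    fun i => ?_, fun i => ?_, fun i hi => if_neg (not_le.2 hi), ?_⟩
  · dsimp only
    split_ifs
    · exact homogeneousComponent_isHomogeneous _ _
    · exact isHomogeneous_zero _ _ _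
  · dsimp only
    split_ifs
    · rw [← homogeneousComponent_casimir, h1, map_zero]
    · exact map_zero _
  · set f := ∑ i, c i * g i with hfdef
    have hfρ : f = ρ f := by
      conv_lhs => rw [h3 f, hfc, map_zero, add_zero]
    have hfn : homogeneousComponent n f = f := by
      rw [homogeneousComponent_of_mem hf, if_pos rfl]
    rw [← hfn]
    conv_lhs => rw [hfρ, hfdef]
    rw [map_sum, map_sum]
    refine Finset.sum_congr rfl fun i _ => ?_
    rw [mul_comm, (h5 _ (hgc i) _).1, homogeneousComponent_mul_of_isHomogeneous (hg i)]
    split_ifs with h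
    · exact (congrArg _ (if_pos h)).symm
    · exact ((congrArg _ (if_neg h)).trans (mul_zero _)).symm

/-- The ring of invariants is finite over the subalgebra generated by homogeneous invariants
cutting out the nullcone. -/
theorem exists_generators_over {d r : ℕ} (hr : 0 < r) (p : Fin d → MvPolynomial (ι × κ) k)
    (hp : ∀ l, (p l).IsHomogeneous r) (hpc : ∀ l, casimir k (p l) = 0)
    (hnull : ∀ n > 0, ∀ f : MvPolynomial (ι × κ) k, f.IsHomogeneous n → casimir k f = 0 →
      f ∈ (Ideal.span (Set.range p)).radical) :
    ∃ (m : ℕ) (a : Fin m → MvPolynomial (ι × κ) k), (∀ j, casimir k (a j) = 0) ∧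
      ∀ f, casimir k f = 0 → ∃ q : Fin m → MvPolynomial (Fin d) k,
        f = ∑ j, aeval p (q j) * a j := by
  classical
  set S : Set (MvPolynomial (ι × κ) k) := {f | ∃ n > 0, f.IsHomogeneous n ∧ casimir k f = 0}
    with hS
  obtain ⟨G, hGS, hG⟩ := (Submodule.fg_span_iff_fg_span_finset_subset S).1
    (IsNoetherian.noetherian (Ideal.span S))
  have hGS' : ∀ g : G, ∃ n > 0, (g : MvPolynomial (ι × κ) k).IsHomogeneous n ∧
    casimir k (g : MvPolynomial (ι × κ) k) = 0 := fun g => hGS g.2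
  choose e he heg hec using hGS'
  have hG' : Ideal.span S = Ideal.span (Set.range fun g : G => (g : MvPolynomial (ι × κ) k)) := by
    rw [show Set.range (fun g : G => (g : MvPolynomial (ι × κ) k)) = ↑G from Subtype.range_coe]
    exact hG
  obtain ⟨D, hD⟩ : ∃ D, ∀ g, e g ≤ D :=
    ⟨∑ g, e g, fun g => Finset.single_le_sum (fun _ _ => Nat.zero_le _) (Finset.mem_univ g)⟩
  have hrad : Ideal.span S ≤ (Ideal.span (Set.range p)).radical :=
    Ideal.span_le.2 fun f ⟨n, hn, hf, hfc⟩ => hnull n hn f hf hfc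
  obtain ⟨N, hN⟩ := Ideal.exists_pow_le_of_le_radical_of_fg hrad
    (IsNoetherian.noetherian (Ideal.span S))
  have hpow : ∀ N n : ℕ, N * D < n → ∀ f : MvPolynomial (ι × κ) k, f.IsHomogeneous n →
      casimir k f = 0 → f ∈ Ideal.span S ^ N := by
    intro N
    induction N with
    | zero => intro n _ f _ _; simp
    | succ N ih =>
      intro n hn f hf hfc
      have hfS : f ∈ Ideal.span S := Ideal.subset_span ⟨n, by omega, hf, hfc⟩
      obtain ⟨h, hh, hhc, -, rfl⟩ := exists_invariant_coeffs _ e heg hec f hf hfc (hG' ▸ hfS)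
      refine sum_mem fun g _ => ?_
      rw [pow_succ']
      refine Ideal.mul_mem_mul (Ideal.subset_span ⟨e g, he g, heg g, hec g⟩)
        (ih (n - e g) ?_ _ (hh g) (hhc g))
      have := hD g
      rw [Nat.succ_mul] at hn
      omega
  have hfin : (⨆ n ∈ Finset.range (N * D + 1),
      homogeneousSubmodule (ι × κ) k n ⊓ LinearMap.ker (casimir (ι := ι) (κ := κ) k)).FG := by
    refine Submodule.fg_biSup _ _ fun n _ => ?_
    have : Module.Finite k (homogeneousSubmodule (ι × κ) k n) :=
      Module.Finite.iff_fg.2 (homogeneousSubmodule_fg _ _ n)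
    have : Module.Finite k ↥(homogeneousSubmodule (ι × κ) k n ⊓
      LinearMap.ker (casimir (ι := ι) (κ := κ) k)) := Submodule.finiteDimensional_inf_left _ _
    exact Module.Finite.iff_fg.1 this
  obtain ⟨m, a, ha⟩ := Submodule.fg_iff_exists_fin_generating_family.1 hfin
  have hac : ∀ j, casimir k (a j) = 0 := by
    intro j
    have h1 : a j ∈ Submodule.span k (Set.range a) := Submodule.subset_span ⟨j, rfl⟩
    rw [ha] at h1
    have h2 : (⨆ n ∈ Finset.range (N * D + 1), homogeneousSubmodule (ι × κ) k n ⊓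
        LinearMap.ker (casimir (ι := ι) (κ := κ) k)) ≤
        LinearMap.ker (casimir (ι := ι) (κ := κ) k) := iSup₂_le fun _ _ => inf_le_right
    exact h2 h1
  have hadd : ∀ {α : Type} (s : Finset α) (f : α → MvPolynomial (ι × κ) k),
      (∀ i ∈ s, ∃ q : Fin m → MvPolynomial (Fin d) k, f i = ∑ j, aeval p (q j) * a j) →
      ∃ q : Fin m → MvPolynomial (Fin d) k, ∑ i ∈ s, f i = ∑ j, aeval p (q j) * a j := by
    intro α s f h
    choose! q hq using h
    refine ⟨fun j => ∑ i ∈ s, q i j, ?_⟩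
    simp only [map_sum, Finset.sum_mul]
    rw [Finset.sum_comm]
    exact Finset.sum_congr rfl fun i hi => hq i hi
  have hmain : ∀ n, ∀ f : MvPolynomial (ι × κ) k, f.IsHomogeneous n → casimir k f = 0 →
      ∃ q : Fin m → MvPolynomial (Fin d) k, f = ∑ j, aeval p (q j) * a j := by
    intro n
    induction n using Nat.strong_induction_on with
    | _ n ih =>
      intro f hf hfc
      by_cases hn : n < N * D + 1
      · have h1 : f ∈ Submodule.span k (Set.range a) := by
          rw [ha]
          exact Submodule.mem_iSup_of_mem n (Submodule.mem_iSup_of_mem (Finset.mem_range.2 hn)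
            ⟨hf, hfc⟩)
        obtain ⟨c, rfl⟩ := (Submodule.mem_span_range_iff_exists_fun k).1 h1
        refine ⟨fun j => C (c j), Finset.sum_congr rfl fun j _ => ?_⟩
        rw [smul_eq_C_mul, ← algebraMap_eq, ← algebraMap_eq, AlgHom.commutes]
      · have h1 : f ∈ Ideal.span (Set.range p) := hN (hpow N n (by omega) f hf hfc)
        obtain ⟨h, hh, hhc, h0, rfl⟩ := exists_invariant_coeffs p (fun _ => r) hp hpc f hf hfc h1
        refine hadd _ _ fun l _ => ?_
        by_cases hl : n < r
        · exact ⟨fun _ => 0, by simp [h0 l hl]⟩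
        · obtain ⟨q, hq⟩ := ih (n - r) (by omega) (h l) (hh l) (hhc l)
          refine ⟨fun j => X l * q j, ?_⟩
          rw [hq, Finset.mul_sum]
          refine Finset.sum_congr rfl fun j _ => ?_
          rw [map_mul, aeval_X, mul_assoc]
  refine ⟨m, a, hac, fun f hf => ?_⟩
  rw [← sum_homogeneousComponent f]
  refine hadd _ _ fun n _ => hmain n _ (homogeneousComponent_isHomogeneous n f) ?_
  rw [← homogeneousComponent_casimir, hf, map_zero]

end

end

section

open MvPolynomial

section
variable {k : Type} [Field k] {r s : ℕ}

/-- The specialization of the generic matrix to `(z • 1 | Y)`. -/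
noncomputable def blockSpec (k : Type) [Field k] (r s : ℕ) :
    MvPolynomial (Fin r × Fin s) k →ₐ[k] MvPolynomial (Option (Fin r × Fin (s - r))) k :=
  aeval fun p => if h : (p.2 : ℕ) < r then (if (p.1 : ℕ) = p.2 then X none else 0)
    else X (some (p.1, ⟨p.2 - r, by have := p.2.2; omega⟩))

/-- The columns of the minors used to bound the transcendence degree of the invariants. -/
def spotCols (hrs : r ≤ s) : Option (Fin r × Fin (s - r)) → Fin r → Fin s
  | none => Fin.castLE hrs
  | some (i, j) => Function.update (Fin.castLE hrs) i ⟨r + j, by have := j.2; omega⟩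

theorem blockSpec_none (hrs : r ≤ s) :
    blockSpec k r s ((genericMatrix k r s).submatrix id (spotCols hrs none)).det =
      X none ^ r := by
  have : ((genericMatrix k r s).submatrix id (spotCols hrs none)).map (blockSpec k r s) =
      Matrix.scalar (Fin r) (X none) := by
    ext1 a b
    simp [spotCols, blockSpec, Matrix.diagonal_apply, Fin.ext_iff]
  rw [AlgHom.map_det, AlgHom.mapMatrix_apply, this]
  simp

theorem blockSpec_some (hrs : r ≤ s) (i : Fin r) (j : Fin (s - r)) :
    X none * blockSpec k r s ((genericMatrix k r s).submatrix id (spotCols hrs (some (i, j)))).det =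
      X none ^ r * X (some (i, j)) := by
  set A : Matrix (Fin r) (Fin r) (MvPolynomial (Option (Fin r × Fin (s - r))) k) :=
    Matrix.scalar (Fin r) (X none) with hA
  have : ((genericMatrix k r s).submatrix id (spotCols hrs (some (i, j)))).map (blockSpec k r s) =
      A.updateCol i fun a => X (some (a, j)) := by
    ext1 a b
    rw [Matrix.updateCol_apply]
    split_ifs with h
    · subst h
      simp [spotCols, blockSpec]
    · simp [spotCols, blockSpec, Matrix.diagonal_apply, Fin.ext_iff, Function.update_of_ne h, hA]
  rw [AlgHom.map_det, AlgHom.mapMatrix_apply, this, ← Matrix.cramer_apply]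
  have h := congrFun (Matrix.mulVec_cramer A fun a => X (some (a, j))) i
  have hdet : A.det = X none ^ r := by simp [hA]
  rw [hdet, Pi.smul_apply, smul_eq_mul] at h
  rw [← h]
  generalize A.cramer _ = w
  rw [hA, Matrix.scalar_apply, Matrix.mulVec_diagonal]

theorem algebraicIndependent_blockSpec (hr : 0 < r) (hrs : r ≤ s) :
    AlgebraicIndependent k fun o => blockSpec k r s
      ((genericMatrix k r s).submatrix id (spotCols hrs o)).det := by
  set x : Option (Fin r × Fin (s - r)) → MvPolynomial (Option (Fin r × Fin (s - r))) k :=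
    fun o => blockSpec k r s ((genericMatrix k r s).submatrix id (spotCols hrs o)).det with hx
  have hmem : ∀ o, IsAlgebraic (Algebra.adjoin k (Set.range x)) (x o) := fun o =>
    isAlgebraic_algebraMap (A := MvPolynomial (Option (Fin r × Fin (s - r))) k)
      (⟨x o, Algebra.subset_adjoin ⟨o, rfl⟩⟩ : Algebra.adjoin k (Set.range x))
  have hz : IsAlgebraic (Algebra.adjoin k (Set.range x)) (X none :
      MvPolynomial (Option (Fin r × Fin (s - r))) k) := by
    refine IsAlgebraic.of_pow hr ?_
    rw [← blockSpec_none hrs]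
    exact hmem none
  have hX : ∀ o, IsAlgebraic (Algebra.adjoin k (Set.range x)) (X o :
      MvPolynomial (Option (Fin r × Fin (s - r))) k) := by
    rintro (_ | ⟨i, j⟩)
    · exact hz
    · refine IsAlgebraic.of_mul (y := X none ^ r) ?_ (hz.pow r) ?_
      · exact mem_nonZeroDivisors_of_ne_zero (pow_ne_zero _ (X_ne_zero _))
      · rw [← blockSpec_some hrs]
        exact hz.mul (hmem (some (i, j)))
  have : Algebra.IsAlgebraic (Algebra.adjoin k (Set.range x))
      (MvPolynomial (Option (Fin r × Fin (s - r))) k) := by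
    refine ⟨fun f => ?_⟩
    induction f using MvPolynomial.induction_on with
    | C a =>
      exact isAlgebraic_algebraMap (A := MvPolynomial (Option (Fin r × Fin (s - r))) k)
        (algebraMap k (Algebra.adjoin k (Set.range x)) a)
    | add f g hf hg => exact hf.add hg
    | mul_X f i hf => exact hf.mul (hX i)
  refine (Algebra.IsAlgebraic.isTranscendenceBasis_of_le_trdeg_of_finite k x ?_).1
  rw [MvPolynomial.trdeg_of_isDomain, Cardinal.lift_id]

variable (k r s) in
/-- The parameters: weight sums of maximal minors of the generic matrix. -/
noncomputable def params : Fin (r * (s - r) + 1) → MvPolynomial (Fin r × Fin s) k :=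
  fun l => weightMinor (genericMatrix k r s) l

theorem casimir_minor [CharZero k] (c : Fin r → Fin s) :
    casimir k ((genericMatrix k r s).submatrix id c).det = 0 := by
  rw [casimir_apply]
  refine Finset.sum_eq_zero fun p hp => ?_
  have : polar k p.1 p.2 ((genericMatrix k r s).submatrix id c).det = 0 :=
    polar_det c p.1 p.2 (by simpa using hp)
  rw [this, map_zero]

theorem polar_params [CharZero k] (l : Fin (r * (s - r) + 1)) (i j : Fin r) (hij : i ≠ j) :
    polar k i j (params k r s l) = 0 := by
  rw [params, weightMinor, map_sum]
  exact Finset.sum_eq_zero fun c _ => polar_det c i j hij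

theorem casimir_params [CharZero k] (l : Fin (r * (s - r) + 1)) :
    casimir k (params k r s l) = 0 := by
  rw [params, weightMinor, map_sum]
  exact Finset.sum_eq_zero fun c _ => casimir_minor c

theorem isHomogeneous_params (l : Fin (r * (s - r) + 1)) :
    (params k r s l).IsHomogeneous r := by
  rw [params, weightMinor]
  refine IsHomogeneous.sum _ _ _ fun c _ => ?_
  rw [Matrix.det_apply]
  refine IsHomogeneous.sum _ _ _ fun σ _ => ?_
  rw [Units.smul_def, zsmul_eq_mul, ← map_intCast (C (σ := Fin r × Fin s) (R := k)), ← smul_eq_C_mul]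
  refine Submodule.smul_mem (homogeneousSubmodule (Fin r × Fin s) k r) _ ?_
  have := IsHomogeneous.prod (Finset.univ : Finset (Fin r))
    (fun i => (genericMatrix k r s).submatrix id c (σ i) i) (fun _ => 1)
    fun i _ => isHomogeneous_X k (id (σ i), c i)
  simpa using this

theorem mem_radical_params [CharZero k] (n : ℕ) (hn : 0 < n)
    (f : MvPolynomial (Fin r × Fin s) k) (hf : f.IsHomogeneous n) (hfc : casimir k f = 0) :
    f ∈ (Ideal.span (Set.range (params k r s))).radical := by
  have h : (Ideal.span (Set.range (params k r s))).radical =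
      (minorsIdeal (genericMatrix k r s) r).radical := by
    rw [← radical_weightMinor]
    congr 2
    ext f
    exact List.mem_ofFn.symm
  rw [h, Ideal.radical_eq_sInf]
  refine (Ideal.mem_sInf).2 fun Q ⟨hQ, hprime⟩ => ?_
  rw [minorsIdeal_le_iff] at hQ
  let K := FractionRing (MvPolynomial (Fin r × Fin s) k ⧸ Q)
  let x : Matrix (Fin r) (Fin s) K :=
    ((genericMatrix k r s).map (Ideal.Quotient.mk Q)).map (algebraMap _ K)
  obtain ⟨v, hv, hvx⟩ := exists_vecMul_of_minors_eq_zero x fun c => by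
    have := congrArg (algebraMap _ K) (hQ c)
    rw [RingHom.map_det, map_zero] at this
    exact this
  have h0 := aeval_eq_zero_of_vecMul_eq_zero f hfc hn hf x v hv hvx
  have h1 : aeval (fun p : Fin r × Fin s => x p.1 p.2) f =
      algebraMap _ K (Ideal.Quotient.mk Q f) := by
    have : (aeval (fun p : Fin r × Fin s => x p.1 p.2) : _ →ₐ[k] K) =
      ((IsScalarTower.toAlgHom k (MvPolynomial (Fin r × Fin s) k ⧸ Q) K).comp
        (Ideal.Quotient.mkₐ k Q)) := by
      ext p
      rw [aeval_X]
      rfl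
    rw [this]
    rfl
  rw [h1] at h0
  exact Ideal.Quotient.eq_zero_iff_mem.1 (IsFractionRing.injective _ K (h0.trans (map_zero _).symm))

theorem algebraicIndependent_params [CharZero k] (hr : 0 < r) (hrs : r ≤ s) :
    AlgebraicIndependent k (params k r s) := by
  obtain ⟨m, a, hac, ha⟩ := exists_generators_over hr (params k r s) isHomogeneous_params
    casimir_params mem_radical_params
  classical
  let A := casimirAlgebra k (Fin r) (Fin s)
  let p' : Fin (r * (s - r) + 1) → A := fun l => ⟨params k r s l, casimir_params l⟩
  let a' : Fin m → A := fun j => ⟨a j, hac j⟩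
  have hp' : ∀ q : MvPolynomial (Fin (r * (s - r) + 1)) k,
      aeval (params k r s) q = (aeval p' q : A) := by
    intro q
    have : aeval (params k r s) = A.val.comp (aeval p') := by
      ext l
      simp [p']
    rw [this]
    rfl
  have : Module.Finite (Algebra.adjoin k (Set.range p')) A := by
    refine ⟨⟨Finset.image a' Finset.univ, ?_⟩⟩
    rw [eq_top_iff]
    rintro ⟨f, hf⟩ -
    obtain ⟨q, hq⟩ := ha f hf
    have h1 : (⟨f, hf⟩ : A) = ∑ j, aeval p' (q j) * a' j := by
      refine Subtype.ext ?_
      rw [AddSubmonoidClass.coe_finsetSum]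
      refine hq.trans (Finset.sum_congr rfl fun j _ => ?_)
      rw [hp']
      rfl
    rw [h1]
    refine sum_mem fun j _ => ?_
    have h2 : aeval p' (q j) ∈ Algebra.adjoin k (Set.range p') := by
      rw [Algebra.adjoin_range_eq_range_aeval]
      exact ⟨q j, rfl⟩
    exact Submodule.smul_mem _ (⟨_, h2⟩ : Algebra.adjoin k (Set.range p'))
      (Submodule.subset_span (Finset.mem_coe.2 (Finset.mem_image_of_mem _ (Finset.mem_univ j))))
  have : Algebra.IsAlgebraic (Algebra.adjoin k (Set.range p')) A := inferInstance
  have h2 : AlgebraicIndependent k fun o =>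
      (⟨((genericMatrix k r s).submatrix id (spotCols hrs o)).det, casimir_minor _⟩ : A) :=
    AlgebraicIndependent.of_comp ((blockSpec k r s).comp A.val)
      (algebraicIndependent_blockSpec hr hrs)
  have h3 : AlgebraicIndependent k p' := by
    refine (Algebra.IsAlgebraic.isTranscendenceBasis_of_le_trdeg_of_finite k p' ?_).1
    refine le_trans (le_of_eq ?_) h2.cardinalMk_le_trdeg
    simp
  exact h3.map' (f := A.val) Subtype.val_injective

end

end

section

open MvPolynomial

/-- A module that is finite over a polynomial subalgebra becomes free after inverting a
single nonzero element, compatibly with a projection onto it. -/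
theorem exists_coords {k R : Type} [Field k] [CommRing R] [Algebra k R] {d m : ℕ} (p : Fin d → R)
    (ρ : R →ₗ[k] R) (hρ : ∀ (q : MvPolynomial (Fin d) k) f, ρ (aeval p q * f) = aeval p q * ρ f)
    (a : Fin m → R) (ha : ∀ j, ρ (a j) = a j)
    (hfin : ∀ f, ∃ q : Fin m → MvPolynomial (Fin d) k, ρ f = ∑ j, aeval p (q j) * a j) :
    ∃ (J : Type) (_ : Fintype J) (_ : DecidableEq J) (c : MvPolynomial (Fin d) k)
      (φ : J → R →ₗ[k] MvPolynomial (Fin d) k) (ι : J → MvPolynomial (Fin d) k →ₗ[k] R), c ≠ 0 ∧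
      (∀ j l f, φ j (p l * f) = X l * φ j f) ∧ (∀ j l q, ι j (X l * q) = p l * ι j q) ∧
      (∀ f, aeval p c * ρ f = ∑ j, ι j (φ j f)) ∧
      (∀ i j q, φ j (ι i q) = if i = j then c * q else 0) ∧ ∀ j f, φ j (ρ f) = φ j f := by
  classical
  let _ : Module (MvPolynomial (Fin d) k) R := Module.compHom R (aeval p).toRingHom
  have smul_def : ∀ (q : MvPolynomial (Fin d) k) (f : R), q • f = aeval p q * f :=
    fun _ _ => rfl
  obtain ⟨I, hI, hmax⟩ := exists_maximal_linearIndepOn (MvPolynomial (Fin d) k) a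
  have hb : ∀ j, ∃ b : MvPolynomial (Fin d) k, b ≠ 0 ∧ b • a j ∈
      Submodule.span (MvPolynomial (Fin d) k) (a '' I) := by
    intro j
    by_cases hj : j ∈ I
    · exact ⟨1, one_ne_zero, by
        rw [one_smul]
        exact Submodule.subset_span ⟨j, hj, rfl⟩⟩
    · exact hmax j hj
  choose b hb0 hb using hb
  set c := ∏ j, b j with hc
  have hc0 : c ≠ 0 := Finset.prod_ne_zero_iff.2 fun j _ => hb0 j
  let v : I → R := fun i => a i
  have hv : LinearIndependent (MvPolynomial (Fin d) k) v := hI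
  have hrange : Set.range v = a '' I := by
    rw [Set.image_eq_range]
  have hca : ∀ j, c • a j ∈ Submodule.span (MvPolynomial (Fin d) k) (Set.range v) := by
    intro j
    rw [hrange, hc, ← Finset.prod_erase_mul _ _ (Finset.mem_univ j), mul_smul]
    exact Submodule.smul_mem _ _ (hb j)
  have hcf : ∀ f, c • ρ f ∈ Submodule.span (MvPolynomial (Fin d) k) (Set.range v) := by
    intro f
    obtain ⟨q, hq⟩ := hfin f
    rw [hq, Finset.smul_sum]
    refine sum_mem fun j _ => ?_
    rw [← smul_def, smul_comm]
    exact Submodule.smul_mem _ _ (hca j)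
  let ρ' : R →ₗ[MvPolynomial (Fin d) k] R :=
    { toFun := ρ
      map_add' := map_add ρ
      map_smul' := fun q f => hρ q f }
  let Φ : R →ₗ[MvPolynomial (Fin d) k] (I →₀ MvPolynomial (Fin d) k) :=
    hv.repr ∘ₗ (c • ρ').codRestrict _ hcf
  have hΦ : ∀ f, Finsupp.linearCombination _ v (Φ f) = c • ρ f := fun f =>
    hv.linearCombination_repr _
  have hC : ∀ (x : k) (f : R), x • f = (C x : MvPolynomial (Fin d) k) • f := fun x f => by
    rw [smul_def, ← algebraMap_eq, AlgHom.commutes, Algebra.smul_def]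
  have hρv : ∀ i q, ρ (aeval p q * v i) = aeval p q * v i := fun i q => by
    rw [hρ, ha]
  refine ⟨I, inferInstance, inferInstance, c, fun j =>
    { toFun := fun f => Φ f j
      map_add' := fun f g => by rw [map_add]; rfl
      map_smul' := fun x f => by rw [hC, map_smul, Finsupp.smul_apply, smul_eq_mul, RingHom.id_apply,
        smul_eq_C_mul] }, fun j =>
    { toFun := fun q => aeval p q * v j
      map_add' := fun q q' => by rw [map_add, add_mul]
      map_smul' := fun x q => by rw [map_smul, smul_mul_assoc, RingHom.id_apply] },
    hc0, fun j l f => ?_, fun j l q => ?_, fun f => ?_, fun i j q => ?_, fun j f => ?_⟩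
  · have : p l * f = (X l : MvPolynomial (Fin d) k) • f := by rw [smul_def, aeval_X]
    simp only [LinearMap.coe_mk, AddHom.coe_mk]
    rw [this, map_smul, Finsupp.smul_apply, smul_eq_mul]
  · simp only [LinearMap.coe_mk, AddHom.coe_mk]
    rw [map_mul, aeval_X, mul_assoc]
  · simp only [LinearMap.coe_mk, AddHom.coe_mk]
    rw [← smul_def, ← hΦ, Finsupp.linearCombination_apply, Finsupp.sum_fintype _ _ (by simp)]
    rfl
  · simp only [LinearMap.coe_mk, AddHom.coe_mk]
    have : Φ (aeval p q * v i) = Finsupp.single i (c * q) := by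
      refine hv ?_
      rw [hΦ, hρv, Finsupp.linearCombination_single, mul_smul]
      rfl
    rw [this, Finsupp.single_apply]
  · simp only [LinearMap.coe_mk, AddHom.coe_mk]
    have : Φ (ρ f) = Φ f := by
      refine hv ?_
      obtain ⟨q, hq⟩ := hfin f
      rw [hΦ, hΦ, hq, map_sum]
      congr 1
      refine Finset.sum_congr rfl fun j _ => ?_
      rw [hρ, ha]
    rw [this]

/-- The data comparing `H^n(p; R)` with the local cohomology of a polynomial ring in the
parameters. -/
structure ParamData (k : Type) [Field k] (r s : ℕ) where
  /-- the projection onto the invariants -/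
  ρ : MvPolynomial (Fin r × Fin s) k →ₗ[k] MvPolynomial (Fin r × Fin s) k
  /-- the homotopy -/
  τ : MvPolynomial (Fin r × Fin s) k →ₗ[k] MvPolynomial (Fin r × Fin s) k
  casimir_ρ : ∀ f, casimir k (ρ f) = 0
  ρ_add_τ : ∀ f, f = ρ f + τ (casimir k f)
  ρ_casimir : ∀ f, ρ (casimir k f) = 0
  ρ_param : ∀ l f, ρ (params k r s l * f) = params k r s l * ρ f
  τ_param : ∀ l f, τ (params k r s l * f) = params k r s l * τ f
  /-- the index set of the coordinates -/
  J : Type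
  [fin : Fintype J]
  [dec : DecidableEq J]
  /-- the common denominator -/
  c : MvPolynomial (Fin (r * (s - r) + 1)) k
  /-- the coordinates -/
  φ : J → MvPolynomial (Fin r × Fin s) k →ₗ[k] MvPolynomial (Fin (r * (s - r) + 1)) k
  /-- the generators -/
  ι : J → MvPolynomial (Fin (r * (s - r) + 1)) k →ₗ[k] MvPolynomial (Fin r × Fin s) k
  c_ne : c ≠ 0
  φ_param : ∀ j l f, φ j (params k r s l * f) = X l * φ j f
  ι_X : ∀ j l q, ι j (X l * q) = params k r s l * ι j q
  sum_ι_φ : ∀ f, aeval (params k r s) c * ρ f = ∑ j, ι j (φ j f)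
  φ_ι : ∀ i j q, φ j (ι i q) = if i = j then c * q else 0
  φ_ρ : ∀ j f, φ j (ρ f) = φ j f
  nonempty : Nonempty J

attribute [instance] ParamData.fin ParamData.dec ParamData.nonempty

theorem nonempty_paramData (k : Type) [Field k] [CharZero k] {r s : ℕ} (hr : 0 < r)
    (hrs : r ≤ s) : Nonempty (ParamData k r s) := by
  obtain ⟨ρ, τ, h1, h2, h3, h4, h5⟩ := exists_reynolds k (Fin r) (Fin s)
  obtain ⟨m, a, hac, ha⟩ := exists_generators_over hr (params k r s) isHomogeneous_params
    casimir_params mem_radical_params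
  have hρc : ∀ f, casimir k f = 0 → ρ f = f := fun f hf => by
    conv_rhs => rw [h3 f, hf, map_zero, add_zero]
  have hcp : ∀ q : MvPolynomial _ k, casimir k (aeval (params k r s) q) = 0 := fun q => by
    have h : (aeval (params k r s) q) ∈ casimirAlgebra k (Fin r) (Fin s) := by
      have : Algebra.adjoin k (Set.range (params k r s)) ≤ casimirAlgebra k (Fin r) (Fin s) := by
        rw [Algebra.adjoin_le_iff]
        rintro _ ⟨l, rfl⟩
        exact casimir_params l
      refine this ?_
      rw [Algebra.adjoin_range_eq_range_aeval]
      exact ⟨q, rfl⟩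
    exact h
  obtain ⟨J, i1, i2, c, φ, ι, hc, e1, e2, e3, e4, e5⟩ := exists_coords (params k r s) ρ
    (fun q f => (h5 _ (hcp q) f).1) a (fun j => hρc _ (hac j)) fun f => ha _ (h1 f)
  refine ⟨⟨ρ, τ, h1, h3, h2, fun l f => (h5 _ (casimir_params l) f).1,
    fun l f => (h5 _ (casimir_params l) f).2, J, c, φ, ι, hc, e1, e2, e3, e4, e5, ?_⟩⟩
  by_contra hJ
  rw [not_nonempty_iff] at hJ
  have h := e3 1
  rw [Finset.univ_eq_empty, Finset.sum_empty, hρc 1 (casimir_C 1), mul_one] at h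
  exact hc ((algebraicIndependent_params hr hrs) (h.trans (map_zero _).symm))

end

section

section functionals

/-- The `k`-linear functionals on a `k`-algebra `T`, as a `T`-module. -/
def Functionals (k T : Type) [Field k] [CommRing T] [Algebra k T] : Type := T →ₗ[k] k

namespace Functionals

variable {k T : Type} [Field k] [CommRing T] [Algebra k T]

noncomputable instance : AddCommGroup (Functionals k T) := inferInstanceAs (AddCommGroup (T →ₗ[k] k))

instance : FunLike (Functionals k T) T k := inferInstanceAs (FunLike (T →ₗ[k] k) T k)

instance : LinearMapClass (Functionals k T) k T k :=
  inferInstanceAs (LinearMapClass (T →ₗ[k] k) k T k)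

/-- A `k`-linear map as a functional. -/
def mk (φ : T →ₗ[k] k) : Functionals k T := φ

theorem mk_apply (φ : T →ₗ[k] k) (g : T) : mk φ g = φ g := rfl

theorem add_apply (φ ψ : Functionals k T) (g : T) : (φ + ψ) g = φ g + ψ g := rfl

theorem zero_apply (g : T) : (0 : Functionals k T) g = 0 := rfl

theorem ext {φ ψ : Functionals k T} (h : ∀ g, φ g = ψ g) : φ = ψ := LinearMap.ext h

noncomputable instance : Module T (Functionals k T) where
  smul f ψ := LinearMap.comp (ψ : T →ₗ[k] k) (LinearMap.mulLeft k f)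
  one_smul ψ := ext fun g => congrArg ψ (one_mul g)
  mul_smul f g ψ := ext fun h => congrArg ψ (show f * g * h = g * (f * h) by ring)
  smul_zero f := rfl
  smul_add f φ ψ := rfl
  add_smul f g ψ := ext fun h =>
    (congrArg ψ (add_mul f g h)).trans (map_add ψ (f * h) (g * h))
  zero_smul ψ := ext fun h => (congrArg ψ (zero_mul h)).trans (map_zero ψ)

theorem smul_apply (f : T) (ψ : Functionals k T) (g : T) : (f • ψ) g = ψ (f * g) := rfl

theorem injective : Module.Injective T (Functionals k T) where
  out {X Y} _ _ _ _ f hf g := by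
    let _ : Module k X := Module.compHom X (algebraMap k T)
    let _ : Module k Y := Module.compHom Y (algebraMap k T)
    have hX : ∀ (c : k) (x : X), c • x = algebraMap k T c • x := fun _ _ => rfl
    have hY : ∀ (c : k) (y : Y), c • y = algebraMap k T c • y := fun _ _ => rfl
    let f' : X →ₗ[k] Y :=
      { toFun := f
        map_add' := f.map_add
        map_smul' := fun c x => by
          change f (c • x) = c • f x
          rw [hX, hY, map_smul] }
    obtain ⟨q, hq⟩ := LinearMap.exists_leftInverse_of_injective f' (LinearMap.ker_eq_bot.2 hf)
    let g' : X →ₗ[k] k :=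
      { toFun x := g x 1
        map_add' x y := by rw [map_add, add_apply]
        map_smul' c x := by
          rw [hX, map_smul, smul_apply, mul_one, Algebra.algebraMap_eq_smul_one, map_smul]
          rfl }
    refine ⟨{ toFun y := { toFun t := g' (q (t • y))
                           map_add' s t := by rw [add_smul, map_add, map_add]
                           map_smul' c t := by
                            rw [← map_smul, ← map_smul, hY, smul_smul, ← Algebra.smul_def]
                            rfl }
              map_add' y z := ext fun t => ?_
              map_smul' s y := ext fun t => ?_ }, fun x => ext fun t => ?_⟩
    · change g' (q (t • (y + z))) = g' (q (t • y)) + g' (q (t • z))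
      rw [smul_add, map_add, map_add]
    · change g' (q (t • s • y)) = g' (q ((s * t) • y))
      rw [smul_smul, mul_comm]
    · change g' (q (t • f x)) = g x t
      have e : q (t • f x) = t • x := by
        rw [← map_smul]
        exact LinearMap.congr_fun hq (t • x)
      rw [e]
      change g (t • x) 1 = _
      rw [map_smul, smul_apply, mul_one]

end Functionals

end functionals

namespace Cx

variable {T : Type} [CommRing T]

theorem injective_of_equiv {Q Q' : Type} [AddCommGroup Q] [Module T Q] [AddCommGroup Q']
    [Module T Q'] (e : Q ≃ₗ[T] Q') (h : Module.Injective T Q) : Module.Injective T Q' where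
  out X Y _ _ _ _ f hf g := by
    obtain ⟨h, hh⟩ := h.out f hf (e.symm.toLinearMap.comp g)
    exact ⟨e.toLinearMap.comp h, fun x => by simp [hh]⟩

theorem mem_listTors_cons {Q : Type} [AddCommGroup Q] [Module T Q] {f : T} {l : List T} {m : Q} :
    m ∈ listTors (f :: l) Q ↔ m ∈ powTors f Q ∧ m ∈ listTors l Q := by
  rw [mem_listTors, List.forall_mem_cons, ← mem_listTors]

theorem mem_powTors_coe {Q : Type} [AddCommGroup Q] [Module T Q] (f : T) (N : Submodule T Q)
    (m : N) : m ∈ powTors f N ↔ (m : Q) ∈ powTors f Q := by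
  rw [mem_powTors, mem_powTors]
  refine exists_congr fun n => ?_
  rw [← Submodule.coe_smul, ZeroMemClass.coe_eq_zero]

theorem powTors_submodule_equiv {Q : Type} [AddCommGroup Q] [Module T Q] (f : T)
    (N : Submodule T Q) : Nonempty (powTors f N ≃ₗ[T] (powTors f Q ⊓ N : Submodule T Q)) := by
  have e : (powTors f N).map N.subtype = powTors f Q ⊓ N := by
    ext m
    constructor
    · rintro ⟨m, hm, rfl⟩
      exact ⟨(mem_powTors_coe f _ m).1 hm, m.2⟩
    · intro h
      exact ⟨⟨m, h.2⟩, (mem_powTors_coe f _ ⟨m, h.2⟩).2 h.1, rfl⟩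
  rw [← e]
  exact ⟨Submodule.equivMapOfInjective _ N.injective_subtype _⟩

theorem listTors_nil {Q : Type} [AddCommGroup Q] [Module T Q] :
    listTors ([] : List T) Q = ⊤ :=
  eq_top_iff.2 fun _ _ => mem_listTors.2 fun _ h => absurd h List.not_mem_nil

theorem injective_listTors [IsNoetherianRing T] {Q : Type} [AddCommGroup Q] [Module T Q]
    (hQ : Module.Injective T Q) (l : List T) : Module.Injective T (listTors l Q) := by
  induction l with
  | nil =>
    rw [listTors_nil]
    exact injective_of_equiv Submodule.topEquiv.symm hQ
  | cons f l ih =>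
    obtain ⟨e⟩ := powTors_submodule_equiv f (listTors l Q)
    have h : listTors (f :: l) Q = powTors f Q ⊓ listTors l Q :=
      Submodule.ext fun m => mem_listTors_cons
    rw [h]
    exact injective_of_equiv e (injective_powTors ih f)

end Cx

open MvPolynomial

/-- The functionals on a polynomial ring that are torsion for the ideal of the variables. -/
noncomputable def inverseSystem (k σ : Type) [Field k] [Fintype σ] :
    Submodule (MvPolynomial σ k) (Functionals k (MvPolynomial σ k)) :=
  Cx.listTors ((Finset.univ : Finset σ).toList.map X) _

namespace inverseSystem

variable {k σ : Type} [Field k] [Fintype σ]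

theorem mem_iff {ψ : Functionals k (MvPolynomial σ k)} :
    ψ ∈ inverseSystem k σ ↔ ∀ i, ∃ N : ℕ, (X i : MvPolynomial σ k) ^ N • ψ = 0 := by
  simp [inverseSystem, Cx.mem_listTors, Cx.mem_powTors]

theorem injective : Module.Injective (MvPolynomial σ k) (inverseSystem k σ) :=
  Cx.injective_listTors Functionals.injective _

theorem exists_bound (ψ : inverseSystem k σ) :
    ∃ N : ℕ, ∀ a : σ →₀ ℕ, ψ.1 (monomial a 1) ≠ 0 → ∀ i, a i < N := by
  choose N hN using mem_iff.1 ψ.2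
  refine ⟨Finset.univ.sup N, fun a ha i => lt_of_not_ge fun h => ha ?_⟩
  have h' : Finsupp.single i (N i) ≤ a := Finsupp.single_le_iff.2 ((Finset.le_sup (Finset.mem_univ i)).trans h)
  have e : (monomial a 1 : MvPolynomial σ k) = X i ^ N i * monomial (a - Finsupp.single i (N i)) 1 := by
    rw [X_pow_eq_monomial, monomial_mul, one_mul, add_tsub_cancel_of_le h']
  rw [e, ← Functionals.smul_apply, hN, Functionals.zero_apply]

theorem finite_support (ψ : inverseSystem k σ) :
    {a : σ →₀ ℕ | ψ.1 (monomial a 1) ≠ 0}.Finite := by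
  obtain ⟨N, hN⟩ := exists_bound ψ
  classical
  refine Set.Finite.subset (Set.finite_Icc 0 (Finsupp.equivFunOnFinite.symm fun _ => N)) fun a ha => ?_
  exact ⟨zero_le, fun i => (hN a ha i).le⟩

omit [Fintype σ] in
theorem functionals_ext {φ ψ : Functionals k (MvPolynomial σ k)}
    (h : ∀ a, φ (monomial a 1) = ψ (monomial a 1)) : φ = ψ :=
  MvPolynomial.linearMap_ext fun a => LinearMap.ext_ring (h a)

omit [Fintype σ] in
theorem coeff_zero_X_mul (i : σ) (f : MvPolynomial σ k) : coeff 0 (X i * f) = 0 := by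
  classical
  rw [coeff_X_mul']
  simp

/-- The generator of the socle: evaluation of the constant coefficient. -/
noncomputable def socle (k σ : Type) [Field k] [Fintype σ] : inverseSystem k σ :=
  ⟨Functionals.mk (lcoeff k (0 : σ →₀ ℕ)), mem_iff.2 fun i => ⟨1, by
    refine functionals_ext fun a => ?_
    rw [Functionals.smul_apply, Functionals.zero_apply, pow_one, Functionals.mk_apply,
      lcoeff_apply, coeff_zero_X_mul]⟩⟩

theorem socle_apply (f : MvPolynomial σ k) : (socle k σ).1 f = coeff 0 f := rfl

theorem socle_ne_zero : socle k σ ≠ 0 := fun h => by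
  have := congrArg (fun ψ : inverseSystem k σ => ψ.1 1) h
  simp only [socle_apply] at this
  simp at this
  exact one_ne_zero this

theorem X_smul_socle (i : σ) : (X i : MvPolynomial σ k) • socle k σ = 0 :=
  Subtype.ext <| functionals_ext fun a => by
    exact coeff_zero_X_mul _ _

theorem exists_smul_eq_socle {ι : Type} [Finite ι] (ψ : ι → inverseSystem k σ) (h : ψ ≠ 0) :
    ∃ (f : MvPolynomial σ k) (α : ι → k), α ≠ 0 ∧ 
      ∀ i, f • ψ i = (C (α i) : MvPolynomial σ k) • socle k σ := by
  have hfin : {a : σ →₀ ℕ | ∃ i, (ψ i).1 (monomial a 1) ≠ 0}.Finite := by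
    simpa only [Set.ofPred_exists] using Set.finite_iUnion fun i => finite_support (ψ i)
  obtain ⟨i, hi⟩ := Function.ne_iff.1 h
  have hne : {a : σ →₀ ℕ | ∃ i, (ψ i).1 (monomial a 1) ≠ 0}.Nonempty := by
    by_contra he
    refine hi (Subtype.ext (functionals_ext fun a => ?_))
    by_contra hx
    exact he ⟨a, i, hx⟩
  obtain ⟨a, ha, hmax⟩ := Set.exists_max_image _ (fun a => a.degree) hfin hne
  refine ⟨monomial a 1, fun i => (ψ i).1 (monomial a 1), ?_, fun i => Subtype.ext (functionals_ext fun b => ?_)⟩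
  · obtain ⟨j, hj⟩ := ha
    exact Function.ne_iff.2 ⟨j, hj⟩
  · classical
    change (ψ i).1 (monomial a 1 * monomial b 1) = coeff 0 (C _ * monomial b 1)
    rw [monomial_mul, one_mul, coeff_C_mul, coeff_monomial]
    split_ifs with hb
    · rw [hb, add_zero, mul_one]
    · rw [mul_zero]
      by_contra hx
      have := hmax (a + b) ⟨i, hx⟩
      rw [map_add] at this
      exact hb ((Finsupp.degree_eq_zero_iff b).1 (by omega))

end inverseSystem

end

section

open MvPolynomial

section weyl

variable {k σ H : Type} [Field k] [AddCommGroup H] [Module (MvPolynomial σ k) H]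

/-- Commuting operators `D i` making a `k[x]`-module a module over the Weyl algebra. -/
structure IsWeyl (D : σ → H →+ H) : Prop where
  comm : ∀ i j y, D i (D j y) = D j (D i y)
  leibniz : ∀ i (f : MvPolynomial σ k) y, D i (f • y) = f • D i y + pderiv i f • y

namespace IsWeyl

variable {D : σ → H →+ H}

theorem C_smul (hD : IsWeyl (k := k) D) (i : σ) (c : k) (y : H) :
    D i ((C c : MvPolynomial σ k) • y) = (C c : MvPolynomial σ k) • D i y := by
  rw [hD.leibniz, pderiv_C, zero_smul, add_zero]

variable [DecidableEq σ]

theorem X_smul_foldr (hD : IsWeyl (k := k) D) {z : H}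
    (hz : ∀ i, (X i : MvPolynomial σ k) • z = 0)
    (_ : LeftCommutative fun i (y : H) => D i y) (i : σ) (m : Multiset σ) :
    (X i : MvPolynomial σ k) • m.foldr (fun j (y : H) => D j y) z =
      -(m.count i • (m.erase i).foldr (fun j (y : H) => D j y) z) := by
  induction m using Multiset.induction_on with
  | empty => simp [hz]
  | cons j m ih =>
    have key : (X i : MvPolynomial σ k) • D j (m.foldr (fun j (y : H) => D j y) z) =
        D j ((X i : MvPolynomial σ k) • m.foldr (fun j (y : H) => D j y) z) -
          pderiv j (X i : MvPolynomial σ k) • m.foldr (fun j (y : H) => D j y) z := by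
      rw [hD.leibniz, add_sub_cancel_right]
    rw [Multiset.foldr_cons, key, ih, map_neg, map_nsmul, pderiv_X]
    by_cases h : i = j
    · subst h
      rw [Multiset.erase_cons_head, Multiset.count_cons_self, Pi.single_eq_same, one_smul,
        succ_nsmul, neg_add, ← sub_eq_add_neg]
      congr 2
      by_cases hi : i ∈ m
      · rw [← Multiset.foldr_cons (f := fun j (y : H) => D j y), Multiset.cons_erase hi]
      · rw [Multiset.count_eq_zero_of_notMem hi, zero_smul, zero_smul]
    · rw [Multiset.erase_cons_tail _ (Ne.symm h), Multiset.foldr_cons, Multiset.count_cons_of_ne h,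
        Pi.single_eq_of_ne h, zero_smul, sub_zero]

variable [Fintype σ] [CharZero k]

theorem exists_divided_powers (hD : IsWeyl (k := k) D) {z : H}
    (hz : ∀ i, (X i : MvPolynomial σ k) • z = 0) : ∃ w : (σ →₀ ℕ) → H, w 0 = z ∧
      (∀ i a, (X i : MvPolynomial σ k) • w (a + Finsupp.single i 1) = w a) ∧
      (∀ i a, a i = 0 → (X i : MvPolynomial σ k) • w a = 0) ∧
      ∀ i a, D i (w a) = -((a i + 1) • w (a + Finsupp.single i 1)) := by
  have hc : LeftCommutative fun i (y : H) => D i y := ⟨hD.comm⟩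
  let v : (σ →₀ ℕ) → H := fun a => (Finsupp.toMultiset a).foldr (fun j (y : H) => D j y) z
  let e : (σ →₀ ℕ) → k := fun a => ∏ i, (-1) ^ a i * ((a i).factorial : k)⁻¹
  have hv1 : ∀ i a, D i (v a) = v (a + Finsupp.single i 1) := fun i a => by
    simp only [v, map_add, Finsupp.toMultiset_single, one_smul]
    rw [add_comm, Multiset.singleton_add, Multiset.foldr_cons]
  have hv2 : ∀ i a, (X i : MvPolynomial σ k) • v (a + Finsupp.single i 1) =
      -((a i + 1) • v a) := fun i a => by
    simp only [v]
    rw [hD.X_smul_foldr hz hc, map_add, Finsupp.toMultiset_single, one_smul, add_comm,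
      Multiset.singleton_add, Multiset.erase_cons_head, Multiset.count_cons_self,
      Finsupp.count_toMultiset]
  have hv3 : ∀ i a, a i = 0 → (X i : MvPolynomial σ k) • v a = 0 := fun i a h => by
    simp only [v]
    rw [hD.X_smul_foldr hz hc, Finsupp.count_toMultiset, h, zero_smul, neg_zero]
  have he : ∀ i a, (a i + 1 : k) * e (a + Finsupp.single i 1) = -e a := fun i a => by
    simp only [e]
    rw [← Finset.mul_prod_erase _ _ (Finset.mem_univ i),
      ← Finset.mul_prod_erase _ (fun j => (-1) ^ a j * ((a j).factorial : k)⁻¹) (Finset.mem_univ i),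
      Finset.prod_congr rfl (g := fun j => (-1) ^ a j * ((a j).factorial : k)⁻¹) fun j hj => by
        rw [Finsupp.add_apply, Finsupp.single_eq_of_ne (Finset.ne_of_mem_erase hj), add_zero],
      Finsupp.add_apply, Finsupp.single_eq_same, Nat.factorial_succ, pow_succ]
    have : (a i + 1 : k) ≠ 0 := Nat.cast_add_one_ne_zero _
    push_cast
    field_simp
  have hn : ∀ (n : ℕ) (y : H), n • y = (C (n : k) : MvPolynomial σ k) • y := fun n y => by
    rw [map_natCast, Nat.cast_smul_eq_nsmul]
  refine ⟨fun a => (C (e a) : MvPolynomial σ k) • v a, ?_, fun i a => ?_, fun i a h => ?_,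
    fun i a => ?_⟩
  · simp [e, v]
  · dsimp only
    rw [smul_comm, hv2, smul_neg, hn, smul_smul, ← neg_smul, ← map_mul, ← map_neg]
    congr 2
    have := he i a
    push_cast
    linear_combination -this
  · dsimp only
    rw [smul_comm, hv3 i a h, smul_zero]
  · dsimp only
    rw [hD.C_smul, hv1, hn, smul_smul, ← neg_smul, ← map_mul, ← map_neg]
    congr 2
    push_cast
    rw [he, neg_neg]

omit [Field k] [AddCommGroup H] [Module (MvPolynomial σ k) H] [Fintype σ] [CharZero k] in
theorem finsum_shift {A : Type} [AddCommMonoid A] (i : σ) (g : (σ →₀ ℕ) → A)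
    (hg : ∀ a, a i = 0 → g a = 0) : ∑ᶠ a, g a = ∑ᶠ a, g (a + Finsupp.single i 1) := by
  rw [← finsum_mem_range (f := g) (g := fun a => a + Finsupp.single i 1) (add_left_injective _),
    ← finsum_mem_univ]
  refine finsum_mem_inter_support_eq _ _ _ (Set.ext fun a => ?_)
  simp only [Set.mem_inter_iff, Set.mem_univ, true_and, Set.mem_range, Function.mem_support]
  refine ⟨fun h => ⟨⟨a - Finsupp.single i 1, tsub_add_cancel_of_le ?_⟩, h⟩, fun h => h.2⟩
  exact Finsupp.single_le_iff.2 (Nat.one_le_iff_ne_zero.2 fun h0 => h (hg a h0))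

/-- A socle element of a Weyl module generates a copy of the inverse system. -/
theorem exists_linearMap (hD : IsWeyl (k := k) D) {z : H}
    (hz : ∀ i, (X i : MvPolynomial σ k) • z = 0) :
    ∃ W : inverseSystem k σ →ₗ[MvPolynomial σ k] H, W (inverseSystem.socle k σ) = z ∧
      ∀ i (ψ φ : inverseSystem k σ), (∀ f, φ.1 f = ψ.1 (pderiv i f)) → D i (W ψ) = -W φ := by
  obtain ⟨w, hw0, hw1, hw2, hw3⟩ := hD.exists_divided_powers hz
  let g : inverseSystem k σ → (σ →₀ ℕ) → H := fun ψ a =>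
    (C (ψ.1 (monomial a 1)) : MvPolynomial σ k) • w a
  have hfin : ∀ ψ, (Function.support (g ψ)).Finite := fun ψ =>
    (inverseSystem.finite_support ψ).subset fun a ha h0 => ha (by simp [g, h0])
  have hadd : ∀ φ ψ, ∑ᶠ a, g (φ + ψ) a = (∑ᶠ a, g φ a) + ∑ᶠ a, g ψ a := fun φ ψ => by
    rw [← finsum_add_distrib (hfin φ) (hfin ψ)]
    refine finsum_congr fun a => ?_
    simp only [g, ← add_smul, ← map_add]
    rfl
  have hC : ∀ (c : k) ψ, ∑ᶠ a, g ((C c : MvPolynomial σ k) • ψ) a =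
      (C c : MvPolynomial σ k) • ∑ᶠ a, g ψ a := fun c ψ => by
    rw [smul_finsum' _ (hfin ψ)]
    refine finsum_congr fun a => ?_
    simp only [g, smul_smul, ← map_mul]
    congr 2
    change ψ.1 (C c * monomial a 1) = _
    rw [← smul_eq_C_mul, map_smul, smul_eq_mul]
  have hX : ∀ i ψ, ∑ᶠ a, g ((X i : MvPolynomial σ k) • ψ) a =
      (X i : MvPolynomial σ k) • ∑ᶠ a, g ψ a := fun i ψ => by
    rw [smul_finsum' _ (hfin ψ), finsum_shift i fun a => (X i : MvPolynomial σ k) • g ψ a]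
    · refine finsum_congr fun a => ?_
      simp only [g]
      rw [smul_comm (X i), hw1]
      congr 2
      change ψ.1 (X i * monomial a 1) = _
      rw [X, monomial_mul, one_mul, add_comm]
    · intro a ha
      simp only [g]
      rw [smul_comm, hw2 i a ha, smul_zero]
  refine ⟨{ toFun ψ := ∑ᶠ a, g ψ a
            map_add' := hadd
            map_smul' f ψ := ?_ }, ?_, fun i ψ φ h => ?_⟩
  · rw [RingHom.id_apply]
    induction f using MvPolynomial.induction_on generalizing ψ with
    | C c => exact hC c ψ
    | add p q hp hq => rw [add_smul, hadd, hp, hq, add_smul]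
    | mul_X p i hp => rw [mul_smul, hp, hX, mul_smul]
  · change ∑ᶠ a, g (inverseSystem.socle k σ) a = z
    rw [finsum_eq_single _ 0]
    · simp [g, inverseSystem.socle_apply, hw0]
    · intro a ha
      simp [g, inverseSystem.socle_apply, coeff_monomial, ha]
  · change D i (∑ᶠ a, g ψ a) = -∑ᶠ a, g φ a
    rw [AddMonoidHom.map_finsum _ (hfin ψ), finsum_shift i (g φ), ← finsum_neg_distrib]
    · refine finsum_congr fun a => ?_
      simp only [g]
      rw [hD.C_smul, hw3, smul_neg, h, pderiv_monomial, Finsupp.add_apply, Finsupp.single_eq_same,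
        add_tsub_cancel_right, one_mul, ← Nat.cast_smul_eq_nsmul (MvPolynomial σ k), smul_smul,
        ← map_natCast (C : k →+* MvPolynomial σ k), ← map_mul]
      congr 3
      rw [← mul_one ((a i + 1 : ℕ) : k), ← smul_eq_mul ((a i + 1 : ℕ) : k), ← smul_monomial,
        map_smul, smul_eq_mul, smul_eq_mul, mul_one, mul_comm]
    · intro a ha
      simp [g, h, pderiv_monomial, ha]

end IsWeyl

end weyl

end

section

open MvPolynomial

namespace Cx

section cH

variable {T T' T'' : Type} [CommRing T] [CommRing T'] [CommRing T'']
  {M M' M'' : Type} [AddCommGroup M] [Module T M] [AddCommGroup M'] [Module T' M']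
  [AddCommGroup M''] [Module T'' M''] {l : List T} {l' : List T'} {l'' : List T''} {n : ℤ}

/-- The map on Čech cohomology induced by an additive map. -/
noncomputable def cH (φ : M →+ M') (l : List T) (l' : List T') (n : ℤ) :
    (cech M l).H n →+ (cech M' l').H n :=
  (cechMap φ l l').H n

theorem cH_comp {φ : M →+ M'} {ψ : M' →+ M''} (hφ : Compat φ l l') (hψ : Compat ψ l' l'')
    (y : (cech M l).H n) : cH (ψ.comp φ) l l'' n y = cH ψ l' l'' n (cH φ l l' n y) :=
  (Hom.H_congr (G := (cechMap ψ l' l'').comp (cechMap φ l l')) (cechMap_comp hφ hψ) y).trans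
    (Hom.H_comp _ _ y)

theorem cH_add {φ ψ : M →+ M'} (hφ : Compat φ l l') (hψ : Compat ψ l l') (y : (cech M l).H n) :
    cH (φ + ψ) l l' n y = cH φ l l' n y + cH ψ l l' n y := by
  induction y using H_ind with
  | _ x hd hg =>
    rw [cH, cH, cH, Hom.H_cl, Hom.H_cl, Hom.H_cl, cl_add]
    congr 1
    exact cechMap_add hφ hψ x

theorem cH_zero (h : l.length = l'.length) (y : (cech M l).H n) :
    cH (0 : M →+ M') l l' n y = 0 := by
  induction y using H_ind with
  | _ x hd hg =>
    rw [cH, Hom.H_cl, cl_eq_zero]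
    exact ⟨0, zero_mem _, by rw [cechMap_zero h, map_zero]⟩

theorem cH_id (y : (cech M l).H n) : cH (AddMonoidHom.id M) l l n y = y := by
  induction y using H_ind with
  | _ x hd hg =>
    rw [cH, Hom.H_cl]
    congr 1
    exact cechMap_id l x

theorem cH_smul {φ : M →+ M'} (hc : Compat φ l l') {t : T} {t' : T'}
    (h : ∀ m, φ (t • m) = t' • φ m) (y : (cech M l).H n) :
    cH φ l l' n (t • y) = t' • cH φ l l' n y :=
  Hom.H_smul _ (cechMap_smul hc h) y

theorem cH_smul_id {M : Type} [AddCommGroup M] [Module T M] {l : List T} (t : T)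
    (y : (cech M l).H n) : cH (DistribSMul.toAddMonoidHom M t) l l n y = t • y := by
  induction y using H_ind with
  | _ x hd hg =>
    rw [cH, Hom.H_cl, smul_cl]
    congr 1
    exact cechMap_smul_eq t l x

theorem compat_sum {ι : Type} {s : Finset ι} {φ : ι → M →+ M'} (h : ∀ i ∈ s, Compat (φ i) l l')
    (hl : l.length = l'.length) : Compat (∑ i ∈ s, φ i) l l' := by
  classical
  induction s using Finset.induction_on with
  | empty => exact compat_zero hl
  | insert i s hi ih =>
    rw [Finset.forall_mem_insert] at h
    rw [Finset.sum_insert hi]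
    exact h.1.add (ih h.2)

theorem cH_sum {ι : Type} {s : Finset ι} {φ : ι → M →+ M'} (h : ∀ i ∈ s, Compat (φ i) l l')
    (hl : l.length = l'.length) (y : (cech M l).H n) :
    cH (∑ i ∈ s, φ i) l l' n y = ∑ i ∈ s, cH (φ i) l l' n y := by
  classical
  induction s using Finset.induction_on with
  | empty => exact cH_zero hl y
  | insert i s hi ih =>
    rw [Finset.forall_mem_insert] at h
    rw [Finset.sum_insert hi, Finset.sum_insert hi, cH_add h.1 (compat_sum h.2 hl), ih h.2]

theorem compat_ofFn {m : ℕ} {f : Fin m → T} {f' : Fin m → T'} {φ : M →+ M'}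
    (h : ∀ i x, φ (f i • x) = f' i • φ x) : Compat φ (List.ofFn f) (List.ofFn f') :=
  List.forall₂_iff_get.2 ⟨by simp, fun i h₁ h₂ => by simpa using h _⟩

end cH

theorem pderiv_comm {k σ : Type} [CommRing k] (i j : σ) (f : MvPolynomial σ k) :
    pderiv i (pderiv j f) = pderiv j (pderiv i f) := by
  classical
  have h : ⁅pderiv (R := k) i, pderiv j⁆ = (0 : Derivation k (MvPolynomial σ k) (MvPolynomial σ k)) := by
    refine MvPolynomial.derivation_ext fun m => ?_
    rw [Derivation.commutator_apply, pderiv_X, pderiv_X, Pi.single_apply, Pi.single_apply]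
    split_ifs <;> simp
  have := congrArg (fun δ : Derivation k (MvPolynomial σ k) (MvPolynomial σ k) => δ f) h
  rw [Derivation.commutator_apply] at this
  exact sub_eq_zero.1 this

theorem isWeyl_conH (k σ : Type) [Field k] (l : List (MvPolynomial σ k)) (n : ℤ) :
    IsWeyl (k := k) fun i : σ => conH (k := k) (pderiv i) l n where
  comm i j y := conH_comm _ _ (fun a => pderiv_comm i j a) y
  leibniz _ f y := conH_smul _ f y

section params

variable {k : Type} [Field k] [CharZero k] {r s : ℕ} {n : ℤ}

local notation "R" => MvPolynomial (Fin r × Fin s) k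
local notation "P" => MvPolynomial (Fin (r * (s - r) + 1)) k
local notation "𝐩" => List.ofFn (params k r s)
local notation "𝐱" => varList k (r * (s - r) + 1)

omit [CharZero k] in
theorem conH_polar (i j : Fin r) (l : List R) (y : (cech R l).H n) :
    conH (polar k i j) l n y =
      ∑ c : Fin s, (X (i, c) : R) • conH (k := k) (pderiv (j, c)) l n y :=
  conH_sum Finset.univ (fun c : Fin s => (X (i, c) : R)) (fun c => pderiv (j, c)) (polar k i j) (fun a => polar_apply k i j a) y

omit [CharZero k] in
theorem compat_params {φ : R →+ R} (h : ∀ l f, φ (params k r s l * f) = params k r s l * φ f) :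
    Compat φ 𝐩 𝐩 :=
  compat_ofFn h

theorem compat_polar {i j : Fin r} (hij : i ≠ j) : Compat (polar (κ := Fin s) k i j : R →+ R) 𝐩 𝐩 :=
  compat_params fun l f => by
    change polar k i j (params k r s l * f) = params k r s l * polar k i j f
    rw [Derivation.leibniz, polar_params l i j hij, smul_zero, add_zero, smul_eq_mul]

theorem conH_polar_eq {i j : Fin r} (hij : i ≠ j) (y : (cech R 𝐩).H n) :
    conH (polar k i j) 𝐩 n y = cH (polar (κ := Fin s) k i j : R →+ R) 𝐩 𝐩 n y :=
  conH_eq _ (fun f hf => by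
    obtain ⟨l, rfl⟩ := List.mem_ofFn.1 hf
    exact polar_params l i j hij) y

theorem compat_casimir : Compat (casimir k : R →ₗ[k] R).toAddMonoidHom 𝐩 𝐩 :=
  compat_params fun l _ => casimir_mul _ _ (casimir_params l)

theorem cH_casimir (y : (cech R 𝐩).H n) :
    cH (casimir k : R →ₗ[k] R).toAddMonoidHom 𝐩 𝐩 n y =
      ∑ p ∈ Finset.univ.filter fun p : Fin r × Fin r => p.1 ≠ p.2,
        conH (polar k p.2 p.1) 𝐩 n (conH (polar k p.1 p.2) 𝐩 n y) := by
  have e : (casimir k : R →ₗ[k] R).toAddMonoidHom =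
      ∑ p ∈ Finset.univ.filter fun p : Fin r × Fin r => p.1 ≠ p.2,
        ((polar (κ := Fin s) k p.2 p.1 : R →+ R).comp (polar (κ := Fin s) k p.1 p.2 : R →+ R)) := by
    refine AddMonoidHom.ext fun f => ?_
    rw [AddMonoidHom.finsetSum_apply]
    exact casimir_apply k f
  have hne : ∀ p ∈ Finset.univ.filter fun p : Fin r × Fin r => p.1 ≠ p.2, p.1 ≠ p.2 :=
    fun p hp => (Finset.mem_filter.1 hp).2
  rw [e, cH_sum (fun p hp => (compat_polar (hne p hp)).comp (compat_polar (hne p hp).symm)) rfl]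
  refine Finset.sum_congr rfl fun p hp => ?_
  rw [cH_comp (compat_polar (hne p hp)) (compat_polar (hne p hp).symm),
    conH_polar_eq (hne p hp), conH_polar_eq (hne p hp).symm]

variable (D : ParamData k r s)

omit [CharZero k] in
theorem compat_ρ : Compat D.ρ.toAddMonoidHom 𝐩 𝐩 := compat_params D.ρ_param

omit [CharZero k] in
theorem compat_τ : Compat D.τ.toAddMonoidHom 𝐩 𝐩 := compat_params D.τ_param

omit [CharZero k] in
theorem compat_φ (j : D.J) : Compat (D.φ j).toAddMonoidHom 𝐩 𝐱 := compat_ofFn (D.φ_param j)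

omit [CharZero k] in
theorem compat_ι (j : D.J) : Compat (D.ι j).toAddMonoidHom 𝐱 𝐩 := compat_ofFn (D.ι_X j)

theorem cH_ρ_of_casimir (y : (cech R 𝐩).H n)
    (h : cH (casimir k : R →ₗ[k] R).toAddMonoidHom 𝐩 𝐩 n y = 0) :
    cH D.ρ.toAddMonoidHom 𝐩 𝐩 n y = y := by
  have e : AddMonoidHom.id R = D.ρ.toAddMonoidHom +
      D.τ.toAddMonoidHom.comp (casimir k : R →ₗ[k] R).toAddMonoidHom :=
    AddMonoidHom.ext fun f => D.ρ_add_τ f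
  conv_rhs => rw [← cH_id y, e, cH_add (compat_ρ D) (compat_casimir.comp (compat_τ D)),
    cH_comp compat_casimir (compat_τ D), h, map_zero, add_zero]

omit [CharZero k] in
theorem cH_sum_φ (y : (cech R 𝐩).H n) :
    (aeval (params k r s) D.c : R) • cH D.ρ.toAddMonoidHom 𝐩 𝐩 n y =
      ∑ j ∈ D.fin.elems, cH (D.ι j).toAddMonoidHom 𝐱 𝐩 n (cH (D.φ j).toAddMonoidHom 𝐩 𝐱 n y) := by
  have e : (DistribSMul.toAddMonoidHom R (aeval (params k r s) D.c : R)).comp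
      D.ρ.toAddMonoidHom = ∑ j ∈ D.fin.elems, (D.ι j).toAddMonoidHom.comp (D.φ j).toAddMonoidHom := by
    refine AddMonoidHom.ext fun f => ?_
    rw [AddMonoidHom.finsetSum_apply]
    exact D.sum_ι_φ f
  rw [← cH_smul_id, ← cH_comp (compat_ρ D) (compat_smul _ _), e,
    cH_sum (fun j _ => (compat_φ D j).comp (compat_ι D j)) rfl]
  exact Finset.sum_congr rfl fun j _ => cH_comp (compat_φ D j) (compat_ι D j) y

omit [CharZero k] in
theorem ρ_aeval (q : P) (f : R) :
    D.ρ (aeval (params k r s) q * f) = aeval (params k r s) q * D.ρ f := by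
  induction q using MvPolynomial.induction_on generalizing f with
  | C a => rw [algHom_C, ← Algebra.smul_def, map_smul, Algebra.smul_def]
  | add p q hp hq => rw [map_add, add_mul, map_add, hp, hq, add_mul]
  | mul_X p i hp => rw [map_mul (aeval (params k r s)), aeval_X, mul_assoc, hp, D.ρ_param, mul_assoc]

omit [CharZero k] in
theorem cH_ρ_smul (q : P) (y : (cech R 𝐩).H n) :
    cH D.ρ.toAddMonoidHom 𝐩 𝐩 n ((aeval (params k r s) q : R) • y) =
      (aeval (params k r s) q : R) • cH D.ρ.toAddMonoidHom 𝐩 𝐩 n y :=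
  cH_smul (compat_ρ D) (ρ_aeval D q) y

omit [CharZero k] in
theorem conH_polar_eq_zero {i j : Fin r} (hij : i ≠ j) (l : List R) (z : (cech R l).H n)
    (hz : ∀ a, (X a : R) • z = 0) : conH (polar k i j) l n z = 0 := by
  rw [conH_polar]
  refine Finset.sum_eq_zero fun c _ => ?_
  have h := conH_smul (k := k) (pderiv (j, c)) (X (i, c) : R) z
  rwa [hz, map_zero, pderiv_X, Pi.single_eq_of_ne (by simp [hij]), zero_smul, add_zero,
    eq_comm] at h

theorem cH_ρ_socle (z : (cech R 𝐩).H n) (hz : ∀ a, (X a : R) • z = 0) :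
    cH D.ρ.toAddMonoidHom 𝐩 𝐩 n z = z := by
  refine cH_ρ_of_casimir D z ?_
  rw [cH_casimir]
  refine Finset.sum_eq_zero fun p hp => ?_
  rw [conH_polar_eq_zero (Finset.mem_filter.1 hp).2 _ z hz, map_zero]

end params

end Cx

theorem inverseSystem.exists_smul_eq {k σ : Type} [Field k] [Fintype σ] {c : MvPolynomial σ k}
    (hc : c ≠ 0) (ψ : inverseSystem k σ) : ∃ φ : inverseSystem k σ, c • φ = ψ := by
  obtain ⟨h, hh⟩ := (inverseSystem.injective (k := k) (σ := σ)).out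
    (LinearMap.toSpanSingleton (MvPolynomial σ k) (MvPolynomial σ k) c)
    (fun a b hab => mul_right_cancel₀ hc hab)
    (LinearMap.toSpanSingleton (MvPolynomial σ k) (inverseSystem k σ) ψ)
  refine ⟨h 1, ?_⟩
  have := hh 1
  simp only [LinearMap.toSpanSingleton_apply, one_smul] at this
  rw [← map_smul, smul_eq_mul, mul_one, this]

namespace Cx

/-- There are no socle elements below the top degree. -/
theorem eq_zero_of_X_smul_eq_zero {k : Type} [Field k] [CharZero k] {r s : ℕ} (hr : 0 < r)
    (hrs : r ≤ s) {n : ℕ} (hn : n < r * (s - r) + 1)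
    (z : (cech (MvPolynomial (Fin r × Fin s) k) (List.ofFn (params k r s))).H n)
    (hz : ∀ a, (X a : MvPolynomial (Fin r × Fin s) k) • z = 0) : z = 0 := by
  obtain ⟨D⟩ := nonempty_paramData k hr hrs
  obtain ⟨W, hW, -⟩ := (isWeyl_conH k (Fin r × Fin s) (List.ofFn (params k r s)) n).exists_linearMap hz
  have hC : (aeval (params k r s) D.c : MvPolynomial (Fin r × Fin s) k) ≠ 0 := fun h =>
    D.c_ne ((injective_iff_map_eq_zero _).1 (algebraicIndependent_params hr hrs) _ h)
  obtain ⟨φ, hφ⟩ := inverseSystem.exists_smul_eq hC (inverseSystem.socle k _)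
  have := subsingleton_poly k _ n hn
  rw [← cH_ρ_socle D z hz, ← hW, ← hφ, map_smul, cH_ρ_smul, cH_sum_φ]
  exact Finset.sum_eq_zero fun j _ => by
    rw [Subsingleton.elim (cH (D.φ j).toAddMonoidHom _ (varList k _) n _) 0, map_zero]

end Cx

end

section ranks

variable {k M : Type} [Field k] [AddCommGroup M] [Module k M]

theorem rank_inf_ker_pow_le (T : Module.End k M) (U : Submodule k M) (hU : ∀ x ∈ U, T x ∈ U)
    (n : ℕ) : Module.rank k (U ⊓ LinearMap.ker (T ^ n) : Submodule k M) ≤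
      n * Module.rank k (U ⊓ LinearMap.ker T : Submodule k M) := by
  induction n with
  | zero =>
    have : (U ⊓ LinearMap.ker (T ^ 0) : Submodule k M) = ⊥ :=
      (Submodule.eq_bot_iff _).2 fun x hx => hx.2
    rw [this]
    simp
  | succ n ih =>
    let f := T.domRestrict (U ⊓ LinearMap.ker (T ^ (n + 1)))
    have h1 : Module.rank k (LinearMap.range f) ≤
        Module.rank k (U ⊓ LinearMap.ker (T ^ n) : Submodule k M) := by
      refine Submodule.rank_mono ?_
      rintro _ ⟨x, rfl⟩
      refine ⟨hU _ x.2.1, ?_⟩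
      have h : (T ^ (n + 1)) x.1 = 0 := x.2.2
      have e : (T ^ n) (T x.1) = (T ^ (n + 1)) x.1 :=
        (LinearMap.congr_fun (pow_succ T n) x.1).symm
      exact e.trans h
    have h2 : Module.rank k (LinearMap.ker f) ≤
        Module.rank k (U ⊓ LinearMap.ker T : Submodule k M) := by
      let g : LinearMap.ker f →ₗ[k] (U ⊓ LinearMap.ker T : Submodule k M) :=
        LinearMap.codRestrict _ ((Submodule.subtype _).comp (Submodule.subtype _))
          fun x => ⟨x.1.2.1, x.2⟩
      refine LinearMap.rank_le_of_injective g fun x y h => ?_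
      have h' : (g x : M) = g y := congrArg _ h
      exact Subtype.ext (Subtype.ext h')
    rw [← LinearMap.rank_range_add_rank_ker f, Nat.cast_succ, add_mul, one_mul]
    exact add_le_add (h1.trans ih) h2

omit [Field k] [AddCommGroup M] [Module k M] in
theorem iInf_mem_cons {α L : Type} [CompleteLattice L] (a : α) (l : List α) (f : α → L) :
    ⨅ x ∈ a :: l, f x = f a ⊓ ⨅ x ∈ l, f x := by
  refine le_antisymm (le_inf (iInf₂_le a List.mem_cons_self)
    (le_iInf₂ fun x hx => iInf₂_le x (List.mem_cons_of_mem _ hx))) (le_iInf₂ fun x hx => ?_)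
  rcases List.mem_cons.1 hx with rfl | hx
  · exact inf_le_left
  · exact inf_le_right.trans (iInf₂_le x hx)

theorem rank_iInf_ker_pow_le (l : List (Module.End k M)) (hc : ∀ S ∈ l, ∀ T ∈ l, Commute S T)
    (n : ℕ) (U : Submodule k M) (hU : ∀ T ∈ l, ∀ x ∈ U, T x ∈ U) :
    Module.rank k (U ⊓ ⨅ T ∈ l, LinearMap.ker (T ^ n) : Submodule k M) ≤
      (n : Cardinal) ^ l.length *
        Module.rank k (U ⊓ ⨅ T ∈ l, LinearMap.ker T : Submodule k M) := by
  induction l generalizing U with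
  | nil =>
    rw [List.length_nil, pow_zero, one_mul]
    exact Submodule.rank_mono (inf_le_inf_left _ (le_iInf₂ fun x hx => absurd hx List.not_mem_nil))
  | cons T l ih =>
    rw [iInf_mem_cons, iInf_mem_cons, ← inf_assoc, ← inf_assoc]
    have hU' : ∀ S ∈ l, ∀ x ∈ U ⊓ LinearMap.ker (T ^ n), S x ∈ U ⊓ LinearMap.ker (T ^ n) := by
      intro S hS x hx
      have hx' := Submodule.mem_inf.1 hx
      have h := (hc S (List.mem_cons_of_mem _ hS) T List.mem_cons_self).pow_right n
      refine Submodule.mem_inf.2 ⟨hU S (List.mem_cons_of_mem _ hS) x hx'.1, ?_⟩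
      rw [LinearMap.mem_ker, ← Module.End.mul_apply, ← h.eq, Module.End.mul_apply,
        LinearMap.mem_ker.1 hx'.2, map_zero]
    refine (ih (fun S hS T hT => hc S (List.mem_cons_of_mem _ hS) T (List.mem_cons_of_mem _ hT))
      _ hU').trans ?_
    rw [List.length_cons, pow_succ, mul_assoc, inf_right_comm,
      inf_right_comm U (LinearMap.ker T)]
    refine mul_le_mul_right (rank_inf_ker_pow_le T (U ⊓ ⨅ S ∈ l, LinearMap.ker S)
      (fun x hx => ?_) n) _
    have hx' := Submodule.mem_inf.1 hx
    refine Submodule.mem_inf.2 ⟨hU T List.mem_cons_self x hx'.1,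
      (Submodule.mem_iInf _).2 fun S => (Submodule.mem_iInf _).2 fun hS => ?_⟩
    have h := hc S (List.mem_cons_of_mem _ hS) T List.mem_cons_self
    have hx2 : S x = 0 := (Submodule.mem_iInf _).1 ((Submodule.mem_iInf _).1 hx'.2 S) hS
    rw [LinearMap.mem_ker, ← Module.End.mul_apply, h.eq, Module.End.mul_apply, hx2, map_zero]

theorem finrank_le_of_ker_le {V W Z : Type} [AddCommGroup V] [Module k V] [AddCommGroup W]
    [Module k W] [AddCommGroup Z] [Module k Z] [FiniteDimensional k V] [FiniteDimensional k W]
    (α : V →ₗ[k] W) (β : V →ₗ[k] Z) (h : LinearMap.ker α ≤ LinearMap.ker β)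
    (hβ : Function.Surjective β) : Module.finrank k Z ≤ Module.finrank k W := by
  have h1 := LinearMap.finrank_range_add_finrank_ker α
  have h2 := LinearMap.finrank_range_add_finrank_ker β
  have h3 := Submodule.finrank_mono h
  have h4 := Submodule.finrank_le (LinearMap.range α)
  rw [LinearMap.range_eq_top.2 hβ, finrank_top] at h2
  omega

end ranks

theorem exists_pow_lt_two_mul_pow (d δ : ℕ) : ∃ m : ℕ, (m + δ + 1) ^ d < 2 * (m + 1) ^ d := by
  refine ⟨2 * d * δ, ?_⟩
  have h0 : (0 : ℚ) < (2 * d * δ + δ + 1 : ℚ) := by positivity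
  have h := one_add_mul_le_pow (a := -((δ : ℚ) / (2 * d * δ + δ + 1))) (by
    rw [neg_le_neg_iff, div_le_iff₀ h0]
    nlinarith [show (0 : ℚ) ≤ d * δ by positivity, show (0 : ℚ) ≤ δ by positivity]) d
  have e : (1 : ℚ) + -((δ : ℚ) / (2 * d * δ + δ + 1)) =
      (2 * d * δ + 1) / (2 * d * δ + δ + 1) := by
    field_simp
    ring
  have h' : (1 : ℚ) / 2 < 1 + d * -((δ : ℚ) / (2 * d * δ + δ + 1)) := by
    have : (d : ℚ) * ((δ : ℚ) / (2 * d * δ + δ + 1)) < 1 / 2 := by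
      rw [← mul_div_assoc, div_lt_iff₀ h0]
      nlinarith [show (0 : ℚ) ≤ δ by positivity]
    linarith
  rw [e, div_pow] at h
  have h2 := h'.trans_le h
  rw [lt_div_iff₀ (by positivity)] at h2
  have h3 : ((2 * d * δ + δ + 1 : ℕ) : ℚ) ^ d < 2 * ((2 * d * δ + 1 : ℕ) : ℚ) ^ d := by
    push_cast
    linarith
  exact_mod_cast h3

section

open MvPolynomial

section growth

variable {k : Type} [Field k] [CharZero k] {r s : ℕ}

local notation "R" => MvPolynomial (Fin r × Fin s) k
local notation "P" => MvPolynomial (Fin (r * (s - r) + 1)) k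

/-- The sum of the homogeneous components of degree at most `N`. -/
noncomputable def truncHom (k σ : Type) [Field k] (N : ℕ) :
    MvPolynomial σ k →ₗ[k] MvPolynomial σ k :=
  ∑ i ∈ Finset.range (N + 1), homogeneousComponent i

omit [CharZero k] in
theorem truncHom_apply {σ : Type} (N : ℕ) (f : MvPolynomial σ k) :
    truncHom k σ N f = ∑ i ∈ Finset.range (N + 1), homogeneousComponent i f := by
  rw [truncHom, LinearMap.sum_apply]

omit [CharZero k] in
theorem truncHom_eq {σ : Type} {N : ℕ} {f : MvPolynomial σ k} (h : f.totalDegree ≤ N) :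
    truncHom k σ N f = f := by
  rw [truncHom_apply]
  conv_rhs => rw [← sum_homogeneousComponent f]
  refine (Finset.sum_subset (Finset.range_mono (by omega)) fun i _ hi => ?_).symm
  rw [Finset.mem_range] at hi
  exact homogeneousComponent_eq_zero _ _ (by omega)

omit [CharZero k] in
theorem truncHom_mul_of_lt {σ : Type} {N e : ℕ} (h : N < e) {g : MvPolynomial σ k}
    (hg : g.IsHomogeneous e) (f : MvPolynomial σ k) : truncHom k σ N (g * f) = 0 := by
  rw [truncHom_apply]
  refine Finset.sum_eq_zero fun i hi => ?_
  rw [homogeneousComponent_mul_of_isHomogeneous hg, if_neg]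
  rw [Finset.mem_range] at hi
  omega

omit [CharZero k] in
theorem exists_truncHom_mul {σ : Type} (N : ℕ) {e : ℕ} {g : MvPolynomial σ k}
    (hg : g.IsHomogeneous e) (f : MvPolynomial σ k) : ∃ h, truncHom k σ N (g * f) = g * h := by
  rw [truncHom_apply]
  refine ⟨∑ i ∈ Finset.range (N + 1), if e ≤ i then homogeneousComponent (i - e) f else 0, ?_⟩
  rw [Finset.mul_sum]
  refine Finset.sum_congr rfl fun i _ => ?_
  rw [homogeneousComponent_mul_of_isHomogeneous hg]
  split_ifs <;> simp

/-- The exponents all of whose entries are at most `n`. -/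
noncomputable def boxExp {d : ℕ} (n : ℕ) (b : Fin d → Fin (n + 1)) : Fin d →₀ ℕ :=
  Finsupp.equivFunOnFinite.symm fun i => (b i : ℕ)

theorem boxExp_injective {d n : ℕ} : Function.Injective (boxExp (d := d) n) := fun _ _ h =>
  funext fun i => Fin.ext (congrFun (Finsupp.equivFunOnFinite.symm.injective h) i)

theorem exists_boxExp {d n : ℕ} {a : Fin d →₀ ℕ} (h : ∀ i, a i ≤ n) : ∃ b, boxExp n b = a :=
  ⟨fun i => ⟨a i, Nat.lt_succ_of_le (h i)⟩, Finsupp.ext fun _ => rfl⟩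

theorem boxExp_le {d n : ℕ} (b : Fin d → Fin (n + 1)) (i : Fin d) : boxExp n b i ≤ n :=
  Nat.le_of_lt_succ (b i).2

variable (D : ParamData k r s)

omit [CharZero k] in
theorem ParamData.φ_param_pow (j : D.J) (l : Fin (r * (s - r) + 1)) (n : ℕ) (f : R) :
    D.φ j (params k r s l ^ n * f) = X l ^ n * D.φ j f := by
  induction n generalizing f with
  | zero => simp
  | succ n ih => rw [pow_succ, mul_assoc, ih, D.φ_param, pow_succ, mul_assoc]

omit [CharZero k] in
theorem ParamData.φ_aeval (j : D.J) (q : P) (f : R) :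
    D.φ j (aeval (params k r s) q * f) = q * D.φ j f := by
  induction q using MvPolynomial.induction_on generalizing f with
  | C a => rw [algHom_C, ← Algebra.smul_def, map_smul, smul_eq_C_mul]
  | add p q hp hq => rw [map_add, add_mul, map_add, hp, hq, add_mul]
  | mul_X p i hp => rw [map_mul (aeval (params k r s)), aeval_X, mul_assoc, hp, D.φ_param, mul_assoc]

/-- The functional with prescribed values on low degree invariants. -/
noncomputable def boxFunctional (N n : ℕ) (v : D.J × (Fin (r * (s - r) + 1) → Fin (n + 1)) → k) :
    R →ₗ[k] k :=
  ∑ p, v p • (lcoeff k (boxExp n p.2)).comp ((D.φ p.1).comp (truncHom k (Fin r × Fin s) N))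

omit [CharZero k] in
theorem boxFunctional_apply (N n : ℕ) (v : D.J × (Fin (r * (s - r) + 1) → Fin (n + 1)) → k)
    (f : R) : boxFunctional D N n v f =
      ∑ p, v p * coeff (boxExp n p.2) (D.φ p.1 (truncHom k (Fin r × Fin s) N f)) := by
  rw [boxFunctional, LinearMap.sum_apply]
  rfl

omit [CharZero k] in
theorem boxFunctional_mem (N n : ℕ) (v : D.J × (Fin (r * (s - r) + 1) → Fin (n + 1)) → k) :
    Functionals.mk (boxFunctional D N n v) ∈ inverseSystem k (Fin r × Fin s) :=
  inverseSystem.mem_iff.2 fun i => ⟨N + 1, Functionals.ext fun f => by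
    rw [Functionals.smul_apply, Functionals.mk_apply, boxFunctional_apply,
      truncHom_mul_of_lt (Nat.lt_succ_self N) (isHomogeneous_X_pow i _)]
    simp [Functionals.zero_apply]⟩

/-- `boxFunctional` as an element of the inverse system. -/
noncomputable def boxElem (N n : ℕ) (v : D.J × (Fin (r * (s - r) + 1) → Fin (n + 1)) → k) :
    inverseSystem k (Fin r × Fin s) :=
  ⟨Functionals.mk (boxFunctional D N n v), boxFunctional_mem D N n v⟩

omit [CharZero k] in
theorem boxElem_apply (N n : ℕ) (v : D.J × (Fin (r * (s - r) + 1) → Fin (n + 1)) → k)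
    (f : R) : (boxElem D N n v).1 f =
      ∑ p, v p * coeff (boxExp n p.2) (D.φ p.1 (truncHom k (Fin r × Fin s) N f)) :=
  boxFunctional_apply D N n v f

omit [CharZero k] in
theorem boxElem_add (N n : ℕ) (v w : D.J × (Fin (r * (s - r) + 1) → Fin (n + 1)) → k) :
    boxElem D N n (v + w) = boxElem D N n v + boxElem D N n w :=
  Subtype.ext <| Functionals.ext fun f => by
    rw [Submodule.coe_add, Functionals.add_apply, boxElem_apply, boxElem_apply, boxElem_apply,
      ← Finset.sum_add_distrib]
    exact Finset.sum_congr rfl fun p _ => add_mul _ _ _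

omit [CharZero k] in
theorem boxElem_smul (N n : ℕ) (a : k) (v : D.J × (Fin (r * (s - r) + 1) → Fin (n + 1)) → k) :
    boxElem D N n (a • v) = (C a : R) • boxElem D N n v :=
  Subtype.ext <| Functionals.ext fun f => by
    rw [Submodule.coe_smul, Functionals.smul_apply, boxElem_apply, boxElem_apply,
      ← smul_eq_C_mul, Finset.sum_congr rfl fun p _ => ?_]
    rw [map_smul, map_smul, coeff_smul, smul_eq_mul, Pi.smul_apply, smul_eq_mul]
    ring

omit [CharZero k] in
theorem boxElem_casimir (N n : ℕ) (v : D.J × (Fin (r * (s - r) + 1) → Fin (n + 1)) → k) (f : R) :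
    (boxElem D N n v).1 (casimir k f) = 0 := by
  rw [boxElem_apply]
  refine Finset.sum_eq_zero fun p _ => ?_
  have : truncHom k (Fin r × Fin s) N (casimir k f) = casimir k (truncHom k _ N f) := by
    rw [truncHom_apply, truncHom_apply, map_sum]
    exact Finset.sum_congr rfl fun i _ => homogeneousComponent_casimir i f
  rw [this, ← D.φ_ρ, D.ρ_casimir, map_zero, coeff_zero, mul_zero]

omit [CharZero k] in
theorem params_pow_smul_boxElem (N n : ℕ) (v : D.J × (Fin (r * (s - r) + 1) → Fin (n + 1)) → k)
    (l : Fin (r * (s - r) + 1)) : params k r s l ^ (n + 1) • boxElem D N n v = 0 :=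
  Subtype.ext <| Functionals.ext fun f => by
    rw [Submodule.coe_smul, Functionals.smul_apply, boxElem_apply]
    refine Finset.sum_eq_zero fun p _ => ?_
    obtain ⟨h, hh⟩ := exists_truncHom_mul N ((isHomogeneous_params (k := k) l).pow (n + 1)) f
    rw [hh, D.φ_param_pow, X_pow_eq_monomial, coeff_monomial_mul', if_neg, mul_zero]
    intro hle
    have := hle l
    have := boxExp_le p.2 l
    simp at *
    omega

omit [CharZero k] in
theorem boxElem_aeval_mul {N n : ℕ} (q : P) (j : D.J)
    (v : D.J × (Fin (r * (s - r) + 1) → Fin (n + 1)) → k)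
    (hN : (aeval (params k r s) q * D.ι j 1 : R).totalDegree ≤ N) :
    (boxElem D N n v).1 (aeval (params k r s) q * D.ι j 1) =
      ∑ b, v (j, b) * coeff (boxExp n b) (q * D.c) := by
  rw [boxElem_apply, truncHom_eq hN, Fintype.sum_prod_type, Finset.sum_eq_single j]
  · simp only [D.φ_aeval, D.φ_ι, if_true, mul_one]
  · intro i _ hij
    simp only [D.φ_aeval, D.φ_ι, if_neg hij.symm, mul_zero, coeff_zero, Finset.sum_const_zero]
  · simp

/-- The pairing matrix given by multiplication by `q`. -/
noncomputable def boxPairing {d : ℕ} (J : Type) (n m : ℕ) (q : MvPolynomial (Fin d) k) :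
    (J × (Fin d → Fin (n + 1)) → k) →ₗ[k] (J × (Fin d → Fin (m + 1)) → k) where
  toFun v p := ∑ b, v (p.1, b) * coeff (boxExp n b) (monomial (boxExp m p.2) 1 * q)
  map_add' v w := funext fun p => by simp [add_mul, Finset.sum_add_distrib]
  map_smul' a v := funext fun p => by simp [mul_assoc, Finset.mul_sum]

omit [CharZero k] in
theorem boxPairing_surjective {d : ℕ} (J : Type) [Finite J] {n m : ℕ} {q : MvPolynomial (Fin d) k}
    (hq : q ≠ 0) (hn : m + q.totalDegree ≤ n) : Function.Surjective (boxPairing J n m q) := by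
  classical
  let _ := Fintype.ofFinite J
  rw [← LinearMap.range_eq_top]
  by_contra h
  obtain ⟨f, hf, hle⟩ := Submodule.exists_le_ker_of_lt_top _ (lt_top_iff_ne_top.2 h)
  let g : J → MvPolynomial (Fin d) k := fun j =>
    ∑ b', monomial (boxExp m b') (f (Pi.single (j, b') 1))
  have hg : ∀ j, g j * q = 0 := by
    intro j
    ext a
    rw [coeff_zero]
    by_cases ha : ∀ i, a i ≤ n
    · obtain ⟨b, rfl⟩ := exists_boxExp ha
      have h1 := hle ⟨Pi.single (j, b) 1, rfl⟩
      rw [LinearMap.mem_ker, LinearMap.pi_apply_eq_sum_univ f, Fintype.sum_prod_type,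
        Finset.sum_eq_single j] at h1
      · rw [← h1, Finset.sum_mul, coeff_sum]
        refine Finset.sum_congr rfl fun b' _ => ?_
        have : boxPairing J n m q (Pi.single (j, b) 1) (j, b') =
            coeff (boxExp n b) (monomial (boxExp m b') 1 * q) := by
          change ∑ b₁, _ = _
          rw [Finset.sum_eq_single b]
          · simp
          · intro b₁ _ hb
            rw [Pi.single_eq_of_ne (by simpa using hb), zero_mul]
          · simp
        rw [this, ← mul_one (f _), ← smul_eq_mul (f _) (1 : k), ← smul_monomial, smul_mul_assoc,
          coeff_smul, smul_eq_mul, smul_eq_mul, mul_comm]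
        congr 2
        exact funext fun _ => by simp [Pi.single_apply, eq_comm]
      · intro i _ hi
        refine Finset.sum_eq_zero fun b' _ => ?_
        have : boxPairing J n m q (Pi.single (j, b) 1) (i, b') = 0 :=
          Finset.sum_eq_zero fun b₁ _ => by
            rw [Pi.single_eq_of_ne (by simp [hi]), zero_mul]
        rw [this, zero_smul]
      · simp
    · push Not at ha
      obtain ⟨i, hi⟩ := ha
      rw [Finset.sum_mul, coeff_sum]
      refine Finset.sum_eq_zero fun b' _ => ?_
      rw [coeff_monomial_mul']
      split_ifs with hle'
      · rw [coeff_eq_zero_of_totalDegree_lt, mul_zero]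
        have h2 := boxExp_le b' i
        have h3 := hle' i
        calc q.totalDegree < (a - boxExp m b') i := by
              rw [Finsupp.tsub_apply]
              omega
          _ ≤ _ := by
            by_cases h0 : (a - boxExp m b') i = 0
            · rw [h0]; exact Nat.zero_le _
            · exact Finset.single_le_sum (f := fun i => (a - boxExp m b') i)
                (fun _ _ => Nat.zero_le _) (Finsupp.mem_support_iff.2 h0)
      · rfl
  refine hf (LinearMap.ext fun v => ?_)
  rw [LinearMap.pi_apply_eq_sum_univ f, LinearMap.zero_apply]
  refine Finset.sum_eq_zero fun p _ => ?_
  have h0 := (mul_eq_zero.1 (hg p.1)).resolve_right hq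
  have h1 := congrArg (coeff (boxExp m p.2)) h0
  rw [coeff_sum, Finset.sum_eq_single p.2, coeff_monomial, if_pos rfl, coeff_zero] at h1
  · have e : (fun j => if p = j then (1 : k) else 0) = Pi.single (p.1, p.2) 1 :=
      funext fun _ => by simp [Pi.single_apply, eq_comm]
    rw [e, h1, smul_zero]
  · intro b' _ hb
    rw [coeff_monomial, if_neg (fun h => hb (boxExp_injective h))]
  · simp

omit [CharZero k] in
theorem rank_le_of_socle {d : ℕ} {H : Type} [AddCommGroup H] [Module (MvPolynomial (Fin d) k) H]
    [Module k H] [IsScalarTower k (MvPolynomial (Fin d) k) H] (z : H)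
    (hz : ∀ v : H, (∀ i, (X i : MvPolynomial (Fin d) k) • v = 0) →
      ∃ a : k, v = (C a : MvPolynomial (Fin d) k) • z) (n : ℕ) (F : Submodule k H)
    (hF : ∀ v ∈ F, ∀ i, (X i : MvPolynomial (Fin d) k) ^ n • v = 0) :
    Module.rank k F ≤ ((n ^ d : ℕ) : Cardinal) := by
  let T : Fin d → Module.End k H := fun i =>
    Module.toModuleEnd k (S := MvPolynomial (Fin d) k) H (X i)
  have hT : ∀ i j, Commute (T i) (T j) := fun i j =>
    (Commute.all (X i : MvPolynomial (Fin d) k) (X j)).map (Module.toModuleEnd k H)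
  have h := rank_iInf_ker_pow_le (List.ofFn T)
    (by
      intro S hS S' hS'
      obtain ⟨i, rfl⟩ := List.mem_ofFn.1 hS
      obtain ⟨j, rfl⟩ := List.mem_ofFn.1 hS'
      exact hT i j) n ⊤ fun _ _ _ _ => trivial
  have h1 : Module.rank k (⊤ ⊓ ⨅ S ∈ List.ofFn T, LinearMap.ker S : Submodule k H) ≤ 1 := by
    refine (Submodule.rank_mono (t := k ∙ z) fun v hv => ?_).trans ?_
    · obtain ⟨a, ha⟩ := hz v fun i => (Submodule.mem_iInf _).1 ((Submodule.mem_iInf _).1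
        (Submodule.mem_inf.1 hv).2 (T i)) (List.mem_ofFn.2 ⟨i, rfl⟩)
      refine Submodule.mem_span_singleton.2 ⟨a, ?_⟩
      rw [ha, ← algebraMap_smul (MvPolynomial (Fin d) k) a z]
      rfl
    · exact (rank_span_le _).trans (by simp)
  calc Module.rank k F ≤ Module.rank k (⊤ ⊓ ⨅ S ∈ List.ofFn T, LinearMap.ker (S ^ n) :
        Submodule k H) := Submodule.rank_mono fun v hv => Submodule.mem_inf.2 ⟨trivial,
          (Submodule.mem_iInf _).2 fun S => (Submodule.mem_iInf _).2 fun hS => by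
            obtain ⟨i, rfl⟩ := List.mem_ofFn.1 hS
            rw [LinearMap.mem_ker, ← map_pow]
            exact hF v hv i⟩
    _ ≤ _ := h
    _ ≤ (n : Cardinal) ^ d * 1 := by
      rw [List.length_ofFn]
      exact mul_le_mul_right h1 _
    _ = _ := by push_cast; rw [mul_one]

omit [CharZero k] in
/-- Two independent copies of the inverse system have too many invariants to be controlled by
copies of a module over the parameter ring with simple socle. -/
theorem ParamData.not_injective (D : ParamData k r s) {H H' : Type} [AddCommGroup H] [Module R H]
    [AddCommGroup H'] [Module P H'] (Ω : (Fin 2 → inverseSystem k (Fin r × Fin s)) →ₗ[R] H)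
    (Φ : D.J → H →+ H') (hΦ : ∀ (j) (q : P) y, Φ j ((aeval (params k r s) q : R) • y) = q • Φ j y)
    (h : ∀ ψ, (∀ ε f, (ψ ε).1 (casimir k f) = 0) → (∀ j, Φ j (Ω ψ) = 0) →
      (aeval (params k r s) D.c : R) • Ω ψ = 0) (z : H')
    (hz : ∀ v : H', (∀ i, (X i : P) • v = 0) → ∃ a : k, v = (C a : P) • z) :
    ¬ Function.Injective Ω := by
  intro hΩ
  let _ : Module k H' := Module.compHom H' (algebraMap k P)
  have : IsScalarTower k P H' := ⟨fun a q v => by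
    change (a • q) • v = algebraMap k P a • q • v
    rw [Algebra.smul_def, mul_smul]⟩
  obtain ⟨m, hm⟩ := exists_pow_lt_two_mul_pow (r * (s - r) + 1) (D.c * D.c).totalDegree
  let n := m + (D.c * D.c).totalDegree
  let N : ℕ := Finset.univ.sup fun p : D.J × (Fin (r * (s - r) + 1) → Fin (m + 1)) =>
    (aeval (params k r s) (D.c * monomial (boxExp m p.2) 1) * D.ι p.1 1 : R).totalDegree
  let F : Submodule k H' := ⨅ i : Fin (r * (s - r) + 1), LinearMap.ker
    (Module.toModuleEnd k (S := P) H' ((X i : P) ^ (n + 1)))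
  have hF : ∀ v, v ∈ F ↔ ∀ i, (X i : P) ^ (n + 1) • v = 0 := fun v => Submodule.mem_iInf _
  have hrank := rank_le_of_socle z hz (n + 1) F fun v hv => (hF v).1 hv
  have : FiniteDimensional k F :=
    Module.rank_lt_aleph0_iff.1 (hrank.trans_lt (Cardinal.natCast_lt_aleph0))
  have hfin : Module.finrank k F ≤ (n + 1) ^ (r * (s - r) + 1) := by
    rw [← Module.finrank_eq_rank] at hrank
    exact_mod_cast hrank
  have hC : ∀ (j) (a : k) y, Φ j ((C a : R) • y) = (C a : P) • Φ j y := fun j a y => by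
    rw [← hΦ, algHom_C]
    rfl
  let V := Fin 2 → D.J × (Fin (r * (s - r) + 1) → Fin (n + 1)) → k
  let ψ : V → Fin 2 → inverseSystem k (Fin r × Fin s) := fun v ε => boxElem D N n (v ε)
  have hψa : ∀ v w, ψ (v + w) = ψ v + ψ w := fun v w => funext fun ε => boxElem_add D N n _ _
  have hψs : ∀ (a : k) v, ψ (a • v) = (C a : R) • ψ v := fun a v =>
    funext fun ε => boxElem_smul D N n a _
  let α : V →ₗ[k] D.J → F :=
    { toFun := fun v j => ⟨Φ j (Ω (ψ v)), (hF _).2 fun i => by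
        have e : (X i : P) ^ (n + 1) • Φ j (Ω (ψ v)) =
            Φ j ((params k r s i ^ (n + 1)) • Ω (ψ v)) := by
          rw [← hΦ, map_pow (aeval (params k r s)), aeval_X]
        have e' : params k r s i ^ (n + 1) • ψ v = 0 :=
          funext fun ε => params_pow_smul_boxElem D N n _ i
        rw [e, ← map_smul, e', map_zero, map_zero]⟩
      map_add' := fun v w => funext fun j => Subtype.ext <| by
        simp only [hψa, map_add]
        rfl
      map_smul' := fun a v => funext fun j => Subtype.ext <| by
        simp only [hψs, map_smul, hC]
        rfl }
  let β : V →ₗ[k] Fin 2 → D.J × (Fin (r * (s - r) + 1) → Fin (m + 1)) → k :=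
    (boxPairing D.J n m (D.c * D.c)).compLeft (Fin 2)
  have hβ : Function.Surjective β := fun w => by
    choose v hv using fun ε => boxPairing_surjective D.J (mul_ne_zero D.c_ne D.c_ne)
      (le_refl n) (w ε)
    exact ⟨v, funext hv⟩
  have hker : LinearMap.ker α ≤ LinearMap.ker β := by
    intro v hv
    have h1 : ∀ j, Φ j (Ω (ψ v)) = 0 := fun j => congrArg Subtype.val (congrFun (LinearMap.mem_ker.1 hv) j)
    have h2 := h (ψ v) (fun ε f => boxElem_casimir D N n _ f) h1
    rw [← map_smul, ← map_zero Ω] at h2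
    have h3 := hΩ h2
    refine LinearMap.mem_ker.2 (funext fun ε => funext fun p => ?_)
    have h4 : (boxElem D N n (v ε)).1 (aeval (params k r s) (D.c * monomial (boxExp m p.2) 1) *
        D.ι p.1 1) = 0 := by
      have h5 : (aeval (params k r s) D.c : R) • boxElem D N n (v ε) = 0 := congrFun h3 ε
      rw [map_mul (aeval (params k r s)), mul_assoc, ← Functionals.smul_apply,
        ← Submodule.coe_smul, h5, ZeroMemClass.coe_zero, Functionals.zero_apply]
    rw [boxElem_aeval_mul] at h4
    · refine Eq.trans (Finset.sum_congr rfl fun b _ => ?_) h4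
      rw [mul_comm D.c (monomial _ _), mul_assoc]
    · exact Finset.le_sup (f := fun p : D.J × (Fin (r * (s - r) + 1) → Fin (m + 1)) =>
        (aeval (params k r s) (D.c * monomial (boxExp m p.2) 1) * D.ι p.1 1 : R).totalDegree)
        (Finset.mem_univ p)
  have hle := finrank_le_of_ker_le α β hker hβ
  simp only [Module.finrank_pi_fintype, Module.finrank_self, Finset.sum_const, Finset.card_univ,
    Fintype.card_prod, Fintype.card_fun, Fintype.card_fin, smul_eq_mul, mul_one] at hle
  have hJ : 0 < Fintype.card D.J := Fintype.card_pos
  have h5 := Nat.mul_le_mul_left (Fintype.card D.J) hfin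
  have h6 : (m + (D.c * D.c).totalDegree + 1) ^ (r * (s - r) + 1) = (n + 1) ^ (r * (s - r) + 1) := rfl
  rw [h6] at hm
  have h7 := Nat.mul_lt_mul_of_pos_left hm hJ
  nlinarith

end growth

end

section

open MvPolynomial

theorem exists_smul_ne_zero_socle {k σ M : Type} [CommRing k] [Finite σ] [AddCommGroup M]
    [Module (MvPolynomial σ k) M] {y : M} (hy : y ≠ 0)
    (h : ∀ i, ∃ N : ℕ, (X i : MvPolynomial σ k) ^ N • y = 0) :
    ∃ f : MvPolynomial σ k, f • y ≠ 0 ∧ ∀ i, (X i : MvPolynomial σ k) • f • y = 0 := by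
  classical
  let _ := Fintype.ofFinite σ
  suffices ∀ s : Finset σ, ∃ f : MvPolynomial σ k, f • y ≠ 0 ∧
      ∀ i ∈ s, (X i : MvPolynomial σ k) • f • y = 0 by
    obtain ⟨f, hf, hf'⟩ := this Finset.univ
    exact ⟨f, hf, fun i => hf' i (Finset.mem_univ i)⟩
  intro s
  induction s using Finset.induction_on with
  | empty => exact ⟨1, by rwa [one_smul], fun i hi => absurd hi (Finset.notMem_empty i)⟩
  | insert i s _ ih =>
    obtain ⟨f, hf, hf'⟩ := ih
    have hex : ∃ N : ℕ, (X i : MvPolynomial σ k) ^ N • f • y = 0 := by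
      obtain ⟨N, hN⟩ := h i
      exact ⟨N, by rw [smul_comm, hN, smul_zero]⟩
    obtain ⟨N, hN⟩ : ∃ N, Nat.find hex = N + 1 := Nat.exists_eq_succ_of_ne_zero fun h0 => by
      have := Nat.find_spec hex
      rw [h0, pow_zero, one_smul] at this
      exact hf this
    refine ⟨X i ^ N * f, ?_, ?_⟩
    · rw [mul_smul]
      exact Nat.find_min hex (by omega)
    · rw [Finset.forall_mem_insert]
      refine ⟨?_, fun j hj => ?_⟩
      · rw [mul_smul, ← mul_smul, ← pow_succ', ← hN]
        exact Nat.find_spec hex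
      · rw [mul_smul, smul_comm, hf' j hj, smul_zero]

theorem inverseSystem.sum_injective {k σ ι H : Type} [Field k] [Fintype σ] [Fintype ι]
    [AddCommGroup H] [Module (MvPolynomial σ k) H]
    (W : ι → inverseSystem k σ →ₗ[MvPolynomial σ k] H)
    (h : ∀ α : ι → k, ∑ i, (C (α i) : MvPolynomial σ k) • W i (inverseSystem.socle k σ) = 0 →
      α = 0) :
    Function.Injective (∑ i, (W i).comp (LinearMap.proj i) :
      (ι → inverseSystem k σ) →ₗ[MvPolynomial σ k] H) := by
  rw [injective_iff_map_eq_zero]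
  intro ψ hψ
  by_contra hne
  obtain ⟨f, α, hα, hf⟩ := inverseSystem.exists_smul_eq_socle ψ hne
  refine hα (h α ?_)
  have := congrArg (fun y => f • y) hψ
  simp only [smul_zero, LinearMap.sum_apply, LinearMap.comp_apply, LinearMap.proj_apply,
    Finset.smul_sum, ← map_smul, hf] at this
  rw [← this]
  exact Finset.sum_congr rfl fun i _ => (map_smul (W i) _ _).symm

theorem inverseSystem.exists_comp_derivation {k σ : Type} [Field k] [Fintype σ]
    (δ : Derivation k (MvPolynomial σ k) (MvPolynomial σ k)) (ψ : inverseSystem k σ) :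
    ∃ φ : inverseSystem k σ, ∀ f, φ.1 f = ψ.1 (δ f) := by
  refine ⟨⟨Functionals.mk ((ψ.1 : MvPolynomial σ k →ₗ[k] k).comp δ.toLinearMap),
    inverseSystem.mem_iff.2 fun i => ?_⟩, fun f => rfl⟩
  obtain ⟨N, hN⟩ := inverseSystem.mem_iff.1 ψ.2 i
  refine ⟨N + 1, Functionals.ext fun f => ?_⟩
  have h : ∀ g, ψ.1 (X i ^ N * g) = 0 := fun g => by
    rw [← Functionals.smul_apply, hN, Functionals.zero_apply]
  have e : δ (X i ^ (N + 1) * f) = X i ^ N * (X i * δ f + ((N : MvPolynomial σ k) + 1) * δ (X i) * f) := by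
    rw [Derivation.leibniz, Derivation.leibniz_pow]
    simp only [smul_eq_mul, nsmul_eq_mul, Nat.add_sub_cancel, Nat.cast_add, Nat.cast_one]
    ring
  change ψ.1 (δ (X i ^ (N + 1) * f)) = 0
  rw [e, h]

namespace Cx

section params

variable {k : Type} [Field k] [CharZero k] {r s : ℕ} {n : ℤ}

local notation "R" => MvPolynomial (Fin r × Fin s) k
local notation "P" => MvPolynomial (Fin (r * (s - r) + 1)) k
local notation "𝐩" => List.ofFn (params k r s)
local notation "𝐱" => varList k (r * (s - r) + 1)

omit [CharZero k] in
theorem exists_conH_polar {l : List R} {W : inverseSystem k (Fin r × Fin s) →ₗ[R] (cech R l).H n}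
    (hW : ∀ (i) (ψ φ : inverseSystem k (Fin r × Fin s)), (∀ f, φ.1 f = ψ.1 (pderiv i f)) →
      conH (k := k) (pderiv i) l n (W ψ) = -W φ) {i j : Fin r} (hij : i ≠ j)
    (ψ : inverseSystem k (Fin r × Fin s)) : ∃ φ : inverseSystem k (Fin r × Fin s),
      (∀ f, φ.1 f = ψ.1 (polar k i j f)) ∧ conH (polar k i j) l n (W ψ) = -W φ := by
  choose φ hφ using fun c : Fin s => inverseSystem.exists_comp_derivation (pderiv (j, c)) ψ
  refine ⟨∑ c, (X (i, c) : R) • φ c, fun f => ?_, ?_⟩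
  · rw [polar_apply]
    have h1 : ∀ t : Finset (Fin s), (∑ c ∈ t, (X (i, c) : R) • φ c).1 f =
        ψ.1 (∑ c ∈ t, X (i, c) * pderiv (j, c) f) := by
      classical
      intro t
      induction t using Finset.induction_on with
      | empty => simp [Functionals.zero_apply]
      | insert c t hc ih =>
        rw [Finset.sum_insert hc, Finset.sum_insert hc, Submodule.coe_add, Functionals.add_apply,
          ih, map_add, Submodule.coe_smul, Functionals.smul_apply, hφ, Derivation.leibniz,
          pderiv_X, Pi.single_eq_of_ne (by simp [hij]), smul_zero, add_zero, smul_eq_mul]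
    exact h1 Finset.univ
  · rw [conH_polar, map_sum, ← Finset.sum_neg_distrib]
    refine Finset.sum_congr rfl fun c _ => ?_
    rw [hW (j, c) ψ (φ c) (hφ c), map_smul, smul_neg]

theorem cH_casimir_eq_zero
    {W : inverseSystem k (Fin r × Fin s) →ₗ[R] (cech R 𝐩).H n}
    (hW : ∀ (i) (ψ φ : inverseSystem k (Fin r × Fin s)), (∀ f, φ.1 f = ψ.1 (pderiv i f)) →
      conH (k := k) (pderiv i) 𝐩 n (W ψ) = -W φ) (ψ : inverseSystem k (Fin r × Fin s))
    (hψ : ∀ f, ψ.1 (casimir k f) = 0) :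
    cH (casimir k : R →ₗ[k] R).toAddMonoidHom 𝐩 𝐩 n (W ψ) = 0 := by
  have key : ∀ p : Fin r × Fin r, ∃ φ : inverseSystem k (Fin r × Fin s), p.1 ≠ p.2 →
      (∀ f, φ.1 f = ψ.1 (polar k p.1 p.2 (polar k p.2 p.1 f))) ∧
        conH (polar k p.2 p.1) 𝐩 n (conH (polar k p.1 p.2) 𝐩 n (W ψ)) = W φ := by
    intro p
    by_cases hp : p.1 = p.2
    · exact ⟨0, fun h => absurd hp h⟩
    obtain ⟨φ, h1, h2⟩ := exists_conH_polar hW hp ψ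
    obtain ⟨φ', h1', h2'⟩ := exists_conH_polar hW (Ne.symm hp) φ
    refine ⟨φ', fun _ => ⟨fun f => by rw [h1', h1], ?_⟩⟩
    rw [h2, map_neg, h2', neg_neg]
  choose φ hφ using key
  refine (cH_casimir (W ψ)).trans ((Finset.sum_congr rfl fun p hp =>
    (hφ p (Finset.mem_filter.1 hp).2).2).trans ((map_sum W φ _).symm.trans ?_))
  refine (congrArg W (Subtype.ext (Functionals.ext fun f => ?_))).trans (map_zero W)
  have h1 : ∀ t : Finset (Fin r × Fin r), (∀ p ∈ t, p.1 ≠ p.2) → (∑ p ∈ t, φ p).1 f =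
      ψ.1 (∑ p ∈ t, polar k p.1 p.2 (polar k p.2 p.1 f)) := by
    intro t
    induction t using Finset.induction_on with
    | empty => simp [Functionals.zero_apply]
    | insert c t hc ih =>
      intro ht
      rw [Finset.forall_mem_insert] at ht
      rw [Finset.sum_insert hc, Finset.sum_insert hc, Submodule.coe_add, Functionals.add_apply,
        ih ht.2, map_add, (hφ c ht.1).1]
  refine (h1 _ fun p hp => (Finset.mem_filter.1 hp).2).trans (Eq.trans ?_ (hψ f))
  rw [casimir_apply]
  refine congrArg ψ.1 (Finset.sum_equiv (Equiv.prodComm _ _) (fun p => ?_) fun p _ => rfl)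
  rw [Finset.mem_filter_univ, Finset.mem_filter_univ]
  exact ne_comm

theorem exists_socle_relation (hr : 0 < r) (hrs : r ≤ s)
    (z : Fin 2 → (cech R 𝐩).H (r * (s - r) + 1 : ℕ)) (hz : ∀ ε a, (X a : R) • z ε = 0) :
    ∃ α : Fin 2 → k, α ≠ 0 ∧ ∑ ε, (C (α ε) : R) • z ε = 0 := by
  by_contra! hne
  obtain ⟨D⟩ := nonempty_paramData k hr hrs
  choose W hW hW' using fun ε => (isWeyl_conH k (Fin r × Fin s) 𝐩
    (r * (s - r) + 1 : ℕ)).exists_linearMap (hz ε)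
  obtain ⟨z₀, -, -, hz₀⟩ := exists_socle_poly k (r * (s - r) + 1)
  let Ω : (Fin 2 → inverseSystem k (Fin r × Fin s)) →ₗ[R] (cech R 𝐩).H (r * (s - r) + 1 : ℕ) :=
    ∑ ε, (W ε).comp (LinearMap.proj ε)
  refine D.not_injective Ω
    (fun j => cH (D.φ j).toAddMonoidHom 𝐩 𝐱 (r * (s - r) + 1 : ℕ))
    (fun j q y => cH_smul (compat_φ D j) (fun f => D.φ_aeval j q f) y) (fun ψ hψ h0 => ?_) z₀ hz₀
    (inverseSystem.sum_injective W fun α h => ?_)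
  · have h1 : cH D.ρ.toAddMonoidHom 𝐩 𝐩 _ (Ω ψ) = Ω ψ := by
      refine cH_ρ_of_casimir D _ ?_
      rw [LinearMap.sum_apply, map_sum]
      exact Finset.sum_eq_zero fun ε _ => cH_casimir_eq_zero (hW' ε) _ (hψ ε)
    rw [← h1, cH_sum_φ]
    exact Finset.sum_eq_zero fun j _ => by rw [h0 j, map_zero]
  · by_contra hα
    refine hne α hα ?_
    rw [← h]
    exact Finset.sum_congr rfl fun ε _ => by rw [hW]

omit [CharZero k] in
theorem exists_ne_zero_top (D : ParamData k r s)
    (h : ∃ v : (cech P 𝐱).H n, D.c • v ≠ 0) : ∃ y : (cech R 𝐩).H n, y ≠ 0 := by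
  obtain ⟨v, hv⟩ := h
  obtain ⟨j⟩ := D.nonempty
  refine ⟨cH (D.ι j).toAddMonoidHom 𝐱 𝐩 n v, fun h0 => hv ?_⟩
  have e : (D.φ j).toAddMonoidHom.comp (D.ι j).toAddMonoidHom =
      DistribSMul.toAddMonoidHom P D.c := AddMonoidHom.ext fun q => by
    change D.φ j (D.ι j q) = D.c • q
    rw [D.φ_ι, if_pos rfl, smul_eq_mul]
  rw [← cH_smul_id, ← e, cH_comp (compat_ι D j) (compat_φ D j), h0, map_zero]

/-- If the top cohomology is supported at the origin, it is the inverse system. -/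
theorem nonempty_equiv_inverseSystem (hr : 0 < r) (hrs : r ≤ s)
    (htors : ∀ (y : (cech R 𝐩).H (r * (s - r) + 1 : ℕ)) a, ∃ N : ℕ, (X a : R) ^ N • y = 0) :
    Nonempty (inverseSystem k (Fin r × Fin s) ≃ₗ[R] (cech R 𝐩).H (r * (s - r) + 1 : ℕ)) := by
  obtain ⟨D⟩ := nonempty_paramData k hr hrs
  obtain ⟨y, hy⟩ := exists_ne_zero_top (n := (r * (s - r) + 1 : ℕ)) D
    (smul_ne_zero_poly k _ D.c D.c_ne)
  obtain ⟨f, hf, hz⟩ := exists_smul_ne_zero_socle hy (htors y)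
  obtain ⟨W, hW, -⟩ := (isWeyl_conH k (Fin r × Fin s) 𝐩
    (r * (s - r) + 1 : ℕ)).exists_linearMap hz
  have hinj : Function.Injective W := by
    have h := inverseSystem.sum_injective (ι := Unit) (fun _ => W) fun α h => by
      rw [Fintype.sum_unique, hW] at h
      refine funext fun i => ?_
      by_contra hα
      refine hf ?_
      rw [← one_smul R (f • y), ← C_1, ← inv_mul_cancel₀ hα, C_mul, mul_smul]
      rw [show (C (α i) : R) • f • y = 0 from h, smul_zero]
    intro ψ ψ' e
    exact congrFun (@h (fun _ => ψ) (fun _ => ψ') (by simpa using e)) ()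
  obtain ⟨p, hp⟩ := (inverseSystem.injective (k := k) (σ := Fin r × Fin s)).out W hinj
    LinearMap.id
  refine ⟨LinearEquiv.ofBijective W ⟨hinj, fun y' => ?_⟩⟩
  by_contra hy'
  have hne : y' - W (p y') ≠ 0 := fun h => hy' ⟨p y', (sub_eq_zero.1 h).symm⟩
  obtain ⟨g, hg, hz'⟩ := exists_smul_ne_zero_socle hne (htors _)
  have hpg : p (g • (y' - W (p y'))) = 0 := by
    rw [map_smul, map_sub, hp, LinearMap.id_apply, sub_self, smul_zero]
  obtain ⟨α, hα, h⟩ := exists_socle_relation hr hrs ![f • y, g • (y' - W (p y'))]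
    (fun ε a => by fin_cases ε <;> [exact hz a; exact hz' a])
  rw [Fin.sum_univ_two] at h
  change (C (α 0) : R) • f • y + (C (α 1) : R) • g • (y' - W (p y')) = 0 at h
  have hunit : ∀ (a : k) (x : (cech R 𝐩).H (r * (s - r) + 1 : ℕ)), (C a : R) • x = 0 →
      x ≠ 0 → a = 0 := fun a x h hx => by
    by_contra ha
    refine hx ?_
    rw [← one_smul R x, ← C_1, ← inv_mul_cancel₀ ha, C_mul, mul_smul, h, smul_zero]
  have h0 : α 0 = 0 := by
    have := congrArg p h
    rw [map_add, map_smul p _ (f • y), map_smul p _ (g • _), hpg, smul_zero, add_zero, map_zero,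
      ← hW, hp, LinearMap.id_apply] at this
    refine hunit _ (f • y) ?_ hf
    rw [← hW, ← map_smul, this, map_zero]
  rw [h0, C_0, zero_smul, zero_add] at h
  exact hα (funext fun ε => by fin_cases ε <;> [exact h0; exact hunit _ _ h hg])

end params

end Cx

end

section

open MvPolynomial

theorem det_submatrix_mem_minorsIdeal {T α β κ : Type} [CommRing T] [Fintype κ] [DecidableEq κ]
    (M : Matrix α β T) {n : ℕ} (hκ : Fintype.card κ = n) {p : κ → α} {q : κ → β}
    (hp : p.Injective) (hq : q.Injective) : (M.submatrix p q).det ∈ minorsIdeal M n := by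
  let g := (Fintype.equivFinOfCardEq hκ).symm
  rw [← Matrix.det_submatrix_equiv_self g]
  exact Ideal.subset_span ⟨(⟨p ∘ g, hp.comp g.injective⟩, ⟨q ∘ g, hq.comp g.injective⟩), rfl⟩

namespace Chart

section defs

variable (k : Type) [Field k] (u r' s' : ℕ)

/-- The polynomial ring in the entries of a block matrix outside the lower right block. -/
abbrev Base : Type := MvPolynomial ((Fin u × (Fin u ⊕ Fin s')) ⊕ (Fin r' × Fin u)) k

variable (B : Type) [CommRing B] [Algebra (Base k u r' s') B]

/-- The upper left block. -/
noncomputable def b₁₁ : Matrix (Fin u) (Fin u) B :=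
  Matrix.of fun i j => algebraMap (Base k u r' s') B (X (.inl (i, .inl j)))

/-- The upper right block. -/
noncomputable def b₁₂ : Matrix (Fin u) (Fin s') B :=
  Matrix.of fun i j => algebraMap (Base k u r' s') B (X (.inl (i, .inr j)))

/-- The lower left block. -/
noncomputable def b₂₁ : Matrix (Fin r') (Fin u) B :=
  Matrix.of fun i j => algebraMap (Base k u r' s') B (X (.inr (i, j)))

/-- The lower right block of the matrix of rank `u` with the given other blocks. -/
noncomputable def corner : Matrix (Fin r') (Fin s') B :=
  b₂₁ k u r' s' B * (b₁₁ k u r' s' B)⁻¹ * b₁₂ k u r' s' B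

/-- The generic matrix in coordinates in which the Schur complement of the upper left block is a
matrix of indeterminates. -/
noncomputable def mat : Matrix (Fin u ⊕ Fin r') (Fin u ⊕ Fin s') (MvPolynomial (Fin r' × Fin s') B) :=
  Matrix.fromBlocks ((b₁₁ k u r' s' B).map C) ((b₁₂ k u r' s' B).map C)
    ((b₂₁ k u r' s' B).map C) (Matrix.of (fun i j => X (i, j)) + (corner k u r' s' B).map C)

/-- The lower triangular factor of `mat`. -/
noncomputable def lower : Matrix (Fin u ⊕ Fin r') (Fin u ⊕ Fin r') (MvPolynomial (Fin r' × Fin s') B) :=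
  Matrix.fromBlocks 1 0 ((b₂₁ k u r' s' B * (b₁₁ k u r' s' B)⁻¹).map C) 1

/-- The upper triangular factor of `mat`. -/
noncomputable def upper : Matrix (Fin u ⊕ Fin r') (Fin u ⊕ Fin s') (MvPolynomial (Fin r' × Fin s') B) :=
  Matrix.fromBlocks ((b₁₁ k u r' s' B).map C) ((b₁₂ k u r' s' B).map C) 0
    (Matrix.of fun i j => X (i, j))

variable {u r' s'} {r s : ℕ} (e : Fin u ⊕ Fin r' ≃ Fin r) (f : Fin u ⊕ Fin s' ≃ Fin s)

/-- The homomorphism which maps the generic matrix to `mat`. -/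
noncomputable def hom : MvPolynomial (Fin r × Fin s) k →+* MvPolynomial (Fin r' × Fin s') B :=
  eval₂Hom (C.comp ((algebraMap (Base k u r' s') B).comp C))
    fun p => mat k u r' s' B (e.symm p.1) (f.symm p.2)

/-- The variables outside the lower right block. -/
noncomputable def incl : Base k u r' s' →ₐ[k] MvPolynomial (Fin r × Fin s) k :=
  rename (Sum.elim (fun p => (e (.inl p.1), f p.2)) fun p => (e (.inr p.1), f (.inl p.2)))

end defs

section

variable {k : Type} [Field k] {u r' s' r s : ℕ} {B : Type} [CommRing B]
  [Algebra (Base k u r' s') B] (e : Fin u ⊕ Fin r' ≃ Fin r) (f : Fin u ⊕ Fin s' ≃ Fin s)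

theorem genericMatrix_map_hom :
    (genericMatrix k r s).map (hom k B e f) = (mat k u r' s' B).submatrix e.symm f.symm := by
  ext1 i j
  simp [hom]

theorem hom_incl (b : Base k u r' s') :
    hom k B e f (incl k e f b) = C (algebraMap (Base k u r' s') B b) := by
  have : (hom k B e f).comp (incl k e f).toRingHom = C.comp (algebraMap (Base k u r' s') B) := by
    refine MvPolynomial.ringHom_ext ?_ ?_
    · intro c
      simp [hom, incl]
    · rintro (⟨i, j | j⟩ | ⟨i, j⟩) <;> simp [hom, incl, mat, b₁₁, b₁₂, b₂₁]
  exact RingHom.congr_fun this b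

theorem mat_eq (h : IsUnit (b₁₁ k u r' s' B).det) :
    mat k u r' s' B =
      lower k u r' s' B * upper k u r' s' B := by
  rw [lower, upper, Matrix.fromBlocks_multiply, mat]
  congr 1
  · simp
  · simp
  · rw [← Matrix.map_mul, Matrix.mul_assoc, Matrix.nonsing_inv_mul _ h]
    simp
  · rw [← Matrix.map_mul, corner, Matrix.one_mul, add_comm]

theorem exists_minor (h : IsUnit (b₁₁ k u r' s' B).det) (p : Fin r' × Fin s') :
    ∃ m ∈ minorsIdeal (genericMatrix k r s) (u + 1),
      hom k B e f m = C (b₁₁ k u r' s' B).det * X p := by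
  let a : Fin u ⊕ Unit → Fin u ⊕ Fin r' := Sum.map id fun _ => p.1
  let b : Fin u ⊕ Unit → Fin u ⊕ Fin s' := Sum.map id fun _ => p.2
  refine ⟨((genericMatrix k r s).submatrix (e ∘ a) (f ∘ b)).det,
    det_submatrix_mem_minorsIdeal _ (by simp) (e.injective.comp ?_) (f.injective.comp ?_), ?_⟩
  · exact Function.injective_id.sumMap (Function.injective_of_subsingleton _)
  · exact Function.injective_id.sumMap (Function.injective_of_subsingleton _)
  rw [RingHom.map_det, RingHom.mapMatrix_apply, ← Matrix.submatrix_map, genericMatrix_map_hom,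
    Matrix.submatrix_submatrix, ← Function.comp_assoc, ← Function.comp_assoc,
    Equiv.symm_comp_self, Equiv.symm_comp_self, Function.id_comp, Function.id_comp, mat_eq h]
  let L : Matrix (Fin u ⊕ Unit) (Fin u ⊕ Unit) (MvPolynomial (Fin r' × Fin s') B) :=
    Matrix.fromBlocks 1 0 (((b₂₁ k u r' s' B * (b₁₁ k u r' s' B)⁻¹).map C).submatrix
      (fun _ : Unit => p.1) id) 1
  let U : Matrix (Fin u ⊕ Unit) (Fin u ⊕ Unit) (MvPolynomial (Fin r' × Fin s') B) :=
    Matrix.fromBlocks ((b₁₁ k u r' s' B).map C) (((b₁₂ k u r' s' B).map C).submatrix id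
      fun _ : Unit => p.2) 0 (Matrix.of fun _ _ => X p)
  have : (lower k u r' s' B * upper k u r' s' B).submatrix a b = L * U := by
    rw [lower, upper, Matrix.fromBlocks_multiply, Matrix.fromBlocks_multiply]
    ext1 (i | i) (j | j) <;> simp [a, b, Matrix.mul_apply]
  rw [this, Matrix.det_mul, Matrix.det_fromBlocks_zero₁₂, Matrix.det_fromBlocks_zero₂₁]
  simp [RingHom.map_det]

theorem exists_hom_mul (S : Submonoid (Base k u r' s')) [IsLocalization S B]
    (a : MvPolynomial (Fin r' × Fin s') B) :
    ∃ b ∈ S, ∃ g, hom k B e f (incl k e f b) * a = hom k B e f g := by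
  have hC (c : B) : ∃ b ∈ S, ∃ g, hom k B e f (incl k e f b) * C c = hom k B e f g := by
    obtain ⟨⟨x, b⟩, hb⟩ := IsLocalization.surj S c
    exact ⟨b, b.2, incl k e f x, by rw [hom_incl, hom_incl, ← C_mul, mul_comm, hb]⟩
  have hX (p : Fin r' × Fin s') : ∃ b ∈ S, ∃ g,
      hom k B e f (incl k e f b) * X p = hom k B e f g := by
    obtain ⟨b, hb, g, hg⟩ := hC (corner k u r' s' B p.1 p.2)
    refine ⟨b, hb, incl k e f b * X (e (.inr p.1), f (.inr p.2)) - g, ?_⟩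
    rw [map_sub, ← hg, map_mul]
    have : hom k B e f (X (e (.inr p.1), f (.inr p.2))) = X p + C (corner k u r' s' B p.1 p.2) := by
      simp [hom, mat]
    rw [this]
    ring
  induction a using MvPolynomial.induction_on with
  | C c => exact hC c
  | add x y hx hy =>
    obtain ⟨b, hb, g, hg⟩ := hx
    obtain ⟨b', hb', g', hg'⟩ := hy
    refine ⟨b * b', mul_mem hb hb', incl k e f b' * g + incl k e f b * g', ?_⟩
    rw [map_add (hom k B e f), map_mul (hom k B e f), map_mul (hom k B e f), ← hg, ← hg',
      map_mul (incl k e f), map_mul (hom k B e f)]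
    ring
  | mul_X x p hx =>
    obtain ⟨b, hb, g, hg⟩ := hx
    obtain ⟨b', hb', g', hg'⟩ := hX p
    refine ⟨b * b', mul_mem hb hb', g * g', ?_⟩
    rw [map_mul (hom k B e f), ← hg, ← hg', map_mul (incl k e f), map_mul (hom k B e f)]
    ring

theorem hom_injective (h : Function.Injective (algebraMap (Base k u r' s') B)) :
    Function.Injective (hom k B e f) := by
  let φ : MvPolynomial (Fin r × Fin s) k →+* MvPolynomial (Fin r' × Fin s') (Base k u r' s') :=
    eval₂Hom (C.comp C) fun p => match e.symm p.1, f.symm p.2 with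
      | .inl i, j => C (X (.inl (i, j)))
      | .inr i, .inl j => C (X (.inr (i, j)))
      | .inr i, .inr j => X (i, j)
  let χ : MvPolynomial (Fin r' × Fin s') (Base k u r' s') →+* MvPolynomial (Fin r × Fin s) k :=
    eval₂Hom (incl k e f : Base k u r' s' →+* _) fun p => X (e (.inr p.1), f (.inr p.2))
  have hφ : Function.Injective φ := by
    refine Function.LeftInverse.injective (g := χ) fun x => ?_
    refine RingHom.congr_fun (f := χ.comp φ) (g := RingHom.id _)
      (MvPolynomial.ringHom_ext ?_ ?_) x
    · intro c
      simp [φ, χ]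
    · rintro ⟨i, j⟩
      obtain ⟨i, rfl⟩ := e.surjective i
      obtain ⟨j, rfl⟩ := f.surjective j
      rcases i with i | i <;> rcases j with j | j <;> simp [φ, χ, incl]
  let τ : MvPolynomial (Fin r' × Fin s') B →+* MvPolynomial (Fin r' × Fin s') B :=
    eval₂Hom C fun p => X p - C (corner k u r' s' B p.1 p.2)
  have hτ : τ.comp (hom k B e f) = (MvPolynomial.map (algebraMap (Base k u r' s') B)).comp φ := by
    refine MvPolynomial.ringHom_ext ?_ ?_
    · intro c
      simp [τ, hom, φ]
    · rintro ⟨i, j⟩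
      obtain ⟨i, rfl⟩ := e.surjective i
      obtain ⟨j, rfl⟩ := f.surjective j
      rcases i with i | i <;> rcases j with j | j <;> simp [φ, τ, hom, mat, b₁₁, b₁₂, b₂₁]
  refine Function.Injective.of_comp (f := τ) ?_
  rw [← RingHom.coe_comp, hτ, RingHom.coe_comp]
  exact (MvPolynomial.map_injective _ h).comp hφ

end

end Chart

end

section

open MvPolynomial

section field

variable {K α β α' β' : Type} [Field K]

theorem exists_vecMul_submatrix [Fintype α] [Fintype α'] (M : Matrix α β K) (e : α' ≃ α) (f : β' ≃ β) :
    (∃ v ≠ 0, Matrix.vecMul v (M.submatrix e f) = 0) ↔ ∃ v ≠ 0, Matrix.vecMul v M = 0 := by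
  have key (v : α → K) : Matrix.vecMul (v ∘ e) (M.submatrix e f) = Matrix.vecMul v M ∘ f := by
    rw [Matrix.submatrix_vecMul_equiv, Function.comp_assoc, Equiv.self_comp_symm,
      Function.comp_id]
  constructor
  · rintro ⟨v, hv, h⟩
    refine ⟨v ∘ e.symm, fun h0 => hv ?_, ?_⟩
    · rw [← Function.comp_id v, ← Equiv.symm_comp_self e, ← Function.comp_assoc, h0]; rfl
    · have := key (v ∘ e.symm)
      rw [Function.comp_assoc, Equiv.symm_comp_self, Function.comp_id, h] at this
      refine funext fun j => ?_
      obtain ⟨j, rfl⟩ := f.surjective j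
      exact (congrFun this j).symm
  · rintro ⟨v, hv, h⟩
    refine ⟨v ∘ e, fun h0 => hv ?_, by rw [key, h]; rfl⟩
    rw [← Function.comp_id v, ← Equiv.self_comp_symm e, ← Function.comp_assoc, h0]; rfl

theorem exists_vecMul_mul [Fintype α] [DecidableEq α] (L : Matrix α α K) (hL : IsUnit L.det)
    (U : Matrix α β K) :
    (∃ v ≠ 0, Matrix.vecMul v (L * U) = 0) ↔ ∃ v ≠ 0, Matrix.vecMul v U = 0 := by
  constructor
  · rintro ⟨v, hv, h⟩
    refine ⟨Matrix.vecMul v L, fun h0 => hv ?_, by rw [Matrix.vecMul_vecMul, h]⟩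
    rw [← Matrix.vecMul_one v, ← Matrix.mul_nonsing_inv L hL, ← Matrix.vecMul_vecMul, h0,
      Matrix.zero_vecMul]
  · rintro ⟨v, hv, h⟩
    refine ⟨Matrix.vecMul v L⁻¹, fun h0 => hv ?_, ?_⟩
    · rw [← Matrix.vecMul_one v, ← Matrix.nonsing_inv_mul L hL, ← Matrix.vecMul_vecMul, h0,
        Matrix.zero_vecMul]
    · rw [Matrix.vecMul_vecMul, ← Matrix.mul_assoc, Matrix.nonsing_inv_mul L hL, Matrix.one_mul, h]

theorem exists_vecMul_fromBlocks [Fintype α] [DecidableEq α] [Fintype α'] (a : Matrix α α K)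
    (ha : IsUnit a.det) (b : Matrix α β K) (y : Matrix α' β K) :
    (∃ v ≠ 0, Matrix.vecMul v (Matrix.fromBlocks a b 0 y) = 0) ↔
      ∃ v ≠ 0, Matrix.vecMul v y = 0 := by
  constructor
  · rintro ⟨v, hv, h⟩
    rw [Matrix.vecMul_fromBlocks] at h
    have h1 : Matrix.vecMul (v ∘ Sum.inl) a = 0 := by
      refine funext fun j => ?_
      simpa using congrFun h (.inl j)
    have h0 : v ∘ Sum.inl = 0 := by
      rw [← Matrix.vecMul_one (v ∘ Sum.inl), ← Matrix.mul_nonsing_inv a ha,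
        ← Matrix.vecMul_vecMul, h1, Matrix.zero_vecMul]
    refine ⟨v ∘ Sum.inr, fun h2 => hv (funext fun i => ?_), funext fun j => ?_⟩
    · rcases i with i | i
      · exact congrFun h0 i
      · exact congrFun h2 i
    · have := congrFun h (.inr j)
      simpa [h0] using this
  · rintro ⟨v, hv, h⟩
    refine ⟨Sum.elim 0 v, fun h0 => hv (funext fun i => congrFun h0 (.inr i)), ?_⟩
    rw [Matrix.vecMul_fromBlocks]
    ext1 (j | j)
    · simp
    · simp [h]

end field

/-- A prime ideal contains the maximal minors if and only if the rows of the matrix are linearly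
dependent over the residue field. -/
theorem minorsIdeal_le_iff_exists {T K : Type} [CommRing T] [Field K] {r s : ℕ}
    (M : Matrix (Fin r) (Fin s) T) (Q : Ideal T) (g : T →+* K) (hg : RingHom.ker g = Q) :
    minorsIdeal M r ≤ Q ↔ ∃ v ≠ 0, Matrix.vecMul v (M.map g) = 0 := by
  have key (c : Fin r → Fin s) : ((M.map g).submatrix id c).det = g (M.submatrix id c).det := by
    rw [RingHom.map_det, RingHom.mapMatrix_apply, Matrix.submatrix_map]
  have key' (c : Fin r → Fin s) :
      ((M.map (Ideal.Quotient.mk Q)).submatrix id c).det = 0 ↔ ((M.map g).submatrix id c).det = 0 := by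
    rw [key, ← RingHom.mem_ker, hg, ← Ideal.Quotient.eq_zero_iff_mem, RingHom.map_det,
      RingHom.mapMatrix_apply, Matrix.submatrix_map]
  rw [minorsIdeal_le_iff]
  constructor
  · intro h
    exact exists_vecMul_of_minors_eq_zero _ fun c => (key' c).1 (h c)
  · rintro ⟨v, hv, h⟩ c
    exact (key' c).2 (minor_eq_zero_of_vecMul _ v hv h c)

namespace Chart

variable {k : Type} [Field k] {u r' s' r s : ℕ} {B : Type} [CommRing B]
  [Algebra (Base k u r' s') B] (e : Fin u ⊕ Fin r' ≃ Fin r) (f : Fin u ⊕ Fin s' ≃ Fin s)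

theorem radical_minorsIdeal (h : IsUnit (b₁₁ k u r' s' B).det) :
    (minorsIdeal ((genericMatrix k r s).map (hom k B e f)) r).radical =
      (minorsIdeal (Matrix.of fun (i : Fin r') (j : Fin s') =>
        (X (i, j) : MvPolynomial (Fin r' × Fin s') B)) r').radical := by
  have key (Q : Ideal (MvPolynomial (Fin r' × Fin s') B)) (hQ : Q.IsPrime) :
      minorsIdeal ((genericMatrix k r s).map (hom k B e f)) r ≤ Q ↔
      minorsIdeal (Matrix.of fun (i : Fin r') (j : Fin s') =>
        (X (i, j) : MvPolynomial (Fin r' × Fin s') B)) r' ≤ Q := by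
    let g : MvPolynomial (Fin r' × Fin s') B →+* FractionRing (MvPolynomial (Fin r' × Fin s') B ⧸ Q) :=
      (algebraMap _ _).comp (Ideal.Quotient.mk Q)
    have hg : RingHom.ker g = Q := by
      rw [RingHom.ker_comp_of_injective _ (IsFractionRing.injective _ _), Ideal.mk_ker]
    rw [minorsIdeal_le_iff_exists _ Q g hg, minorsIdeal_le_iff_exists _ Q g hg,
      genericMatrix_map_hom, ← Matrix.submatrix_map, exists_vecMul_submatrix, mat_eq h,
      Matrix.map_mul, exists_vecMul_mul, upper, Matrix.fromBlocks_map, Matrix.map_zero,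
      exists_vecMul_fromBlocks]
    · rw [Matrix.map_map, ← RingHom.coe_comp, ← RingHom.mapMatrix_apply, ← RingHom.map_det]
      exact h.map _
    · exact map_zero g
    · rw [← RingHom.mapMatrix_apply, ← RingHom.map_det, lower, Matrix.det_fromBlocks_zero₁₂]
      simp
  rw [Ideal.radical_eq_sInf, Ideal.radical_eq_sInf]
  congr 1
  ext Q
  exact ⟨fun hQ => ⟨(key Q hQ.2).1 hQ.1, hQ.2⟩, fun hQ => ⟨(key Q hQ.2).2 hQ.1, hQ.2⟩⟩

theorem map_params :
    (List.ofFn (params k r s)).map (hom k B e f) = List.ofFn fun l : Fin (r * (s - r) + 1) =>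
      weightMinor ((genericMatrix k r s).map (hom k B e f)) l := by
  rw [List.map_ofFn]
  congr 1
  ext1 l
  exact map_weightMinor _ _ _

theorem radical_params (h : IsUnit (b₁₁ k u r' s' B).det) :
    (Ideal.span {x | x ∈ (List.ofFn (params k r s)).map (hom k B e f)}).radical =
      (Ideal.span {x | x ∈ List.ofFn fun l : Fin (r' * (s' - r') + 1) =>
        weightMinor (Matrix.of fun (i : Fin r') (j : Fin s') =>
          (X (i, j) : MvPolynomial (Fin r' × Fin s') B)) l}).radical := by
  rw [map_params, radical_weightMinor, radical_weightMinor, radical_minorsIdeal e f h]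

/-- A minor of size `u + 1` has no constant term in the new coordinates. -/
theorem constantCoeff_hom_minor {L : Type} [Field L] [Algebra (Base k u r' s') L]
    (h : IsUnit (b₁₁ k u r' s' L).det) :
    minorsIdeal (genericMatrix k r s) (u + 1) ≤
      RingHom.ker (constantCoeff.comp (hom k L e f)) := by
  rw [minorsIdeal, Ideal.span_le]
  rintro _ ⟨⟨p, q⟩, rfl⟩
  rw [SetLike.mem_coe, RingHom.mem_ker, RingHom.comp_apply, RingHom.map_det,
    RingHom.mapMatrix_apply, ← Matrix.submatrix_map, genericMatrix_map_hom, mat_eq h,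
    Matrix.submatrix_submatrix, RingHom.map_det, RingHom.mapMatrix_apply, ← Matrix.submatrix_map,
    Matrix.map_mul]
  let N₁ : Matrix (Fin u ⊕ Fin r') (Fin u) L :=
    Matrix.fromRows 1 (b₂₁ k u r' s' L * (b₁₁ k u r' s' L)⁻¹)
  let N₂ : Matrix (Fin u) (Fin u ⊕ Fin s') L :=
    Matrix.fromCols (b₁₁ k u r' s' L) (b₁₂ k u r' s' L)
  have : (lower k u r' s' L).map constantCoeff * (upper k u r' s' L).map constantCoeff =
      N₁ * N₂ := by
    rw [← Matrix.map_mul, lower, upper, Matrix.fromBlocks_multiply,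
      Matrix.fromRows_mul_fromCols]
    ext1 (i | i) (j | j) <;> simp [Matrix.mul_apply]
  rw [this, Matrix.submatrix_mul _ _ _ id _ Function.bijective_id]
  by_contra hne
  have h1 := Matrix.rank_of_isUnit _ ((Matrix.isUnit_iff_isUnit_det _).2 (Ne.isUnit hne))
  have h2 := (Matrix.rank_mul_le_left (N₁.submatrix (e.symm ∘ p) id)
    (N₂.submatrix id (f.symm ∘ q))).trans (Matrix.rank_le_width _)
  rw [h1, Fintype.card_fin] at h2
  omega

end Chart

end

section

open MvPolynomial

theorem exists_equiv_extending {u r r' : ℕ} (h : u + r' = r) {p : Fin u → Fin r}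
    (hp : Function.Injective p) : ∃ e : Fin u ⊕ Fin r' ≃ Fin r, ∀ i, e (.inl i) = p i := by
  classical
  have hc : Fintype.card ↥(Set.range p)ᶜ = r' := by
    rw [Fintype.card_compl_set, Set.card_range_of_injective hp, Fintype.card_fin, Fintype.card_fin]
    omega
  exact ⟨(Equiv.sumCongr (Equiv.ofInjective p hp) (Fintype.equivFinOfCardEq hc).symm).trans
    (Equiv.Set.sumCompl (Set.range p)), fun i => rfl⟩

namespace Cx

/-- Injectivity in cohomology of an extension of the coefficient ring. -/
theorem cH_map_injective {k B L σ : Type} [Field k] [CommRing B] [CommRing L] [Algebra k B]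
    [Algebra k L] (j : B →ₐ[k] L) (hj : Function.Injective j) {m : ℕ}
    (q : Fin m → MvPolynomial σ k) (n : ℤ) :
    Function.Injective (cH (MvPolynomial.map (σ := σ) (j : B →+* L)).toAddMonoidHom
      (List.ofFn fun i => MvPolynomial.map (algebraMap k B) (q i))
      (List.ofFn fun i => MvPolynomial.map (algebraMap k L) (q i)) n) := by
  classical
  obtain ⟨ρ, hρ⟩ := j.toLinearMap.exists_leftInverse_of_injective (LinearMap.ker_eq_bot.2 hj)
  let P₀ (g : MvPolynomial σ L) : MvPolynomial σ B := ∑ d ∈ g.support, monomial d (ρ (coeff d g))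
  have hP (g : MvPolynomial σ L) (d) : coeff d (P₀ g) = ρ (coeff d g) := by
    rw [coeff_sum]
    simp_rw [coeff_monomial]
    rw [Finset.sum_ite_eq']
    split_ifs with hd
    · rfl
    · rw [notMem_support_iff.1 hd, map_zero]
  let P : MvPolynomial σ L →+ MvPolynomial σ B := AddMonoidHom.mk' P₀ fun g g' => by
    ext d
    rw [coeff_add, hP, hP, hP, coeff_add, map_add]
  replace hP (g : MvPolynomial σ L) (d) : coeff d (P g) = ρ (coeff d g) := hP g d
  have c1 : Compat (MvPolynomial.map (j : B →+* L)).toAddMonoidHom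
      (List.ofFn fun i => MvPolynomial.map (algebraMap k B) (q i))
      (List.ofFn fun i => MvPolynomial.map (algebraMap k L) (q i)) :=
    compat_ofFn fun i x => by
      change MvPolynomial.map (j : B →+* L) (MvPolynomial.map (algebraMap k B) (q i) * x) =
        MvPolynomial.map (algebraMap k L) (q i) * MvPolynomial.map (j : B →+* L) x
      rw [map_mul, MvPolynomial.map_map, AlgHom.comp_algebraMap_of_tower k]
  have c2 : Compat P (List.ofFn fun i => MvPolynomial.map (algebraMap k L) (q i))
      (List.ofFn fun i => MvPolynomial.map (algebraMap k B) (q i)) :=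
    compat_ofFn fun i x => by
      change P (MvPolynomial.map (algebraMap k L) (q i) * x) =
        MvPolynomial.map (algebraMap k B) (q i) * P x
      ext d
      rw [hP, coeff_mul, coeff_mul, map_sum]
      refine Finset.sum_congr rfl fun a _ => ?_
      rw [hP, coeff_map, coeff_map, ← Algebra.smul_def, ← Algebra.smul_def, map_smul]
  have e : P.comp (MvPolynomial.map (j : B →+* L)).toAddMonoidHom =
      AddMonoidHom.id (MvPolynomial σ B) := by
    refine AddMonoidHom.ext fun g => ?_
    ext d
    change coeff d (P (MvPolynomial.map (j : B →+* L) g)) = coeff d g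
    rw [hP, coeff_map]
    exact LinearMap.congr_fun hρ (coeff d g)
  refine Function.LeftInverse.injective (g := cH P _ _ n) fun y => ?_
  rw [← cH_comp c1 c2, e, cH_id]

end Cx

namespace Chart

section

variable {k : Type} [Field k] {u r' s' r s : ℕ} {B : Type} [CommRing B]
  [Algebra (Base k u r' s') B] (e : Fin u ⊕ Fin r' ≃ Fin r) (f : Fin u ⊕ Fin s' ≃ Fin s)

/-- The weighted sums of the maximal minors of the matrix of indeterminates. -/
noncomputable def schurParams (r' s' : ℕ) (B : Type) [CommRing B] :
    Fin (r' * (s' - r') + 1) → MvPolynomial (Fin r' × Fin s') B := fun l =>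
  weightMinor (Matrix.of fun (i : Fin r') (j : Fin s') =>
    (X (i, j) : MvPolynomial (Fin r' × Fin s') B)) l

theorem map_schurParams {B L : Type} [CommRing B] [CommRing L] (g : B →+* L) (l) :
    MvPolynomial.map g (schurParams r' s' B l) = schurParams r' s' L l := by
  rw [schurParams, schurParams, map_weightMinor]
  congr 1
  ext1 i j
  simp

/-- The cohomology in a chart. -/
theorem exists_chartMap (S : Submonoid (Base k u r' s')) [IsLocalization S B]
    (hS : S ≤ nonZeroDivisors _) (h : IsUnit (b₁₁ k u r' s' B).det) (n : ℕ) :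
    ∃ κ : (Cx.cech (MvPolynomial (Fin r × Fin s) k) (List.ofFn (params k r s))).H n →+
        (Cx.cech (MvPolynomial (Fin r' × Fin s') B) (List.ofFn (schurParams r' s' B))).H n,
      (∀ (g : MvPolynomial (Fin r × Fin s) k) y, κ (g • y) = hom k B e f g • κ y) ∧
      (∀ y, κ y = 0 → ∃ b ∈ S, (incl k e f b : MvPolynomial (Fin r × Fin s) k) • y = 0) ∧
      ∀ z, ∃ b ∈ S, ∃ y, κ y = hom k B e f (incl k e f b) • z := by
  have : IsNoetherianRing B := IsLocalization.isNoetherianRing S B inferInstance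
  have hinj : Function.Injective (algebraMap (Base k u r' s') B) :=
    IsLocalization.injective B hS
  have h1 := LocCoh.localCohomology_equiv (M := MvPolynomial (Fin r' × Fin s') B) (n := n)
    (J := Ideal.span {x | x ∈ List.ofFn (schurParams r' s' B)}) _ rfl
  have h2 := LocCoh.localCohomology_equiv (M := MvPolynomial (Fin r' × Fin s') B) (n := n)
    (J := Ideal.span {x | x ∈ List.ofFn (schurParams r' s' B)})
    ((List.ofFn (params k r s)).map (hom k B e f)) (radical_params e f h).symm
  obtain ⟨e₁⟩ := h1
  obtain ⟨e₂⟩ := h2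
  let E := e₂.symm.trans e₁
  have hloc : (Cx.cechMap (hom k B e f).toAddMonoidHom (List.ofFn (params k r s))
      ((List.ofFn (params k r s)).map (hom k B e f))).IsLoc
        (S.map (incl k e f)) (hom k B e f) := by
    refine Cx.isLoc_cechMap (fun g x => map_mul (hom k B e f) g x) (fun y => ?_) (fun x hx => ?_) _
    · obtain ⟨b, hb, g, hg⟩ := exists_hom_mul (e := e) (f := f) S y
      exact ⟨_, Submonoid.mem_map_of_mem _ hb, g, hg.symm⟩
    · refine ⟨1, one_mem _, ?_⟩
      rw [one_smul]
      exact hom_injective e f hinj (hx.trans (map_zero _).symm)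
  refine ⟨E.toAddMonoidHom.comp (Cx.cH (hom k B e f).toAddMonoidHom _ _ n), ?_, ?_, ?_⟩
  · intro g y
    change E _ = _ • E _
    rw [Cx.cH_smul (Cx.compat_map fun g _ x => map_mul (hom k B e f) g x)
      (fun x => map_mul (hom k B e f) g x), map_smul]
  · intro y hy
    obtain ⟨_, ⟨b, hb, rfl⟩, h⟩ := hloc.H_inj y (E.map_eq_zero_iff.1 hy)
    exact ⟨b, hb, h⟩
  · intro z
    obtain ⟨_, ⟨b, hb, rfl⟩, y, hy⟩ := hloc.H_surj (E.symm z)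
    refine ⟨b, hb, y, ?_⟩
    change E (Cx.cH _ _ _ n y) = _
    rw [Cx.cH, hy, map_smul, E.apply_symm_apply]

variable (k u r' s') in
/-- The determinant of the upper left block. -/
noncomputable def pivot : Base k u r' s' := (b₁₁ k u r' s' (Base k u r' s')).det

theorem algebraMap_pivot : algebraMap _ B (pivot k u r' s') = (b₁₁ k u r' s' B).det := by
  rw [pivot, RingHom.map_det]
  rfl

theorem pivot_ne_zero : pivot k u r' s' ≠ 0 := by
  let g : MvPolynomial (Fin u × Fin u) k →ₐ[k] Base k u r' s' :=
    rename fun p => .inl (p.1, .inl p.2)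
  have hg : Function.Injective g := rename_injective _ fun p q h => by
    simpa [Prod.ext_iff] using h
  have : pivot k u r' s' = g (Matrix.mvPolynomialX (Fin u) (Fin u) k).det := by
    rw [AlgHom.map_det, pivot]
    congr 1
    ext1 i j
    simp [g, b₁₁]
  rw [this]
  exact (map_ne_zero_iff g hg).2 (Matrix.det_mvPolynomialX_ne_zero _ _)

theorem incl_pivot : incl k e f (pivot k u r' s') =
    ((genericMatrix k r s).submatrix (e ∘ .inl) (f ∘ .inl)).det := by
  rw [pivot, AlgHom.map_det]
  congr 1
  ext1 i j
  simp [b₁₁, incl]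

theorem isUnit_det (h : IsUnit (algebraMap _ B (pivot k u r' s'))) :
    IsUnit (b₁₁ k u r' s' B).det := by
  rwa [← algebraMap_pivot]

end

end Chart

end

section

open MvPolynomial

namespace Chart

section torsion

variable {k : Type} [Field k] {r s : ℕ}

theorem exists_X_pow_smul_eq_zero (hr : 0 < r) (hrs : r < s)
    (y : (Cx.cech (MvPolynomial (Fin r × Fin s) k) (List.ofFn (params k r s))).H
      (r * (s - r) + 1 : ℕ)) (a : Fin r × Fin s) :
    ∃ N : ℕ, (X a : MvPolynomial (Fin r × Fin s) k) ^ N • y = 0 := by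
  obtain ⟨e, he⟩ := exists_equiv_extending (u := 1) (r' := r - 1) (by omega : _ = r)
    (p := fun _ => a.1) (Function.injective_of_subsingleton _)
  obtain ⟨f, hf⟩ := exists_equiv_extending (u := 1) (r' := s - 1) (by omega : _ = s)
    (p := fun _ => a.2) (Function.injective_of_subsingleton _)
  let P := pivot k 1 (r - 1) (s - 1)
  obtain ⟨κ, -, hκ, -⟩ := exists_chartMap (B := Localization.Away P) e f (Submonoid.powers P)
    (powers_le_nonZeroDivisors_of_noZeroDivisors pivot_ne_zero)
    (isUnit_det (IsLocalization.Away.algebraMap_isUnit P)) (r * (s - r) + 1)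
  have : Subsingleton ((Cx.cech (MvPolynomial (Fin (r - 1) × Fin (s - 1)) (Localization.Away P))
      (List.ofFn (schurParams (r - 1) (s - 1) (Localization.Away P)))).H (r * (s - r) + 1 : ℕ)) := by
    refine Cx.subsingleton_cech_H _ (Or.inr ?_)
    rw [List.length_ofFn, Nat.cast_lt, Nat.sub_sub_sub_cancel_right hr]
    exact Nat.add_lt_add_right (Nat.mul_lt_mul_of_pos_right (by omega) (by omega)) 1
  obtain ⟨_, ⟨N, rfl⟩, h⟩ := hκ y (Subsingleton.elim _ _)
  refine ⟨N, ?_⟩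
  rwa [map_pow, incl_pivot, Matrix.det_unique, Matrix.submatrix_apply, Function.comp_apply,
    Function.comp_apply, he, hf] at h

end torsion

theorem smul_eq_constantCoeff_smul {σ L M : Type} [CommRing L] [AddCommGroup M]
    [Module (MvPolynomial σ L) M] {w : M} (hw : ∀ p, (X p : MvPolynomial σ L) • w = 0)
    (g : MvPolynomial σ L) : g • w = (C (constantCoeff g) : MvPolynomial σ L) • w := by
  induction g using MvPolynomial.induction_on with
  | C c => rw [constantCoeff_C]
  | add g g' h h' => rw [add_smul, h, h', map_add, map_add, add_smul]
  | mul_X g p h => rw [mul_smul, hw, smul_zero, map_mul, constantCoeff_X, mul_zero, map_zero, zero_smul]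

section

variable {k : Type} [Field k] {u r' s' r s : ℕ}
  (e : Fin u ⊕ Fin r' ≃ Fin r) (f : Fin u ⊕ Fin s' ≃ Fin s)

variable (L : Type) [Field L] [Algebra (Base k u r' s') L] [IsFractionRing (Base k u r' s') L]

theorem isUnit_det_field : IsUnit (b₁₁ k u r' s' L).det :=
  isUnit_det (Ne.isUnit ((map_ne_zero_iff _ (IsFractionRing.injective (Base k u r' s') L)).2 pivot_ne_zero))

theorem X_smul_eq_zero_of_minor {M : Type} [AddCommGroup M]
    [Module (MvPolynomial (Fin r' × Fin s') L) M] {w : M}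
    (hw : ∀ m ∈ minorsIdeal (genericMatrix k r s) (u + 1), hom k L e f m • w = 0)
    (p : Fin r' × Fin s') : (X p : MvPolynomial (Fin r' × Fin s') L) • w = 0 := by
  obtain ⟨m, hm, h⟩ := exists_minor e f (isUnit_det_field (k := k) L) p
  have := hw m hm
  rw [h, mul_smul] at this
  exact (IsUnit.smul_eq_zero ((isUnit_det_field (k := k) L).map C)).1 this

theorem exists_hom_mul_mem (a : MvPolynomial (Fin r' × Fin s') L)
    (ha : constantCoeff a = 0) :
    ∃ b ≠ 0, ∃ g ∈ minorsIdeal (genericMatrix k r s) (u + 1),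
      hom k L e f (incl k e f b) * a = hom k L e f g := by
  have ha' : a ∈ Ideal.span (Set.range (X : Fin r' × Fin s' → MvPolynomial _ L)) := by
    have := smul_eq_constantCoeff_smul (w := Ideal.Quotient.mk (Ideal.span (Set.range
      (X : Fin r' × Fin s' → MvPolynomial _ L))) 1) (fun p => ?_) a
    · rw [ha, map_zero, zero_smul, ← Ideal.Quotient.mk_eq_mk, ← Submodule.Quotient.mk_smul,
        smul_eq_mul, mul_one] at this
      exact (Submodule.Quotient.mk_eq_zero _).1 this
    · rw [← Ideal.Quotient.mk_eq_mk, ← Submodule.Quotient.mk_smul, smul_eq_mul, mul_one]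
      exact (Submodule.Quotient.mk_eq_zero _).2 (Ideal.subset_span ⟨p, rfl⟩)
  clear ha
  induction ha' using Submodule.span_induction with
  | mem x hx =>
    obtain ⟨p, rfl⟩ := hx
    obtain ⟨m, hm, h⟩ := exists_minor e f (isUnit_det_field (k := k) L) p
    exact ⟨pivot k u r' s', pivot_ne_zero, m, hm, by rw [hom_incl, algebraMap_pivot, h]⟩
  | zero => exact ⟨1, one_ne_zero, 0, zero_mem _, by rw [mul_zero, map_zero]⟩
  | add x y _ _ hx hy =>
    obtain ⟨b, hb, g, hg, h⟩ := hx
    obtain ⟨b', hb', g', hg', h'⟩ := hy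
    refine ⟨b * b', mul_ne_zero hb hb', incl k e f b' * g + incl k e f b * g',
      add_mem (Ideal.mul_mem_left _ _ hg) (Ideal.mul_mem_left _ _ hg'), ?_⟩
    rw [map_add (hom k _ e f), map_mul (hom k _ e f), map_mul (hom k _ e f), ← h, ← h',
      map_mul (incl k e f), map_mul (hom k _ e f)]
    ring
  | smul c x _ hx =>
    obtain ⟨b, hb, g, hg, h⟩ := hx
    obtain ⟨b', hb', g', hg'⟩ := exists_hom_mul (e := e) (f := f)
      (nonZeroDivisors (Base k u r' s')) c
    refine ⟨b' * b, mul_ne_zero (nonZeroDivisors.ne_zero hb') hb, g' * g,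
      Ideal.mul_mem_left _ _ hg, ?_⟩
    rw [map_mul (hom k _ e f), ← hg', ← h, map_mul (incl k e f), map_mul (hom k _ e f), smul_eq_mul]
    ring

omit [IsFractionRing (Base k u r' s') L] in
theorem constantCoeff_hom_incl (b : Base k u r' s') :
    constantCoeff (hom k L e f (incl k e f b)) = algebraMap _ _ b := by
  rw [hom_incl, constantCoeff_C]

theorem ker_constantCoeff_hom (hp : (minorsIdeal (genericMatrix k r s) (u + 1)).IsPrime) :
    RingHom.ker (constantCoeff.comp (hom k L e f)) =
      minorsIdeal (genericMatrix k r s) (u + 1) := by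
  refine le_antisymm (fun g hg => ?_) (constantCoeff_hom_minor e f (isUnit_det_field (k := k) L))
  obtain ⟨b, hb, g', hg', h⟩ := exists_hom_mul_mem (k := k) e f L _ hg
  rw [← map_mul] at h
  rw [← hom_injective e f (IsFractionRing.injective (Base k u r' s') L) h] at hg'
  refine (hp.mem_or_mem hg').resolve_left fun hb' => hb ?_
  have := constantCoeff_hom_minor (k := k) e f (isUnit_det_field L) hb'
  rw [RingHom.mem_ker, RingHom.comp_apply, constantCoeff_hom_incl] at this
  exact (map_eq_zero_iff _ (IsFractionRing.injective (Base k u r' s') L)).1 this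

omit [IsFractionRing (Base k u r' s') L] in
theorem map_comp_hom {B : Type} [CommRing B] [Algebra (Base k u r' s') B] (j : B →+* L)
    (hj : ∀ b : Base k u r' s', j (algebraMap _ B b) = algebraMap _ L b)
    (h : IsUnit (b₁₁ k u r' s' B).det) :
    (MvPolynomial.map j).comp (hom k B e f) = hom k L e f := by
  have h1 : (b₁₁ k u r' s' B).map j = b₁₁ k u r' s' L := by ext1; simp [b₁₁, hj]
  have h2 : (b₁₂ k u r' s' B).map j = b₁₂ k u r' s' L := by ext1; simp [b₁₂, hj]
  have h3 : (b₂₁ k u r' s' B).map j = b₂₁ k u r' s' L := by ext1; simp [b₂₁, hj]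
  have h4 : (b₁₁ k u r' s' B)⁻¹.map j = (b₁₁ k u r' s' L)⁻¹ := by
    refine (Matrix.inv_eq_left_inv ?_).symm
    rw [← h1, ← Matrix.map_mul, Matrix.nonsing_inv_mul _ h]
    simp
  have h5 (a b) : j (corner k u r' s' B a b) = corner k u r' s' L a b := by
    rw [← Matrix.map_apply (f := j), corner, Matrix.map_mul, Matrix.map_mul, h2, h3, h4, corner]
  refine MvPolynomial.ringHom_ext (fun c => by simp [hom, hj]) ?_
  rintro ⟨a, b⟩
  obtain ⟨a, rfl⟩ := e.surjective a
  obtain ⟨b, rfl⟩ := f.surjective b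
  rcases a with a | a <;> rcases b with b | b <;>
    simp [hom, mat, ← h1, ← h2, ← h3, h5]

theorem schurParams_eq (r' s' : ℕ) (L : Type) [Field L] : schurParams r' s' L = params L r' s' := rfl

theorem exists_algHom (B : Type) [CommRing B] [Algebra (Base k u r' s') B]
    [IsLocalization.Away (pivot k u r' s') B] [Algebra k B] [IsScalarTower k (Base k u r' s') B]
    [Algebra k L] [IsScalarTower k (Base k u r' s') L] :
    ∃ j : B →ₐ[k] L, (∀ b : Base k u r' s', j (algebraMap _ B b) = algebraMap _ _ b) ∧
      Function.Injective j := by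
  have hP : ∀ y : Submonoid.powers (pivot k u r' s'),
      IsUnit (Algebra.algHom k (Base k u r' s') L y) := fun y =>
    Ne.isUnit ((map_ne_zero_iff _ (IsFractionRing.injective (Base k u r' s') L)).2
      (nonZeroDivisors.ne_zero (powers_le_nonZeroDivisors_of_noZeroDivisors pivot_ne_zero y.2)))
  refine ⟨IsLocalization.liftAlgHom (M := Submonoid.powers (pivot k u r' s')) hP,
    fun b => IsLocalization.lift_eq _ b, ?_⟩
  refine (IsLocalization.lift_injective_iff _).2 fun x y => ?_
  exact ((IsLocalization.injective B (powers_le_nonZeroDivisors_of_noZeroDivisors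
    pivot_ne_zero)).eq_iff).trans (IsFractionRing.injective (Base k u r' s') L).eq_iff.symm

theorem exists_ne_zero_field_aux (B : Type) [CommRing B] [Algebra (Base k u r' s') B]
    [IsLocalization.Away (pivot k u r' s') B] [Algebra k B] [IsScalarTower k (Base k u r' s') B]
    [Algebra k L] [IsScalarTower k (Base k u r' s') L] {n : ℕ} {Q : Ideal (MvPolynomial (Fin r × Fin s) k)} [Q.IsPrime]
    (z : (Cx.cech (MvPolynomial (Fin r × Fin s) k) (List.ofFn (params k r s))).H n)
    (hz : ∀ g : MvPolynomial (Fin r × Fin s) k, g • z = 0 ↔ g ∈ Q)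
    (hQ : incl k e f (pivot k u r' s') ∉ Q) :
    ∃ w : (Cx.cech (MvPolynomial (Fin r' × Fin s') L)
        (List.ofFn (params L r' s'))).H n, w ≠ 0 ∧
      ∀ g ∈ Q, hom k L e f g • w = 0 := by
  rw [← schurParams_eq]
  have hB : IsUnit (b₁₁ k u r' s' B).det := isUnit_det (IsLocalization.Away.algebraMap_isUnit (pivot k u r' s'))
  obtain ⟨κ, hκ, hκ', -⟩ := exists_chartMap (B := B) e f (Submonoid.powers (pivot k u r' s'))
    (powers_le_nonZeroDivisors_of_noZeroDivisors pivot_ne_zero) hB n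
  obtain ⟨j, hj, hj'⟩ := exists_algHom (k := k) (u := u) (r' := r') (s' := s') L B
  have hinj := Cx.cH_map_injective j hj' (schurParams r' s' k) n
  rw [funext (map_schurParams (r' := r') (s' := s') (algebraMap k B)),
    funext (map_schurParams (r' := r') (s' := s') (algebraMap k L))] at hinj
  have hhom : (MvPolynomial.map (j : B →+* L)).comp (hom k B e f) =
      hom k L e f := map_comp_hom e f L (j : B →+* L) (fun b => hj b) hB
  refine ⟨Cx.cH (MvPolynomial.map (j : B →+* L)).toAddMonoidHom _ _ n (κ z),
    fun h => ?_, fun g hg => ?_⟩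
  · obtain ⟨_, ⟨N, rfl⟩, h⟩ := hκ' z (hinj (h.trans (map_zero _).symm))
    rw [hz, map_pow] at h
    exact hQ (Ideal.IsPrime.mem_of_pow_mem inferInstance _ h)
  · rw [← hhom, RingHom.comp_apply]
    refine (Cx.cH_smul (t := hom k B e f g) (Cx.compat_ofFn fun i x => ?_) (fun x => ?_)
      (κ z)).symm.trans ?_
    · change MvPolynomial.map (j : B →+* L) (schurParams r' s' B i * x) =
        schurParams r' s' L i * MvPolynomial.map (j : B →+* L) x
      rw [map_mul, map_schurParams]
    · exact map_mul (MvPolynomial.map (j : B →+* L)) _ _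
    · rw [← hκ, (hz g).2 hg, map_zero, map_zero]

theorem exists_ne_zero_field [Algebra k L] [IsScalarTower k (Base k u r' s') L] {n : ℕ} {Q : Ideal (MvPolynomial (Fin r × Fin s) k)} [Q.IsPrime]
    (z : (Cx.cech (MvPolynomial (Fin r × Fin s) k) (List.ofFn (params k r s))).H n)
    (hz : ∀ g : MvPolynomial (Fin r × Fin s) k, g • z = 0 ↔ g ∈ Q)
    (hQ : incl k e f (pivot k u r' s') ∉ Q) :
    ∃ w : (Cx.cech (MvPolynomial (Fin r' × Fin s') L)
        (List.ofFn (params L r' s'))).H n, w ≠ 0 ∧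
      ∀ g ∈ Q, hom k L e f g • w = 0 :=
  exists_ne_zero_field_aux e f L (Localization.Away (pivot k u r' s')) z hz hQ

end

end Chart

end

section

open MvPolynomial

theorem minorsIdeal_zero {T α β : Type} [CommRing T] (M : Matrix α β T) : minorsIdeal M 0 = ⊤ :=
  (Ideal.eq_top_iff_one _).2 (Ideal.subset_span
    ⟨(Function.Embedding.ofIsEmpty, Function.Embedding.ofIsEmpty), Matrix.det_isEmpty⟩)

namespace Chart

variable {k : Type} [Field k] {r s : ℕ}

/-- A prime annihilator of a cohomology class is a determinantal ideal, and it determines the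
cohomological degree. -/
theorem exists_minorsIdeal_le [CharZero k] (hr : 0 < r) (hrs : r < s) {n : ℕ}
    {Q : Ideal (MvPolynomial (Fin r × Fin s) k)} [hQ : Q.IsPrime]
    (z : (Cx.cech (MvPolynomial (Fin r × Fin s) k) (List.ofFn (params k r s))).H n)
    (hz : ∀ g : MvPolynomial (Fin r × Fin s) k, g • z = 0 ↔ g ∈ Q) :
    ∃ u < r, n = (r - u) * (s - r) + 1 ∧
      ((minorsIdeal (genericMatrix k r s) (u + 1)).IsPrime →
        Q = minorsIdeal (genericMatrix k r s) (u + 1)) := by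
  classical
  have hmax : minorsIdeal (genericMatrix k r s) r ≤ Q := by
    refine Ideal.le_radical.trans ?_
    rw [← radical_weightMinor, hQ.radical_le_iff, Ideal.span_le]
    intro x hx
    obtain ⟨N, hN⟩ := Cx.exists_pow_smul_eq_zero (M := MvPolynomial (Fin r × Fin s) k)
      (l := List.ofFn (params k r s)) (f := x) hx z
    exact hQ.mem_of_pow_mem N ((hz _).1 hN)
  have hex : ∃ u, minorsIdeal (genericMatrix k r s) (u + 1) ≤ Q :=
    ⟨r - 1, by rwa [Nat.sub_add_cancel hr]⟩
  obtain ⟨u, hu, hmin⟩ : ∃ u, minorsIdeal (genericMatrix k r s) (u + 1) ≤ Q ∧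
      ¬ minorsIdeal (genericMatrix k r s) u ≤ Q := by
    refine ⟨Nat.find hex, Nat.find_spec hex, ?_⟩
    rcases h : Nat.find hex with _ | v
    · rw [minorsIdeal_zero, top_le_iff]
      exact hQ.ne_top
    · exact Nat.find_min hex (h ▸ Nat.lt_succ_self v)
  obtain ⟨⟨p, q⟩, hpq⟩ : ∃ pq : (Fin u ↪ Fin r) × (Fin u ↪ Fin s),
      ((genericMatrix k r s).submatrix pq.1 pq.2).det ∉ Q := by
    by_contra! h
    exact hmin (Ideal.span_le.2 (Set.range_subset_iff.2 h))
  have hur : u ≤ r := by simpa using Fintype.card_le_of_embedding p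
  have hur' : u < r := by
    refine hur.lt_of_ne ?_
    rintro rfl
    exact hpq (hmax (Ideal.subset_span ⟨(p, q), rfl⟩))
  obtain ⟨e, he⟩ := exists_equiv_extending (r' := r - u) (by omega : _ = r) p.injective
  obtain ⟨f, hf⟩ := exists_equiv_extending (r' := s - u) (by omega : _ = s) q.injective
  let L := FractionRing (Base k u (r - u) (s - u))
  have : CharZero L := charZero_of_injective_algebraMap (algebraMap k L).injective
  have hQ' : incl k e f (pivot k u (r - u) (s - u)) ∉ Q := by
    rw [incl_pivot, show e ∘ Sum.inl = p from funext he, show f ∘ Sum.inl = q from funext hf]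
    exact hpq
  obtain ⟨w, hw, hwQ⟩ := exists_ne_zero_field e f L z hz hQ'
  have hX := X_smul_eq_zero_of_minor e f L fun m hm => hwQ m (hu hm)
  have hsub : s - u - (r - u) = s - r := by omega
  refine ⟨u, hur', ?_, fun hp => le_antisymm ?_ hu⟩
  · refine le_antisymm ?_ ?_
    · by_contra! hlt
      have := Cx.subsingleton_cech_H (MvPolynomial (Fin (r - u) × Fin (s - u)) L)
        (l := List.ofFn (params L (r - u) (s - u))) (n := n) (Or.inr (by
          rw [List.length_ofFn, hsub]
          exact_mod_cast hlt))
      exact hw (Subsingleton.elim _ _)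
    · by_contra! hlt
      exact hw (Cx.eq_zero_of_X_smul_eq_zero (by omega) (by omega)
        (n := n) (by rw [hsub]; exact_mod_cast hlt) w hX)
  · rw [← ker_constantCoeff_hom e f L hp]
    intro g hg
    have h1 := hwQ g hg
    rw [smul_eq_constantCoeff_smul hX] at h1
    rw [RingHom.mem_ker, RingHom.comp_apply]
    by_contra hne
    exact hw ((IsUnit.smul_eq_zero ((Ne.isUnit hne).map C)).1 h1)

end Chart

end

section

open MvPolynomial

/-- Restriction of scalars along a flat algebra preserves injective modules. -/
theorem injective_restrictScalars_of_flat {T A E : Type} [CommRing T] [CommRing A] [Algebra T A]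
    [Module.Flat T A] [AddCommGroup E] [Module A E] [Module T E] [IsScalarTower T A E]
    (h : Module.Injective A E) : Module.Injective T E where
  out X Y _ _ _ _ φ hφ g := by
    have hinj : Function.Injective (φ.baseChange A) :=
      Module.Flat.lTensor_preserves_injective_linearMap φ hφ
    obtain ⟨ψ, hψ⟩ := h.out (φ.baseChange A) hinj (g.liftBaseChange A)
    refine ⟨(ψ.restrictScalars T).comp (TensorProduct.mk T A Y 1), fun x => ?_⟩
    have := hψ (1 ⊗ₜ x)
    rwa [LinearMap.baseChange_tmul, LinearMap.liftBaseChange_tmul, one_smul] at this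

namespace Chart

section

variable {k : Type} [Field k] {u r' s' r s : ℕ}
  (e : Fin u ⊕ Fin r' ≃ Fin r) (f : Fin u ⊕ Fin s' ≃ Fin s)

variable (L : Type) [Field L] [Algebra (Base k u r' s') L] [IsFractionRing (Base k u r' s') L]
variable {E : Type} [AddCommGroup E] [Module (MvPolynomial (Fin r' × Fin s') L) E]
  [Module (MvPolynomial (Fin r × Fin s) k) E]
  (hE : ∀ (g : MvPolynomial (Fin r × Fin s) k) (x : E), g • x = hom k L e f g • x)

theorem isUnit_hom_incl {b : Base k u r' s'} (hb : b ≠ 0) :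
    IsUnit (hom k L e f (incl k e f b)) := by
  rw [hom_incl]
  exact (Ne.isUnit ((map_ne_zero_iff _ (IsFractionRing.injective (Base k u r' s') L)).2 hb)).map C

include hE in
theorem injective_compHom (h : Module.Injective (MvPolynomial (Fin r' × Fin s') L) E) :
    Module.Injective (MvPolynomial (Fin r × Fin s) k) E := by
  let _ : Algebra (MvPolynomial (Fin r × Fin s) k) (MvPolynomial (Fin r' × Fin s') L) :=
    (hom k L e f).toAlgebra
  have hloc : IsLocalization ((nonZeroDivisors (Base k u r' s')).map (incl k e f))
      (MvPolynomial (Fin r' × Fin s') L) := by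
    refine (isLocalization_iff _ _).2 ⟨?_, fun z => ?_, fun {x y} h => ⟨1, ?_⟩⟩
    · rintro ⟨_, b, hb, rfl⟩
      exact isUnit_hom_incl e f L (nonZeroDivisors.ne_zero hb)
    · obtain ⟨b, hb, g, hg⟩ := exists_hom_mul (e := e) (f := f)
        (nonZeroDivisors (Base k u r' s')) z
      exact ⟨(g, ⟨_, b, hb, rfl⟩), (mul_comm _ _).trans hg⟩
    · rw [hom_injective e f (IsFractionRing.injective (Base k u r' s') L) h]
  have : Module.Flat (MvPolynomial (Fin r × Fin s) k) (MvPolynomial (Fin r' × Fin s') L) :=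
    IsLocalization.flat _ ((nonZeroDivisors (Base k u r' s')).map (incl k e f))
  have : IsScalarTower (MvPolynomial (Fin r × Fin s) k) (MvPolynomial (Fin r' × Fin s') L) E :=
    IsScalarTower.of_algebraMap_smul fun g x => (hE g x).symm
  exact injective_restrictScalars_of_flat h

include hE in
omit [IsFractionRing (Base k u r' s') L] in
theorem smul_bijective
    (tors : ∀ (y : E) p, ∃ N : ℕ, (X p : MvPolynomial (Fin r' × Fin s') L) ^ N • y = 0)
    (div : ∀ {c : MvPolynomial (Fin r' × Fin s') L}, c ≠ 0 → ∀ y : E, ∃ x : E, c • x = y)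
    {q : MvPolynomial (Fin r × Fin s) k} (hq : constantCoeff (hom k L e f q) ≠ 0) :
    Function.Bijective fun x : E => q • x := by
  have hsmul : (fun x : E => q • x) = fun x => hom k L e f q • x := funext (hE q)
  rw [hsmul]
  refine ⟨fun x y h => ?_, fun y => div (fun h0 => hq (by rw [h0, map_zero])) y⟩
  by_contra hne
  obtain ⟨g, hg, hX⟩ := exists_smul_ne_zero_socle (sub_ne_zero.2 hne) (tors _)
  have h0 : hom k L e f q • g • (x - y) = 0 := by
    rw [smul_comm, smul_sub, sub_eq_zero.2 h, smul_zero]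
  rw [smul_eq_constantCoeff_smul hX] at h0
  exact hg ((IsUnit.smul_eq_zero ((Ne.isUnit hq).map C)).1 h0)

theorem mem_primeCompl_iff_constantCoeff (hp : (minorsIdeal (genericMatrix k r s) (u + 1)).IsPrime)
    {q : MvPolynomial (Fin r × Fin s) k} :
    q ∈ (minorsIdeal (genericMatrix k r s) (u + 1)).primeCompl ↔
      constantCoeff (hom k L e f q) ≠ 0 := by
  rw [Ideal.mem_primeCompl_iff, ← ker_constantCoeff_hom e f L hp, RingHom.mem_ker,
    RingHom.comp_apply]

include L in
theorem incl_mem_primeCompl (hp : (minorsIdeal (genericMatrix k r s) (u + 1)).IsPrime)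
    {b : Base k u r' s'} (hb : b ≠ 0) :
    incl k e f b ∈ (minorsIdeal (genericMatrix k r s) (u + 1)).primeCompl := by
  rw [mem_primeCompl_iff_constantCoeff e f L hp, constantCoeff_hom_incl]
  exact (map_ne_zero_iff _ (IsFractionRing.injective (Base k u r' s') L)).2 hb

include hE in
theorem isLocalizedModule (hp : (minorsIdeal (genericMatrix k r s) (u + 1)).IsPrime)
    (tors : ∀ (y : E) p, ∃ N : ℕ, (X p : MvPolynomial (Fin r' × Fin s') L) ^ N • y = 0)
    (div : ∀ {c : MvPolynomial (Fin r' × Fin s') L}, c ≠ 0 → ∀ y : E, ∃ x : E, c • x = y)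
    {H : Type} [AddCommGroup H] [Module (MvPolynomial (Fin r × Fin s) k) H]
    (κ : H →ₗ[MvPolynomial (Fin r × Fin s) k] E)
    (hκ : ∀ y, κ y = 0 → ∃ b : Base k u r' s', b ≠ 0 ∧ incl k e f b • y = 0)
    (hκ' : ∀ z, ∃ b : Base k u r' s', b ≠ 0 ∧ ∃ y, κ y = incl k e f b • z) :
    IsLocalizedModule (minorsIdeal (genericMatrix k r s) (u + 1)).primeCompl κ where
  map_units q := (Module.End.isUnit_iff _).2
    (smul_bijective e f L hE tors div ((mem_primeCompl_iff_constantCoeff e f L hp).1 q.2))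
  surj z := by
    obtain ⟨b, hb, y, hy⟩ := hκ' z
    exact ⟨(y, ⟨_, incl_mem_primeCompl e f L hp hb⟩), hy.symm⟩
  exists_of_eq {x y} h := by
    obtain ⟨b, hb, hxy⟩ := hκ (x - y) (by rw [map_sub, h, sub_self])
    exact ⟨⟨_, incl_mem_primeCompl e f L hp hb⟩, sub_eq_zero.1 ((smul_sub _ _ _).symm.trans hxy)⟩

include hE in
theorem exists_essential (hp : (minorsIdeal (genericMatrix k r s) (u + 1)).IsPrime)
    {w : E} (hw : w ≠ 0) (hX : ∀ p, (X p : MvPolynomial (Fin r' × Fin s') L) • w = 0)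
    (ess : ∀ y : E, y ≠ 0 → ∃ (g : MvPolynomial (Fin r' × Fin s') L) (α : L), α ≠ 0 ∧
      g • y = (C α : MvPolynomial (Fin r' × Fin s') L) • w) :
    ∃ ι : (MvPolynomial (Fin r × Fin s) k ⧸ minorsIdeal (genericMatrix k r s) (u + 1))
        →ₗ[MvPolynomial (Fin r × Fin s) k] E, Function.Injective ι ∧
      ∀ N : Submodule (MvPolynomial (Fin r × Fin s) k) E, N ≠ ⊥ → N ⊓ LinearMap.range ι ≠ ⊥ := by
  have hC {c : L} (hc : c ≠ 0) : (C c : MvPolynomial (Fin r' × Fin s') L) • w ≠ 0 := fun h =>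
    hw ((IsUnit.smul_eq_zero ((Ne.isUnit hc).map C)).1 h)
  have hker (g : MvPolynomial (Fin r × Fin s) k) :
      g • w = 0 ↔ g ∈ minorsIdeal (genericMatrix k r s) (u + 1) := by
    rw [hE, smul_eq_constantCoeff_smul hX, ← not_iff_not,
      ← Ideal.mem_primeCompl_iff (P := minorsIdeal (genericMatrix k r s) (u + 1)),
      mem_primeCompl_iff_constantCoeff e f L hp]
    exact ⟨fun h h0 => h (by rw [h0, map_zero, zero_smul]), hC⟩
  refine ⟨Submodule.liftQ _ (LinearMap.toSpanSingleton (MvPolynomial (Fin r × Fin s) k) E w)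
    fun g hg => (hker g).2 hg, ?_, fun N hN => ?_⟩
  · rw [← LinearMap.ker_eq_bot]
    exact Submodule.ker_liftQ_eq_bot _ _ _ fun g hg => (hker g).1 hg
  · obtain ⟨y, hyN, hy⟩ := N.ne_bot_iff.1 hN
    obtain ⟨g, α, hα, hg⟩ := ess y hy
    obtain ⟨b, hb, g₁, h₁⟩ := exists_hom_mul (e := e) (f := f)
      (nonZeroDivisors (Base k u r' s')) g
    obtain ⟨b', hb', g₂, h₂⟩ := exists_hom_mul (e := e) (f := f)
      (nonZeroDivisors (Base k u r' s')) (C α : MvPolynomial (Fin r' × Fin s') L)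
    have key : (incl k e f b' * g₁) • y = (incl k e f b * g₂) • w := by
      rw [hE, hE, map_mul, map_mul, ← h₁, ← h₂, mul_smul, mul_smul, mul_smul, mul_smul, hg,
        smul_comm]
    refine (Submodule.ne_bot_iff _).2 ⟨(incl k e f b' * g₁) • y,
      Submodule.mem_inf.2 ⟨N.smul_mem _ hyN, ?_⟩, ?_⟩
    · rw [key]
      exact ⟨Submodule.Quotient.mk (incl k e f b * g₂), rfl⟩
    · rw [key, hE, map_mul, ← h₂, mul_smul, mul_smul, hom_incl, hom_incl, ← mul_smul, ← mul_smul,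
        ← C_mul, ← C_mul]
      exact hC (mul_ne_zero (mul_ne_zero ((map_ne_zero_iff _ (IsFractionRing.injective _ L)).2
        (nonZeroDivisors.ne_zero hb)) ((map_ne_zero_iff _
          (IsFractionRing.injective _ L)).2 (nonZeroDivisors.ne_zero hb'))) hα)

end

end Chart

end

section

open MvPolynomial

namespace Chart

section

variable {k : Type} [Field k] {u r' s' r s : ℕ}
  (e : Fin u ⊕ Fin r' ≃ Fin r) (f : Fin u ⊕ Fin s' ≃ Fin s)

variable (L : Type) [Field L] [CharZero L] [Algebra (Base k u r' s') L]
  [IsFractionRing (Base k u r' s') L]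
  [Module (MvPolynomial (Fin r × Fin s) k) (inverseSystem L (Fin r' × Fin s'))]
  (hE : ∀ (g : MvPolynomial (Fin r × Fin s) k) (x : inverseSystem L (Fin r' × Fin s')),
    g • x = hom k L e f g • x)

include hE in
theorem exists_map_inverseSystem (hr' : 0 < r') (hrs' : r' < s') {n : ℕ}
    (hn : n = r' * (s' - r') + 1) :
    ∃ κ : (Cx.cech (MvPolynomial (Fin r × Fin s) k) (List.ofFn (params k r s))).H n
        →ₗ[MvPolynomial (Fin r × Fin s) k] inverseSystem L (Fin r' × Fin s'),
      (∀ y, κ y = 0 → ∃ b : Base k u r' s', b ≠ 0 ∧ incl k e f b • y = 0) ∧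
      ∀ z, ∃ b : Base k u r' s', b ≠ 0 ∧ ∃ y, κ y = incl k e f b • z := by
  subst hn
  have hchart := exists_chartMap (B := L) e f (nonZeroDivisors (Base k u r' s'))
    le_rfl (isUnit_det_field (k := k) L) (r' * (s' - r') + 1)
  rw [schurParams_eq] at hchart
  obtain ⟨κ, hκ, hκ', hκ''⟩ := hchart
  obtain ⟨W⟩ := Cx.nonempty_equiv_inverseSystem (k := L) hr' hrs'.le
    (exists_X_pow_smul_eq_zero hr' hrs')
  refine ⟨{ toFun := fun y => W.symm (κ y)
            map_add' := fun x y => by rw [map_add, map_add]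
            map_smul' := fun g y => by
              rw [hκ, RingHom.id_apply, hE]
              exact W.symm.map_smul _ _ }, fun y hy => ?_, fun z => ?_⟩
  · obtain ⟨b, hb, h⟩ := hκ' y ((map_eq_zero_iff _ W.symm.injective).1 hy)
    exact ⟨b, nonZeroDivisors.ne_zero hb, h⟩
  · obtain ⟨b, hb, y, hy⟩ := hκ'' (W z)
    refine ⟨b, nonZeroDivisors.ne_zero hb, y, ?_⟩
    change W.symm (κ y) = _
    rw [hy, hE]
    exact (W.symm.map_smul _ _).trans (by rw [W.symm_apply_apply])

end

variable {k : Type} [Field k] [CharZero k] {r s : ℕ}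

/-- A determinantal ideal is the only associated prime in its degree. -/
theorem eq_of_isAssociatedPrime (hr : 0 < r) (hrs : r < s) {t n : ℕ} (ht : t < r)
    (hn : n = (r - t) * (s - r) + 1)
    (hp : (minorsIdeal (genericMatrix k r s) (t + 1)).IsPrime)
    {Q : Ideal (MvPolynomial (Fin r × Fin s) k)}
    (hQ : IsAssociatedPrime Q
      ((Cx.cech (MvPolynomial (Fin r × Fin s) k) (List.ofFn (params k r s))).H n)) :
    Q = minorsIdeal (genericMatrix k r s) (t + 1) := by
  obtain ⟨hQp, z, hz⟩ := isAssociatedPrime_iff.1 hQ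
  obtain ⟨u, hu, hnu, h⟩ := exists_minorsIdeal_le hr hrs z (Q := Q) fun g => by
    rw [hz, Submodule.mem_colon_singleton, Submodule.mem_bot]
  obtain rfl : u = t := by
    have h1 : (r - u) * (s - r) = (r - t) * (s - r) := by omega
    have := Nat.eq_of_mul_eq_mul_right (by omega) h1
    omega
  exact h hp

theorem injective_of_isAssociatedPrime_eq {R H E : Type} [CommRing R] [IsNoetherianRing R]
    [AddCommGroup H] [Module R H] [AddCommGroup E] [Module R E] {P : Ideal R}
    (hass : ∀ Q, IsAssociatedPrime Q H → Q = P) (κ : H →ₗ[R] E)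
    (hκ : ∀ y, κ y = 0 → ∃ b ∉ P, b • y = 0) : Function.Injective κ := by
  refine (injective_iff_map_eq_zero κ).2 fun y hy => ?_
  by_contra hne
  obtain ⟨b, hb, hby⟩ := hκ y hy
  obtain ⟨Q, hQ, hle⟩ := exists_le_isAssociatedPrime_of_isNoetherianRing R y hne
  exact hb (hass Q hQ ▸ hle (by rwa [Submodule.mem_colon_singleton, Submodule.mem_bot]))

theorem associatedPrimes_eq_singleton {R H : Type} [CommRing R] [IsNoetherianRing R]
    [AddCommGroup H] [Module R H] {P : Ideal R}
    (hass : ∀ Q, IsAssociatedPrime Q H → Q = P) {y : H} (hy : y ≠ 0) :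
    associatedPrimes R H = {P} := by
  obtain ⟨Q, hQ, -⟩ := exists_le_isAssociatedPrime_of_isNoetherianRing R y hy
  exact Set.eq_singleton_iff_unique_mem.2 ⟨hass Q hQ ▸ hQ, hass⟩

omit [CharZero k] in
/-- The cohomology of the parameters localizes to an injective hull of the residue ring of a
determinantal ideal. -/
theorem exists_hull (L : Type) {t : ℕ} [Field L] [CharZero L]
    [Algebra (Base k t (r - t) (s - t)) L] [IsFractionRing (Base k t (r - t) (s - t)) L]
    (hrs : r < s) {n : ℕ} (ht : t < r)
    (hn : n = (r - t) * (s - r) + 1)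
    (hp : (minorsIdeal (genericMatrix k r s) (t + 1)).IsPrime) :
    (∃ y : (Cx.cech (MvPolynomial (Fin r × Fin s) k) (List.ofFn (params k r s))).H n, y ≠ 0) ∧
    ∃ (E : Type) (_ : AddCommGroup E) (_ : Module (MvPolynomial (Fin r × Fin s) k) E),
      Module.Injective (MvPolynomial (Fin r × Fin s) k) E ∧
      (∃ ι : (MvPolynomial (Fin r × Fin s) k ⧸ minorsIdeal (genericMatrix k r s) (t + 1))
          →ₗ[MvPolynomial (Fin r × Fin s) k] E, Function.Injective ι ∧
        ∀ N : Submodule (MvPolynomial (Fin r × Fin s) k) E,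
          N ≠ ⊥ → N ⊓ LinearMap.range ι ≠ ⊥) ∧
      ∃ κ : (Cx.cech (MvPolynomial (Fin r × Fin s) k) (List.ofFn (params k r s))).H n
          →ₗ[MvPolynomial (Fin r × Fin s) k] E,
        IsLocalizedModule (minorsIdeal (genericMatrix k r s) (t + 1)).primeCompl κ := by
  obtain ⟨e, -⟩ := exists_equiv_extending (r' := r - t) (by omega : _ = r)
    (Fin.castLE_injective ht.le)
  obtain ⟨f, -⟩ := exists_equiv_extending (r' := s - t) (by omega : _ = s)
    (Fin.castLE_injective (ht.trans hrs).le)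
  let _ : Module (MvPolynomial (Fin r × Fin s) k) (inverseSystem L (Fin (r - t) × Fin (s - t))) :=
    Module.compHom _ (hom k L e f)
  have hE (g : MvPolynomial (Fin r × Fin s) k)
      (x : inverseSystem L (Fin (r - t) × Fin (s - t))) : g • x = hom k L e f g • x := rfl
  obtain ⟨κ, hκ, hκ'⟩ := exists_map_inverseSystem e f L hE (by omega) (by omega)
    (hn.trans (by congr 2; omega))
  have hloc := isLocalizedModule e f L hE hp
    (fun y p => (inverseSystem.mem_iff.1 y.2 p).imp fun N hN => Subtype.ext hN)
    inverseSystem.exists_smul_eq κ hκ hκ'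
  refine ⟨?_, _, inferInstance, inferInstance, injective_compHom e f L hE inverseSystem.injective,
    exists_essential e f L hE hp inverseSystem.socle_ne_zero inverseSystem.X_smul_socle
      fun y hy => ?_, κ, hloc⟩
  · obtain ⟨b, hb, y, hy⟩ := hκ' (inverseSystem.socle _ _)
    refine ⟨y, fun h => inverseSystem.socle_ne_zero (k := L) (σ := Fin (r - t) × Fin (s - t)) ?_⟩
    rw [h, map_zero, hE] at hy
    exact (IsUnit.smul_eq_zero (isUnit_hom_incl e f L hb)).1 hy.symm
  · obtain ⟨g, α, hα, h⟩ := inverseSystem.exists_smul_eq_socle (fun _ : Unit => y)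
      fun h => hy (congrFun h ())
    exact ⟨g, α (), fun h0 => hα (funext fun _ => h0), h ()⟩

end Chart

end

/-- Let `k` be a field of characteristic zero, `X` an `r × s` matrix of indeterminates
with `r < s`, `R = k[X]`, `I = I_r(X)`, and `i = (r−t)(s−r) + 1` with `0 ≤ t < r`.  Then
`I_{t+1}(X)` is prime, the set of associated primes of `H^i_I(R)` is exactly
`{I_{t+1}(X)}`, the localization of `H^i_I(R)` at `I_{t+1}(X)` is isomorphic to
`E_R(R/I_{t+1}(X))` (the injective hull, i.e. an injective module containing
`R/I_{t+1}(X)` as an essential submodule), and `H^i_I(R)` embeds into it. -/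
theorem stmt_16 {k : Type} [Field k] [CharZero k] (r s t i : ℕ) (hr : 0 < r) (hrs : r < s)
    (ht : t < r) (hi : i = (r - t) * (s - r) + 1)
    (hp : (minorsIdeal (genericMatrix k r s) (t + 1)).IsPrime) :
    associatedPrimes (detPolyRing k r s)
        ((localCohomology (minorsIdeal (genericMatrix k r s) r) i).obj
          (ModuleCat.of (detPolyRing k r s) (detPolyRing k r s)))
      = {minorsIdeal (genericMatrix k r s) (t + 1)} ∧
    ∃ (E : Type) (_ : AddCommGroup E) (_ : Module (detPolyRing k r s) E),
      Module.Injective (detPolyRing k r s) E ∧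
      ∃ ι : (detPolyRing k r s ⧸ minorsIdeal (genericMatrix k r s) (t + 1))
          →ₗ[detPolyRing k r s] E,
        Function.Injective ι ∧
        (∀ N : Submodule (detPolyRing k r s) E, N ≠ ⊥ → N ⊓ LinearMap.range ι ≠ ⊥) ∧
        Nonempty
          ((LocalizedModule
              (@Ideal.primeCompl _ _ (minorsIdeal (genericMatrix k r s) (t + 1)) hp)
              ((localCohomology (minorsIdeal (genericMatrix k r s) r) i).obj
                (ModuleCat.of (detPolyRing k r s) (detPolyRing k r s))))
            ≃ₗ[detPolyRing k r s] E) ∧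
        ∃ ψ : ((localCohomology (minorsIdeal (genericMatrix k r s) r) i).obj
            (ModuleCat.of (detPolyRing k r s) (detPolyRing k r s))) →ₗ[detPolyRing k r s] E,
          Function.Injective ψ := by
  let L := FractionRing (Chart.Base k t (r - t) (s - t))
  have : CharZero L := charZero_of_injective_algebraMap (algebraMap k L).injective
  obtain ⟨⟨y, hy⟩, E, _, _, hE, ⟨ι, hι, hess⟩, κ, hκ⟩ := Chart.exists_hull L hrs ht hi hp
  obtain ⟨e⟩ := LocCoh.localCohomology_equiv (M := MvPolynomial (Fin r × Fin s) k) (n := i)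
    (J := minorsIdeal (genericMatrix k r s) r) (List.ofFn (params k r s))
    (radical_weightMinor (genericMatrix k r s)).symm
  have hass := fun Q => Chart.eq_of_isAssociatedPrime hr hrs ht hi hp (Q := Q)
  refine ⟨(LinearEquiv.AssociatedPrimes.eq e).trans (Chart.associatedPrimes_eq_singleton hass hy),
    E, inferInstance, inferInstance, hE, ι, hι, hess, ⟨?_⟩, κ.comp e.toLinearMap, ?_⟩
  · have := IsLocalizedModule.of_linearEquiv_right
      (minorsIdeal (genericMatrix k r s) (t + 1)).primeCompl κ e
    exact IsLocalizedModule.iso (minorsIdeal (genericMatrix k r s) (t + 1)).primeCompl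
      (κ.comp e.toLinearMap)
  · refine (Chart.injective_of_isAssociatedPrime_eq hass κ fun y hy => ?_).comp e.injective
    obtain ⟨c, hc⟩ := hκ.exists_of_eq (hy.trans (map_zero κ).symm)
    exact ⟨c, c.2, hc.trans (smul_zero c)⟩
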